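/- Let S be a compact, orientable, two-dimensional embedded C^∞ submanifold of ℝ³ without boundary. There exist constants c > 0 and h₀ ∈ (0,1), depending only on S and γ₀ (in particular independent of z₀ and h), such that for every z₀ ∈ S and every admissible quasi-uniform triangulation T_h with h ≤ h₀, the cut-off lifted logarithm l̃ and its discrete projection l̃_h satisfy the W^{1,1}-estimate ∫_S ( |l̃ − L̃_h| + |∇_S(l̃ − L̃_h)| ) ≤ c h |log h|. -/

import Mathlib

open MeasureTheory Metric
open scoped RealInnerProductSpace ENNReal NNReal

noncomputable section

/-- Ambient Euclidean space `ℝ³`. -/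
abbrev E3 : Type := EuclideanSpace ℝ (Fin 3)

/-- The tangential gradient of `w : E3 → ℝ` along the set `A` at `x`, with values projected
onto the subspace `P`: the orthogonal projection onto `P` of the Riesz representative of the
derivative of `w` within `A` at `x`. -/
def tGrad (A : Set E3) (P : Submodule ℝ E3) (w : E3 → ℝ) (x : E3) : E3 :=
  (Submodule.orthogonalProjectionOnto P ((InnerProductSpace.toDual ℝ E3).symm (fderivWithin ℝ w A x)) : E3)

/-- A compact, orientable, two-dimensional embedded `C^∞` submanifold of `ℝ³` without boundary,
described by a global smooth unit normal field `n` and local smooth regular defining functions. -/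
structure SmoothSurface where
  S : Set E3
  n : E3 → E3
  compact : IsCompact S
  nonempty : S.Nonempty
  localLevel : ∀ x ∈ S, ∃ U : Set E3, ∃ F : E3 → ℝ, IsOpen U ∧ x ∈ U ∧
    ContDiff ℝ (⊤ : ℕ∞) F ∧ S ∩ U = {y ∈ U | F y = 0} ∧
    (∀ y ∈ U, gradient F y ≠ 0) ∧
    (∀ y, y ∈ S ∩ U → ∃ t : ℝ, gradient F y = t • n y)
  n_unit : ∀ x ∈ S, ‖n x‖ = 1
  n_smooth : ∃ U : Set E3, IsOpen U ∧ S ⊆ U ∧ ContDiffOn ℝ (⊤ : ℕ∞) n U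

namespace SmoothSurface

variable (Srf : SmoothSurface)

/-- The tangent plane of `S` at `x`, as the orthogonal complement of the normal. -/
def tangent (x : E3) : Submodule ℝ E3 := (ℝ ∙ Srf.n x)ᗮ

/-- The tangential gradient `∇_S w` on the surface. -/
def grad (w : E3 → ℝ) (x : E3) : E3 := tGrad Srf.S (Srf.tangent x) w x

/-- The bilinear form `a(v,w) = ∫_S (⟨∇_S v, ∇_S w⟩ + v w)` (w.r.t. 2-dimensional
Hausdorff measure on `S`). -/
def aForm (v w : E3 → ℝ) : ℝ :=
  ∫ x in Srf.S, (⟪Srf.grad v x, Srf.grad w x⟫ + v x * w x) ∂μH[2]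

end SmoothSurface

/-- The (closed, flat) triangle with vertices `t.1, t.2.1, t.2.2`. -/
def triOf (t : E3 × E3 × E3) : Set E3 := convexHull ℝ {t.1, t.2.1, t.2.2}

/-- The vertex set of a triangle. -/
def vertsOf (t : E3 × E3 × E3) : Set E3 := {t.1, t.2.1, t.2.2}

/-- The plane spanned by a triangle. -/
def planeOf (t : E3 × E3 × E3) : Set E3 := (affineSpan ℝ (vertsOf t) : Set E3)

/-- The direction (2-dimensional linear subspace) of the plane of a triangle. -/
def dirOf (t : E3 × E3 × E3) : Submodule ℝ E3 := (affineSpan ℝ (vertsOf t)).direction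

/-- The triangle-wise tangential gradient `∇_{S_h} w` on the triangle `t`. -/
def gradTri (t : E3 × E3 × E3) (w : E3 → ℝ) (x : E3) : E3 := tGrad (triOf t) (dirOf t) w x

/-- An admissible quasi-uniform triangulation `T_h` of the surface `Srf` with mesh parameter `h`
and quasi-uniformity constant `γ₀`, together with the nearest-point projection `a` defined on
a tubular neighbourhood `N` of the surface. -/
structure Triangulation (Srf : SmoothSurface) (γ₀ h : ℝ) where
  T : Finset (E3 × E3 × E3)
  a : E3 → E3
  N : Set E3
  T_nonempty : T.Nonempty
  indep : ∀ t ∈ T, AffineIndependent ℝ ![t.1, t.2.1, t.2.2]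
  verts_on : ∀ t ∈ T, vertsOf t ⊆ Srf.S
  meet : ∀ t ∈ T, ∀ t' ∈ T, t ≠ t' →
    triOf t ∩ triOf t' = ∅ ∨
    (∃ v, v ∈ vertsOf t ∩ vertsOf t' ∧ triOf t ∩ triOf t' = {v}) ∨
    (∃ v w, v ≠ w ∧ v ∈ vertsOf t ∩ vertsOf t' ∧ w ∈ vertsOf t ∩ vertsOf t' ∧
      triOf t ∩ triOf t' = segment ℝ v w)
  diam_le : ∀ t ∈ T, Metric.diam (triOf t) ≤ h
  disk : ∀ t ∈ T, ∃ y ∈ triOf t, closedBall y (γ₀ * h) ∩ planeOf t ⊆ triOf t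
  N_open : IsOpen N
  S_sub : Srf.S ⊆ N
  Sh_sub : (⋃ t ∈ T, triOf t) ⊆ N
  a_smooth : ContDiffOn ℝ (⊤ : ℕ∞) a N
  a_mem : ∀ x ∈ N, a x ∈ Srf.S
  a_nearest : ∀ x ∈ N, ∀ y ∈ Srf.S, dist x (a x) ≤ dist x y
  a_unique : ∀ x ∈ N, ∀ y ∈ Srf.S, dist x y = dist x (a x) → y = a x
  a_bij : Set.BijOn a (⋃ t ∈ T, triOf t) Srf.S

namespace Triangulation

variable {Srf : SmoothSurface} {γ₀ h : ℝ} (Tr : Triangulation Srf γ₀ h)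

/-- The polyhedral surface `S_h`, the union of the triangles. -/
def Sh : Set E3 := ⋃ t ∈ Tr.T, triOf t

/-- Membership in the finite element space `V_h` of continuous, piecewise affine functions
on `S_h` (as functions `E3 → ℝ`; only the values on `S_h` are relevant). -/
def IsVh (v : E3 → ℝ) : Prop :=
  ContinuousOn v Tr.Sh ∧
  ∀ t ∈ Tr.T, ∃ (L : E3 →ₗ[ℝ] ℝ) (c : ℝ), ∀ x ∈ triOf t, v x = L x + c


/-- The discrete bilinear form
`a_h(v,w) = ∫_{S_h} (⟨∇_{S_h} v, ∇_{S_h} w⟩ + v w)`, computed triangle by triangle. -/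
def ahForm (v w : E3 → ℝ) : ℝ :=
  ∑ t ∈ Tr.T, ∫ x in triOf t,
    (⟪gradTri t v x, gradTri t w x⟫ + v x * w x) ∂μH[2]

/-- The lift of a function on `S_h` to a function on `S` via the inverse of `a|_{S_h}`. -/
def liftS (w : E3 → ℝ) : E3 → ℝ := fun y => w (Function.invFunOn Tr.a Tr.Sh y)

/-- The lift of `f : S → ℝ` to `S_h` is `f ∘ a`. -/
def liftSh (f : E3 → ℝ) : E3 → ℝ := fun x => f (Tr.a x)

end Triangulation

/-- `f` is smooth in a neighbourhood of the set `A`. -/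
def SmoothNear (f : E3 → ℝ) (A : Set E3) : Prop :=
  ∃ V : Set E3, IsOpen V ∧ A ⊆ V ∧ ContDiffOn ℝ (⊤ : ℕ∞) f V

/-- `u` is the (weak, hence smooth) solution of `-Δ_S u + u = f` on the surface `Srf`. -/
def IsSolution (Srf : SmoothSurface) (f u : E3 → ℝ) : Prop :=
  SmoothNear u Srf.S ∧
  ∀ φ : E3 → ℝ, ContDiff ℝ (⊤ : ℕ∞) φ → Srf.aForm u φ = ∫ x in Srf.S, f x * φ x ∂μH[2]

/-- `uh` is the discrete Galerkin solution in `V_h` with data the lift `f ∘ a` of `f`. -/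
def Triangulation.IsDiscreteSolution {Srf : SmoothSurface} {γ₀ h : ℝ}
    (Tr : Triangulation Srf γ₀ h) (f uh : E3 → ℝ) : Prop :=
  Tr.IsVh uh ∧
  ∀ φh : E3 → ℝ, Tr.IsVh φh →
    Tr.ahForm uh φh = ∫ x in Tr.Sh, f (Tr.a x) * φh x ∂μH[2]

/-- Orthogonal projection onto the affine tangent plane of `S` at `z₀`. -/
def SmoothSurface.P0 (Srf : SmoothSurface) (z₀ : E3) (x : E3) : E3 :=
  z₀ + (Submodule.orthogonalProjectionOnto (Srf.tangent z₀) (x - z₀) : E3)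

/-- `r(x) = ‖P₀(x) − z₀‖`, the distance of the tangential projection of `x` to `z₀`. -/
def SmoothSurface.rfn (Srf : SmoothSurface) (z₀ : E3) (x : E3) : ℝ :=
  ‖Srf.P0 z₀ x - z₀‖

/-- The affine tangent plane `z₀ + T_{z₀}S`. -/
def SmoothSurface.tplane (Srf : SmoothSurface) (z₀ : E3) : Set E3 :=
  {x : E3 | x - z₀ ∈ Srf.tangent z₀}

/-- The disk `D = B₁₀₀(z₀)` in the affine tangent plane at `z₀`. -/
def SmoothSurface.disk100 (Srf : SmoothSurface) (z₀ : E3) : Set E3 :=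
  Srf.tplane z₀ ∩ closedBall z₀ 100

/-- `r₁ > 0` is a graph radius for `S`: uniformly in `z₀ ∈ S`, the piece `B_{2r₁}(z₀) ∩ S`
is a graph over the tangent plane at `z₀`, in particular `P₀` is injective on it. -/
def SmoothSurface.IsGraphRadius (Srf : SmoothSurface) (r₁ : ℝ) : Prop :=
  0 < r₁ ∧ r₁ ≤ 1 ∧ ∀ z₀ ∈ Srf.S, Set.InjOn (Srf.P0 z₀) (Srf.S ∩ closedBall z₀ (2 * r₁))

/-- `ζ` is an admissible smooth cutoff at `z₀`: supported in the ball of radius `3r₁/2`,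
equal to `1` on the ball of radius `r₁`, with `C²`-bounds at most `Cζ` (uniform in `z₀`). -/
def IsCutoff (z₀ : E3) (r₁ Cζ : ℝ) (ζ : E3 → ℝ) : Prop :=
  ContDiff ℝ (⊤ : ℕ∞) ζ ∧ tsupport ζ ⊆ closedBall z₀ (3 / 2 * r₁) ∧
  (∀ x ∈ closedBall z₀ r₁, ζ x = 1) ∧
  ∀ x : E3, |ζ x| + ‖fderiv ℝ ζ x‖ + ‖fderiv ℝ (fderiv ℝ ζ) x‖ ≤ Cζ

/-- `v` is the Neumann Green's function with pole `z₀` of `−Δ + 1` on the disk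
`D = B₁₀₀(z₀)` in the tangent plane at `z₀`: it is smooth away from the pole, satisfies
`∫_D (⟨∇v, ∇φ⟩ + v φ) = φ(z₀)` for every smooth test function, and differs from
`(1/2π) log‖· − z₀‖` by an `H²(D)`-function with norm at most `CG`. -/
def SmoothSurface.IsGreen (Srf : SmoothSurface) (z₀ : E3) (CG : ℝ) (v : E3 → ℝ) : Prop :=
  ContDiffOn ℝ (⊤ : ℕ∞) v (Srf.disk100 z₀ \ {z₀}) ∧
  (∀ φ : E3 → ℝ, ContDiff ℝ (⊤ : ℕ∞) φ →
    ∫ x in Srf.disk100 z₀,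
      (⟪tGrad (Srf.disk100 z₀) (Srf.tangent z₀) v x,
        tGrad (Srf.disk100 z₀) (Srf.tangent z₀) φ x⟫ + v x * φ x) ∂μH[2] = φ z₀) ∧
  (∫ x in Srf.disk100 z₀,
      ((v x - (1 / (2 * Real.pi)) * Real.log ‖x - z₀‖) ^ 2 +
        ‖fderivWithin ℝ (fun y => v y - (1 / (2 * Real.pi)) * Real.log ‖y - z₀‖)
            (Srf.disk100 z₀) x‖ ^ 2 +
        ‖fderivWithin ℝ
            (fun y => fderivWithin ℝ
              (fun y' => v y' - (1 / (2 * Real.pi)) * Real.log ‖y' - z₀‖)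
              (Srf.disk100 z₀) y)
            (Srf.disk100 z₀) x‖ ^ 2) ∂μH[2]) ≤ CG

/-- The approximate Green's function `g̃(x) = ζ(x) v(P₀(x))` on `S`. -/
def approxGreen (Srf : SmoothSurface) (z₀ : E3) (ζ v : E3 → ℝ) : E3 → ℝ :=
  fun x => ζ x * v (Srf.P0 z₀ x)

/-- The cut-off lifted logarithm `l̃(x) = ζ(x) log r(x)` on `S`. -/
def cutLog (Srf : SmoothSurface) (z₀ : E3) (ζ : E3 → ℝ) : E3 → ℝ :=
  fun x => ζ x * Real.log (Srf.rfn z₀ x)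

/-- `lh` is the discrete (Galerkin) projection of the function `w` on `S`:
`a_h(lh, v_h) = a(w, V_h)` for all `v_h ∈ V_h`, where `V_h` is the lift of `v_h` to `S`. -/
def Triangulation.IsDiscreteProjection {Srf : SmoothSurface} {γ₀ h : ℝ}
    (Tr : Triangulation Srf γ₀ h) (w lh : E3 → ℝ) : Prop :=
  Tr.IsVh lh ∧ ∀ vh : E3 → ℝ, Tr.IsVh vh → Tr.ahForm lh vh = Srf.aForm w (Tr.liftS vh)

section
/-- Uniform geometric facts about the surface. -/
structure GeoFacts (Srf : SmoothSurface) (K ρ₀ : ℝ) : Prop where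
  K_ge : 1 ≤ K
  ρ_pos : 0 < ρ₀
  ρ_le : ρ₀ ≤ 1
  lip : ∀ x ∈ Srf.S, ∀ y ∈ Srf.S, ‖Srf.n x - Srf.n y‖ ≤ K * ‖x - y‖
  quad : ∀ x ∈ Srf.S, ∀ y ∈ Srf.S, |⟪Srf.n x, y - x⟫| ≤ K * ‖y - x‖ ^ 2
  graph : ∀ x ∈ Srf.S, ∀ v : E3, ‖v‖ ≤ ρ₀ → ∃ s : ℝ, |s| ≤ 2 * ‖v‖ ∧ x + v + s • Srf.n x ∈ Srf.S
  diffn : ∀ x ∈ Srf.S, DifferentiableAt ℝ Srf.n x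
  dn_le : ∀ x ∈ Srf.S, ‖fderiv ℝ Srf.n x‖ ≤ K

lemma taylor_local (F : E3 → ℝ) (hF : ContDiff ℝ (⊤ : ℕ∞) F) (x₀ : E3) :
    ∃ M : ℝ, 0 ≤ M ∧ ∃ r > 0, ∀ x ∈ ball x₀ r, ∀ y ∈ ball x₀ r,
      |F y - F x - fderiv ℝ F x (y - x)| ≤ M * ‖y - x‖ ^ 2 := by
  have h1 : ContDiff ℝ 1 (fderiv ℝ F) := hF.fderiv_right (by norm_cast)
  obtain ⟨K, s, hs, hl⟩ := (h1.contDiffAt (x := x₀)).exists_lipschitzOnWith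
  obtain ⟨r, hr, hrs⟩ := Metric.mem_nhds_iff.1 hs
  refine ⟨K, K.2, r, hr, fun x hx y hy => ?_⟩
  have hseg : segment ℝ x y ⊆ ball x₀ r := (convex_ball x₀ r).segment_subset hx hy
  have := (convex_segment (𝕜 := ℝ) x y).norm_image_sub_le_of_norm_fderiv_le' (f := F) (φ := fderiv ℝ F x)
    (C := K * ‖y - x‖) (fun z _ => hF.differentiable (by simp) z) (fun z hz => ?_)
    (left_mem_segment ℝ x y) (right_mem_segment ℝ x y)
  · rw [Real.norm_eq_abs] at this; nlinarith
  · have h2 := hl.dist_le_mul z (hrs (hseg hz)) x (hrs hx)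
    rw [dist_eq_norm, dist_eq_norm] at h2
    have h3 : ‖z - x‖ ≤ ‖y - x‖ := by
      obtain ⟨a, b, ha, hb, hab, rfl⟩ := hz
      have : a • x + b • y - x = b • (y - x) := by
        have : a = 1 - b := by linarith
        subst this; module
      rw [this, norm_smul, Real.norm_eq_abs, abs_of_nonneg hb]
      nlinarith [norm_nonneg (y - x)]
    exact h2.trans (mul_le_mul_of_nonneg_left h3 K.2)

lemma local_data (Srf : SmoothSurface) (x₀ : E3) (hx₀ : x₀ ∈ Srf.S) :
    ∃ M : ℝ, 0 ≤ M ∧ ∃ r > 0, ∃ F : E3 → ℝ, Continuous F ∧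
      (∀ x ∈ ball x₀ r, (x ∈ Srf.S ↔ F x = 0)) ∧
      ∀ x ∈ Srf.S ∩ ball x₀ r, ∃ t : ℝ, t ≠ 0 ∧ ∀ y ∈ ball x₀ r,
        |t * F y - ⟪Srf.n x, y - x⟫| ≤ M * ‖y - x‖ ^ 2 := by
  obtain ⟨U, F, hU, hxU, hF, hSU, hg, hgn⟩ := Srf.localLevel x₀ hx₀
  obtain ⟨M, hM, r, hr, hT⟩ := taylor_local F hF x₀
  obtain ⟨r', hr', hrU⟩ := Metric.isOpen_iff.1 hU x₀ hxU
  have hcg : Continuous (fun y => ‖gradient F y‖) := by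
    have h1 : Continuous (fderiv ℝ F) := hF.continuous_fderiv (by simp)
    unfold gradient
    fun_prop
  have hpos : 0 < ‖gradient F x₀‖ := norm_pos_iff.2 (hg x₀ hxU)
  have hev : ∀ᶠ y in nhds x₀, ‖gradient F x₀‖ / 2 < ‖gradient F y‖ :=
    hcg.continuousAt.eventually (lt_mem_nhds (by linarith))
  obtain ⟨r'', hr'', hrg⟩ := Metric.eventually_nhds_iff_ball.1 hev
  set c := ‖gradient F x₀‖ / 2 with hc
  have hcpos : 0 < c := by positivity
  refine ⟨M / c, by positivity, min r (min r' r''), by positivity, F, hF.continuous, ?_, ?_⟩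
  · intro x hx
    have hxU' : x ∈ U := hrU (ball_subset_ball (by simp) hx)
    have : x ∈ Srf.S ∩ U ↔ x ∈ {y ∈ U | F y = 0} := by rw [hSU]
    simpa [hxU'] using this
  · rintro x ⟨hxS, hx⟩
    have hxU' : x ∈ U := hrU (ball_subset_ball (by simp) hx)
    have hx1 : x ∈ ball x₀ r := ball_subset_ball (by simp) hx
    have hx2 : x ∈ ball x₀ r'' := ball_subset_ball (by simp) hx
    obtain ⟨t, ht⟩ := hgn x ⟨hxS, hxU'⟩
    have habs : c < |t| := by
      have := hrg x hx2
      rw [ht, norm_smul, Srf.n_unit x hxS, mul_one] at this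
      simpa using this
    have ht0 : t ≠ 0 := by
      rintro rfl; simp at habs; linarith
    have hFx : F x = 0 := by
      have : x ∈ {y ∈ U | F y = 0} := hSU ▸ ⟨hxS, hxU'⟩
      exact this.2
    refine ⟨t⁻¹, inv_ne_zero ht0, fun y hy => ?_⟩
    have h := hT x hx1 y (ball_subset_ball (by simp) hy)
    have hd : fderiv ℝ F x (y - x) = t * ⟪Srf.n x, y - x⟫ := by
      have : fderiv ℝ F x (y - x) = ⟪gradient F x, y - x⟫ := by
        simp [gradient]
      rw [this, ht, real_inner_smul_left]
    rw [hd, hFx, sub_zero] at h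
    have e : t⁻¹ * F y - ⟪Srf.n x, y - x⟫ = t⁻¹ * (F y - t * ⟪Srf.n x, y - x⟫) := by
      field_simp
    rw [e, abs_mul, abs_inv]
    have h1 : |t|⁻¹ ≤ c⁻¹ := by gcongr
    calc |t|⁻¹ * |F y - t * ⟪Srf.n x, y - x⟫| ≤ c⁻¹ * (M * ‖y - x‖ ^ 2) := by gcongr
      _ = M / c * ‖y - x‖ ^ 2 := by ring

lemma uniform_data (Srf : SmoothSurface) :
    ∃ M : ℝ, 0 ≤ M ∧ ∃ r > 0, ∀ x ∈ Srf.S, ∃ F : E3 → ℝ, Continuous F ∧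
      (∀ y ∈ ball x r, (y ∈ Srf.S ↔ F y = 0)) ∧
      ∀ y ∈ ball x r, |F y - ⟪Srf.n x, y - x⟫| ≤ M * ‖y - x‖ ^ 2 := by
  choose! M hM r hr F hF h1 h2 using local_data Srf
  obtain ⟨t, hcov⟩ := Srf.compact.elim_nhds_subcover' (fun x hx => ball x (r x / 2))
    (fun x hx => ball_mem_nhds _ (by have := hr x hx; positivity))
  have hne : t.Nonempty := by
    by_contra hne
    rw [Finset.not_nonempty_iff_eq_empty] at hne
    subst hne
    obtain ⟨x, hx⟩ := Srf.nonempty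
    simpa using hcov hx
  refine ⟨t.sup' hne (fun x => M x), ?_, t.inf' hne (fun x => r x / 2), ?_, ?_⟩
  · obtain ⟨x, hx⟩ := hne
    exact (hM x x.2).trans (Finset.le_sup' (fun x : Srf.S => M x) hx)
  · show 0 < _
    rw [Finset.lt_inf'_iff]
    intro x hx
    have := hr x x.2
    positivity
  · intro x hx
    have := hcov hx
    simp only [Set.mem_iUnion] at this
    obtain ⟨x0, hx0, hxb⟩ := this
    have hr0 := hr x0 x0.2
    have hinf : t.inf' hne (fun x => r x / 2) ≤ r x0 / 2 := Finset.inf'_le (fun x : Srf.S => r x / 2) hx0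
    have hsub : ball x (t.inf' hne (fun x => r x / 2)) ⊆ ball (x0 : E3) (r x0) := by
      intro y hy
      rw [mem_ball] at *
      have := dist_triangle y x x0
      linarith
    obtain ⟨τ, hτ, hT⟩ := h2 x0 x0.2 x ⟨hx, ball_subset_ball (by linarith) hxb⟩
    refine ⟨fun y => τ * F x0 y, continuous_const.mul (hF x0 x0.2), ?_, ?_⟩
    · intro y hy
      rw [h1 x0 x0.2 y (hsub hy)]
      simp [hτ]
    · intro y hy
      refine (hT y (hsub hy)).trans ?_
      gcongr
      exact Finset.le_sup' (fun x : Srf.S => M x) hx0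

lemma exists_geoFacts (Srf : SmoothSurface) : ∃ K ρ₀ : ℝ, GeoFacts Srf K ρ₀ := by
  obtain ⟨M, hM, r, hr, hdat⟩ := uniform_data Srf
  obtain ⟨U, hU, hSU, hn⟩ := Srf.n_smooth
  have hcd : ∀ x ∈ Srf.S, ContDiffAt ℝ 1 Srf.n x := fun x hx =>
    ((hn x (hSU hx)).contDiffAt (hU.mem_nhds (hSU hx))).of_le (by norm_cast)
  obtain ⟨K1, hK1⟩ := LocallyLipschitzOn.exists_lipschitzOnWith_of_compact (f := Srf.n) Srf.compact (by
    intro x hx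
    obtain ⟨K, s, hs, hl⟩ := (hcd x hx).exists_lipschitzOnWith
    exact ⟨K, s, mem_nhdsWithin_of_mem_nhds hs, hl⟩)
  obtain ⟨K2, hK2⟩ : ∃ C, ∀ x ∈ Srf.S, ‖fderiv ℝ Srf.n x‖ ≤ C := by
    apply Srf.compact.exists_bound_of_continuousOn
    intro x hx
    exact ((hcd x hx).fderiv_right (m := 0) (by norm_num)).continuousAt.continuousWithinAt
  set ρ := min 1 (min (r / 4) (1 / (9 * M + 9))) with hρ
  have hρpos : 0 < ρ := by positivity
  set K := 1 + K1 + |K2| + M + 1 / r with hK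
  have hK1p : (0:ℝ) ≤ K1 := K1.2
  have hrinv : 0 < 1 / r := by positivity
  have hK2p := abs_nonneg K2
  refine ⟨K, ρ, by linarith, hρpos, by simp [hρ], ?_, ?_, ?_, ?_, ?_⟩
  · intro x hx y hy
    have := hK1.dist_le_mul x hx y hy
    rw [dist_eq_norm, dist_eq_norm] at this
    refine this.trans ?_
    gcongr
    linarith
  · intro x hx y hy
    obtain ⟨F, hF, hF1, hF2⟩ := hdat x hx
    by_cases hd : y ∈ ball x r
    · have h := hF2 y hd
      rw [(hF1 y hd).1 hy, zero_sub, abs_neg] at h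
      refine h.trans ?_
      gcongr
      linarith
    · have hd' : r ≤ ‖y - x‖ := by simpa [dist_eq_norm] using hd
      have h1 : |⟪Srf.n x, y - x⟫| ≤ ‖y - x‖ := by
        have := abs_real_inner_le_norm (Srf.n x) (y - x)
        rwa [Srf.n_unit x hx, one_mul] at this
      calc |⟪Srf.n x, y - x⟫| ≤ ‖y - x‖ := h1
        _ ≤ (1 / r) * ‖y - x‖ ^ 2 := by
          rw [one_div, ← div_eq_inv_mul, le_div_iff₀ hr]; nlinarith
        _ ≤ K * ‖y - x‖ ^ 2 := by gcongr; linarith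
  · intro x hx v hv
    obtain ⟨F, hF, hF1, hF2⟩ := hdat x hx
    have hn1 := Srf.n_unit x hx
    have hnorm : ∀ s : ℝ, |s| ≤ 2 * ‖v‖ → ‖v + s • Srf.n x‖ ≤ 3 * ‖v‖ := by
      intro s hs
      calc ‖v + s • Srf.n x‖ ≤ ‖v‖ + ‖s • Srf.n x‖ := norm_add_le _ _
        _ = ‖v‖ + |s| := by rw [norm_smul, hn1, mul_one, Real.norm_eq_abs]
        _ ≤ _ := by linarith
    have hv4 : ‖v‖ ≤ r / 4 := hv.trans ((min_le_right _ _).trans (min_le_left _ _))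
    have hvM : ‖v‖ * (9 * M + 9) ≤ 1 := by
      have : ‖v‖ ≤ 1 / (9 * M + 9) := hv.trans ((min_le_right _ _).trans (min_le_right _ _))
      rwa [le_div_iff₀ (by positivity)] at this
    have hball : ∀ s : ℝ, |s| ≤ 2 * ‖v‖ → x + v + s • Srf.n x ∈ ball x r := by
      intro s hs
      rw [mem_ball, dist_eq_norm]
      have : x + v + s • Srf.n x - x = v + s • Srf.n x := by abel
      rw [this]
      have := hnorm s hs
      linarith [norm_nonneg v]
    have hest : ∀ s : ℝ, |s| ≤ 2 * ‖v‖ →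
        |F (x + v + s • Srf.n x) - (⟪Srf.n x, v⟫ + s)| ≤ ‖v‖ := by
      intro s hs
      have h := hF2 _ (hball s hs)
      have e : x + v + s • Srf.n x - x = v + s • Srf.n x := by abel
      rw [e, inner_add_right, real_inner_smul_right, real_inner_self_eq_norm_sq, hn1] at h
      have h3 := hnorm s hs
      have : M * ‖v + s • Srf.n x‖ ^ 2 ≤ ‖v‖ := by
        calc M * ‖v + s • Srf.n x‖ ^ 2 ≤ M * (3 * ‖v‖) ^ 2 := by gcongr
          _ = (‖v‖ * (9 * M)) * ‖v‖ := by ring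
          _ ≤ 1 * ‖v‖ := by
              gcongr
              nlinarith [norm_nonneg v]
          _ = ‖v‖ := one_mul _
      calc _ = |F (x + v + s • Srf.n x) - (⟪Srf.n x, v⟫ + s * 1 ^ 2)| := by norm_num
        _ ≤ _ := h.trans this
    have hin : |⟪Srf.n x, v⟫| ≤ ‖v‖ := by
      have := abs_real_inner_le_norm (Srf.n x) v
      rwa [hn1, one_mul] at this
    have hv0 := norm_nonneg v
    have hcont : ContinuousOn (fun s : ℝ => F (x + v + s • Srf.n x)) (Set.Icc (-(2 * ‖v‖)) (2 * ‖v‖)) := by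
      apply Continuous.continuousOn
      fun_prop
    have hiv := intermediate_value_Icc (by linarith) hcont
    have h0 : (0:ℝ) ∈ Set.Icc (F (x + v + (-(2 * ‖v‖)) • Srf.n x)) (F (x + v + (2 * ‖v‖) • Srf.n x)) := by
      have e1 := hest (-(2 * ‖v‖)) (by rw [abs_neg, abs_of_nonneg (by positivity)])
      have e2 := hest (2 * ‖v‖) (by rw [abs_of_nonneg (by positivity)])
      rw [abs_le] at e1 e2 hin
      constructor <;> linarith [e1.1, e1.2, e2.1, e2.2, hin.1, hin.2]
    obtain ⟨s, hs, hs0⟩ := hiv h0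
    have hsabs : |s| ≤ 2 * ‖v‖ := abs_le.2 ⟨hs.1, hs.2⟩
    exact ⟨s, hsabs, (hF1 _ (hball s hsabs)).2 hs0⟩
  · intro x hx
    exact (hcd x hx).differentiableAt (by norm_num)
  · intro x hx
    refine (hK2 x hx).trans ?_
    have := le_abs_self K2
    linarith

end

section
namespace SmoothSurface
variable (Srf : SmoothSurface)

/-- A nearest point on the surface. -/
def proj (z : E3) : E3 := (Srf.compact.exists_infDist_eq_dist Srf.nonempty z).choose

lemma proj_mem (z : E3) : Srf.proj z ∈ Srf.S :=
  (Srf.compact.exists_infDist_eq_dist Srf.nonempty z).choose_spec.1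

lemma dist_proj (z : E3) : infDist z Srf.S = dist z (Srf.proj z) :=
  (Srf.compact.exists_infDist_eq_dist Srf.nonempty z).choose_spec.2

lemma proj_nearest (z : E3) (y : E3) (hy : y ∈ Srf.S) : dist z (Srf.proj z) ≤ dist z y := by
  rw [← dist_proj]; exact infDist_le_dist_of_mem hy

/-- Orthogonal projection onto the tangent plane. -/
def Pt (x : E3) : E3 →L[ℝ] E3 := (Srf.tangent x).starProjection

lemma Pt_apply {x : E3} (hx : x ∈ Srf.S) (v : E3) : Srf.Pt x v = v - ⟪Srf.n x, v⟫ • Srf.n x := by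
  unfold Pt tangent
  rw [Submodule.starProjection_orthogonal_val, Submodule.starProjection_unit_singleton ℝ (Srf.n_unit x hx)]

lemma Pt_norm_le (x v : E3) : ‖Srf.Pt x v‖ ≤ ‖v‖ := Submodule.norm_starProjection_apply_le _ _

lemma Pt_opNorm_le (x : E3) : ‖Srf.Pt x‖ ≤ 1 := Submodule.starProjection_norm_le _

lemma Pt_n {x : E3} (hx : x ∈ Srf.S) : Srf.Pt x (Srf.n x) = 0 := by
  rw [Pt_apply _ hx, real_inner_self_eq_norm_sq, Srf.n_unit x hx]; simp

lemma inner_n_Pt {x : E3} (hx : x ∈ Srf.S) (v : E3) : ⟪Srf.n x, Srf.Pt x v⟫ = 0 := by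
  rw [Pt_apply _ hx, inner_sub_right, real_inner_smul_right, real_inner_self_eq_norm_sq, Srf.n_unit x hx]
  simp

lemma Pt_eq_self {x : E3} (hx : x ∈ Srf.S) {v : E3} (h : ⟪Srf.n x, v⟫ = 0) : Srf.Pt x v = v := by
  rw [Pt_apply _ hx, h]; simp

lemma Pt_symm (x v w : E3) : ⟪Srf.Pt x v, w⟫ = ⟪v, Srf.Pt x w⟫ := by
  unfold Pt
  exact Submodule.inner_starProjection_left_eq_right _ _ _

lemma sub_Pt_norm {x : E3} (hx : x ∈ Srf.S) (v : E3) : ‖v - Srf.Pt x v‖ = |⟪Srf.n x, v⟫| := by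
  rw [Pt_apply _ hx, sub_sub_cancel, norm_smul, Srf.n_unit x hx, mul_one, Real.norm_eq_abs]

end SmoothSurface

variable {Srf : SmoothSurface} {K ρ : ℝ}

lemma GeoFacts.K_pos (hG : GeoFacts Srf K ρ) : 0 < K := lt_of_lt_of_le one_pos hG.K_ge

lemma GeoFacts.graph_tan (hG : GeoFacts Srf K ρ) {x : E3} (hx : x ∈ Srf.S) {τ : E3}
    (hτ : ⟪Srf.n x, τ⟫ = 0) (hle : ‖τ‖ ≤ ρ) :
    ∃ s : ℝ, |s| ≤ 2 * ‖τ‖ ∧ |s| ≤ 9 * K * ‖τ‖ ^ 2 ∧ x + τ + s • Srf.n x ∈ Srf.S := by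
  obtain ⟨s, hs, hmem⟩ := hG.graph x hx τ hle
  refine ⟨s, hs, ?_, hmem⟩
  have hq := hG.quad x hx _ hmem
  have e : x + τ + s • Srf.n x - x = τ + s • Srf.n x := by abel
  have hn := Srf.n_unit x hx
  rw [e, inner_add_right, real_inner_smul_right, real_inner_self_eq_norm_sq, hn, hτ] at hq
  have h3 : ‖τ + s • Srf.n x‖ ≤ 3 * ‖τ‖ := by
    calc ‖τ + s • Srf.n x‖ ≤ ‖τ‖ + ‖s • Srf.n x‖ := norm_add_le _ _
      _ = ‖τ‖ + |s| := by rw [norm_smul, hn, mul_one, Real.norm_eq_abs]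
      _ ≤ _ := by linarith
  have hK := hG.K_pos
  calc |s| = |0 + s * 1 ^ 2| := by norm_num
    _ ≤ K * ‖τ + s • Srf.n x‖ ^ 2 := hq
    _ ≤ K * (3 * ‖τ‖) ^ 2 := by gcongr
    _ = _ := by ring

/-- First order optimality for nearest points. -/
lemma GeoFacts.nearest_normal (hG : GeoFacts Srf K ρ) {z p : E3} (hp : p ∈ Srf.S)
    (hnear : ∀ y ∈ Srf.S, dist z p ≤ dist z y) :
    z = p + ⟪Srf.n p, z - p⟫ • Srf.n p := by
  set g := z - p with hg
  set τ := Srf.Pt p g with hτ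
  have hτn : ⟪Srf.n p, τ⟫ = 0 := Srf.inner_n_Pt hp g
  have hn := Srf.n_unit p hp
  have hgt : g = τ + ⟪Srf.n p, g⟫ • Srf.n p := by
    rw [hτ, Srf.Pt_apply hp]; abel
  suffices h : τ = 0 by
    rw [h, zero_add] at hgt
    rw [← hgt, hg]; abel
  by_contra hne
  have hτpos : 0 < ‖τ‖ := norm_pos_iff.2 hne
  have hK := hG.K_pos
  have hρ := hG.ρ_pos
  set D := 18 * K * ‖g‖ + 9 with hD
  have hDpos : 0 < D := by positivity
  set t := min (ρ / ‖τ‖) (1 / D) with ht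
  have htpos : 0 < t := by positivity
  have h1 : ‖t • τ‖ = t * ‖τ‖ := by rw [norm_smul, Real.norm_eq_abs, abs_of_pos htpos]
  obtain ⟨s, hs1, hs2, hmem⟩ := hG.graph_tan hp (τ := t • τ) (by rw [real_inner_smul_right, hτn, mul_zero])
    (by
      rw [h1]
      have : t ≤ ρ / ‖τ‖ := min_le_left _ _
      rwa [le_div_iff₀ hτpos] at this)
  have hd := hnear _ hmem
  rw [dist_eq_norm, dist_eq_norm] at hd
  have e : z - (p + t • τ + s • Srf.n p) = g - (t • τ + s • Srf.n p) := by rw [hg]; abel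
  rw [e, ← hg] at hd
  have hsq : ‖g‖ ^ 2 ≤ ‖g - (t • τ + s • Srf.n p)‖ ^ 2 := by gcongr
  rw [norm_sub_sq_real g (t • τ + s • Srf.n p)] at hsq
  have hgτ : ⟪g, τ⟫ = ‖τ‖ ^ 2 := by
    have : ⟪g, τ⟫ = ⟪τ + ⟪Srf.n p, g⟫ • Srf.n p, τ⟫ := by rw [← hgt]
    rw [this, inner_add_left, real_inner_smul_left, hτn, mul_zero, add_zero, real_inner_self_eq_norm_sq]
  rw [inner_add_right, real_inner_smul_right, real_inner_smul_right, hgτ] at hsq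
  have h3 : ‖t • τ + s • Srf.n p‖ ≤ 3 * (t * ‖τ‖) := by
    calc _ ≤ ‖t • τ‖ + ‖s • Srf.n p‖ := norm_add_le _ _
      _ = t * ‖τ‖ + |s| := by rw [h1, norm_smul, hn, mul_one, Real.norm_eq_abs]
      _ ≤ _ := by rw [h1] at hs1; linarith
  have h4 : ‖t • τ + s • Srf.n p‖ ^ 2 ≤ (3 * (t * ‖τ‖)) ^ 2 := by gcongr
  have h5 : |s * ⟪g, Srf.n p⟫| ≤ 9 * K * (t * ‖τ‖) ^ 2 * ‖g‖ := by
    rw [abs_mul]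
    have := abs_real_inner_le_norm g (Srf.n p)
    rw [hn, mul_one] at this
    rw [h1] at hs2
    gcongr
  have h6 := neg_abs_le (s * ⟪g, Srf.n p⟫)
  have h7 : 2 * (t * ‖τ‖ ^ 2) ≤ t * ‖τ‖ ^ 2 * (t * D) := by
    rw [hD]; nlinarith
  have h8 : t * D ≤ 1 := by
    have : t ≤ 1 / D := min_le_right _ _
    rwa [le_div_iff₀ hDpos] at this
  have h9 : 0 < t * ‖τ‖ ^ 2 := by positivity
  nlinarith

lemma GeoFacts.near_lip (hG : GeoFacts Srf K ρ) {p q : E3} (hp : p ∈ Srf.S) (hq : q ∈ Srf.S)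
    {s t δ : ℝ} (hs : |s| ≤ δ) (ht : |t| ≤ δ) :
    (1 - 2 * K * δ) * ‖p - q‖ ≤ ‖(p + s • Srf.n p) - (q + t • Srf.n q)‖ := by
  set u := p - q with hu
  have h1 := hG.quad p hp q hq
  have h2 := hG.quad q hq p hp
  have hK := hG.K_pos
  rw [← hu] at h2
  have e1 : q - p = -u := by rw [hu]; abel
  rw [e1, norm_neg, inner_neg_right, abs_neg] at h1
  have h3 : ⟪(p + s • Srf.n p) - (q + t • Srf.n q), u⟫ = ‖u‖ ^ 2 + s * ⟪Srf.n p, u⟫ - t * ⟪Srf.n q, u⟫ := by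
    have : (p + s • Srf.n p) - (q + t • Srf.n q) = u + s • Srf.n p - t • Srf.n q := by rw [hu]; abel
    rw [this, inner_sub_left, inner_add_left, real_inner_smul_left, real_inner_smul_left,
      real_inner_self_eq_norm_sq]
  have h4 := real_inner_le_norm ((p + s • Srf.n p) - (q + t • Srf.n q)) u
  rw [h3] at h4
  have hδ : 0 ≤ δ := (abs_nonneg s).trans hs
  have h5 : |s * ⟪Srf.n p, u⟫| ≤ δ * (K * ‖u‖ ^ 2) := by rw [abs_mul]; gcongr
  have h6 : |t * ⟪Srf.n q, u⟫| ≤ δ * (K * ‖u‖ ^ 2) := by rw [abs_mul]; gcongr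
  rw [abs_le] at h5 h6
  by_cases h0 : ‖u‖ = 0
  · rw [h0]; simp
  · have hpos : 0 < ‖u‖ := lt_of_le_of_ne (norm_nonneg _) (Ne.symm h0)
    have : ((1 - 2 * K * δ) * ‖u‖) * ‖u‖ ≤ ‖(p + s • Srf.n p) - (q + t • Srf.n q)‖ * ‖u‖ := by
      nlinarith [h5.1, h6.2]
    exact le_of_mul_le_mul_right this hpos

/-- signed normal coordinate -/
def SmoothSurface.sd (Srf : SmoothSurface) (z : E3) : ℝ := ⟪Srf.n (Srf.proj z), z - Srf.proj z⟫

lemma GeoFacts.proj_decomp (hG : GeoFacts Srf K ρ) (z : E3) :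
    z = Srf.proj z + Srf.sd z • Srf.n (Srf.proj z) :=
  hG.nearest_normal (Srf.proj_mem z) (fun y hy => Srf.proj_nearest z y hy)

lemma GeoFacts.abs_sd (hG : GeoFacts Srf K ρ) (z : E3) : |Srf.sd z| = infDist z Srf.S := by
  rw [Srf.dist_proj, dist_eq_norm]
  have h : z - Srf.proj z = Srf.sd z • Srf.n (Srf.proj z) := by
    nth_rewrite 1 [hG.proj_decomp z]; abel
  rw [h, norm_smul, Srf.n_unit _ (Srf.proj_mem z), mul_one, Real.norm_eq_abs]

/-- nearest points are unique near the surface -/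
lemma GeoFacts.proj_eq (hG : GeoFacts Srf K ρ) {p : E3} (hp : p ∈ Srf.S) {s : ℝ}
    (hs : 4 * K * |s| ≤ 1) : Srf.proj (p + s • Srf.n p) = p := by
  set z := p + s • Srf.n p with hz
  have h1 : |Srf.sd z| ≤ |s| := by
    rw [hG.abs_sd]
    refine (infDist_le_dist_of_mem hp).trans ?_
    rw [dist_eq_norm, hz, add_sub_cancel_left, norm_smul, Srf.n_unit p hp, mul_one, Real.norm_eq_abs]
  have h2 := hG.near_lip (Srf.proj_mem z) hp h1 le_rfl
  rw [← hG.proj_decomp z, ← hz, sub_self, norm_zero] at h2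
  have h3 : (1:ℝ)/2 ≤ 1 - 2 * K * |s| := by linarith
  have h4 := norm_nonneg (Srf.proj z - p)
  have : ‖Srf.proj z - p‖ = 0 := by nlinarith
  exact sub_eq_zero.1 (norm_eq_zero.1 this)

lemma GeoFacts.nearest_eq (hG : GeoFacts Srf K ρ) {z p : E3} (hp : p ∈ Srf.S)
    (hnear : ∀ y ∈ Srf.S, dist z p ≤ dist z y) (hz : 4 * K * infDist z Srf.S ≤ 1) :
    Srf.proj z = p := by
  have h1 := hG.nearest_normal hp hnear
  set s := ⟪Srf.n p, z - p⟫
  have h2 : |s| = infDist z Srf.S := by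
    apply le_antisymm
    · have : |s| = dist z p := by
        rw [dist_eq_norm]
        nth_rewrite 1 [h1]
        rw [add_sub_cancel_left, norm_smul, Srf.n_unit p hp, mul_one, Real.norm_eq_abs]
      rw [this, Srf.dist_proj]
      exact hnear _ (Srf.proj_mem z)
    · refine (infDist_le_dist_of_mem hp).trans ?_
      nth_rewrite 1 [h1]
      rw [dist_eq_norm, add_sub_cancel_left, norm_smul, Srf.n_unit p hp, mul_one, Real.norm_eq_abs]
  have h3 := hG.proj_eq hp (s := s) (by rw [h2]; exact hz)
  rwa [← h1] at h3

lemma GeoFacts.proj_self (hG : GeoFacts Srf K ρ) {p : E3} (hp : p ∈ Srf.S) : Srf.proj p = p := by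
  have := hG.proj_eq hp (s := 0) (by simp)
  simpa using this

lemma GeoFacts.proj_lip' (hG : GeoFacts Srf K ρ) {z w : E3} {δ : ℝ}
    (hz : infDist z Srf.S ≤ δ) (hw : infDist w Srf.S ≤ δ) :
    (1 - 2 * K * δ) * ‖Srf.proj z - Srf.proj w‖ ≤ ‖z - w‖ := by
  have := hG.near_lip (Srf.proj_mem z) (Srf.proj_mem w) (s := Srf.sd z) (t := Srf.sd w) (δ := δ)
    (by rwa [hG.abs_sd]) (by rwa [hG.abs_sd])
  rwa [← hG.proj_decomp, ← hG.proj_decomp] at this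

lemma GeoFacts.proj_lip (hG : GeoFacts Srf K ρ) {z w : E3}
    (hz : 4 * K * infDist z Srf.S ≤ 1) (hw : 4 * K * infDist w Srf.S ≤ 1) :
    ‖Srf.proj z - Srf.proj w‖ ≤ 2 * ‖z - w‖ := by
  have hK := hG.K_pos
  have h1 : infDist z Srf.S ≤ 1 / (4 * K) := by rw [le_div_iff₀ (by positivity)]; linarith
  have h2 : infDist w Srf.S ≤ 1 / (4 * K) := by rw [le_div_iff₀ (by positivity)]; linarith
  have := hG.proj_lip' h1 h2
  have e : 1 - 2 * K * (1 / (4 * K)) = 1 / 2 := by field_simp; norm_num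
  rw [e] at this
  linarith

end

section
variable {Srf : SmoothSurface} {K ρ : ℝ}

lemma infDist_le_add_norm (Srf : SmoothSurface) (z y : E3) :
    infDist (z + y) Srf.S ≤ infDist z Srf.S + ‖y‖ := by
  have := infDist_le_infDist_add_dist (s := Srf.S) (x := z + y) (y := z)
  simpa [dist_eq_norm] using this

lemma infDist_le_norm {x : E3} (hx : x ∈ Srf.S) (y : E3) : infDist (x + y) Srf.S ≤ ‖y‖ := by
  have := infDist_le_add_norm Srf x y
  rwa [infDist_zero_of_mem hx, zero_add] at this

set_option maxHeartbeats 1000000 in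
/-- differentiability of the nearest point projection -/
lemma GeoFacts.hasFDerivAt_proj (hG : GeoFacts Srf K ρ) {z : E3}
    (hz : 8 * K * infDist z Srf.S < 1) :
    ∃ A : E3 →L[ℝ] E3, HasFDerivAt Srf.proj A z ∧
      (∀ v, ‖A v - Srf.Pt (Srf.proj z) v‖ ≤ 2 * K * infDist z Srf.S * ‖v‖) := by
  have hK := hG.K_pos
  set p := Srf.proj z with hp
  have hpS : p ∈ Srf.S := Srf.proj_mem z
  set s := Srf.sd z with hs
  have hsabs : |s| = infDist z Srf.S := hG.abs_sd z
  rw [← hsabs] at hz ⊢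
  set P := Srf.Pt p with hP
  set N := fderiv ℝ Srf.n p with hN
  have hNle : ‖N‖ ≤ K := hG.dn_le p hpS
  set t : E3 →L[ℝ] E3 := -(s • (P * N)) with ht
  have htle : ‖t‖ ≤ |s| * K := by
    rw [ht, norm_neg, norm_smul, Real.norm_eq_abs]
    have : ‖P * N‖ ≤ 1 * K := (norm_mul_le _ _).trans (by
      gcongr; exact Srf.Pt_opNorm_le p)
    rw [one_mul] at this
    gcongr
  have ht1 : ‖t‖ < 1 / 8 := by nlinarith
  set T := Units.oneSub t (by linarith) with hT
  set B : E3 →L[ℝ] E3 := ((T⁻¹ : (E3 →L[ℝ] E3)ˣ) : E3 →L[ℝ] E3) with hB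
  have hTB : ∀ v, (1 - t) (B v) = v := by
    intro v
    have : (T : E3 →L[ℝ] E3) * B = 1 := T.mul_inv
    have h2 := congrArg (fun f : E3 →L[ℝ] E3 => f v) this
    simpa [hT] using h2
  have hBT : ∀ v, B ((1 - t) v) = v := by
    intro v
    have : B * (T : E3 →L[ℝ] E3) = 1 := T.inv_mul
    have h2 := congrArg (fun f : E3 →L[ℝ] E3 => f v) this
    simpa [hT] using h2
  have hBle : ∀ v, ‖B v‖ ≤ 2 * ‖v‖ := by
    intro v
    have h1 := hTB v
    have h2 : ‖B v‖ ≤ ‖v‖ + ‖t (B v)‖ := by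
      have : B v = v + t (B v) := by
        nth_rewrite 2 [← h1]
        simp
      nth_rewrite 1 [this]
      exact norm_add_le _ _
    have h3 := t.le_opNorm (B v)
    have := norm_nonneg (B v)
    nlinarith
  refine ⟨B * P, ?_, ?_⟩
  · -- the derivative
    have hdn := (hG.diffn p hpS).hasFDerivAt
    rw [hasFDerivAt_iff_isLittleO_nhds_zero, Asymptotics.isLittleO_iff]
    intro c hc
    rw [hasFDerivAt_iff_isLittleO_nhds_zero, Asymptotics.isLittleO_iff] at hdn
    have hdn' := hdn (c := c / 8) (by positivity)
    rw [Metric.eventually_nhds_iff] at hdn'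
    obtain ⟨r, hr, hdn'⟩ := hdn'
    have hz' : 0 < 1 - 8 * K * |s| := by linarith
    rw [Metric.eventually_nhds_iff]
    refine ⟨min (min (r / 2) ((1 - 8 * K * |s|) / (8 * K))) (c / (80 * K)), by positivity, ?_⟩
    intro η hη
    rw [dist_zero_right, lt_min_iff, lt_min_iff] at hη
    obtain ⟨⟨hη1, hη2⟩, hη3⟩ := hη
    rw [lt_div_iff₀ (by positivity)] at hη2 hη3
    set p' := Srf.proj (z + η) with hp'
    have hpS' : p' ∈ Srf.S := Srf.proj_mem _
    set s' := Srf.sd (z + η) with hs'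
    have hinf : infDist (z + η) Srf.S ≤ |s| + ‖η‖ := by
      rw [hsabs]; exact infDist_le_add_norm Srf z η
    set u := p' - p with hu
    have hule : ‖u‖ ≤ 2 * ‖η‖ := by
      have := hG.proj_lip (z := z + η) (w := z) (by nlinarith) (by rw [← hsabs]; nlinarith [abs_nonneg s])
      rwa [add_sub_cancel_left] at this
    have hη0 := norm_nonneg η
    have d1 := hG.proj_decomp z
    have d2 := hG.proj_decomp (z + η)
    rw [← hp, ← hs] at d1
    rw [← hp', ← hs'] at d2
    set m := Srf.n p' - Srf.n p with hm
    have hmle : ‖m‖ ≤ K * ‖u‖ := hG.lip p' hpS' p hpS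
    have e1 : η = u + s • m + (s' - s) • Srf.n p' := by
      have h0 : η = (p' + s' • Srf.n p') - (p + s • Srf.n p) := by
        rw [← d2, ← d1]; abel
      rw [h0, hu, hm]; module
    have hss : |s' - s| ≤ 4 * ‖η‖ := by
      have h1 : (s' - s) • Srf.n p' = η - u - s • m := by
        have h0 : ∀ a b c d : E3, a = b + c + d → d = a - b - c := by
          intro a b c d h; rw [h]; abel
        exact h0 _ _ _ _ e1
      have h2 : |s' - s| = ‖η - u - s • m‖ := by
        rw [← h1, norm_smul, Srf.n_unit p' hpS', mul_one, Real.norm_eq_abs]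
      rw [h2]
      have h3 : ‖s • m‖ ≤ |s| * (K * (2 * ‖η‖)) := by
        rw [norm_smul, Real.norm_eq_abs]
        gcongr
        exact hmle.trans (by gcongr)
      have h4 : ‖η - u - s • m‖ ≤ ‖η‖ + ‖u‖ + ‖s • m‖ :=
        (norm_sub_le _ _).trans (by gcongr; exact norm_sub_le _ _)
      nlinarith
    have hPn : P (Srf.n p) = 0 := Srf.Pt_n hpS
    have e2 : P η = P u + s • P m + (s' - s) • P m := by
      have : Srf.n p' = m + Srf.n p := by rw [hm]; abel
      nth_rewrite 1 [e1]
      rw [this]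
      simp only [map_add, map_smul, hPn, add_zero]
    have hrem : ‖m - N u‖ ≤ c / 8 * ‖u‖ := by
      have := hdn' (y := u) (by rw [dist_zero_right]; linarith)
      have e : p + u = p' := by rw [hu]; abel
      rwa [e] at this
    have e3 : (1 - t) u - P η = (u - P u) - s • P (m - N u) - (s' - s) • P m := by
      rw [e2, ht]
      simp only [ContinuousLinearMap.sub_apply, ContinuousLinearMap.one_apply, ContinuousLinearMap.neg_apply,
        ContinuousLinearMap.smul_apply, ContinuousLinearMap.mul_apply, map_sub, smul_sub]
      abel
    have hq : ‖u - P u‖ ≤ K * ‖u‖ ^ 2 := by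
      rw [Srf.sub_Pt_norm hpS]
      exact hG.quad p hpS p' hpS'
    have b1 : ‖s • P (m - N u)‖ ≤ |s| * (c / 8 * (2 * ‖η‖)) := by
      rw [norm_smul, Real.norm_eq_abs]
      gcongr
      exact (Srf.Pt_norm_le _ _).trans (hrem.trans (by gcongr))
    have b2 : ‖(s' - s) • P m‖ ≤ 4 * ‖η‖ * (K * (2 * ‖η‖)) := by
      rw [norm_smul, Real.norm_eq_abs]
      gcongr
      exact (Srf.Pt_norm_le _ _).trans (hmle.trans (by gcongr))
    have b3 : ‖u - P u‖ ≤ K * (2 * ‖η‖) ^ 2 := hq.trans (by gcongr)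
    have b4 : ‖(1 - t) u - P η‖ ≤ K * (2 * ‖η‖) ^ 2 + |s| * (c / 8 * (2 * ‖η‖)) + 4 * ‖η‖ * (K * (2 * ‖η‖)) := by
      rw [e3]
      refine (norm_sub_le _ _).trans (add_le_add ((norm_sub_le _ _).trans (add_le_add b3 b1)) b2)
    have e4 : p' - p - (B * P) η = B ((1 - t) u - P η) := by
      rw [map_sub, hBT, ContinuousLinearMap.mul_apply]
    rw [e4]
    have b5 := hBle ((1 - t) u - P η)
    have hs1 : |s| ≤ 1 := by nlinarith [hG.K_ge, abs_nonneg s]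
    have : |s| * (c / 8 * (2 * ‖η‖)) ≤ 1 * (c / 8 * (2 * ‖η‖)) := by gcongr
    have c1 : ‖η‖ * (80 * K) * ‖η‖ ≤ c * ‖η‖ := by gcongr
    calc _ ≤ _ := b5
      _ ≤ 2 * (K * (2 * ‖η‖) ^ 2 + 1 * (c / 8 * (2 * ‖η‖)) + 4 * ‖η‖ * (K * (2 * ‖η‖))) := by linarith
      _ = 24 / 80 * (‖η‖ * (80 * K) * ‖η‖) + 1 / 2 * (c * ‖η‖) := by ring
      _ ≤ _ := by linarith [mul_nonneg hc.le hη0]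
  · intro v
    have e : B (P v) - P v = B (t (P v)) := by
      have h1 := hBT (P v)
      have : (1 - t) (P v) = P v - t (P v) := by simp
      rw [this, map_sub] at h1
      exact sub_eq_of_eq_add ((sub_eq_iff_eq_add.1 h1).trans (add_comm _ _))
    rw [ContinuousLinearMap.mul_apply]
    have h2 : ‖B (P v) - P v‖ ≤ 2 * (|s| * K * ‖v‖) := by
      rw [e]
      refine (hBle _).trans ?_
      gcongr
      refine (t.le_opNorm _).trans ?_
      gcongr
      exact Srf.Pt_norm_le _ _
    linarith

lemma GeoFacts.hasFDerivAt_proj_self (hG : GeoFacts Srf K ρ) {x : E3} (hx : x ∈ Srf.S) :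
    HasFDerivAt Srf.proj (Srf.Pt x) x := by
  have h0 : infDist x Srf.S = 0 := infDist_zero_of_mem hx
  obtain ⟨A, hA, hb⟩ := hG.hasFDerivAt_proj (z := x) (by rw [h0]; norm_num)
  rw [hG.proj_self hx, h0] at hb
  have : A = Srf.Pt x := by
    ext1 v
    have := hb v
    rw [mul_zero, zero_mul] at this
    exact sub_eq_zero.1 (norm_le_zero_iff.1 this)
  rwa [← this]

/-- differentiability of `w ∘ proj` off the surface -/
lemma GeoFacts.diff_comp (hG : GeoFacts Srf K ρ) {z : E3} (hz : 8 * K * infDist z Srf.S < 1)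
    {w : E3 → ℝ} (hw : DifferentiableWithinAt ℝ w Srf.S (Srf.proj z)) :
    DifferentiableAt ℝ (fun y => w (Srf.proj y)) z := by
  obtain ⟨A, hA, -⟩ := hG.hasFDerivAt_proj hz
  have := hw.hasFDerivWithinAt.comp (s := Set.univ) z hA.hasFDerivWithinAt (fun y _ => Srf.proj_mem y)
  exact (hasFDerivWithinAt_univ.1 this).differentiableAt

lemma GeoFacts.diffAt_iff (hG : GeoFacts Srf K ρ) {x : E3} (hx : x ∈ Srf.S) {w : E3 → ℝ} :
    DifferentiableAt ℝ (fun y => w (Srf.proj y)) x ↔ DifferentiableWithinAt ℝ w Srf.S x := by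
  constructor
  · intro h
    exact h.differentiableWithinAt.congr (fun y hy => by rw [hG.proj_self hy]) (by rw [hG.proj_self hx])
  · intro h
    apply hG.diff_comp
    · rw [infDist_zero_of_mem hx]; norm_num
    · rwa [hG.proj_self hx]

/-- key formula for the tangential gradient -/
lemma GeoFacts.grad_eq (hG : GeoFacts Srf K ρ) {x : E3} (hx : x ∈ Srf.S) (w : E3 → ℝ) :
    Srf.grad w x = gradient (fun y => w (Srf.proj y)) x := by
  unfold SmoothSurface.grad tGrad gradient
  by_cases h : DifferentiableWithinAt ℝ w Srf.S x
  · have h1 : HasFDerivAt (fun y => w (Srf.proj y)) ((fderivWithin ℝ w Srf.S x).comp (Srf.Pt x)) x := by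
      have h2 := hG.hasFDerivAt_proj_self hx
      have h3 : HasFDerivWithinAt w (fderivWithin ℝ w Srf.S x) Srf.S (Srf.proj x) := by
        rw [hG.proj_self hx]; exact h.hasFDerivWithinAt
      have := h3.comp (s := Set.univ) x h2.hasFDerivWithinAt (fun y _ => Srf.proj_mem y)
      exact hasFDerivWithinAt_univ.1 this
    rw [h1.fderiv]
    apply ext_inner_right ℝ
    intro v
    rw [InnerProductSpace.toDual_symm_apply]
    have := Srf.Pt_symm x ((InnerProductSpace.toDual ℝ E3).symm (fderivWithin ℝ w Srf.S x)) v
    rw [InnerProductSpace.toDual_symm_apply] at this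
    exact this
  · have h2 : ¬ DifferentiableAt ℝ (fun y => w (Srf.proj y)) x := fun h3 => h ((hG.diffAt_iff hx).1 h3)
    rw [fderivWithin_zero_of_not_differentiableWithinAt h, fderiv_zero_of_not_differentiableAt h2]
    simp

lemma GeoFacts.inner_grad (hG : GeoFacts Srf K ρ) {x : E3} (hx : x ∈ Srf.S) (w : E3 → ℝ) (v : E3) :
    ⟪Srf.grad w x, v⟫ = fderiv ℝ (fun y => w (Srf.proj y)) x v := by
  rw [hG.grad_eq hx]; unfold gradient; rw [InnerProductSpace.toDual_symm_apply]

lemma GeoFacts.norm_grad (hG : GeoFacts Srf K ρ) {x : E3} (hx : x ∈ Srf.S) (w : E3 → ℝ) :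
    ‖Srf.grad w x‖ = ‖fderiv ℝ (fun y => w (Srf.proj y)) x‖ := by
  rw [hG.grad_eq hx]; unfold gradient; simp

lemma SmoothSurface.grad_tan {x : E3} (w : E3 → ℝ) :
    Srf.Pt x (Srf.grad w x) = Srf.grad w x := by
  unfold SmoothSurface.grad tGrad SmoothSurface.Pt
  apply Submodule.starProjection_eq_self_iff.2
  exact Submodule.coe_mem _

/-- derivative of `w ∘ proj` at a point of the tube in terms of the tangential gradient -/
lemma GeoFacts.fderiv_comp_proj (hG : GeoFacts Srf K ρ) {z : E3} (hz : 8 * K * infDist z Srf.S < 1)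
    {w : E3 → ℝ} (hw : DifferentiableWithinAt ℝ w Srf.S (Srf.proj z)) {A : E3 →L[ℝ] E3}
    (hA : HasFDerivAt Srf.proj A z) (v : E3) :
    fderiv ℝ (fun y => w (Srf.proj y)) z v = ⟪Srf.grad w (Srf.proj z), A v⟫ := by
  have hpS := Srf.proj_mem z
  rw [hG.inner_grad hpS]
  have h1 := ((hG.diffAt_iff hpS).2 hw).hasFDerivAt
  have hev : (fun y => w (Srf.proj y)) =ᶠ[nhds z] fun y => w (Srf.proj (Srf.proj y)) := by
    exact Filter.Eventually.of_forall fun y => by simp only [hG.proj_self (Srf.proj_mem y)]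
  rw [hev.fderiv_eq]
  have h2 := h1.comp z hA
  have h3 : (fun y => w (Srf.proj (Srf.proj y))) = (fun y => w (Srf.proj y)) ∘ Srf.proj := rfl
  rw [h3, h2.fderiv]; rfl

end

section
variable {Srf : SmoothSurface} {K ρ : ℝ}

/-- Hausdorff measure of a set under a map with a local Lipschitz bound. -/
lemma hausdorff_image_le {X : Type*} [MetricSpace X] [MeasurableSpace X] [BorelSpace X]
    [SecondCountableTopology X] {Y : Type*} [MetricSpace Y] [MeasurableSpace Y] [BorelSpace Y]
    (f : X → Y) (A : Set X) (L r : ℝ) (hL : 0 ≤ L) (hr : 0 < r)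
    (h : ∀ x ∈ A, ∀ y ∈ A, dist x y < r → dist (f x) (f y) ≤ L * dist x y) :
    μH[2] (f '' A) ≤ ENNReal.ofReal (L ^ 2) * μH[2] A := by
  rcases isEmpty_or_nonempty X with hX | hX
  · have : A = ∅ := Set.eq_empty_of_isEmpty A
    simp [this]
  set U : ℕ → Set X := fun i => ball (TopologicalSpace.denseSeq X i) (r / 2) with hU
  set P := disjointed U with hP
  have hcov : ⋃ i, P i = Set.univ := by
    rw [hP, iUnion_disjointed, Set.eq_univ_iff_forall]
    intro x
    obtain ⟨i, hi⟩ := (TopologicalSpace.denseRange_denseSeq X).exists_dist_lt x (half_pos hr)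
    exact Set.mem_iUnion.2 ⟨i, hi⟩
  have hPm : ∀ i, MeasurableSet (P i) := fun i =>
    MeasurableSet.disjointed (fun j => isOpen_ball.measurableSet) i
  have hsum : μH[2] A = ∑' i, μH[2] (P i ∩ A) := by
    have h1 : μH[2] A = (Measure.restrict μH[2] A) (⋃ i, P i) := by rw [hcov]; simp
    rw [h1, measure_iUnion (disjoint_disjointed U) hPm]
    congr 1; ext i
    rw [Measure.restrict_apply (hPm i)]
  have hpiece : ∀ i, μH[2] (f '' (P i ∩ A)) ≤ ENNReal.ofReal (L ^ 2) * μH[2] (P i ∩ A) := by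
    intro i
    have hl : LipschitzOnWith (Real.toNNReal L) f (P i ∩ A) := by
      apply LipschitzOnWith.of_dist_le_mul
      intro x hx y hy
      rw [Real.coe_toNNReal _ hL]
      apply h x hx.2 y hy.2
      have hx1 : x ∈ U i := disjointed_subset U i hx.1
      have hy1 : y ∈ U i := disjointed_subset U i hy.1
      rw [hU, mem_ball] at hx1 hy1
      have := dist_triangle_right x y (TopologicalSpace.denseSeq X i)
      linarith
    have := hl.hausdorffMeasure_image_le (d := 2) (by norm_num)
    convert this using 2
    rw [ENNReal.ofReal_pow hL]
    norm_cast
  have hA : A = ⋃ i, P i ∩ A := by rw [← Set.iUnion_inter, hcov, Set.univ_inter]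
  calc μH[2] (f '' A) = μH[2] (⋃ i, f '' (P i ∩ A)) := by
        conv_lhs => rw [hA]
        rw [Set.image_iUnion]
    _ ≤ ∑' i, μH[2] (f '' (P i ∩ A)) := measure_iUnion_le _
    _ ≤ ∑' i, ENNReal.ofReal (L ^ 2) * μH[2] (P i ∩ A) := ENNReal.tsum_le_tsum hpiece
    _ = _ := by rw [ENNReal.tsum_mul_left, ← hsum]

lemma hausdorff_le_image {X : Type*} [MetricSpace X] [MeasurableSpace X] [BorelSpace X]
    {Y : Type*} [MetricSpace Y] [MeasurableSpace Y] [BorelSpace Y] [SecondCountableTopology Y]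
    (f : X → Y) (A : Set X) (L r : ℝ) (hL : 0 ≤ L) (hr : 0 < r)
    (h : ∀ x ∈ A, ∀ y ∈ A, dist (f x) (f y) < r → dist x y ≤ L * dist (f x) (f y)) :
    μH[2] A ≤ ENNReal.ofReal (L ^ 2) * μH[2] (f '' A) := by
  rcases isEmpty_or_nonempty X with hX | hX
  · have : A = ∅ := Set.eq_empty_of_isEmpty A
    simp [this]
  have hg : ∀ x ∈ A, Function.invFunOn f A (f x) ∈ A ∧ f (Function.invFunOn f A (f x)) = f x := fun x hx =>
    ⟨Function.invFunOn_mem ⟨x, hx, rfl⟩, Function.invFunOn_eq ⟨x, hx, rfl⟩⟩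
  have hg' : ∀ x ∈ A, Function.invFunOn f A (f x) = x := by
    intro x hx
    have h1 := h _ (hg x hx).1 x hx (by rw [(hg x hx).2, dist_self]; exact hr)
    rw [(hg x hx).2, dist_self, mul_zero] at h1
    exact dist_le_zero.1 h1
  have himg : Function.invFunOn f A '' (f '' A) = A := by
    rw [Set.image_image]
    ext x; constructor
    · rintro ⟨y, hy, rfl⟩; exact (hg y hy).1
    · intro hx; exact ⟨x, hx, hg' x hx⟩
  have := hausdorff_image_le (Function.invFunOn f A) (f '' A) L r hL hr (by
    rintro _ ⟨x, hx, rfl⟩ _ ⟨y, hy, rfl⟩ hd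
    rw [hg' x hx, hg' y hy]
    exact h x hx y hy hd)
  rwa [himg] at this

/-- tangential coordinates -/
lemma SmoothSurface.coords {x : E3} (hx : x ∈ Srf.S) :
    ∃ Q : E3 →L[ℝ] (Fin 2 → ℝ), (∀ d, ‖Q d‖ ≤ ‖d‖) ∧
      ∀ d, ‖d‖ ^ 2 ≤ ⟪Srf.n x, d⟫ ^ 2 + 2 * ‖Q d‖ ^ 2 := by
  obtain ⟨b, hb⟩ := Orthonormal.exists_orthonormalBasis_extension_of_card_eq (𝕜 := ℝ) (E := E3) (ι := Fin 3)
    (by simp) (v := fun _ => Srf.n x) (s := {0}) (by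
      constructor
      · rintro ⟨i, hi⟩; exact Srf.n_unit x hx
      · rintro ⟨i, hi⟩ ⟨j, hj⟩ hij
        exact absurd (Subtype.ext (hi.trans hj.symm)) hij)
  have hb0 : b 0 = Srf.n x := hb 0 rfl
  refine ⟨ContinuousLinearMap.pi ![innerSL ℝ (b 1), innerSL ℝ (b 2)], ?_, ?_⟩
  · intro d
    rw [pi_norm_le_iff_of_nonneg (norm_nonneg _)]
    intro i
    fin_cases i
    · simpa [b.norm_eq_one] using norm_inner_le_norm (𝕜 := ℝ) (b 1) d
    · simpa [b.norm_eq_one] using norm_inner_le_norm (𝕜 := ℝ) (b 2) d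
  · intro d
    have h := b.sum_sq_norm_inner_right d
    rw [Fin.sum_univ_three, hb0] at h
    set Q : E3 →L[ℝ] (Fin 2 → ℝ) := ContinuousLinearMap.pi ![innerSL ℝ (b 1), innerSL ℝ (b 2)]
    have h1 : ‖⟪b 1, d⟫‖ ≤ ‖Q d‖ := norm_le_pi_norm (Q d) 0
    have h2 : ‖⟪b 2, d⟫‖ ≤ ‖Q d‖ := norm_le_pi_norm (Q d) 1
    have h3 : ‖⟪b 1, d⟫‖ ^ 2 ≤ ‖Q d‖ ^ 2 := by gcongr
    have h4 : ‖⟪b 2, d⟫‖ ^ 2 ≤ ‖Q d‖ ^ 2 := by gcongr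
    simp only [Real.norm_eq_abs, sq_abs] at h h3 h4
    linarith

lemma GeoFacts.coords_anti (hG : GeoFacts Srf K ρ) {x : E3} (hx : x ∈ Srf.S) :
    ∃ Q : E3 →L[ℝ] (Fin 2 → ℝ), (∀ d, ‖Q d‖ ≤ ‖d‖) ∧
      ∀ y ∈ Srf.S ∩ closedBall x (1 / (8 * K)), ∀ z ∈ Srf.S ∩ closedBall x (1 / (8 * K)),
        dist y z ≤ 2 * dist (Q y) (Q z) := by
  have hK := hG.K_pos
  obtain ⟨Q, hQ1, hQ2⟩ := Srf.coords hx
  refine ⟨Q, hQ1, ?_⟩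
  rintro y ⟨hy, hyb⟩ z ⟨hz, hzb⟩
  rw [dist_eq_norm, dist_eq_norm, ← map_sub]
  set d := y - z with hd
  rw [mem_closedBall, dist_eq_norm] at hyb hzb
  have h1 := hG.quad z hz y hy
  rw [← hd] at h1
  have h2 : |⟪Srf.n x, d⟫| ≤ |⟪Srf.n z, d⟫| + K * (1 / (8 * K)) * ‖d‖ := by
    have e : ⟪Srf.n x, d⟫ = ⟪Srf.n z, d⟫ - ⟪Srf.n z - Srf.n x, d⟫ := by rw [inner_sub_left]; ring
    rw [e]
    refine (abs_sub _ _).trans ?_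
    gcongr
    refine (abs_real_inner_le_norm _ _).trans ?_
    gcongr
    exact (hG.lip z hz x hx).trans (by gcongr)
  have h3 : ‖d‖ ≤ 2 * (1 / (8 * K)) := by
    have : d = (y - x) - (z - x) := by rw [hd]; abel
    rw [this]
    exact (norm_sub_le _ _).trans (by linarith)
  have h4 : K * ‖d‖ ^ 2 ≤ 1 / 4 * ‖d‖ := by
    have : K * ‖d‖ ^ 2 ≤ K * (2 * (1 / (8 * K))) * ‖d‖ := by
      have := mul_le_mul_of_nonneg_left h3 (mul_nonneg hK.le (norm_nonneg d))
      nlinarith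
    convert this using 2
    field_simp; norm_num
  have h5 : K * (1 / (8 * K)) = 1 / 8 := by field_simp
  rw [h5] at h2
  have h6 : |⟪Srf.n x, d⟫| ≤ 3 / 8 * ‖d‖ := by linarith
  have h7 : ⟪Srf.n x, d⟫ ^ 2 ≤ (3 / 8 * ‖d‖) ^ 2 := by rw [← sq_abs]; gcongr
  have h8 := hQ2 d
  apply le_of_sq_le_sq _ (by positivity)
  nlinarith [sq_nonneg ‖d‖, sq_nonneg ‖Q d‖]

lemma GeoFacts.ahlfors_small (hG : GeoFacts Srf K ρ) {x : E3} (hx : x ∈ Srf.S) {r : ℝ} (hr : 0 ≤ r)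
    (hrK : r ≤ 1 / (8 * K)) : μH[2] (Srf.S ∩ closedBall x r) ≤ ENNReal.ofReal (16 * r ^ 2) := by
  obtain ⟨Q, hQ1, hQ2⟩ := hG.coords_anti hx
  have hsub : closedBall x r ⊆ closedBall x (1 / (8 * K)) := closedBall_subset_closedBall hrK
  refine (hausdorff_le_image Q (Srf.S ∩ closedBall x r) 2 1 (by norm_num) one_pos ?_).trans ?_
  · rintro y ⟨hy, hyb⟩ z ⟨hz, hzb⟩ -
    exact hQ2 y ⟨hy, hsub hyb⟩ z ⟨hz, hsub hzb⟩
  · have himg : Q '' (Srf.S ∩ closedBall x r) ⊆ closedBall (Q x) r := by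
      rintro _ ⟨y, ⟨hy, hyb⟩, rfl⟩
      rw [mem_closedBall, dist_eq_norm, ← map_sub]
      rw [mem_closedBall, dist_eq_norm] at hyb
      exact (hQ1 _).trans hyb
    have h1 : (μH[2] : Measure (Fin 2 → ℝ)) = volume := by
      have := hausdorffMeasure_pi_real (ι := Fin 2)
      simpa using this
    calc _ ≤ ENNReal.ofReal (2 ^ 2) * μH[2] (closedBall (Q x) r) := by gcongr
      _ = ENNReal.ofReal (2 ^ 2) * ENNReal.ofReal ((2 * r) ^ 2) := by
        rw [h1, Real.volume_pi_closedBall _ hr]; simp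
      _ = _ := by rw [← ENNReal.ofReal_mul (by norm_num)]; congr 1; ring

lemma GeoFacts.finite_S (hG : GeoFacts Srf K ρ) : μH[2] Srf.S < ∞ := by
  have hK := hG.K_pos
  apply Srf.compact.measure_lt_top_of_nhdsWithin
  intro x hx
  refine ⟨Srf.S ∩ closedBall x (1 / (8 * K)), ?_, ?_⟩
  · exact Filter.inter_mem self_mem_nhdsWithin (mem_nhdsWithin_of_mem_nhds (closedBall_mem_nhds _ (by positivity)))
  · exact (hG.ahlfors_small hx (by positivity) le_rfl).trans_lt ENNReal.ofReal_lt_top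

/-- Ahlfors regularity from above -/
lemma GeoFacts.ahlfors (hG : GeoFacts Srf K ρ) : ∃ A : ℝ, 1 ≤ A ∧ ∀ x ∈ Srf.S, ∀ r : ℝ, 0 ≤ r →
    μH[2] (Srf.S ∩ closedBall x r) ≤ ENNReal.ofReal (A * r ^ 2) := by
  have hK := hG.K_pos
  set M := (μH[2] Srf.S).toReal with hM
  have hM0 : 0 ≤ M := ENNReal.toReal_nonneg
  refine ⟨16 + M * (64 * K ^ 2), by nlinarith [mul_nonneg hM0 (sq_nonneg K)], ?_⟩
  intro x hx r hr
  by_cases h : r ≤ 1 / (8 * K)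
  · refine (hG.ahlfors_small hx hr h).trans (ENNReal.ofReal_le_ofReal ?_)
    gcongr
    nlinarith [mul_nonneg hM0 (sq_nonneg K)]
  · push Not at h
    refine (measure_mono Set.inter_subset_left).trans ?_
    rw [← ENNReal.ofReal_toReal hG.finite_S.ne]
    apply ENNReal.ofReal_le_ofReal
    rw [div_lt_iff₀ (by positivity)] at h
    have : 1 ≤ (r * (8 * K)) ^ 2 := one_le_pow₀ h.le
    rw [← hM]
    nlinarith [mul_le_mul_of_nonneg_left this hM0, sq_nonneg r]

end

section
variable {Srf : SmoothSurface} {K ρ : ℝ}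

/-- surface measure -/
def SmoothSurface.ms (Srf : SmoothSurface) : Measure E3 := Measure.restrict μH[2] Srf.S

lemma GeoFacts.finite_ms (hG : GeoFacts Srf K ρ) : IsFiniteMeasure Srf.ms := by
  constructor
  unfold SmoothSurface.ms
  rw [Measure.restrict_apply_univ]
  exact hG.finite_S

lemma SmoothSurface.ae_mem (Srf : SmoothSurface) : ∀ᵐ x ∂Srf.ms, x ∈ Srf.S := by
  unfold SmoothSurface.ms
  exact ae_restrict_mem Srf.compact.isClosed.measurableSet

/-- an Ahlfors upper constant -/
def SmoothSurface.Ahl (Srf : SmoothSurface) (A : ℝ) : Prop := 1 ≤ A ∧ ∀ x ∈ Srf.S, ∀ r : ℝ, 0 ≤ r →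
    Srf.ms (closedBall x r) ≤ ENNReal.ofReal (A * r ^ 2)

lemma GeoFacts.exists_Ahl (hG : GeoFacts Srf K ρ) : ∃ A, Srf.Ahl A := by
  obtain ⟨A, hA, h⟩ := hG.ahlfors
  refine ⟨A, hA, fun x hx r hr => ?_⟩
  unfold SmoothSurface.ms
  rw [Measure.restrict_apply isClosed_closedBall.measurableSet, Set.inter_comm]
  exact h x hx r hr

lemma HasSum.congr2 {f g : ℕ → ℝ} {a b : ℝ} (h : HasSum f a) (hf : ∀ k, g k = f k) (hb : b = a) :
    HasSum g b := by
  have : g = f := funext hf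
  rw [this, hb]; exact h

/-- general dyadic bound -/
lemma SmoothSurface.Ahl.lintegral_le {A : ℝ} (hA : Srf.Ahl A) {z₀ : E3} (hz : z₀ ∈ Srf.S) (a r : ℕ → ℝ)
    (ha : ∀ k, 0 ≤ a k) (hr : ∀ k, 0 ≤ r k) (hs : Summable fun k => a k * r k ^ 2)
    (f : E3 → ℝ) (hf : ∀ x ∈ Srf.S, ∃ k, dist x z₀ ≤ r k ∧ f x ≤ a k) :
    ∫⁻ x, ENNReal.ofReal (f x) ∂Srf.ms ≤ ENNReal.ofReal (A * ∑' k, a k * r k ^ 2) := by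
  have hA0 : 0 ≤ A := zero_le_one.trans hA.1
  calc ∫⁻ x, ENNReal.ofReal (f x) ∂Srf.ms
      ≤ ∫⁻ x, ∑' k, (closedBall z₀ (r k)).indicator (fun _ => ENNReal.ofReal (a k)) x ∂Srf.ms := by
        apply lintegral_mono_ae
        filter_upwards [Srf.ae_mem] with x hx
        obtain ⟨k, hk1, hk2⟩ := hf x hx
        refine le_trans ?_ (ENNReal.le_tsum k)
        rw [Set.indicator_of_mem (mem_closedBall.2 hk1)]
        exact ENNReal.ofReal_le_ofReal hk2
    _ = ∑' k, ENNReal.ofReal (a k) * Srf.ms (closedBall z₀ (r k)) := by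
        rw [lintegral_tsum]
        · congr 1; ext k
          rw [lintegral_indicator isClosed_closedBall.measurableSet, setLIntegral_const]
        · intro k
          exact (measurable_const.indicator isClosed_closedBall.measurableSet).aemeasurable
    _ ≤ ∑' k, ENNReal.ofReal (A * (a k * r k ^ 2)) := by
        apply ENNReal.tsum_le_tsum
        intro k
        calc _ ≤ ENNReal.ofReal (a k) * ENNReal.ofReal (A * r k ^ 2) := by
              gcongr; exact hA.2 z₀ hz _ (hr k)
          _ = _ := by rw [← ENNReal.ofReal_mul (ha k)]; congr 1; ring
    _ = _ := by
        rw [← ENNReal.ofReal_tsum_of_nonneg, tsum_mul_left]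
        · intro k; have := ha k; have := hr k; positivity
        · exact hs.mul_left A

lemma SmoothSurface.Ahl.integral_le {A : ℝ} (hA : Srf.Ahl A) {z₀ : E3} (hz : z₀ ∈ Srf.S) (a r : ℕ → ℝ)
    (ha : ∀ k, 0 ≤ a k) (hr : ∀ k, 0 ≤ r k) {B : ℝ} (hs : HasSum (fun k => a k * r k ^ 2) B)
    (f : E3 → ℝ) (hf0 : ∀ x, 0 ≤ f x) (hm : Measurable f)
    (hf : ∀ x ∈ Srf.S, ∃ k, dist x z₀ ≤ r k ∧ f x ≤ a k) :
    Integrable f Srf.ms ∧ ∫ x, f x ∂Srf.ms ≤ A * B := by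
  have h := hA.lintegral_le hz a r ha hr hs.summable f hf
  rw [hs.tsum_eq] at h
  have hB : 0 ≤ B := hs.nonneg (fun k => by have := ha k; have := hr k; positivity)
  have hA0 : 0 ≤ A := zero_le_one.trans hA.1
  constructor
  · refine ⟨hm.aestronglyMeasurable, ?_⟩
    rw [hasFiniteIntegral_iff_ofReal (Filter.Eventually.of_forall hf0)]
    exact h.trans_lt ENNReal.ofReal_lt_top
  · rw [integral_eq_lintegral_of_nonneg_ae (Filter.Eventually.of_forall hf0) hm.aestronglyMeasurable]
    exact ENNReal.toReal_le_of_le_ofReal (by positivity) h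

/-- dyadic index above `η` -/
lemma dyadic_up {η d : ℝ} (hη : 0 < η) (hd : η < d) : ∃ k : ℕ, η * 2 ^ k ≤ d ∧ d ≤ η * 2 ^ (k + 1) := by
  obtain ⟨n, h1, h2⟩ := exists_nat_pow_near (x := d / η) (y := 2) (by rw [le_div_iff₀ hη]; linarith) (by norm_num)
  rw [le_div_iff₀ hη] at h1
  rw [div_lt_iff₀ hη] at h2
  exact ⟨n, by linarith, by linarith⟩

lemma dyadic_down {η d : ℝ} (hd0 : 0 < d) (hd : d ≤ η) :
    ∃ k : ℕ, d ≤ η * (1 / 2) ^ k ∧ η * (1 / 2) ^ k ≤ 2 * d := by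
  obtain ⟨n, h1, h2⟩ := exists_nat_pow_near (x := η / d) (y := 2) (by rw [le_div_iff₀ hd0]; linarith) (by norm_num)
  rw [le_div_iff₀ hd0] at h1
  rw [div_lt_iff₀ hd0] at h2
  refine ⟨n, ?_, ?_⟩
  · rw [one_div, inv_pow, ← div_eq_mul_inv, le_div_iff₀ (by positivity)]; linarith
  · rw [one_div, inv_pow, ← div_eq_mul_inv, div_le_iff₀ (by positivity)]
    rw [pow_succ] at h2; linarith

/-- squared regularised distance -/
def rho2 (z₀ : E3) (η : ℝ) (x : E3) : ℝ := ‖x - z₀‖ ^ 2 + η ^ 2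

lemma rho2_pos {z₀ : E3} {η : ℝ} (hη : 0 < η) (x : E3) : 0 < rho2 z₀ η x := by
  unfold rho2; positivity

lemma measurable_rho2 (z₀ : E3) (η : ℝ) : Measurable (rho2 z₀ η) := by
  unfold rho2; fun_prop

/-- `∫ ρ⁻⁴ ≤ C η⁻²` -/
lemma SmoothSurface.Ahl.rho4 {A : ℝ} (hA : Srf.Ahl A) {z₀ : E3} (hz : z₀ ∈ Srf.S) {η : ℝ} (hη : 0 < η) :
    Integrable (fun x => 1 / rho2 z₀ η x ^ 2) Srf.ms ∧
      ∫ x, 1 / rho2 z₀ η x ^ 2 ∂Srf.ms ≤ A * (64 / 3 / η ^ 2) := by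
  apply hA.integral_le hz (fun k => 16 / η ^ 4 * (1 / 16) ^ k) (fun k => η * 2 ^ k)
    (fun k => by positivity) (fun k => by positivity)
  · have h := (hasSum_geometric_of_lt_one (r := (1/4 : ℝ)) (by norm_num) (by norm_num)).mul_left (16 / η ^ 2)
    refine h.congr2 (fun k => ?_) ?_
    · have : ((2:ℝ) ^ k) ^ 2 = 4 ^ k := by rw [← pow_mul, mul_comm, pow_mul]; norm_num
      rw [mul_pow, this, div_pow, div_pow, one_pow]
      have h16 : (16:ℝ) ^ k = 4 ^ k * 4 ^ k := by rw [← mul_pow]; norm_num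
      rw [h16]; field_simp
    · norm_num; ring
  · intro x; positivity
  · have := measurable_rho2 z₀ η; fun_prop
  · intro x hx
    have hp := rho2_pos (z₀ := z₀) hη x
    rw [dist_eq_norm]
    by_cases hd : ‖x - z₀‖ ≤ η
    · refine ⟨0, by simpa using hd, ?_⟩
      simp only [pow_zero, mul_one]
      have : η ^ 4 ≤ rho2 z₀ η x ^ 2 := by
        have : η ^ 2 ≤ rho2 z₀ η x := by unfold rho2; nlinarith [sq_nonneg ‖x - z₀‖]
        calc η ^ 4 = (η ^ 2) ^ 2 := by ring
          _ ≤ _ := by gcongr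
      rw [div_le_div_iff₀ (by positivity) (by positivity)]
      nlinarith [pow_pos hη 4]
    · push Not at hd
      obtain ⟨k, h1, h2⟩ := dyadic_up hη hd
      refine ⟨k + 1, h2, ?_⟩
      have : (η * 2 ^ k) ^ 4 ≤ rho2 z₀ η x ^ 2 := by
        have : (η * 2 ^ k) ^ 2 ≤ rho2 z₀ η x := by
          unfold rho2
          have : (η * 2 ^ k) ^ 2 ≤ ‖x - z₀‖ ^ 2 := by gcongr
          nlinarith [sq_nonneg η]
        calc (η * 2 ^ k) ^ 4 = ((η * 2 ^ k) ^ 2) ^ 2 := by ring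
          _ ≤ _ := by gcongr
      calc 1 / rho2 z₀ η x ^ 2 ≤ 1 / (η * 2 ^ k) ^ 4 := by gcongr
        _ = _ := by
          rw [mul_pow, pow_succ (1 / 16 : ℝ) k, div_pow, one_pow]
          have h16 : (16:ℝ) ^ k = (2 ^ k) ^ 4 := by rw [← pow_mul, mul_comm, pow_mul]; norm_num
          rw [h16]; field_simp

/-- `∫ ρ⁻² ≤ C |log η|` -/
lemma GeoFacts.exists_rho2 (hG : GeoFacts Srf K ρ) : ∃ C : ℝ, 0 < C ∧ ∀ z₀ ∈ Srf.S, ∀ η : ℝ, 0 < η → η ≤ 1 / 2 →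
    Integrable (fun x => 1 / rho2 z₀ η x) Srf.ms ∧
      ∫ x, 1 / rho2 z₀ η x ∂Srf.ms ≤ C * |Real.log η| := by
  obtain ⟨A, hA⟩ := hG.exists_Ahl
  have hA0 : 0 < A := zero_lt_one.trans_le hA.1
  set D := Metric.diam Srf.S with hD
  have hD0 : 0 ≤ D := diam_nonneg
  have hl2 : 0 < Real.log 2 := Real.log_pos (by norm_num)
  set l := Real.log (D + 1) with hl
  have hl0 : 0 ≤ l := Real.log_nonneg (by linarith)
  refine ⟨A * 4 * ((l / Real.log 2 + 3) / Real.log 2), by positivity, ?_⟩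
  intro z₀ hz η hη hη1
  set N := ⌈Real.log ((D + 1) / η) / Real.log 2⌉₊ with hN
  have hN1 : Real.log ((D + 1) / η) / Real.log 2 ≤ N := Nat.le_ceil _
  have hlogη : Real.log η ≤ - Real.log 2 := by
    rw [← Real.log_inv]; exact Real.log_le_log hη (by linarith)
  have habs : |Real.log η| = - Real.log η := abs_of_neg (by linarith)
  have hlogdiv : Real.log ((D + 1) / η) = l + |Real.log η| := by
    rw [Real.log_div (by positivity) hη.ne', habs]; ring
  have hN2 : (N : ℝ) < (l + |Real.log η|) / Real.log 2 + 1 := by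
    rw [← hlogdiv]
    exact Nat.ceil_lt_add_one (by rw [hlogdiv]; positivity)
  have hN3 : (D + 1) / η ≤ 2 ^ N := by
    rw [div_le_iff₀ hl2] at hN1
    have := (Real.log_le_iff_le_exp (by positivity)).1 hN1
    refine this.trans (le_of_eq ?_)
    rw [mul_comm, Real.exp_mul, Real.exp_log (by norm_num), Real.rpow_natCast]
  have := hA.integral_le hz (fun k => if k < N + 1 then 4 / η ^ 2 * (1 / 4) ^ k else 0) (fun k => η * 2 ^ k)
    (fun k => by split_ifs <;> positivity) (fun k => by positivity) (B := (N + 1) * 4)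
    (f := fun x => 1 / rho2 z₀ η x) ?_ ?_ ?_ ?_
  · refine ⟨this.1, this.2.trans ?_⟩
    have h1 : Real.log 2 ≤ |Real.log η| := by rw [habs]; linarith
    have h2 : (N : ℝ) + 1 ≤ (l / Real.log 2 + 3) / Real.log 2 * |Real.log η| := by
      have h3 : 1 ≤ |Real.log η| / Real.log 2 := by rw [le_div_iff₀ hl2]; linarith
      have h4 : l / Real.log 2 * 1 ≤ l / Real.log 2 * (|Real.log η| / Real.log 2) := by gcongr
      have e : (l / Real.log 2 + 3) / Real.log 2 * |Real.log η| =
        l / Real.log 2 * (|Real.log η| / Real.log 2) + 3 * (|Real.log η| / Real.log 2) := by ring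
      rw [e]
      have e2 : (l + |Real.log η|) / Real.log 2 = l / Real.log 2 + |Real.log η| / Real.log 2 := by ring
      rw [e2] at hN2
      linarith
    calc A * ((N + 1) * 4) ≤ A * (((l / Real.log 2 + 3) / Real.log 2 * |Real.log η|) * 4) := by gcongr
      _ = _ := by ring
  · have h := hasSum_sum_of_ne_finset_zero (L := SummationFilter.unconditional ℕ) (s := Finset.range (N + 1))
      (f := fun k => (if k < N + 1 then 4 / η ^ 2 * (1 / 4) ^ k else 0) * (η * 2 ^ k) ^ 2) (by
        intro b hb
        rw [Finset.mem_range] at hb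
        simp [hb])
    refine h.congr2 (fun k => rfl) ?_
    have : ∀ k ∈ Finset.range (N + 1), (if k < N + 1 then 4 / η ^ 2 * (1 / 4 : ℝ) ^ k else 0) * (η * 2 ^ k) ^ 2 = 4 := by
      intro k hk
      rw [if_pos (Finset.mem_range.1 hk)]
      have : ((2:ℝ) ^ k) ^ 2 = 4 ^ k := by rw [← pow_mul, mul_comm, pow_mul]; norm_num
      rw [mul_pow, this, div_pow, one_pow]; field_simp
    rw [Finset.sum_congr rfl this]; simp
  · intro x; have := rho2_pos (z₀ := z₀) hη x; positivity
  · have := measurable_rho2 z₀ η; fun_prop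
  · intro x hx
    have hp := rho2_pos (z₀ := z₀) hη x
    have hdD : ‖x - z₀‖ ≤ D := by
      rw [← dist_eq_norm]; exact dist_le_diam_of_mem Srf.compact.isBounded hx hz
    rw [dist_eq_norm]
    by_cases hd : ‖x - z₀‖ ≤ η
    · refine ⟨0, by simpa using hd, ?_⟩
      simp only [pow_zero, mul_one, Nat.zero_lt_succ, if_true]
      have : η ^ 2 ≤ rho2 z₀ η x := by unfold rho2; nlinarith [sq_nonneg ‖x - z₀‖]
      rw [div_le_div_iff₀ (by positivity) (by positivity)]
      nlinarith [pow_pos hη 2]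
    · push Not at hd
      obtain ⟨k, h1, h2⟩ := dyadic_up hη hd
      have hkN : k < N := by
        have h3 : (2:ℝ) ^ k < 2 ^ N := by
          refine lt_of_lt_of_le ?_ hN3
          rw [lt_div_iff₀ hη]; linarith
        exact (pow_lt_pow_iff_right₀ (by norm_num : (1:ℝ) < 2)).1 h3
      refine ⟨k + 1, h2, ?_⟩
      simp only [if_pos (Nat.succ_lt_succ hkN)]
      have : (η * 2 ^ k) ^ 2 ≤ rho2 z₀ η x := by
          unfold rho2
          have : (η * 2 ^ k) ^ 2 ≤ ‖x - z₀‖ ^ 2 := by gcongr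
          nlinarith [sq_nonneg η]
      calc 1 / rho2 z₀ η x ≤ 1 / (η * 2 ^ k) ^ 2 := by gcongr
        _ = _ := by
          rw [mul_pow, pow_succ (1 / 4 : ℝ) k, div_pow, one_pow]
          have h16 : (4:ℝ) ^ k = (2 ^ k) ^ 2 := by rw [← pow_mul, mul_comm, pow_mul]; norm_num
          rw [h16]; field_simp

/-- the weight `ω = η² / (d ρ²)` -/
def omg (z₀ : E3) (η : ℝ) (x : E3) : ℝ := η ^ 2 / (‖x - z₀‖ * rho2 z₀ η x)

lemma omg_nonneg (z₀ : E3) (η : ℝ) (x : E3) : 0 ≤ omg z₀ η x := by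
  unfold omg rho2; positivity

lemma measurable_omg (z₀ : E3) (η : ℝ) : Measurable (omg z₀ η) := by
  unfold omg; have := measurable_rho2 z₀ η; fun_prop

/-- `∫ ω 1_{d ≤ η} ≤ C η` -/
lemma SmoothSurface.Ahl.omg_near {A : ℝ} (hA : Srf.Ahl A) {z₀ : E3} (hz : z₀ ∈ Srf.S) {η : ℝ} (hη : 0 < η) :
    Integrable (fun x => (closedBall z₀ η).indicator (fun x => 1 / ‖x - z₀‖) x) Srf.ms ∧
      ∫ x, (closedBall z₀ η).indicator (fun x => 1 / ‖x - z₀‖) x ∂Srf.ms ≤ A * (8 * η) := by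
  have key := hA.integral_le hz (fun k => if k = 0 then 0 else 2 / η * 2 ^ (k - 1))
    (fun k => if k = 0 then Metric.diam Srf.S else η * (1 / 2) ^ (k - 1))
    (fun k => by split_ifs <;> positivity) (fun k => by split_ifs; exact diam_nonneg; positivity) (B := 4 * η)
    (f := fun x => (closedBall z₀ η).indicator (fun x => 1 / ‖x - z₀‖) x) ?_ ?_ ?_ ?_
  · refine ⟨key.1, key.2.trans ?_⟩
    have := hA.1
    nlinarith
  · rw [← hasSum_nat_add_iff' 1]
    simp only [Finset.range_one, Finset.sum_singleton, if_true, zero_mul, sub_zero, Nat.add_eq_zero_iff, one_ne_zero,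
      and_false, if_false, Nat.add_sub_cancel]
    have h := (hasSum_geometric_of_lt_one (r := (1/2 : ℝ)) (by norm_num) (by norm_num)).mul_left (2 * η)
    refine h.congr2 (fun k => ?_) ?_
    · rw [div_pow, one_pow]; field_simp
    · norm_num; ring
  · intro x; exact Set.indicator_nonneg (fun y _ => by positivity) x
  · exact (by fun_prop : Measurable fun x : E3 => 1 / ‖x - z₀‖).indicator isClosed_closedBall.measurableSet
  · intro x hx
    by_cases hd : x ∈ closedBall z₀ η
    · rw [Set.indicator_of_mem hd]
      by_cases h0 : x = z₀
      · refine ⟨0, ?_, ?_⟩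
        · simp only [if_true]; rw [h0, dist_self]; exact diam_nonneg
        · simp [h0]
      · have hpos : 0 < ‖x - z₀‖ := norm_pos_iff.2 (sub_ne_zero.2 h0)
        rw [mem_closedBall, dist_eq_norm] at hd
        obtain ⟨k, h1, h2⟩ := dyadic_down hpos hd
        refine ⟨k + 1, ?_, ?_⟩
        · simp only [Nat.add_eq_zero_iff, one_ne_zero, and_false, if_false, Nat.add_sub_cancel]
          rwa [dist_eq_norm]
        · simp only [Nat.add_eq_zero_iff, one_ne_zero, and_false, if_false, Nat.add_sub_cancel]
          rw [div_pow, one_pow, mul_one_div, div_le_iff₀ (by positivity)] at h2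
          rw [div_le_iff₀ hpos]
          have : 2 / η * 2 ^ k * ‖x - z₀‖ = (2 * ‖x - z₀‖ * 2 ^ k) / η := by ring
          rw [this, le_div_iff₀ hη]; linarith
    · rw [Set.indicator_of_notMem hd]
      exact ⟨0, by simp only [if_true]; exact dist_le_diam_of_mem Srf.compact.isBounded hx hz, by simp⟩

/-- `∫ ω ≤ C η` -/
lemma SmoothSurface.Ahl.omg_int {A : ℝ} (hA : Srf.Ahl A) {z₀ : E3} (hz : z₀ ∈ Srf.S) {η : ℝ} (hη : 0 < η) :
    Integrable (omg z₀ η) Srf.ms ∧ ∫ x, omg z₀ η x ∂Srf.ms ≤ A * (24 * η) := by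
  have hA1 := hA.1
  have h1 := hA.omg_near hz hη
  have h2 := hA.integral_le hz (fun k => 8 / η * (1 / 8) ^ k) (fun k => η * 2 ^ k)
    (fun k => by positivity) (fun k => by positivity) (B := 16 * η)
    (f := fun x => (closedBall z₀ η)ᶜ.indicator (fun x => η ^ 2 / ‖x - z₀‖ ^ 3) x) ?_ ?_ ?_ ?_
  · have hle : ∀ x, omg z₀ η x ≤ (closedBall z₀ η).indicator (fun x => 1 / ‖x - z₀‖) x +
        (closedBall z₀ η)ᶜ.indicator (fun x => η ^ 2 / ‖x - z₀‖ ^ 3) x := by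
      intro x
      by_cases h0 : x = z₀
      · have : omg z₀ η x = 0 := by simp [omg, h0]
        rw [this]
        apply add_nonneg
        · exact Set.indicator_nonneg (fun y _ => by positivity) x
        · exact Set.indicator_nonneg (fun y _ => by positivity) x
      have hpos : 0 < ‖x - z₀‖ := norm_pos_iff.2 (sub_ne_zero.2 h0)
      have hp := rho2_pos (z₀ := z₀) hη x
      by_cases hd : x ∈ closedBall z₀ η
      · rw [Set.indicator_of_mem hd, Set.indicator_of_notMem (by simpa using hd), add_zero]
        unfold omg
        rw [div_le_div_iff₀ (by positivity) hpos, one_mul, mul_comm]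
        gcongr
        unfold rho2; nlinarith [sq_nonneg ‖x - z₀‖]
      · rw [Set.indicator_of_notMem hd, Set.indicator_of_mem (by simpa using hd), zero_add]
        unfold omg
        gcongr
        rw [pow_succ, mul_comm]
        gcongr
        unfold rho2; nlinarith [sq_nonneg η]
    have hi := h1.1.add h2.1
    constructor
    · refine hi.mono' (measurable_omg z₀ η).aestronglyMeasurable (Filter.Eventually.of_forall fun x => ?_)
      rw [Real.norm_eq_abs, abs_of_nonneg (omg_nonneg z₀ η x)]
      exact hle x
    · calc _ ≤ ∫ x, ((closedBall z₀ η).indicator (fun x => 1 / ‖x - z₀‖) x +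
        (closedBall z₀ η)ᶜ.indicator (fun x => η ^ 2 / ‖x - z₀‖ ^ 3) x) ∂Srf.ms :=
            integral_mono_of_nonneg (Filter.Eventually.of_forall (omg_nonneg z₀ η)) hi (Filter.Eventually.of_forall hle)
        _ ≤ A * (8 * η) + A * (16 * η) := by
            rw [integral_add h1.1 h2.1]; exact add_le_add h1.2 h2.2
        _ = _ := by ring
  · have h := (hasSum_geometric_of_lt_one (r := (1/2 : ℝ)) (by norm_num) (by norm_num)).mul_left (8 * η)
    refine h.congr2 (fun k => ?_) ?_
    · have h8 : (8:ℝ) ^ k = 2 ^ k * 2 ^ k * 2 ^ k := by rw [← mul_pow, ← mul_pow]; norm_num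
      rw [div_pow, one_pow, div_pow, one_pow, h8]; field_simp
    · norm_num; ring
  · intro x; exact Set.indicator_nonneg (fun y _ => by positivity) x
  · exact (by fun_prop : Measurable fun x : E3 => η ^ 2 / ‖x - z₀‖ ^ 3).indicator isClosed_closedBall.measurableSet.compl
  · intro x hx
    rw [dist_eq_norm]
    by_cases hd : x ∈ closedBall z₀ η
    · rw [Set.indicator_of_notMem (by simpa using hd)]
      rw [mem_closedBall, dist_eq_norm] at hd
      exact ⟨0, by simpa using hd, by positivity⟩
    · rw [Set.indicator_of_mem (by simpa using hd)]
      rw [mem_closedBall, dist_eq_norm, not_le] at hd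
      obtain ⟨k, h1, h2⟩ := dyadic_up hη hd
      refine ⟨k + 1, h2, ?_⟩
      calc η ^ 2 / ‖x - z₀‖ ^ 3 ≤ η ^ 2 / (η * 2 ^ k) ^ 3 := by gcongr
        _ = _ := by
          have h8 : (8:ℝ) ^ k = (2 ^ k) ^ 3 := by rw [← pow_mul, mul_comm, pow_mul]; norm_num
          rw [mul_pow, pow_succ (1 / 8 : ℝ) k, div_pow, one_pow, h8]; field_simp

end

section
variable {Srf : SmoothSurface} {K ρ : ℝ}

/-- A bijection of compact sets which is locally `L`-bilipschitz. -/
structure NearIso (f : E3 → E3) (A B : Set E3) (L : ℝ) : Prop where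
  bij : Set.BijOn f A B
  mA : MeasurableSet A
  mB : MeasurableSet B
  cont : ContinuousOn f A
  one_le : 1 ≤ L
  loc : ∃ r > 0, ∀ x ∈ A, ∀ y ∈ A, dist x y < r →
    dist (f x) (f y) ≤ L * dist x y ∧ dist x y ≤ L * dist (f x) (f y)
  glob : ∀ x ∈ A, ∀ y ∈ A, dist x y ≤ 2 * dist (f x) (f y)

namespace NearIso
variable {f : E3 → E3} {A B : Set E3} {L : ℝ}

lemma measure_image_le (h : NearIso f A B L) {X : Set E3} (hX : X ⊆ A) :
    μH[2] (f '' X) ≤ ENNReal.ofReal (L ^ 2) * μH[2] X := by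
  obtain ⟨r, hr, hl⟩ := h.loc
  exact hausdorff_image_le f X L r (by linarith [h.one_le]) hr
    (fun x hx y hy hd => (hl x (hX hx) y (hX hy) hd).1)

lemma measure_le_image (h : NearIso f A B L) {X : Set E3} (hX : X ⊆ A) :
    μH[2] X ≤ ENNReal.ofReal (L ^ 2) * μH[2] (f '' X) := by
  obtain ⟨r, hr, hl⟩ := h.loc
  refine hausdorff_le_image f X L (r / 2) (by linarith [h.one_le]) (by positivity)
    (fun x hx y hy hd => (hl x (hX hx) y (hX hy) ?_).2)
  have := h.glob x (hX hx) y (hX hy)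
  linarith

lemma image_inter (h : NearIso f A B L) (Y : Set E3) : f '' (f ⁻¹' Y ∩ A) = Y ∩ B := by
  ext y; constructor
  · rintro ⟨x, ⟨hx1, hx2⟩, rfl⟩; exact ⟨hx1, h.bij.mapsTo hx2⟩
  · rintro ⟨hy, hyB⟩
    obtain ⟨x, hx, rfl⟩ := h.bij.surjOn hyB
    exact ⟨x, ⟨hy, hx⟩, rfl⟩

lemma aemeas (h : NearIso f A B L) : AEMeasurable f (Measure.restrict μH[2] A) :=
  h.cont.aemeasurable h.mA

/-- pushed forward measure -/
def push (f : E3 → E3) (A : Set E3) : Measure E3 := Measure.map f (Measure.restrict μH[2] A)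

lemma push_apply (h : NearIso f A B L) {Y : Set E3} (hY : MeasurableSet Y) :
    push f A Y = μH[2] (f ⁻¹' Y ∩ A) := by
  unfold push
  rw [Measure.map_apply_of_aemeasurable h.aemeas hY, Measure.restrict_apply' h.mA]

lemma push_le (h : NearIso f A B L) : push f A ≤ ENNReal.ofReal (L ^ 2) • Measure.restrict μH[2] B := by
  rw [Measure.le_iff]
  intro Y hY
  rw [h.push_apply hY, Measure.smul_apply, Measure.restrict_apply hY, ← h.image_inter, smul_eq_mul]
  exact h.measure_le_image Set.inter_subset_right

lemma le_push (h : NearIso f A B L) : Measure.restrict μH[2] B ≤ ENNReal.ofReal (L ^ 2) • push f A := by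
  rw [Measure.le_iff]
  intro Y hY
  rw [Measure.smul_apply, h.push_apply hY, Measure.restrict_apply hY, ← h.image_inter, smul_eq_mul]
  exact h.measure_image_le Set.inter_subset_right

lemma ae_of_ae (h : NearIso f A B L) {p : E3 → Prop} (hp : ∀ᵐ x ∂(Measure.restrict μH[2] B), p x) :
    ∀ᵐ x ∂(Measure.restrict μH[2] A), p (f x) := by
  have h1 : push f A ≪ Measure.restrict μH[2] B := by
    refine (Measure.absolutelyContinuous_of_le h.push_le).trans ?_
    exact Measure.smul_absolutelyContinuous
  have h2 : ∀ᵐ y ∂(push f A), p y := h1.ae_le hp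
  exact ae_of_ae_map h.aemeas h2

lemma ae_of_ae' (h : NearIso f A B L) {p : E3 → Prop} (hp : ∀ᵐ x ∂(Measure.restrict μH[2] A), p (f x)) :
    ∀ᵐ x ∂(Measure.restrict μH[2] B), p x := by
  have h1 : μH[2] ({x | ¬ p (f x)} ∩ A) = 0 := by
    rw [ae_iff, Measure.restrict_apply' h.mA] at hp; exact hp
  rw [ae_iff, Measure.restrict_apply' h.mB]
  have h2 := h.measure_image_le (X := {x | ¬ p (f x)} ∩ A) Set.inter_subset_right
  rw [h1, mul_zero] at h2
  refine measure_mono_null ?_ (le_antisymm h2 bot_le)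
  rintro y ⟨hy, hyB⟩
  obtain ⟨x, hx, rfl⟩ := h.bij.surjOn hyB
  exact ⟨x, ⟨hy, hx⟩, rfl⟩

lemma integrable_push (h : NearIso f A B L) {F : E3 → ℝ} (hF : IntegrableOn F B μH[2]) :
    Integrable F (push f A) :=
  Integrable.of_measure_le_smul ENNReal.ofReal_ne_top h.push_le hF

lemma integrable_comp (h : NearIso f A B L) {F : E3 → ℝ} (hF : IntegrableOn F B μH[2]) :
    IntegrableOn (fun x => F (f x)) A μH[2] := by
  have := h.integrable_push hF
  exact this.comp_aemeasurable h.aemeas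

lemma integral_push (h : NearIso f A B L) {F : E3 → ℝ} (hF : IntegrableOn F B μH[2]) :
    ∫ x, F x ∂(push f A) = ∫ x in A, F (f x) ∂μH[2] :=
  integral_map h.aemeas (h.integrable_push hF).aestronglyMeasurable

lemma integral_nonneg_le (h : NearIso f A B L) {F : E3 → ℝ} (hF : IntegrableOn F B μH[2]) (h0 : ∀ x, 0 ≤ F x) :
    |∫ x in A, F (f x) ∂μH[2] - ∫ x in B, F x ∂μH[2]| ≤ (L ^ 2 - 1) * ∫ x in B, F x ∂μH[2] := by
  have hp := h.integrable_push hF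
  have hL2 : 1 ≤ L ^ 2 := one_le_pow₀ h.one_le
  have h1 : ∫ x, F x ∂(push f A) ≤ L ^ 2 * ∫ x in B, F x ∂μH[2] := by
    have := integral_mono_measure h.push_le (Filter.Eventually.of_forall h0) (hF.smul_measure ENNReal.ofReal_ne_top)
    rwa [integral_smul_measure, ENNReal.toReal_ofReal (by positivity), smul_eq_mul] at this
  have h2 : ∫ x in B, F x ∂μH[2] ≤ L ^ 2 * ∫ x, F x ∂(push f A) := by
    have := integral_mono_measure h.le_push (Filter.Eventually.of_forall h0) (hp.smul_measure ENNReal.ofReal_ne_top)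
    rwa [integral_smul_measure, ENNReal.toReal_ofReal (by positivity), smul_eq_mul] at this
  rw [h.integral_push hF] at h1 h2
  have h3 : 0 ≤ ∫ x in B, F x ∂μH[2] := integral_nonneg h0
  have h4 : 0 ≤ ∫ x in A, F (f x) ∂μH[2] := integral_nonneg fun x => h0 _
  rw [abs_le]
  constructor
  · by_cases hc : ∫ x in A, F (f x) ∂μH[2] ≤ ∫ x in B, F x ∂μH[2]
    · nlinarith
    · push Not at hc; nlinarith
  · linarith

lemma integral_comp_le (h : NearIso f A B L) {F : E3 → ℝ} (hF : IntegrableOn F B μH[2]) :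
    |∫ x in A, F (f x) ∂μH[2] - ∫ x in B, F x ∂μH[2]| ≤ (L ^ 2 - 1) * ∫ x in B, |F x| ∂μH[2] := by
  have ha : IntegrableOn (fun x => |F x|) B μH[2] := hF.abs
  have i1 : IntegrableOn (fun x => |F x| + F x) B μH[2] := ha.add hF
  have i2 : IntegrableOn (fun x => |F x| - F x) B μH[2] := ha.sub hF
  have h1 := h.integral_nonneg_le i1 (fun x => by linarith [neg_abs_le (F x)])
  have h2 := h.integral_nonneg_le i2 (fun x => by linarith [le_abs_self (F x)])
  have hFa := h.integrable_comp hF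
  have haa := h.integrable_comp ha
  rw [integral_add haa hFa, integral_add ha hF] at h1
  rw [integral_sub haa hFa, integral_sub ha hF] at h2
  rw [abs_le] at *
  constructor <;> linarith [h1.1, h1.2, h2.1, h2.2]

lemma integral_le (h : NearIso f A B L) {F : E3 → ℝ} (hF : IntegrableOn F B μH[2]) (h0 : ∀ x, 0 ≤ F x) :
    ∫ x in A, F (f x) ∂μH[2] ≤ L ^ 2 * ∫ x in B, F x ∂μH[2] := by
  have := h.integral_nonneg_le hF h0
  rw [abs_le] at this
  linarith [this.2]

end NearIso

end

section
variable {Srf : SmoothSurface} {K ρ : ℝ}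

/-- Lipschitz functions on the surface. -/
def SmoothSurface.LipC (Srf : SmoothSurface) (L : ℝ) (w : E3 → ℝ) : Prop :=
  0 ≤ L ∧ ∀ x ∈ Srf.S, ∀ y ∈ Srf.S, |w x - w y| ≤ L * ‖x - y‖

def SmoothSurface.Lip (Srf : SmoothSurface) (w : E3 → ℝ) : Prop := ∃ L, Srf.LipC L w

lemma SmoothSurface.LipC.lip {L : ℝ} {w : E3 → ℝ} (h : Srf.LipC L w) : Srf.Lip w := ⟨L, h⟩

/-- Rademacher's theorem on the surface. -/
lemma GeoFacts.ae_diff (hG : GeoFacts Srf K ρ) {w : E3 → ℝ} (hw : Srf.Lip w) :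
    ∀ᵐ x ∂Srf.ms, DifferentiableWithinAt ℝ w Srf.S x := by
  obtain ⟨L, hL0, hL⟩ := hw
  have hK := hG.K_pos
  have hm : MeasurableSet Srf.S := Srf.compact.isClosed.measurableSet
  unfold SmoothSurface.ms
  rw [ae_restrict_iff' hm, ae_iff]
  set s : Set E3 := {x | ¬ (x ∈ Srf.S → DifferentiableWithinAt ℝ w Srf.S x)} with hs
  apply measure_null_of_locally_null
  intro x hx
  have hxS : x ∈ Srf.S := by by_contra h; exact hx (fun h' => absurd h' h)
  set r : ℝ := 1 / (8 * K) with hr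
  have hr0 : 0 < r := by positivity
  refine ⟨s ∩ ball x r, Filter.inter_mem self_mem_nhdsWithin
    (mem_nhdsWithin_of_mem_nhds (ball_mem_nhds x hr0)), ?_⟩
  obtain ⟨Q, hQ1, hQ2⟩ := hG.coords_anti hxS
  rw [← hr] at hQ2
  set D := Srf.S ∩ closedBall x r with hD
  set u := s ∩ ball x r with hu
  have huD : u ⊆ D := by
    rintro q ⟨hq1, hq2⟩
    refine ⟨?_, ball_subset_closedBall hq2⟩
    by_contra h; exact hq1 (fun h' => absurd h' h)
  have h1 : μH[2] u ≤ ENNReal.ofReal (2 ^ 2) * μH[2] (Q '' u) :=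
    hausdorff_le_image Q u 2 1 (by norm_num) one_pos (fun y hy z hz _ => hQ2 y (huD hy) z (huD hz))
  have hg : ∀ q ∈ D, Function.invFunOn Q D (Q q) = q := by
    intro q hq
    have a1 : Function.invFunOn Q D (Q q) ∈ D := Function.invFunOn_mem ⟨q, hq, rfl⟩
    have a2 : Q (Function.invFunOn Q D (Q q)) = Q q := Function.invFunOn_eq ⟨q, hq, rfl⟩
    have := hQ2 _ a1 q hq
    rw [a2, dist_self, mul_zero] at this
    exact dist_le_zero.1 this
  set f : (Fin 2 → ℝ) → ℝ := fun a => w (Function.invFunOn Q D a) with hf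
  have hfL : LipschitzOnWith (2 * L).toNNReal f (Q '' D) := by
    apply LipschitzOnWith.of_dist_le_mul
    rintro _ ⟨p, hp, rfl⟩ _ ⟨q, hq, rfl⟩
    simp only [hf]
    rw [hg p hp, hg q hq, Real.dist_eq, Real.coe_toNNReal _ (by positivity)]
    have b1 := hL p hp.1 q hq.1
    have b2 := hQ2 p hp q hq
    rw [dist_eq_norm] at b2
    calc |w p - w q| ≤ L * ‖p - q‖ := b1
      _ ≤ L * (2 * dist (Q p) (Q q)) := by gcongr
      _ = _ := by ring
  have hRad := hfL.ae_differentiableWithinAt_of_mem (μ := (volume : Measure (Fin 2 → ℝ)))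
  have hvol : (μH[2] : Measure (Fin 2 → ℝ)) = volume := by
    have := hausdorffMeasure_pi_real (ι := Fin 2)
    simpa using this
  have h2 : μH[2] (Q '' u) = 0 := by
    rw [hvol]
    rw [ae_iff] at hRad
    refine measure_mono_null ?_ hRad
    rintro _ ⟨q, hq, rfl⟩ hcon
    have hqD := huD hq
    have hd := hcon ⟨q, hqD, rfl⟩
    have h3 : DifferentiableWithinAt ℝ (fun y => f (Q y)) D q :=
      DifferentiableWithinAt.comp (g := f) (f := fun y => Q y) q hd Q.differentiableAt.differentiableWithinAt (Set.mapsTo_image _ _)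
    have h4 : DifferentiableWithinAt ℝ w D q := by
      refine h3.congr (fun y hy => ?_) ?_
      · simp only [hf]; rw [hg y hy]
      · simp only [hf]; rw [hg q hqD]
    apply hq.1
    intro _
    refine h4.mono_of_mem_nhdsWithin ?_
    exact Filter.inter_mem self_mem_nhdsWithin
      (mem_nhdsWithin_of_mem_nhds (Filter.mem_of_superset (isOpen_ball.mem_nhds hq.2) ball_subset_closedBall))
  rw [h2, mul_zero] at h1
  exact le_antisymm h1 bot_le

lemma SmoothSurface.LipC.mono {L L' : ℝ} {w : E3 → ℝ} (h : Srf.LipC L w) (hL : L ≤ L') : Srf.LipC L' w :=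
  ⟨h.1.trans hL, fun x hx y hy => (h.2 x hx y hy).trans (by gcongr)⟩

lemma SmoothSurface.LipC.continuousOn {L : ℝ} {w : E3 → ℝ} (h : Srf.LipC L w) : ContinuousOn w Srf.S := by
  have : LipschitzOnWith L.toNNReal w Srf.S := by
    apply LipschitzOnWith.of_dist_le_mul
    intro x hx y hy
    rw [Real.dist_eq, dist_eq_norm, Real.coe_toNNReal _ h.1]; exact h.2 x hx y hy
  exact this.continuousOn

lemma SmoothSurface.Lip.continuousOn {w : E3 → ℝ} (h : Srf.Lip w) : ContinuousOn w Srf.S := by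
  obtain ⟨L, hL⟩ := h; exact hL.continuousOn

lemma SmoothSurface.Lip.bdd {w : E3 → ℝ} (h : Srf.Lip w) : ∃ M, 0 ≤ M ∧ ∀ x ∈ Srf.S, |w x| ≤ M := by
  obtain ⟨M, hM⟩ := Srf.compact.exists_bound_of_continuousOn h.continuousOn
  exact ⟨max M 0, le_max_right _ _, fun x hx => (hM x hx).trans (le_max_left _ _)⟩

lemma SmoothSurface.Lip.add {v w : E3 → ℝ} (hv : Srf.Lip v) (hw : Srf.Lip w) :
    Srf.Lip (fun x => v x + w x) := by
  obtain ⟨L, h0, hL⟩ := hv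
  obtain ⟨M, k0, hM⟩ := hw
  refine ⟨L + M, by positivity, fun x hx y hy => ?_⟩
  have := hL x hx y hy
  have := hM x hx y hy
  calc |v x + w x - (v y + w y)| = |(v x - v y) + (w x - w y)| := by ring_nf
    _ ≤ _ := abs_add_le _ _
    _ ≤ _ := by linarith

lemma SmoothSurface.Lip.smul {w : E3 → ℝ} (c : ℝ) (hw : Srf.Lip w) : Srf.Lip (fun x => c * w x) := by
  obtain ⟨M, k0, hM⟩ := hw
  refine ⟨|c| * M, by positivity, fun x hx y hy => ?_⟩
  have := hM x hx y hy
  rw [← mul_sub, abs_mul, mul_assoc]; gcongr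

lemma SmoothSurface.Lip.sub {v w : E3 → ℝ} (hv : Srf.Lip v) (hw : Srf.Lip w) :
    Srf.Lip (fun x => v x - w x) := by
  have := hv.add (hw.smul (-1))
  convert this using 2; ring

lemma SmoothSurface.Lip.mul {v w : E3 → ℝ} (hv : Srf.Lip v) (hw : Srf.Lip w) :
    Srf.Lip (fun x => v x * w x) := by
  obtain ⟨A, hA0, hA⟩ := hv.bdd
  obtain ⟨B, hB0, hB⟩ := hw.bdd
  obtain ⟨L, h0, hL⟩ := hv
  obtain ⟨M, k0, hM⟩ := hw
  refine ⟨L * B + A * M, by positivity, fun x hx y hy => ?_⟩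
  have h1 := hL x hx y hy
  have h2 := hM x hx y hy
  calc |v x * w x - v y * w y| = |(v x - v y) * w x + v y * (w x - w y)| := by ring_nf
    _ ≤ |v x - v y| * |w x| + |v y| * |w x - w y| := by
      refine (abs_add_le _ _).trans (by rw [abs_mul, abs_mul])
    _ ≤ (L * ‖x - y‖) * B + A * (M * ‖x - y‖) := by
      gcongr
      · exact hB x hx
      · exact hA y hy
    _ = _ := by ring

lemma SmoothSurface.Lip.const (c : ℝ) : Srf.Lip (fun _ => c) :=
  ⟨0, le_rfl, fun x _ y _ => by simp⟩

/-- Extension of a Lipschitz function is Lipschitz near. -/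
lemma GeoFacts.comp_lip (hG : GeoFacts Srf K ρ) {L : ℝ} {w : E3 → ℝ} (hw : Srf.LipC L w) {z z' : E3}
    (hz : 4 * K * infDist z Srf.S ≤ 1) (hz' : 4 * K * infDist z' Srf.S ≤ 1) :
    |w (Srf.proj z) - w (Srf.proj z')| ≤ 2 * L * ‖z - z'‖ := by
  have h1 := hw.2 _ (Srf.proj_mem z) _ (Srf.proj_mem z')
  have h2 := hG.proj_lip hz hz'
  have := hw.1
  calc _ ≤ L * ‖Srf.proj z - Srf.proj z'‖ := h1
    _ ≤ L * (2 * ‖z - z'‖) := by gcongr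
    _ = _ := by ring

lemma GeoFacts.tube_mem (hG : GeoFacts Srf K ρ) {z : E3} (hz : 8 * K * infDist z Srf.S < 1) :
    ∃ r > 0, ∀ z' ∈ ball z r, 8 * K * infDist z' Srf.S < 1 := by
  have hc : Continuous (fun z' => 8 * K * infDist z' Srf.S) := by
    exact continuous_const.mul (continuous_infDist_pt _)
  obtain ⟨r, hr, h⟩ := Metric.isOpen_iff.1 (isOpen_lt hc continuous_const) z hz
  exact ⟨r, hr, fun z' hz' => h hz'⟩

lemma GeoFacts.norm_fderiv_le (hG : GeoFacts Srf K ρ) {L : ℝ} {w : E3 → ℝ} (hw : Srf.LipC L w) {z : E3}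
    (hz : 8 * K * infDist z Srf.S < 1) : ‖fderiv ℝ (fun y => w (Srf.proj y)) z‖ ≤ 2 * L := by
  obtain ⟨r, hr, h⟩ := hG.tube_mem hz
  have hK := hG.K_pos
  have h0 : (0:ℝ) ≤ 2 * L := by linarith [hw.1]
  have hl : LipschitzOnWith (2 * L).toNNReal (fun y => w (Srf.proj y)) (ball z r) := by
    apply LipschitzOnWith.of_dist_le_mul
    intro x hx y hy
    rw [Real.dist_eq, dist_eq_norm, Real.coe_toNNReal _ h0]
    have e1 := h x hx
    have e2 := h y hy
    have := infDist_nonneg (x := x) (s := Srf.S)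
    have := infDist_nonneg (x := y) (s := Srf.S)
    exact hG.comp_lip hw (by nlinarith) (by nlinarith)
  have := norm_fderiv_le_of_lipschitzOn ℝ (ball_mem_nhds z hr) hl
  rwa [Real.coe_toNNReal _ h0] at this

lemma GeoFacts.tube_self (hG : GeoFacts Srf K ρ) {x : E3} (hx : x ∈ Srf.S) : 8 * K * infDist x Srf.S < 1 := by
  rw [infDist_zero_of_mem hx]; simp

lemma GeoFacts.grad_le (hG : GeoFacts Srf K ρ) {L : ℝ} {w : E3 → ℝ} (hw : Srf.LipC L w) {x : E3}
    (hx : x ∈ Srf.S) : ‖Srf.grad w x‖ ≤ 2 * L := by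
  rw [hG.norm_grad hx]; exact hG.norm_fderiv_le hw (hG.tube_self hx)

lemma GeoFacts.grad_add (hG : GeoFacts Srf K ρ) {v w : E3 → ℝ} {x : E3} (hx : x ∈ Srf.S)
    (hv : DifferentiableWithinAt ℝ v Srf.S x) (hw : DifferentiableWithinAt ℝ w Srf.S x) :
    Srf.grad (fun y => v y + w y) x = Srf.grad v x + Srf.grad w x := by
  have h1 := (hG.diffAt_iff hx).2 hv
  have h2 := (hG.diffAt_iff hx).2 hw
  refine ext_inner_right ℝ (fun u => ?_)
  rw [inner_add_left, hG.inner_grad hx, hG.inner_grad hx, hG.inner_grad hx]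
  have := fderiv_add h1 h2
  have e : (fun y => v (Srf.proj y)) + (fun y => w (Srf.proj y)) = fun y => v (Srf.proj y) + w (Srf.proj y) := rfl
  rw [e] at this
  rw [this]; rfl

lemma GeoFacts.grad_smul (hG : GeoFacts Srf K ρ) {w : E3 → ℝ} {x : E3} (hx : x ∈ Srf.S) (c : ℝ)
    (hw : DifferentiableWithinAt ℝ w Srf.S x) :
    Srf.grad (fun y => c * w y) x = c • Srf.grad w x := by
  have h2 := (hG.diffAt_iff hx).2 hw
  refine ext_inner_right ℝ (fun u => ?_)
  rw [inner_smul_left, hG.inner_grad hx, hG.inner_grad hx, fderiv_const_mul h2]; rfl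

lemma GeoFacts.grad_sub (hG : GeoFacts Srf K ρ) {v w : E3 → ℝ} {x : E3} (hx : x ∈ Srf.S)
    (hv : DifferentiableWithinAt ℝ v Srf.S x) (hw : DifferentiableWithinAt ℝ w Srf.S x) :
    Srf.grad (fun y => v y - w y) x = Srf.grad v x - Srf.grad w x := by
  have := hG.grad_add hx hv (hw.const_mul (-1))
  rw [hG.grad_smul hx (-1) hw] at this
  rw [sub_eq_add_neg, ← neg_one_smul ℝ (Srf.grad w x), ← this]
  congr 1; ext y; ring

lemma GeoFacts.grad_mul (hG : GeoFacts Srf K ρ) {v w : E3 → ℝ} {x : E3} (hx : x ∈ Srf.S)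
    (hv : DifferentiableWithinAt ℝ v Srf.S x) (hw : DifferentiableWithinAt ℝ w Srf.S x) :
    Srf.grad (fun y => v y * w y) x = v x • Srf.grad w x + w x • Srf.grad v x := by
  have h1 := (hG.diffAt_iff hx).2 hv
  have h2 := (hG.diffAt_iff hx).2 hw
  refine ext_inner_right ℝ (fun u => ?_)
  rw [inner_add_left, inner_smul_left, inner_smul_left, hG.inner_grad hx, hG.inner_grad hx, hG.inner_grad hx,
    fderiv_fun_mul h1 h2]
  simp [hG.proj_self hx]

lemma GeoFacts.meas_grad (hG : GeoFacts Srf K ρ) (w : E3 → ℝ) : AEStronglyMeasurable (Srf.grad w) Srf.ms := by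
  have h1 : Measurable (fun x => gradient (fun y => w (Srf.proj y)) x) := by
    unfold gradient
    exact (InnerProductSpace.toDual ℝ E3).symm.continuous.measurable.comp (measurable_fderiv ℝ _)
  refine h1.aestronglyMeasurable.congr ?_
  filter_upwards [Srf.ae_mem] with x hx
  exact (hG.grad_eq hx w).symm

lemma SmoothSurface.Lip.meas {w : E3 → ℝ} (hw : Srf.Lip w) : AEStronglyMeasurable w Srf.ms :=
  hw.continuousOn.aestronglyMeasurable Srf.compact.isClosed.measurableSet

/-- bounded measurable functions are integrable -/
lemma GeoFacts.integrable_of_bdd (hG : GeoFacts Srf K ρ) {F : E3 → ℝ} (hF : AEStronglyMeasurable F Srf.ms)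
    (M : ℝ) (h : ∀ x ∈ Srf.S, |F x| ≤ M) : Integrable F Srf.ms := by
  have := hG.finite_ms
  refine Integrable.of_bound hF M ?_
  filter_upwards [Srf.ae_mem] with x hx using h x hx

lemma cs_integral {μ : Measure E3} {f g : E3 → ℝ} (hf : AEStronglyMeasurable f μ) (hg : AEStronglyMeasurable g μ)
    (hf2 : Integrable (fun x => f x ^ 2) μ) (hg2 : Integrable (fun x => g x ^ 2) μ) :
    Integrable (fun x => f x * g x) μ ∧
      |∫ x, f x * g x ∂μ| ≤ √(∫ x, f x ^ 2 ∂μ) * √(∫ x, g x ^ 2 ∂μ) := by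
  have mf := (memLp_two_iff_integrable_sq hf).2 hf2
  have mg := (memLp_two_iff_integrable_sq hg).2 hg2
  refine ⟨mf.integrable_mul mg, ?_⟩
  have h1 := integral_mul_norm_le_Lp_mul_Lq (μ := μ) (f := f) (g := g) (p := 2) (q := 2)
    (Real.HolderConjugate.two_two) (by simpa using mf) (by simpa using mg)
  rw [Real.sqrt_eq_rpow, Real.sqrt_eq_rpow]
  refine (abs_integral_le_integral_abs).trans ?_
  simp only [abs_mul]
  simpa using h1

end

section
variable {Srf : SmoothSurface} {K ρ : ℝ}

lemma GeoFacts.Pt_sub_le (hG : GeoFacts Srf K ρ) {p q : E3} (hp : p ∈ Srf.S) (hq : q ∈ Srf.S) (v : E3) :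
    ‖v - Srf.Pt p v‖ ≤ |⟪Srf.n q, v⟫| + K * ‖p - q‖ * ‖v‖ := by
  rw [Srf.sub_Pt_norm hp]
  have h1 : ⟪Srf.n p, v⟫ = ⟪Srf.n q, v⟫ + ⟪Srf.n p - Srf.n q, v⟫ := by rw [inner_sub_left]; ring
  rw [h1]
  refine (abs_add_le _ _).trans ?_
  have h2 := abs_real_inner_le_norm (Srf.n p - Srf.n q) v
  have h3 := hG.lip p hp q hq
  have : ‖Srf.n p - Srf.n q‖ * ‖v‖ ≤ K * ‖p - q‖ * ‖v‖ := by gcongr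
  linarith

/-- Projection along a segment is close to a translation. -/
lemma GeoFacts.proj_seg (hG : GeoFacts Srf K ρ) {z1 z2 q : E3} (hq : q ∈ Srf.S) {δ' ρ' β : ℝ}
    (hδ : ∀ z ∈ segment ℝ z1 z2, infDist z Srf.S ≤ δ') (hδ1 : 8 * K * δ' < 1)
    (hρ : ∀ z ∈ segment ℝ z1 z2, ‖Srf.proj z - q‖ ≤ ρ')
    (hβ : |⟪Srf.n q, z2 - z1⟫| ≤ β * ‖z2 - z1‖) :
    ‖Srf.proj z2 - Srf.proj z1 - (z2 - z1)‖ ≤ (2 * K * δ' + K * ρ' + β) * ‖z2 - z1‖ := by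
  have hK := hG.K_pos
  set v := z2 - z1 with hv
  have hseg : ∀ t ∈ Set.Icc (0:ℝ) 1, z1 + t • v ∈ segment ℝ z1 z2 := by
    intro t ht; rw [segment_eq_image']; exact ⟨t, ht, rfl⟩
  have hpt : ∀ t ∈ Set.Icc (0:ℝ) 1, 8 * K * infDist (z1 + t • v) Srf.S < 1 := by
    intro t ht
    have := hδ _ (hseg t ht)
    nlinarith
  set g : ℝ → E3 := fun t => Srf.proj (z1 + t • v) - t • v with hg
  set g' : ℝ → E3 := fun t => deriv g t with hg'
  have hkey : ∀ t ∈ Set.Icc (0:ℝ) 1, HasDerivAt g (g' t) t ∧ ‖g' t‖ ≤ (2 * K * δ' + K * ρ' + β) * ‖v‖ := by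
    intro t ht
    obtain ⟨A, hA, hA2⟩ := hG.hasFDerivAt_proj (hpt t ht)
    have h1 : HasDerivAt (fun t : ℝ => z1 + t • v) v t := by
      simpa using ((hasDerivAt_id t).smul_const v).const_add z1
    have h2 : HasDerivAt (fun t : ℝ => t • v) v t := by
      simpa using ((hasDerivAt_id t).smul_const v)
    have h3 : HasDerivAt g (A v - v) t :=
      (HasFDerivAt.comp_hasDerivAt (f := fun t : ℝ => z1 + t • v) t hA h1).sub h2
    have e : g' t = A v - v := h3.deriv
    refine ⟨by rw [e]; exact h3, ?_⟩
    rw [e]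
    set p := Srf.proj (z1 + t • v)
    have e2 : A v - v = (A v - Srf.Pt p v) - (v - Srf.Pt p v) := by abel
    rw [e2]
    refine (norm_sub_le _ _).trans ?_
    have h4 := hA2 v
    have h5 := hG.Pt_sub_le (Srf.proj_mem (z1 + t • v)) hq v
    have h6 := hδ _ (hseg t ht)
    have h7 := hρ _ (hseg t ht)
    have h8 : 2 * K * infDist (z1 + t • v) Srf.S * ‖v‖ ≤ 2 * K * δ' * ‖v‖ := by gcongr
    have h9 : K * ‖Srf.proj (z1 + t • v) - q‖ * ‖v‖ ≤ K * ρ' * ‖v‖ := by gcongr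
    linarith
  have := norm_image_sub_le_of_norm_deriv_le_segment_01' (f := g) (f' := g')
    (fun t ht => (hkey t ht).1.hasDerivWithinAt) (fun t ht => (hkey t ⟨ht.1, ht.2.le⟩).2)
  have e : g 1 - g 0 = Srf.proj z2 - Srf.proj z1 - v := by
    simp only [hg, one_smul, zero_smul, add_zero, sub_zero]
    rw [hv]
    have : z1 + (z2 - z1) = z2 := by abel
    rw [this]; abel
  rwa [e] at this

/-- tangential translation -/
def SmoothSurface.phi (Srf : SmoothSurface) (y x : E3) : E3 := Srf.proj (x + y)

lemma SmoothSurface.phi_mem (y x : E3) : Srf.phi y x ∈ Srf.S := Srf.proj_mem _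

lemma GeoFacts.tube_add (hG : GeoFacts Srf K ρ) {x y : E3} (hx : x ∈ Srf.S) (hy : 8 * K * ‖y‖ < 1) :
    8 * K * infDist (x + y) Srf.S < 1 := by
  have hK := hG.K_pos
  have := infDist_le_norm (Srf := Srf) hx y
  nlinarith

lemma GeoFacts.tube4 (hG : GeoFacts Srf K ρ) {z : E3} (hy : 8 * K * infDist z Srf.S < 1) :
    4 * K * infDist z Srf.S ≤ 1 := by
  have hK := hG.K_pos
  have := infDist_nonneg (x := z) (s := Srf.S)
  nlinarith

lemma GeoFacts.phi_near (hG : GeoFacts Srf K ρ) {x y : E3} (hx : x ∈ Srf.S) (hy : 8 * K * ‖y‖ < 1) :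
    ‖Srf.phi y x - x‖ ≤ 2 * ‖y‖ := by
  have := hG.proj_lip (hG.tube4 (hG.tube_add hx hy)) (hG.tube4 (hG.tube_self hx))
  rw [hG.proj_self hx] at this
  simpa [SmoothSurface.phi] using this

lemma GeoFacts.phi_diff (hG : GeoFacts Srf K ρ) {x1 x2 y : E3} (h1 : x1 ∈ Srf.S) (h2 : x2 ∈ Srf.S)
    (hy : 8 * K * (‖y‖ + ‖x1 - x2‖) < 1) :
    ‖Srf.phi y x1 - Srf.phi y x2 - (x1 - x2)‖ ≤ 5 * K * (‖y‖ + ‖x1 - x2‖) * ‖x1 - x2‖ := by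
  have hK := hG.K_pos
  have hpt : ∀ z ∈ segment ℝ (x2 + y) (x1 + y), ‖z - x2‖ ≤ ‖y‖ + ‖x1 - x2‖ := by
    intro z hz
    rw [segment_eq_image'] at hz
    obtain ⟨t, ht, rfl⟩ := hz
    have e : x2 + y + t • (x1 + y - (x2 + y)) - x2 = y + t • (x1 - x2) := by
      rw [add_sub_add_right_eq_sub]; abel
    rw [e]
    refine (norm_add_le _ _).trans ?_
    rw [norm_smul, Real.norm_of_nonneg ht.1]
    have := mul_le_of_le_one_left (norm_nonneg (x1 - x2)) ht.2
    linarith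
  have hin : ∀ z ∈ segment ℝ (x2 + y) (x1 + y), infDist z Srf.S ≤ ‖y‖ + ‖x1 - x2‖ := by
    intro z hz
    have := infDist_le_norm (Srf := Srf) h2 (z - x2)
    rw [add_sub_cancel] at this
    exact this.trans (hpt z hz)
  have := hG.proj_seg (z1 := x2 + y) (z2 := x1 + y) (q := x2) h2 (δ' := ‖y‖ + ‖x1 - x2‖)
    (ρ' := 2 * (‖y‖ + ‖x1 - x2‖)) (β := K * (‖y‖ + ‖x1 - x2‖)) hin hy (fun z hz => by
      have a1 := hin z hz
      have a2 : 8 * K * infDist z Srf.S < 1 := by nlinarith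
      have a3 := hG.proj_lip (hG.tube4 a2) (hG.tube4 (hG.tube_self h2))
      rw [hG.proj_self h2] at a3
      have := hpt z hz
      linarith) (by
      rw [add_sub_add_right_eq_sub]
      refine (hG.quad x2 h2 x1 h1).trans ?_
      rw [pow_two, ← mul_assoc]
      have := norm_nonneg y
      gcongr
      linarith)
  rw [add_sub_add_right_eq_sub] at this
  refine this.trans (le_of_eq ?_)
  ring

lemma GeoFacts.phi_iso (hG : GeoFacts Srf K ρ) {y : E3} {b : ℝ} (hb : 0 < b) (hyb : ‖y‖ ≤ b) (hbρ : b ≤ ρ)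
    (hbK : 160 * K * b ≤ 1) : NearIso (Srf.phi y) Srf.S Srf.S (1 + 20 * K * b) := by
  have hK := hG.K_pos
  have hKy : K * ‖y‖ ≤ K * b := by gcongr
  have hm : MeasurableSet Srf.S := Srf.compact.isClosed.measurableSet
  have hloc : ∀ x1 ∈ Srf.S, ∀ x2 ∈ Srf.S, dist x1 x2 < b →
      dist (Srf.phi y x1) (Srf.phi y x2) ≤ (1 + 20 * K * b) * dist x1 x2 ∧
      dist x1 x2 ≤ (1 + 20 * K * b) * dist (Srf.phi y x1) (Srf.phi y x2) := by
    intro x1 h1 x2 h2 hd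
    simp only [dist_eq_norm] at *
    have hKd : K * ‖x1 - x2‖ ≤ K * b := by gcongr
    have := hG.phi_diff h1 h2 (y := y) (by nlinarith)
    set d := ‖x1 - x2‖ with hdd
    have hd0 : 0 ≤ d := norm_nonneg _
    have h5 : ‖Srf.phi y x1 - Srf.phi y x2 - (x1 - x2)‖ ≤ 10 * (K * b) * d := by
      refine this.trans ?_
      apply mul_le_mul_of_nonneg_right _ hd0
      nlinarith
    have n1 := norm_le_norm_add_norm_sub' (Srf.phi y x1 - Srf.phi y x2) (x1 - x2)
    have n2 := norm_le_norm_add_norm_sub (Srf.phi y x1 - Srf.phi y x2) (x1 - x2)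
    rw [← hdd] at n1 n2
    set D := ‖Srf.phi y x1 - Srf.phi y x2‖
    set κ := K * b with hκ
    have hκ0 : 0 < κ := by positivity
    have hκ1 : 160 * κ ≤ 1 := by rw [hκ]; linarith
    have e : 20 * K * b = 20 * κ := by rw [hκ]; ring
    rw [e]
    have hD0 : 0 ≤ D := norm_nonneg _
    refine ⟨by nlinarith, ?_⟩
    have h6 : d * (1 - 10 * κ) ≤ D := by nlinarith
    have h7 : d ≤ (1 + 20 * κ) * (d * (1 - 10 * κ)) := by
      have : (1 + 20 * κ) * (d * (1 - 10 * κ)) - d = d * (κ * (10 - 200 * κ)) := by ring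
      have : 0 ≤ d * (κ * (10 - 200 * κ)) := by
        apply mul_nonneg hd0; apply mul_nonneg hκ0.le; linarith
      linarith
    refine h7.trans ?_
    gcongr
  have hglob : ∀ x1 ∈ Srf.S, ∀ x2 ∈ Srf.S, dist x1 x2 ≤ 2 * dist (Srf.phi y x1) (Srf.phi y x2) := by
    intro x1 h1 x2 h2
    simp only [dist_eq_norm]
    set d := ‖x1 - x2‖ with hdd
    have hd0 : 0 ≤ d := norm_nonneg _
    rcases le_total (20 * K * d) 1 with hc | hc
    · have := hG.phi_diff h1 h2 (y := y) (by nlinarith)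
      have h5 : 5 * K * (‖y‖ + ‖x1 - x2‖) * ‖x1 - x2‖ ≤ 1 / 2 * d := by
        rw [← hdd]
        gcongr
        nlinarith
      have n2 := norm_le_norm_add_norm_sub (Srf.phi y x1 - Srf.phi y x2) (x1 - x2)
      linarith
    · have hy8 : 8 * K * ‖y‖ < 1 := by nlinarith
      have a1 := hG.phi_near h1 hy8
      have a2 := hG.phi_near h2 hy8
      have a3 : 8 * ‖y‖ ≤ d := by
        by_contra hcon
        push Not at hcon
        nlinarith
      have e : x1 - x2 = -(Srf.phi y x1 - x1) + (Srf.phi y x1 - Srf.phi y x2) + (Srf.phi y x2 - x2) := by abel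
      have n1 : d ≤ ‖Srf.phi y x1 - x1‖ + ‖Srf.phi y x1 - Srf.phi y x2‖ + ‖Srf.phi y x2 - x2‖ := by
        rw [hdd]; nth_rewrite 1 [e]
        refine (norm_add₃_le).trans ?_
        rw [norm_neg]
      linarith
  refine ⟨⟨fun x _ => Srf.phi_mem y x, ?_, ?_⟩, hm, hm, ?_, by nlinarith [mul_pos hK hb], ⟨b, hb, hloc⟩, hglob⟩
  · intro x1 h1 x2 h2 he
    have := hglob x1 h1 x2 h2
    rw [he, dist_self, mul_zero] at this
    exact dist_le_zero.1 this
  · intro q hq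
    obtain ⟨s, hs, hmem⟩ := hG.graph q hq (-y) (by rw [norm_neg]; linarith)
    refine ⟨_, hmem, ?_⟩
    unfold SmoothSurface.phi
    have e : q + -y + s • Srf.n q + y = q + s • Srf.n q := by abel
    rw [e]
    apply hG.proj_eq hq
    rw [norm_neg] at hs
    nlinarith
  · rw [Metric.continuousOn_iff]
    intro x hx ε hε
    refine ⟨min b (ε / 2), by positivity, fun x' hx' hd => ?_⟩
    have h1 := (hloc x' hx' x hx (hd.trans_le (min_le_left _ _))).1
    have h2 := hd.trans_le (min_le_right b (ε / 2))
    have : (1 + 20 * K * b) ≤ 2 := by nlinarith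
    have := dist_nonneg (x := x') (y := x)
    nlinarith

/-- gradient of the extension -/
lemma GeoFacts.grad_ext (hG : GeoFacts Srf K ρ) {x y : E3} (hx : x ∈ Srf.S) (hy : 8 * K * ‖y‖ < 1)
    {w : E3 → ℝ} (hw : DifferentiableWithinAt ℝ w Srf.S (Srf.phi y x)) (v : E3) :
    |fderiv ℝ (fun y => w (Srf.proj y)) (x + y) v - ⟪Srf.grad w (Srf.phi y x), v⟫| ≤
      2 * K * ‖y‖ * ‖Srf.grad w (Srf.phi y x)‖ * ‖v‖ := by
  have ht := hG.tube_add hx hy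
  have hK := hG.K_pos
  obtain ⟨A, hA, hA2⟩ := hG.hasFDerivAt_proj ht
  rw [hG.fderiv_comp_proj ht hw hA]
  have e : ⟪Srf.grad w (Srf.phi y x), v⟫ = ⟪Srf.grad w (Srf.phi y x), Srf.Pt (Srf.phi y x) v⟫ := by
    rw [← Srf.Pt_symm, Srf.grad_tan]
  rw [e]
  change |⟪Srf.grad w (Srf.phi y x), A v⟫ - _| ≤ _
  rw [← inner_sub_right]
  refine (abs_real_inner_le_norm _ _).trans ?_
  have h1 := hA2 v
  have h2 := infDist_le_norm (Srf := Srf) hx y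
  change ‖A v - Srf.Pt (Srf.phi y x) v‖ ≤ _ at h1
  calc _ ≤ ‖Srf.grad w (Srf.phi y x)‖ * (2 * K * ‖y‖ * ‖v‖) := by
        gcongr
        refine h1.trans ?_
        gcongr
    _ = _ := by ring

lemma GeoFacts.phi_hasFDeriv (hG : GeoFacts Srf K ρ) {x y : E3} (hx : x ∈ Srf.S) (hy : 8 * K * ‖y‖ < 1)
    {w : E3 → ℝ} (hw : DifferentiableWithinAt ℝ w Srf.S (Srf.phi y x)) :
    HasFDerivAt (fun z => w (Srf.phi y (Srf.proj z)))
      ((fderiv ℝ (fun y => w (Srf.proj y)) (x + y)).comp (Srf.Pt x)) x := by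
  have ht := hG.tube_add hx hy
  have h1 := (hG.diff_comp ht hw).hasFDerivAt
  have h2 : HasFDerivAt (fun z => Srf.proj z + y) (Srf.Pt x) x := (hG.hasFDerivAt_proj_self hx).add_const y
  have e : x + y = Srf.proj x + y := by rw [hG.proj_self hx]
  rw [e] at h1
  have := HasFDerivAt.comp x h1 h2
  rw [← e] at this
  exact this

lemma GeoFacts.diff_phi (hG : GeoFacts Srf K ρ) {x y : E3} (hx : x ∈ Srf.S) (hy : 8 * K * ‖y‖ < 1)
    {w : E3 → ℝ} (hw : DifferentiableWithinAt ℝ w Srf.S (Srf.phi y x)) :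
    DifferentiableWithinAt ℝ (fun z => w (Srf.phi y z)) Srf.S x :=
  (hG.diffAt_iff hx).1 (hG.phi_hasFDeriv hx hy hw).differentiableAt

lemma GeoFacts.grad_phi (hG : GeoFacts Srf K ρ) {x y : E3} (hx : x ∈ Srf.S) (hy : 8 * K * ‖y‖ < 1)
    {w : E3 → ℝ} (hw : DifferentiableWithinAt ℝ w Srf.S (Srf.phi y x)) :
    ‖Srf.grad (fun z => w (Srf.phi y z)) x - Srf.grad w (Srf.phi y x)‖ ≤
      4 * K * ‖y‖ * ‖Srf.grad w (Srf.phi y x)‖ := by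
  have hK := hG.K_pos
  set g := Srf.grad w (Srf.phi y x) with hg
  set u := Srf.grad (fun z => w (Srf.phi y z)) x - g with hu
  have key : ∀ v, |⟪u, v⟫| ≤ 4 * K * ‖y‖ * ‖g‖ * ‖v‖ := by
    intro v
    rw [hu, inner_sub_left, hG.inner_grad hx, (hG.phi_hasFDeriv hx hy hw).fderiv]
    have h1 := hG.grad_ext hx hy hw (Srf.Pt x v)
    rw [← hg] at h1
    have h2 : ‖Srf.Pt x v‖ ≤ ‖v‖ := Srf.Pt_norm_le x v
    have h3 : |⟪g, Srf.Pt x v⟫ - ⟪g, v⟫| ≤ 2 * K * ‖y‖ * ‖g‖ * ‖v‖ := by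
      have e1 : ⟪g, Srf.Pt x v⟫ - ⟪g, v⟫ = - (⟪Srf.n x, v⟫ * ⟪g, Srf.n x - Srf.n (Srf.phi y x)⟫) := by
        have e2 : ⟪g, Srf.n (Srf.phi y x)⟫ = 0 := by
          rw [hg, ← Srf.grad_tan, Srf.Pt_symm, Srf.Pt_n (Srf.phi_mem y x), inner_zero_right]
        rw [Srf.Pt_apply hx, inner_sub_right, inner_smul_right, inner_sub_right, e2]; ring
      rw [e1, abs_neg, abs_mul]
      have a1 := abs_real_inner_le_norm (Srf.n x) v
      rw [Srf.n_unit x hx, one_mul] at a1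
      have a2 := abs_real_inner_le_norm g (Srf.n x - Srf.n (Srf.phi y x))
      have a3 := hG.lip x hx _ (Srf.phi_mem y x)
      have a4 := hG.phi_near hx hy
      rw [norm_sub_rev] at a4
      calc _ ≤ ‖v‖ * (‖g‖ * (K * (2 * ‖y‖))) := by
            gcongr
            refine a2.trans ?_
            gcongr
            refine a3.trans ?_
            gcongr
        _ = _ := by ring
    rw [ContinuousLinearMap.comp_apply]
    calc _ = |(fderiv ℝ (fun y => w (Srf.proj y)) (x + y) (Srf.Pt x v) - ⟪g, Srf.Pt x v⟫) +
          (⟪g, Srf.Pt x v⟫ - ⟪g, v⟫)| := by congr 1; ring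
      _ ≤ _ := abs_add_le _ _
      _ ≤ 2 * K * ‖y‖ * ‖g‖ * ‖Srf.Pt x v‖ + 2 * K * ‖y‖ * ‖g‖ * ‖v‖ := by linarith
      _ ≤ 2 * K * ‖y‖ * ‖g‖ * ‖v‖ + 2 * K * ‖y‖ * ‖g‖ * ‖v‖ := by gcongr
      _ = _ := by ring
  have h := key u
  rw [real_inner_self_eq_norm_sq, abs_of_nonneg (by positivity)] at h
  rcases eq_or_ne ‖u‖ 0 with h0 | h0
  · rw [h0]; positivity
  · have hp : 0 < ‖u‖ := lt_of_le_of_ne (norm_nonneg _) (Ne.symm h0)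
    nlinarith

end

section
variable {Srf : SmoothSurface} {K ρ : ℝ}

/-- smallness of translations -/
structure Sml (K ρ b : ℝ) : Prop where
  pos : 0 < b
  leρ : b ≤ ρ
  leK : 160 * K * b ≤ 1

lemma GeoFacts.sml8 (hG : GeoFacts Srf K ρ) {b : ℝ} (hb : Sml K ρ b) {y : E3} (hy : ‖y‖ ≤ b) : 8 * K * ‖y‖ < 1 := by
  have := hG.K_pos
  have := hb.leK
  have : K * ‖y‖ ≤ K * b := by gcongr
  linarith

lemma GeoFacts.lip_phi (hG : GeoFacts Srf K ρ) {L : ℝ} {w : E3 → ℝ} (hw : Srf.LipC L w) {y : E3}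
    (hy : 8 * K * ‖y‖ < 1) : Srf.LipC (2 * L) (fun x => w (Srf.phi y x)) := by
  refine ⟨by linarith [hw.1], fun x hx x' hx' => ?_⟩
  have := hG.comp_lip hw (hG.tube4 (hG.tube_add hx hy)) (hG.tube4 (hG.tube_add hx' hy))
  rwa [add_sub_add_right_eq_sub] at this

lemma GeoFacts.Lip_phi (hG : GeoFacts Srf K ρ) {w : E3 → ℝ} (hw : Srf.Lip w) {y : E3}
    (hy : 8 * K * ‖y‖ < 1) : Srf.Lip (fun x => w (Srf.phi y x)) := by
  obtain ⟨L, hL⟩ := hw; exact (hG.lip_phi hL hy).lip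

lemma GeoFacts.ae_phi (hG : GeoFacts Srf K ρ) {b : ℝ} (hb : Sml K ρ b) {y : E3} (hy : ‖y‖ ≤ b)
    {w : E3 → ℝ} (hw : Srf.Lip w) : ∀ᵐ x ∂Srf.ms, DifferentiableWithinAt ℝ w Srf.S (Srf.phi y x) :=
  (hG.phi_iso hb.pos hy hb.leρ hb.leK).ae_of_ae (hG.ae_diff hw)

lemma GeoFacts.int_phi_le (hG : GeoFacts Srf K ρ) {b : ℝ} (hb : Sml K ρ b) {y : E3} (hy : ‖y‖ ≤ b)
    {F : E3 → ℝ} (hF : Integrable F Srf.ms) (h0 : ∀ x, 0 ≤ F x) :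
    Integrable (fun x => F (Srf.phi y x)) Srf.ms ∧ ∫ x, F (Srf.phi y x) ∂Srf.ms ≤ 2 * ∫ x, F x ∂Srf.ms := by
  have hI := hG.phi_iso hb.pos hy hb.leρ hb.leK
  refine ⟨hI.integrable_comp hF, (hI.integral_le hF h0).trans ?_⟩
  have h1 : (1 + 20 * K * b) ^ 2 ≤ 2 := by
    have := hb.leK
    have := mul_pos hG.K_pos hb.pos
    nlinarith
  have : 0 ≤ ∫ x, F x ∂Srf.ms := integral_nonneg h0
  exact mul_le_mul_of_nonneg_right h1 this

lemma GeoFacts.int_phi_diff (hG : GeoFacts Srf K ρ) {b : ℝ} (hb : Sml K ρ b) {y : E3} (hy : ‖y‖ ≤ b)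
    {F : E3 → ℝ} (hF : Integrable F Srf.ms) :
    |∫ x, F (Srf.phi y x) ∂Srf.ms - ∫ x, F x ∂Srf.ms| ≤ 43 * K * ‖y‖ * ∫ x, |F x| ∂Srf.ms := by
  have hK := hG.K_pos
  rcases eq_or_ne y 0 with rfl | hy0
  · have : ∫ x, F (Srf.phi 0 x) ∂Srf.ms = ∫ x, F x ∂Srf.ms := by
      apply integral_congr_ae
      filter_upwards [Srf.ae_mem] with x hx
      unfold SmoothSurface.phi
      rw [add_zero, hG.proj_self hx]
    rw [this]; simp
  have hyp : 0 < ‖y‖ := norm_pos_iff.2 hy0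
  have hb2 : 160 * K * ‖y‖ ≤ 1 := by
    have := hb.leK
    have : K * ‖y‖ ≤ K * b := by gcongr
    linarith
  have hI := hG.phi_iso hyp le_rfl (hy.trans hb.leρ) hb2
  refine (hI.integral_comp_le hF).trans ?_
  have h0 : 0 ≤ ∫ x, |F x| ∂Srf.ms := integral_nonneg (fun x => abs_nonneg _)
  refine mul_le_mul_of_nonneg_right ?_ h0
  have := mul_pos hK hyp
  nlinarith

lemma GeoFacts.int_sq_grad (hG : GeoFacts Srf K ρ) {w : E3 → ℝ} (hw : Srf.Lip w) :
    Integrable (fun x => ‖Srf.grad w x‖ ^ 2) Srf.ms := by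
  obtain ⟨L, hL⟩ := hw
  refine hG.integrable_of_bdd ((hG.meas_grad w).norm.pow 2) ((2 * L) ^ 2) (fun x hx => ?_)
  rw [abs_of_nonneg (by positivity)]
  exact pow_le_pow_left₀ (norm_nonneg _) (hG.grad_le hL hx) 2

lemma GeoFacts.int_lip (hG : GeoFacts Srf K ρ) {w : E3 → ℝ} (hw : Srf.Lip w) : Integrable w Srf.ms := by
  obtain ⟨M, hM0, hM⟩ := hw.bdd
  exact hG.integrable_of_bdd hw.meas M hM

lemma GeoFacts.int_sq (hG : GeoFacts Srf K ρ) {w : E3 → ℝ} (hw : Srf.Lip w) :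
    Integrable (fun x => w x ^ 2) Srf.ms := by
  have := hG.int_lip (hw.mul hw)
  simpa [pow_two] using this

lemma GeoFacts.int_inner (hG : GeoFacts Srf K ρ) {v w : E3 → ℝ} (hv : Srf.Lip v) (hw : Srf.Lip w) :
    Integrable (fun x => ⟪Srf.grad v x, Srf.grad w x⟫) Srf.ms := by
  obtain ⟨L, hL⟩ := hv
  obtain ⟨M, hM⟩ := hw
  refine hG.integrable_of_bdd ((hG.meas_grad v).inner (hG.meas_grad w)) ((2 * L) * (2 * M)) (fun x hx => ?_)
  refine (abs_real_inner_le_norm _ _).trans ?_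
  have := hL.1
  gcongr
  · exact hG.grad_le hL hx
  · exact hG.grad_le hM hx

/-- L² estimate for translations -/
lemma GeoFacts.trans_L2 (hG : GeoFacts Srf K ρ) {b : ℝ} (hb : Sml K ρ b) {y : E3} (hy : ‖y‖ ≤ b)
    {w : E3 → ℝ} (hw : Srf.Lip w) :
    ∫ x, (w (Srf.phi y x) - w x) ^ 2 ∂Srf.ms ≤ 16 * ‖y‖ ^ 2 * ∫ x, ‖Srf.grad w x‖ ^ 2 ∂Srf.ms := by
  have hK := hG.K_pos
  obtain ⟨L, hL⟩ := hw
  have hL0 := hL.1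
  have hKy : K * ‖y‖ ≤ K * b := by gcongr
  have hbK := hb.leK
  set θ : E3 → ℝ := fun x => w (Srf.phi y x) - w x with hθ
  have hθL : Srf.Lip θ := (hG.Lip_phi hL.lip (hG.sml8 hb hy)).sub hL.lip
  set G := √(∫ x, ‖Srf.grad w x‖ ^ 2 ∂Srf.ms) with hGd
  set N := √(∫ x, (θ x) ^ 2 ∂Srf.ms) with hN
  set Φ : ℝ → ℝ := fun t => ∫ x, θ x * w (Srf.proj (x + t • y)) ∂Srf.ms with hΦ
  set Φ' : ℝ → ℝ := fun t => ∫ x, θ x * fderiv ℝ (fun z => w (Srf.proj z)) (x + t • y) y ∂Srf.ms with hΦ'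
  have hty : ∀ t : ℝ, |t| < 2 → 8 * K * ‖t • y‖ < 1 := by
    intro t ht
    rw [norm_smul, Real.norm_eq_abs]
    have := norm_nonneg y
    have : |t| * ‖y‖ ≤ 2 * ‖y‖ := by gcongr
    nlinarith
  have hder : ∀ t ∈ Set.Icc (0:ℝ) 1, HasDerivAt Φ (Φ' t) t ∧ ‖Φ' t‖ ≤ 4 * ‖y‖ * G * N := by
    intro t ht
    have htn : ‖t • y‖ ≤ b := by
      rw [norm_smul, Real.norm_of_nonneg ht.1]
      have := mul_le_of_le_one_left (norm_nonneg y) ht.2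
      linarith
    have hnb : ∀ t' ∈ ball t 1, |t'| < 2 := by
      intro t' ht'
      rw [mem_ball, Real.dist_eq] at ht'
      have := abs_lt.1 ht'
      rw [abs_lt]
      constructor <;> linarith [ht.1, ht.2]
    have hlp : ∀ t' ∈ ball t 1, Srf.Lip (fun x => w (Srf.proj (x + t' • y))) := fun t' ht' =>
      hG.Lip_phi hL.lip (hty t' (hnb t' ht'))
    have hmf : Measurable (fun x => fderiv ℝ (fun z => w (Srf.proj z)) (x + t • y) y) := by
      have h1 := (measurable_fderiv_apply_const ℝ (fun z => w (Srf.proj z)) y)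
      exact h1.comp (measurable_id.add_const _)
    have hae := hG.ae_phi hb htn hL.lip
    constructor
    · have := hasDerivAt_integral_of_dominated_loc_of_lip (μ := Srf.ms) (F := fun t x => θ x * w (Srf.proj (x + t • y)))
        (F' := fun x => θ x * fderiv ℝ (fun z => w (Srf.proj z)) (x + t • y) y) (x₀ := t) (s := ball t 1)
        (bound := fun x => |θ x| * (2 * L * ‖y‖)) (ball_mem_nhds t one_pos)
        (by
          filter_upwards [ball_mem_nhds t one_pos] with t' ht'
          exact (hθL.mul (hlp t' ht')).meas)
        (hG.int_lip (hθL.mul (hlp t (mem_ball_self one_pos))))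
        (hθL.meas.mul hmf.aestronglyMeasurable)
        (by
          filter_upwards [Srf.ae_mem] with x hx
          apply LipschitzOnWith.of_dist_le_mul
          intro t1 h1 t2 h2
          rw [Real.dist_eq, Real.dist_eq]
          have := hG.comp_lip hL (hG.tube4 (hG.tube_add hx (hty t1 (hnb t1 h1))))
            (hG.tube4 (hG.tube_add hx (hty t2 (hnb t2 h2))))
          rw [add_sub_add_left_eq_sub, ← sub_smul, norm_smul, Real.norm_eq_abs] at this
          rw [← mul_sub, abs_mul]
          have e : (↑(Real.nnabs (|θ x| * (2 * L * ‖y‖))) : ℝ) = |θ x| * (2 * L * ‖y‖) := by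
            rw [Real.coe_nnabs, abs_of_nonneg (by positivity)]
          rw [e]
          calc _ ≤ |θ x| * (2 * L * (|t1 - t2| * ‖y‖)) := by gcongr
            _ = _ := by ring)
        ((hG.int_lip hθL).abs.mul_const _)
        (by
          filter_upwards [Srf.ae_mem, hae] with x hx hd
          have h1 := (hG.diff_comp (hG.tube_add hx (hG.sml8 hb htn)) hd).hasFDerivAt
          have h2 : HasDerivAt (fun t : ℝ => x + t • y) y t := by
            simpa using ((hasDerivAt_id t).smul_const y).const_add x
          exact (HasFDerivAt.comp_hasDerivAt (f := fun t : ℝ => x + t • y) t h1 h2).const_mul (θ x))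
      exact this.2
    · set f2 : E3 → ℝ := fun x => fderiv ℝ (fun z => w (Srf.proj z)) (x + t • y) y with hf2
      have hb1 : ∀ᵐ x ∂Srf.ms, |f2 x| ≤ 2 * ‖Srf.grad w (Srf.phi (t • y) x)‖ * ‖y‖ := by
        filter_upwards [Srf.ae_mem, hae] with x hx hd
        have h1 := hG.grad_ext hx (hG.sml8 hb htn) hd y
        have h2 := abs_real_inner_le_norm (Srf.grad w (Srf.phi (t • y) x)) y
        have h3 := hG.sml8 hb htn
        set g := ‖Srf.grad w (Srf.phi (t • y) x)‖
        have h4 : 2 * K * ‖t • y‖ * g * ‖y‖ ≤ 1 * g * ‖y‖ := by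
          gcongr
          nlinarith [norm_nonneg (t • y)]
        have := abs_sub_abs_le_abs_sub (f2 x) ⟪Srf.grad w (Srf.phi (t • y) x), y⟫
        simp only [hf2] at *
        linarith
      obtain ⟨i1, i2⟩ := hG.int_phi_le hb htn (hG.int_sq_grad hL.lip) (fun x => by positivity)
      have hle : ∀ᵐ x ∂Srf.ms, f2 x ^ 2 ≤ 4 * ‖y‖ ^ 2 * ‖Srf.grad w (Srf.phi (t • y) x)‖ ^ 2 := by
        filter_upwards [hb1] with x hx
        rw [← sq_abs]
        calc |f2 x| ^ 2 ≤ (2 * ‖Srf.grad w (Srf.phi (t • y) x)‖ * ‖y‖) ^ 2 := by gcongr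
          _ = _ := by ring
      have i3 : Integrable (fun x => f2 x ^ 2) Srf.ms := by
        refine Integrable.mono' (i1.const_mul (4 * ‖y‖ ^ 2)) (hmf.pow_const 2).aestronglyMeasurable ?_
        filter_upwards [hle] with x hx
        rw [Real.norm_of_nonneg (by positivity)]; exact hx
      have i4 := (cs_integral hθL.meas hmf.aestronglyMeasurable (hG.int_sq hθL) i3).2
      have i5 : ∫ x, f2 x ^ 2 ∂Srf.ms ≤ (4 * ‖y‖ * G) ^ 2 := by
        calc _ ≤ ∫ x, 4 * ‖y‖ ^ 2 * ‖Srf.grad w (Srf.phi (t • y) x)‖ ^ 2 ∂Srf.ms :=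
              integral_mono_ae i3 (i1.const_mul _) hle
          _ = 4 * ‖y‖ ^ 2 * ∫ x, ‖Srf.grad w (Srf.phi (t • y) x)‖ ^ 2 ∂Srf.ms := integral_const_mul _ _
          _ ≤ 4 * ‖y‖ ^ 2 * (2 * ∫ x, ‖Srf.grad w x‖ ^ 2 ∂Srf.ms) := by gcongr
          _ = 8 * ‖y‖ ^ 2 * G ^ 2 := by
            rw [hGd, Real.sq_sqrt (integral_nonneg (fun x => by positivity))]; ring
          _ ≤ _ := by nlinarith [sq_nonneg (‖y‖ * G)]
      have i6 : √(∫ x, f2 x ^ 2 ∂Srf.ms) ≤ 4 * ‖y‖ * G := by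
        rw [Real.sqrt_le_left (by positivity)]; exact i5
      rw [Real.norm_eq_abs]
      calc |Φ' t| ≤ N * √(∫ x, f2 x ^ 2 ∂Srf.ms) := i4
        _ ≤ N * (4 * ‖y‖ * G) := by gcongr
        _ = _ := by ring
  have hmv := norm_image_sub_le_of_norm_deriv_le_segment_01' (f := Φ) (f' := Φ')
    (fun t ht => (hder t ht).1.hasDerivWithinAt) (fun t ht => (hder t ⟨ht.1, ht.2.le⟩).2)
  have hNN : N ^ 2 = ∫ x, (θ x) ^ 2 ∂Srf.ms := by
    rw [hN, Real.sq_sqrt (integral_nonneg (fun x => by positivity))]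
  have hΦ10 : Φ 1 - Φ 0 = N ^ 2 := by
    rw [hNN, hΦ]
    simp only
    rw [← integral_sub]
    · apply integral_congr_ae
      filter_upwards [Srf.ae_mem] with x hx
      simp only [one_smul, zero_smul, add_zero, hG.proj_self hx]
      simp only [hθ, SmoothSurface.phi]; ring
    · exact hG.int_lip (hθL.mul (hG.Lip_phi hL.lip (hty 1 (by norm_num))))
    · exact hG.int_lip (hθL.mul (hG.Lip_phi hL.lip (hty 0 (by norm_num))))
  rw [hΦ10, Real.norm_of_nonneg (by positivity)] at hmv
  have hNle : N ≤ 4 * ‖y‖ * G := by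
    have hN0 : 0 ≤ N := Real.sqrt_nonneg _
    rcases eq_or_lt_of_le hN0 with h0 | h0
    · rw [← h0]; positivity
    · nlinarith
  rw [← hNN]
  have hG2 : ∫ x, ‖Srf.grad w x‖ ^ 2 ∂Srf.ms = G ^ 2 := by
    rw [hGd, Real.sq_sqrt (integral_nonneg (fun x => by positivity))]
  rw [hG2]
  calc N ^ 2 ≤ (4 * ‖y‖ * G) ^ 2 := by gcongr
    _ = _ := by ring

end

section
variable {Srf : SmoothSurface} {K ρ : ℝ}

lemma SmoothSurface.aForm_def (Srf : SmoothSurface) (v w : E3 → ℝ) :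
    Srf.aForm v w = ∫ x, (⟪Srf.grad v x, Srf.grad w x⟫ + v x * w x) ∂Srf.ms := rfl

lemma SmoothSurface.aForm_symm (Srf : SmoothSurface) (v w : E3 → ℝ) : Srf.aForm v w = Srf.aForm w v := by
  simp only [SmoothSurface.aForm_def, real_inner_comm, mul_comm]

lemma GeoFacts.grad_congr (hG : GeoFacts Srf K ρ) {v w : E3 → ℝ} (h : ∀ x ∈ Srf.S, v x = w x) {x : E3}
    (hx : x ∈ Srf.S) : Srf.grad v x = Srf.grad w x := by
  rw [hG.grad_eq hx, hG.grad_eq hx]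
  congr 1
  ext y; exact h _ (Srf.proj_mem y)

lemma GeoFacts.aForm_congr (hG : GeoFacts Srf K ρ) {v w v' w' : E3 → ℝ} (h : ∀ x ∈ Srf.S, v x = v' x)
    (h' : ∀ x ∈ Srf.S, w x = w' x) : Srf.aForm v w = Srf.aForm v' w' := by
  rw [SmoothSurface.aForm_def, SmoothSurface.aForm_def]
  apply integral_congr_ae
  filter_upwards [Srf.ae_mem] with x hx
  rw [hG.grad_congr h hx, hG.grad_congr h' hx, h x hx, h' x hx]

lemma GeoFacts.int_a (hG : GeoFacts Srf K ρ) {v w : E3 → ℝ} (hv : Srf.Lip v) (hw : Srf.Lip w) :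
    Integrable (fun x => ⟪Srf.grad v x, Srf.grad w x⟫ + v x * w x) Srf.ms :=
  (hG.int_inner hv hw).add (hG.int_lip (hv.mul hw))

lemma GeoFacts.aForm_add_left (hG : GeoFacts Srf K ρ) {u v w : E3 → ℝ} (hu : Srf.Lip u) (hv : Srf.Lip v)
    (hw : Srf.Lip w) : Srf.aForm (fun x => u x + v x) w = Srf.aForm u w + Srf.aForm v w := by
  simp only [SmoothSurface.aForm_def]
  rw [← integral_add (hG.int_a hu hw) (hG.int_a hv hw)]
  apply integral_congr_ae
  filter_upwards [Srf.ae_mem, hG.ae_diff hu, hG.ae_diff hv] with x hx h1 h2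
  rw [hG.grad_add hx h1 h2, inner_add_left]; ring

lemma GeoFacts.aForm_smul_left (hG : GeoFacts Srf K ρ) {v w : E3 → ℝ} (c : ℝ) (hv : Srf.Lip v) :
    Srf.aForm (fun x => c * v x) w = c * Srf.aForm v w := by
  simp only [SmoothSurface.aForm_def]
  rw [← integral_const_mul]
  apply integral_congr_ae
  filter_upwards [Srf.ae_mem, hG.ae_diff hv] with x hx h1
  rw [hG.grad_smul hx c h1, inner_smul_left]; simp; ring

lemma GeoFacts.aForm_sub_left (hG : GeoFacts Srf K ρ) {u v w : E3 → ℝ} (hu : Srf.Lip u) (hv : Srf.Lip v)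
    (hw : Srf.Lip w) : Srf.aForm (fun x => u x - v x) w = Srf.aForm u w - Srf.aForm v w := by
  have := hG.aForm_add_left hu (hv.smul (-1)) hw
  rw [hG.aForm_smul_left (-1) hv] at this
  rw [sub_eq_add_neg, ← neg_one_mul, ← this]
  congr 1; ext x; ring

lemma GeoFacts.aForm_sub_right (hG : GeoFacts Srf K ρ) {u v w : E3 → ℝ} (hu : Srf.Lip u) (hv : Srf.Lip v)
    (hw : Srf.Lip w) : Srf.aForm w (fun x => u x - v x) = Srf.aForm w u - Srf.aForm w v := by
  rw [Srf.aForm_symm, hG.aForm_sub_left hu hv hw, Srf.aForm_symm, Srf.aForm_symm v]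

/-- pointwise energy -/
def SmoothSurface.pe (Srf : SmoothSurface) (w : E3 → ℝ) (x : E3) : ℝ := √(‖Srf.grad w x‖ ^ 2 + w x ^ 2)

/-- energy norm -/
def SmoothSurface.en (Srf : SmoothSurface) (w : E3 → ℝ) : ℝ := √(Srf.aForm w w)

lemma SmoothSurface.pe_nonneg (w : E3 → ℝ) (x : E3) : 0 ≤ Srf.pe w x := Real.sqrt_nonneg _
lemma SmoothSurface.en_nonneg (w : E3 → ℝ) : 0 ≤ Srf.en w := Real.sqrt_nonneg _

lemma SmoothSurface.pe_sq (w : E3 → ℝ) (x : E3) : Srf.pe w x ^ 2 = ‖Srf.grad w x‖ ^ 2 + w x ^ 2 :=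
  Real.sq_sqrt (by positivity)

lemma SmoothSurface.grad_le_pe (w : E3 → ℝ) (x : E3) : ‖Srf.grad w x‖ ≤ Srf.pe w x :=
  Real.le_sqrt_of_sq_le (by nlinarith [sq_nonneg (w x)])

lemma SmoothSurface.abs_le_pe (w : E3 → ℝ) (x : E3) : |w x| ≤ Srf.pe w x :=
  Real.le_sqrt_of_sq_le (by rw [sq_abs]; nlinarith [sq_nonneg ‖Srf.grad w x‖])

lemma SmoothSurface.prod_le_pe (v w : E3 → ℝ) (x : E3) :
    ‖Srf.grad v x‖ * ‖Srf.grad w x‖ + |v x| * |w x| ≤ Srf.pe v x * Srf.pe w x := by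
  have h1 := Srf.pe_sq v x
  have h2 := Srf.pe_sq w x
  have h3 := mul_nonneg (Srf.pe_nonneg v x) (Srf.pe_nonneg w x)
  apply le_of_sq_le_sq _ h3
  rw [mul_pow, h1, h2, ← sq_abs (v x), ← sq_abs (w x)]
  nlinarith [sq_nonneg (‖Srf.grad v x‖ * |w x| - ‖Srf.grad w x‖ * |v x|)]

lemma SmoothSurface.aForm_self (Srf : SmoothSurface) (w : E3 → ℝ) : Srf.aForm w w = ∫ x, Srf.pe w x ^ 2 ∂Srf.ms := by
  rw [SmoothSurface.aForm_def]
  congr 1; ext x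
  rw [Srf.pe_sq, real_inner_self_eq_norm_sq, pow_two (w x)]

lemma SmoothSurface.aForm_nonneg (w : E3 → ℝ) : 0 ≤ Srf.aForm w w := by
  rw [Srf.aForm_self]; exact integral_nonneg (fun x => by positivity)

lemma SmoothSurface.en_sq (w : E3 → ℝ) : Srf.en w ^ 2 = Srf.aForm w w := Real.sq_sqrt (Srf.aForm_nonneg w)

lemma GeoFacts.meas_pe (hG : GeoFacts Srf K ρ) {w : E3 → ℝ} (hw : Srf.Lip w) :
    AEStronglyMeasurable (Srf.pe w) Srf.ms :=
  Real.continuous_sqrt.comp_aestronglyMeasurable (((hG.meas_grad w).norm.pow 2).add (hw.meas.pow 2))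

lemma GeoFacts.int_pe2 (hG : GeoFacts Srf K ρ) {w : E3 → ℝ} (hw : Srf.Lip w) :
    Integrable (fun x => Srf.pe w x ^ 2) Srf.ms := by
  simp only [Srf.pe_sq]
  exact (hG.int_sq_grad hw).add (hG.int_sq hw)

lemma GeoFacts.int_pepe (hG : GeoFacts Srf K ρ) {v w : E3 → ℝ} (hv : Srf.Lip v) (hw : Srf.Lip w) :
    Integrable (fun x => Srf.pe v x * Srf.pe w x) Srf.ms ∧
      ∫ x, Srf.pe v x * Srf.pe w x ∂Srf.ms ≤ Srf.en v * Srf.en w := by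
  obtain ⟨h1, h2⟩ := cs_integral (hG.meas_pe hv) (hG.meas_pe hw) (hG.int_pe2 hv) (hG.int_pe2 hw)
  refine ⟨h1, (le_abs_self _).trans ?_⟩
  rw [← Srf.aForm_self, ← Srf.aForm_self] at h2
  exact h2

lemma SmoothSurface.integrand_le (v w : E3 → ℝ) (x : E3) :
    |⟪Srf.grad v x, Srf.grad w x⟫ + v x * w x| ≤ Srf.pe v x * Srf.pe w x := by
  refine (abs_add_le _ _).trans (le_trans ?_ (Srf.prod_le_pe v w x))
  rw [abs_mul]
  gcongr
  exact abs_real_inner_le_norm _ _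

lemma GeoFacts.aForm_cs (hG : GeoFacts Srf K ρ) {v w : E3 → ℝ} (hv : Srf.Lip v) (hw : Srf.Lip w) :
    |Srf.aForm v w| ≤ Srf.en v * Srf.en w := by
  obtain ⟨h1, h2⟩ := hG.int_pepe hv hw
  rw [SmoothSurface.aForm_def]
  refine abs_integral_le_integral_abs.trans (le_trans ?_ h2)
  exact integral_mono (hG.int_a hv hw).abs h1 (fun x => Srf.integrand_le v w x)

/-- the L² norm -/
def SmoothSurface.l2 (Srf : SmoothSurface) (w : E3 → ℝ) : ℝ := √(∫ x, w x ^ 2 ∂Srf.ms)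

lemma SmoothSurface.l2_nonneg (w : E3 → ℝ) : 0 ≤ Srf.l2 w := Real.sqrt_nonneg _
lemma SmoothSurface.l2_sq (w : E3 → ℝ) : Srf.l2 w ^ 2 = ∫ x, w x ^ 2 ∂Srf.ms :=
  Real.sq_sqrt (integral_nonneg (fun x => by positivity))

lemma GeoFacts.l2_le_en (hG : GeoFacts Srf K ρ) {w : E3 → ℝ} (hw : Srf.Lip w) : Srf.l2 w ≤ Srf.en w := by
  unfold SmoothSurface.l2 SmoothSurface.en
  rw [Srf.aForm_self]
  apply Real.sqrt_le_sqrt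
  refine integral_mono (hG.int_sq hw) (hG.int_pe2 hw) (fun x => ?_)
  simp only [Srf.pe_sq]
  nlinarith [sq_nonneg ‖Srf.grad w x‖]

lemma GeoFacts.l2_cs (hG : GeoFacts Srf K ρ) {v w : E3 → ℝ} (hv : Srf.Lip v) (hw : Srf.Lip w) :
    |∫ x, v x * w x ∂Srf.ms| ≤ Srf.l2 v * Srf.l2 w :=
  (cs_integral hv.meas hw.meas (hG.int_sq hv) (hG.int_sq hw)).2

lemma GeoFacts.en_smul (hG : GeoFacts Srf K ρ) {w : E3 → ℝ} (c : ℝ) (hw : Srf.Lip w) :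
    Srf.en (fun x => c * w x) = |c| * Srf.en w := by
  unfold SmoothSurface.en
  rw [hG.aForm_smul_left c hw, Srf.aForm_symm, hG.aForm_smul_left c hw, ← mul_assoc,
    Real.sqrt_mul (mul_self_nonneg c), Real.sqrt_mul_self_eq_abs]

lemma GeoFacts.en_add (hG : GeoFacts Srf K ρ) {v w : E3 → ℝ} (hv : Srf.Lip v) (hw : Srf.Lip w) :
    Srf.en (fun x => v x + w x) ≤ Srf.en v + Srf.en w := by
  have h0 : 0 ≤ Srf.en v + Srf.en w := add_nonneg (Srf.en_nonneg v) (Srf.en_nonneg w)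
  apply le_of_sq_le_sq _ h0
  rw [Srf.en_sq, hG.aForm_add_left hv hw (hv.add hw), Srf.aForm_symm v, Srf.aForm_symm w,
    hG.aForm_add_left hv hw hv, hG.aForm_add_left hv hw hw, Srf.aForm_symm w v]
  have := (le_abs_self _).trans (hG.aForm_cs hv hw)
  have := Srf.en_sq v
  have := Srf.en_sq w
  nlinarith

lemma GeoFacts.en_sub (hG : GeoFacts Srf K ρ) {v w : E3 → ℝ} (hv : Srf.Lip v) (hw : Srf.Lip w) :
    Srf.en (fun x => v x - w x) ≤ Srf.en v + Srf.en w := by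
  have := hG.en_add hv (hw.smul (-1))
  rw [hG.en_smul (-1) hw] at this
  simp only [neg_one_mul, abs_neg, abs_one, one_mul, ← sub_eq_add_neg] at this
  exact this

/-- approximate weak solutions -/
lemma GeoFacts.approx_sol (hG : GeoFacts Srf K ρ) {f : E3 → ℝ} (hf : Srf.Lip f) {ε : ℝ} (hε : 0 < ε) :
    ∃ w, Srf.Lip w ∧ Srf.en w ≤ Srf.l2 f + ε ∧
      ∀ v, Srf.Lip v → |Srf.aForm w v - ∫ x, f x * v x ∂Srf.ms| ≤ ε * Srf.en v := by
  set J : (E3 → ℝ) → ℝ := fun v => Srf.aForm v v / 2 - ∫ x, f x * v x ∂Srf.ms with hJ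
  set A : Set ℝ := {j | ∃ v, Srf.Lip v ∧ J v = j} with hA
  have hne : A.Nonempty := ⟨_, fun _ => 0, SmoothSurface.Lip.const 0, rfl⟩
  have hbd : BddBelow A := by
    refine ⟨-(Srf.l2 f ^ 2), ?_⟩
    rintro _ ⟨v, hv, rfl⟩
    have h1 := (le_abs_self _).trans (hG.l2_cs hf hv)
    have h2 := hG.l2_le_en hv
    have h3 := Srf.en_sq v
    have h4 := Srf.l2_nonneg f
    have h5 := Srf.en_nonneg v
    simp only [hJ]
    rw [← h3]
    nlinarith [mul_le_mul_of_nonneg_left h2 h4, sq_nonneg (Srf.en v - Srf.l2 f)]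
  obtain ⟨_, ⟨w, hw, rfl⟩, hwJ⟩ := exists_lt_of_csInf_lt hne (show sInf A < sInf A + ε ^ 2 / 2 by
    have : 0 < ε ^ 2 := by positivity
    linarith)
  have hmain : ∀ v, Srf.Lip v → |Srf.aForm w v - ∫ x, f x * v x ∂Srf.ms| ≤ ε * Srf.en v := by
    intro v hv
    set r := Srf.aForm w v - ∫ x, f x * v x ∂Srf.ms with hr
    have hq : ∀ t : ℝ, 0 ≤ (Srf.aForm v v / 2) * (t * t) + r * t + ε ^ 2 / 2 := by
      intro t
      have ht := hv.smul t
      have h1 : sInf A ≤ J (fun x => w x + t * v x) := csInf_le hbd ⟨_, hw.add ht, rfl⟩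
      have h2 : Srf.aForm (fun x => w x + t * v x) (fun x => w x + t * v x) =
          Srf.aForm w w + 2 * t * Srf.aForm w v + t * t * Srf.aForm v v := by
        rw [hG.aForm_add_left hw ht (hw.add ht), Srf.aForm_symm w, hG.aForm_add_left hw ht hw,
          Srf.aForm_symm _ (fun x => w x + t * v x), hG.aForm_add_left hw ht ht, hG.aForm_smul_left t hv,
          Srf.aForm_symm w, hG.aForm_smul_left t hv, Srf.aForm_symm v (fun x => t * v x), hG.aForm_smul_left t hv,
          Srf.aForm_symm v w]
        try rw [Srf.aForm_symm w (fun x => t * v x), hG.aForm_smul_left t hv, Srf.aForm_symm v w]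
        ring
      have h3 : ∫ x, f x * (w x + t * v x) ∂Srf.ms = ∫ x, f x * w x ∂Srf.ms + t * ∫ x, f x * v x ∂Srf.ms := by
        rw [← integral_const_mul, ← integral_add (hG.int_lip (hf.mul hw)) ((hG.int_lip (hf.mul hv)).const_mul t)]
        congr 1; ext x; ring
      have h4 : J (fun x => w x + t * v x) = J w + t * r + t * t * (Srf.aForm v v / 2) := by
        simp only [hJ]
        rw [h2, h3, hr]; ring
      rw [h4] at h1
      linarith
    have hd := discrim_le_zero hq
    unfold discrim at hd
    have h3 := Srf.en_sq v
    have : r ^ 2 ≤ (ε * Srf.en v) ^ 2 := by rw [mul_pow, h3]; linarith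
    exact abs_le_of_sq_le_sq this (mul_nonneg hε.le (Srf.en_nonneg v))
  refine ⟨w, hw, ?_, hmain⟩
  have h1 := hmain w hw
  have h2 := (le_abs_self _).trans (hG.l2_cs hf hw)
  have h3 := hG.l2_le_en hw
  have h4 := (le_abs_self _).trans h1
  rw [← Srf.en_sq] at h4
  have h5 := Srf.l2_nonneg f
  have h6 := Srf.en_nonneg w
  rcases eq_or_lt_of_le h6 with h0 | h0
  · rw [← h0]; linarith
  · have : Srf.l2 f * Srf.l2 w ≤ Srf.l2 f * Srf.en w := by gcongr
    nlinarith

end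

section
variable {Srf : SmoothSurface} {K ρ : ℝ}

lemma inner_perturb {a b a' b' : E3} {α : ℝ} (h0 : 0 ≤ α) (h1 : ‖a' - a‖ ≤ α * ‖a‖) (h2 : ‖b' - b‖ ≤ α * ‖b‖) :
    |⟪a', b'⟫ - ⟪a, b⟫| ≤ (2 * α + α ^ 2) * (‖a‖ * ‖b‖) := by
  have e : ⟪a', b'⟫ - ⟪a, b⟫ = ⟪a' - a, b⟫ + ⟪a, b' - b⟫ + ⟪a' - a, b' - b⟫ := by
    simp only [inner_sub_left, inner_sub_right]; ring
  rw [e]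
  have t1 := abs_real_inner_le_norm (a' - a) b
  have t2 := abs_real_inner_le_norm a (b' - b)
  have t3 := abs_real_inner_le_norm (a' - a) (b' - b)
  have t1' : ‖a' - a‖ * ‖b‖ ≤ (α * ‖a‖) * ‖b‖ := by gcongr
  have t2' : ‖a‖ * ‖b' - b‖ ≤ ‖a‖ * (α * ‖b‖) := by gcongr
  have t3' : ‖a' - a‖ * ‖b' - b‖ ≤ (α * ‖a‖) * (α * ‖b‖) := by gcongr
  have := abs_add_le (⟪a' - a, b⟫ + ⟪a, b' - b⟫) ⟪a' - a, b' - b⟫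
  have := abs_add_le ⟪a' - a, b⟫ ⟪a, b' - b⟫
  nlinarith

lemma GeoFacts.aForm_phi (hG : GeoFacts Srf K ρ) {b : ℝ} (hb : Sml K ρ b) {y : E3} (hy : ‖y‖ ≤ b)
    {w u : E3 → ℝ} (hw : Srf.Lip w) (hu : Srf.Lip u) :
    |Srf.aForm (fun x => w (Srf.phi y x)) (fun x => u (Srf.phi y x)) - Srf.aForm w u| ≤
      61 * K * ‖y‖ * (Srf.en w * Srf.en u) := by
  have hK := hG.K_pos
  have hKy : K * ‖y‖ ≤ K * b := by gcongr
  have hbK := hb.leK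
  have h8 := hG.sml8 hb hy
  set F : E3 → ℝ := fun x => ⟪Srf.grad w x, Srf.grad u x⟫ + w x * u x with hF
  have hFi : Integrable F Srf.ms := hG.int_a hw hu
  obtain ⟨p1, p2⟩ := hG.int_pepe hw hu
  have h1 := hG.int_phi_diff hb hy hFi
  have h2 : ∫ x, |F x| ∂Srf.ms ≤ Srf.en w * Srf.en u :=
    (integral_mono hFi.abs p1 (fun x => Srf.integrand_le w u x)).trans p2
  obtain ⟨q1, q2⟩ := hG.int_phi_le hb hy p1 (fun x => mul_nonneg (Srf.pe_nonneg w x) (Srf.pe_nonneg u x))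
  have hwp := hG.Lip_phi hw h8
  have hup := hG.Lip_phi hu h8
  have hFp : Integrable (fun x => F (Srf.phi y x)) Srf.ms :=
    (hG.phi_iso hb.pos hy hb.leρ hb.leK).integrable_comp hFi
  have h3 : |Srf.aForm (fun x => w (Srf.phi y x)) (fun x => u (Srf.phi y x)) - ∫ x, F (Srf.phi y x) ∂Srf.ms| ≤
      9 * K * ‖y‖ * ∫ x, Srf.pe w (Srf.phi y x) * Srf.pe u (Srf.phi y x) ∂Srf.ms := by
    rw [SmoothSurface.aForm_def, ← integral_sub (hG.int_a hwp hup) hFp, ← integral_const_mul]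
    refine abs_integral_le_integral_abs.trans ?_
    refine integral_mono_ae ((hG.int_a hwp hup).sub hFp).abs (q1.const_mul _) ?_
    filter_upwards [Srf.ae_mem, hG.ae_phi hb hy hw, hG.ae_phi hb hy hu] with x hx d1 d2
    have g1 := hG.grad_phi hx h8 d1
    have g2 := hG.grad_phi hx h8 d2
    have g3 := inner_perturb (by positivity) g1 g2
    have g4 := Srf.prod_le_pe w u (Srf.phi y x)
    have g5 : 0 ≤ |w (Srf.phi y x)| * |u (Srf.phi y x)| := by positivity
    simp only [hF]
    rw [add_sub_add_right_eq_sub]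
    refine g3.trans ?_
    set κ := K * ‖y‖ with hκ
    have hκ0 : 0 ≤ κ := by positivity
    have e1 : 2 * (4 * K * ‖y‖) + (4 * K * ‖y‖) ^ 2 ≤ 9 * K * ‖y‖ := by
      have : 160 * κ ≤ 1 := by linarith
      have : 2 * (4 * K * ‖y‖) + (4 * K * ‖y‖) ^ 2 = 8 * κ + 16 * κ ^ 2 := by rw [hκ]; ring
      rw [this]
      have : 9 * K * ‖y‖ = 9 * κ := by rw [hκ]; ring
      rw [this]
      nlinarith
    have e2 : 0 ≤ 9 * K * ‖y‖ := by positivity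
    calc _ ≤ 9 * K * ‖y‖ * (‖Srf.grad w (Srf.phi y x)‖ * ‖Srf.grad u (Srf.phi y x)‖) := by gcongr
      _ ≤ _ := mul_le_mul_of_nonneg_left (by linarith) e2
  have e0 : Srf.aForm w u = ∫ x, F x ∂Srf.ms := rfl
  rw [e0]
  have h4 : 9 * K * ‖y‖ * ∫ x, Srf.pe w (Srf.phi y x) * Srf.pe u (Srf.phi y x) ∂Srf.ms ≤
      9 * K * ‖y‖ * (2 * (Srf.en w * Srf.en u)) := by
    gcongr
    exact q2.trans (by linarith)
  have h5 : 43 * K * ‖y‖ * ∫ x, |F x| ∂Srf.ms ≤ 43 * K * ‖y‖ * (Srf.en w * Srf.en u) := by gcongr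
  have := abs_sub_le (Srf.aForm (fun x => w (Srf.phi y x)) (fun x => u (Srf.phi y x)))
    (∫ x, F (Srf.phi y x) ∂Srf.ms) (∫ x, F x ∂Srf.ms)
  nlinarith

lemma GeoFacts.l2_trans (hG : GeoFacts Srf K ρ) {b : ℝ} (hb : Sml K ρ b) {y : E3} (hy : ‖y‖ ≤ b)
    {u v : E3 → ℝ} (huL : Srf.Lip u) (huv : ∀ x ∈ Srf.S, u (Srf.phi y x) = v x) :
    Srf.l2 (fun x => v x - u x) ≤ 4 * ‖y‖ * Srf.en u := by
  have := hG.trans_L2 hb hy huL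
  have e : ∫ x, (u (Srf.phi y x) - u x) ^ 2 ∂Srf.ms = ∫ x, (v x - u x) ^ 2 ∂Srf.ms := by
    apply integral_congr_ae
    filter_upwards [Srf.ae_mem] with x hx
    rw [huv x hx]
  rw [e] at this
  have g : ∫ x, ‖Srf.grad u x‖ ^ 2 ∂Srf.ms ≤ Srf.en u ^ 2 := by
    rw [Srf.en_sq, Srf.aForm_self]
    refine integral_mono (hG.int_sq_grad huL) (hG.int_pe2 huL) (fun x => ?_)
    simp only [Srf.pe_sq]
    nlinarith [sq_nonneg (u x)]
  have h0 := Srf.en_nonneg u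
  unfold SmoothSurface.l2
  rw [Real.sqrt_le_left (by positivity)]
  refine this.trans ?_
  have h1 := mul_le_mul_of_nonneg_left g (show (0:ℝ) ≤ 16 * ‖y‖ ^ 2 by positivity)
  refine h1.trans (le_of_eq ?_)
  ring

lemma reg_arith {y Nu Nv Nw ε lf ld ed Awv Awu Apv fd K : ℝ} (hK1 : 1 ≤ K) (hy0 : 0 ≤ y) (hκ1 : 160 * (K * y) ≤ 1)
    (hu0 : 0 ≤ Nu) (hv0 : 0 ≤ Nv) (hf0 : 0 ≤ lf) (hε : 0 < ε)
    (hwe : Nw ≤ lf + ε)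
    (a1 : |Nv ^ 2 - Nu ^ 2| ≤ 61 * K * y * (Nu * Nu)) (a2 : |Apv - Awu| ≤ 61 * K * y * (Nw * Nu))
    (b1 : |Awv - Awu - fd| ≤ ε * ed) (b2 : ld ≤ 4 * y * Nu) (b3 : |fd| ≤ lf * ld)
    (b4 : ed ≤ Nv + Nu) (b6 : Nv ^ 2 = Apv - Awv) :
    Nv ≤ (130 * K * y) * lf + 4 * ε := by
  obtain ⟨κ, hκ⟩ : ∃ κ, κ = K * y := ⟨_, rfl⟩
  have hκ0 : 0 ≤ κ := by rw [hκ]; positivity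
  have hyκ : y ≤ κ := by rw [hκ]; nlinarith
  rw [← hκ] at hκ1
  have a1' : Nu ≤ 3 / 2 * Nv := by
    have := (abs_le.1 a1).1
    have e : 61 * K * y * (Nu * Nu) = 61 * κ * Nu ^ 2 := by rw [hκ]; ring
    rw [e] at this
    have : 61 * κ * Nu ^ 2 ≤ 1 / 2 * Nu ^ 2 := by gcongr; linarith
    apply le_of_sq_le_sq _ (by positivity)
    nlinarith
  have b7 : lf * ld ≤ lf * (4 * κ * Nu) := by
    gcongr
    refine b2.trans ?_
    gcongr
  have b8 : ε * ed ≤ ε * (Nv + Nu) := by gcongr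
  have a2' := (abs_le.1 a2).2
  have e2 : 61 * K * y * (Nw * Nu) = 61 * κ * (Nw * Nu) := by rw [hκ]; ring
  rw [e2] at a2'
  have b1' := (abs_le.1 b1).1
  have b3' := (abs_le.1 b3).1
  have main : Nv ^ 2 ≤ 61 * κ * (Nw * Nu) + lf * (4 * κ * Nu) + ε * (Nv + Nu) := by
    linarith
  have m1 : 61 * κ * (Nw * Nu) ≤ 61 * κ * ((lf + ε) * (3 / 2 * Nv)) := by gcongr
  have m2 : lf * (4 * κ * Nu) ≤ lf * (4 * κ * (3 / 2 * Nv)) := by gcongr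
  have m3 : ε * (Nv + Nu) ≤ ε * (Nv + 3 / 2 * Nv) := by gcongr
  have m4 : Nv * Nv ≤ (130 * κ * lf + 4 * ε) * Nv := by
    have : 61 * κ * (ε * (3 / 2 * Nv)) ≤ 1 * (ε * (3 / 2 * Nv)) := by
      apply mul_le_mul_of_nonneg_right _ (by positivity); linarith
    have : 0 ≤ κ * lf * Nv := by positivity
    nlinarith
  have e3 : 130 * K * y = 130 * κ := by rw [hκ]; ring
  rw [e3]
  rcases eq_or_lt_of_le hv0 with h0 | h0
  · rw [← h0]; positivity
  · exact le_of_mul_le_mul_right m4 h0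

lemma GeoFacts.regularity (hG : GeoFacts Srf K ρ) {b : ℝ} (hb : Sml K ρ b) {y : E3} (hy : ‖y‖ ≤ b)
    {f w : E3 → ℝ} (hf : Srf.Lip f) (hw : Srf.Lip w) {ε : ℝ} (hε : 0 < ε)
    (hwe : Srf.en w ≤ Srf.l2 f + ε)
    (hsol : ∀ v, Srf.Lip v → |Srf.aForm w v - ∫ x, f x * v x ∂Srf.ms| ≤ ε * Srf.en v) :
    Srf.en (fun x => w (Srf.phi y x) - w x) ≤ (130 * K * ‖y‖) * Srf.l2 f + 4 * ε := by
  have hK := hG.K_pos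
  have hK1 := hG.K_ge
  have hKy : K * ‖y‖ ≤ K * b := by gcongr
  have hbK := hb.leK
  have h8 := hG.sml8 hb hy
  have hI := hG.phi_iso hb.pos hy hb.leρ hb.leK
  set v : E3 → ℝ := fun x => w (Srf.phi y x) - w x with hv
  have hwp := hG.Lip_phi hw h8
  have hvL : Srf.Lip v := hwp.sub hw
  set ψ := Function.invFunOn (Srf.phi y) Srf.S with hψ
  have hψm : ∀ q ∈ Srf.S, ψ q ∈ Srf.S ∧ Srf.phi y (ψ q) = q := fun q hq =>
    ⟨Function.invFunOn_mem (hI.bij.surjOn hq), Function.invFunOn_eq (hI.bij.surjOn hq)⟩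
  set u : E3 → ℝ := fun q => v (ψ q) with hu
  have huL : Srf.Lip u := by
    obtain ⟨L, h0, hL⟩ := hvL
    refine ⟨2 * L, by positivity, fun p hp q hq => ?_⟩
    have h1 := hL _ (hψm p hp).1 _ (hψm q hq).1
    have h2 := hI.glob _ (hψm p hp).1 _ (hψm q hq).1
    rw [(hψm p hp).2, (hψm q hq).2, dist_eq_norm, dist_eq_norm] at h2
    calc _ ≤ L * ‖ψ p - ψ q‖ := h1
      _ ≤ L * (2 * ‖p - q‖) := by gcongr
      _ = _ := by ring
  have huv : ∀ x ∈ Srf.S, u (Srf.phi y x) = v x := by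
    intro x hx
    have := hψm _ (Srf.phi_mem y x)
    simp only [hu]
    rw [hI.bij.injOn this.1 hx this.2]
  have huvL := hG.Lip_phi huL h8
  have c1 : Srf.aForm (fun x => u (Srf.phi y x)) (fun x => u (Srf.phi y x)) = Srf.aForm v v := hG.aForm_congr huv huv
  have c2 : Srf.aForm (fun x => w (Srf.phi y x)) (fun x => u (Srf.phi y x)) = Srf.aForm (fun x => w (Srf.phi y x)) v :=
    hG.aForm_congr (fun _ _ => rfl) huv
  have a1 := hG.aForm_phi hb hy huL huL
  have a2 := hG.aForm_phi hb hy hw huL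
  rw [c1, ← Srf.en_sq, ← Srf.en_sq] at a1
  rw [c2] at a2
  have b1 := hsol (fun x => v x - u x) (hvL.sub huL)
  rw [hG.aForm_sub_right hvL huL hw] at b1
  exact reg_arith hK1 (norm_nonneg y) (by linarith) (Srf.en_nonneg u) (Srf.en_nonneg v) (Srf.l2_nonneg f) hε hwe a1 a2
    b1 (hG.l2_trans hb hy huL huv) (hG.l2_cs hf (hvL.sub huL)) (hG.en_sub hvL huL)
    (by rw [Srf.en_sq]; exact hG.aForm_sub_left hwp hw hvL)

end

section
variable {Srf : SmoothSurface} {K ρ : ℝ}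

/-- Standing hypotheses on a fine mesh; `m = K h / γ` is the small parameter. -/
structure MeshHyp (Srf : SmoothSurface) (K ρ γ h m : ℝ) (Tr : Triangulation Srf γ h) : Prop where
  geo : GeoFacts Srf K ρ
  hpos : 0 < h
  γpos : 0 < γ
  hρ : h ≤ ρ
  m_eq : m = K * h / γ
  small : 4000 * m ≤ 1
  smallK : 4000 * K * h ≤ 1

variable {γ h m : ℝ} {Tr : Triangulation Srf γ h}

lemma triOf_sub_plane (t : E3 × E3 × E3) : triOf t ⊆ planeOf t := convexHull_subset_affineSpan _

lemma vertsOf_sub (t : E3 × E3 × E3) : vertsOf t ⊆ triOf t := subset_convexHull ℝ _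

lemma tri_compact (t : E3 × E3 × E3) : IsCompact (triOf t) :=
  (Set.Finite.isCompact_convexHull (𝕜 := ℝ) (Set.toFinite ({t.1, t.2.1, t.2.2} : Set E3)))

lemma tri_convex (t : E3 × E3 × E3) : Convex ℝ (triOf t) := convex_convexHull _ _

lemma sub_mem_dir {t : E3 × E3 × E3} {x y : E3} (hx : x ∈ triOf t) (hy : y ∈ triOf t) : y - x ∈ dirOf t :=
  AffineSubspace.vsub_mem_direction (triOf_sub_plane t hy) (triOf_sub_plane t hx)

lemma aff_le {t : E3 × E3 × E3} (L : E3 →ₗ[ℝ] ℝ) (c M : ℝ) (hM : ∀ q ∈ vertsOf t, |L q + c| ≤ M) {x : E3}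
    (hx : x ∈ triOf t) : |L x + c| ≤ M := by
  have hc : Convex ℝ {x : E3 | |L x + c| ≤ M} := by
    intro x hx y hy a b ha hb hab
    simp only [Set.mem_setOf_eq] at *
    have e : L (a • x + b • y) + c = a * (L x + c) + b * (L y + c) := by
      have : c = (a + b) * c := by rw [hab, one_mul]
      rw [map_add, map_smul, map_smul, smul_eq_mul, smul_eq_mul]
      linear_combination this
    rw [e, abs_le]
    obtain ⟨h1, h2⟩ := abs_le.1 hx
    obtain ⟨h3, h4⟩ := abs_le.1 hy
    have e2 : M = a * M + b * M := by rw [← add_mul, hab, one_mul]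
    constructor
    · nlinarith [mul_le_mul_of_nonneg_left h1 ha, mul_le_mul_of_nonneg_left h3 hb]
    · nlinarith [mul_le_mul_of_nonneg_left h2 ha, mul_le_mul_of_nonneg_left h4 hb]
  exact convexHull_min (fun q hq => hM q hq) hc hx

namespace MeshHyp

lemma m_pos (hM : MeshHyp Srf K ρ γ h m Tr) : 0 < m := by
  rw [hM.m_eq]; exact div_pos (mul_pos hM.geo.K_pos hM.hpos) hM.γpos

/-- the inscribed disk, in a form with vectors -/
lemma disk' (hM : MeshHyp Srf K ρ γ h m Tr) {t} (ht : t ∈ Tr.T) :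
    ∃ y ∈ triOf t, ∀ τ ∈ dirOf t, ‖τ‖ ≤ γ * h → y + τ ∈ triOf t := by
  obtain ⟨y, hy, hd⟩ := Tr.disk t ht
  refine ⟨y, hy, fun τ hτ hn => hd ⟨?_, ?_⟩⟩
  · rw [mem_closedBall, dist_eq_norm]; simpa using hn
  · have := AffineSubspace.vadd_mem_of_mem_direction hτ (triOf_sub_plane t hy)
    rw [vadd_eq_add, add_comm] at this
    exact this

lemma aff_slope (hM : MeshHyp Srf K ρ γ h m Tr) {t} (ht : t ∈ Tr.T) (L : E3 →ₗ[ℝ] ℝ) (c M : ℝ)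
    (hb : ∀ q ∈ vertsOf t, |L q + c| ≤ M) {τ : E3} (hτ : τ ∈ dirOf t) : |L τ| ≤ M / (γ * h) * ‖τ‖ := by
  obtain ⟨y, hy, hd⟩ := hM.disk' ht
  have hg : 0 < γ * h := mul_pos hM.γpos hM.hpos
  rcases eq_or_ne τ 0 with h0 | h0
  · simp [h0]
  have hn : 0 < ‖τ‖ := norm_pos_iff.2 h0
  set s := γ * h / ‖τ‖ with hs
  have hs0 : 0 < s := by positivity
  have hns : ‖s • τ‖ ≤ γ * h := by
    rw [norm_smul, Real.norm_eq_abs, abs_of_pos hs0, hs]; field_simp; exact le_refl _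
  have h1 := aff_le L c M hb (hd (s • τ) ((dirOf t).smul_mem s hτ) hns)
  have h2 := aff_le L c M hb (hd (-(s • τ)) ((dirOf t).neg_mem ((dirOf t).smul_mem s hτ)) (by rwa [norm_neg]))
  rw [map_add, map_smul, smul_eq_mul] at h1
  rw [map_add, map_neg, map_smul, smul_eq_mul] at h2
  have h3 : |s * L τ| ≤ M := by
    rw [abs_le] at *; constructor <;> linarith [h1.1, h1.2, h2.1, h2.2]
  rw [abs_mul, abs_of_pos hs0] at h3
  have e : M / (γ * h) * ‖τ‖ = M / s := by rw [hs]; field_simp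
  rw [e, le_div_iff₀ hs0]; linarith

lemma dist_le (hM : MeshHyp Srf K ρ γ h m Tr) {t} (ht : t ∈ Tr.T) {x y : E3} (hx : x ∈ triOf t) (hy : y ∈ triOf t) :
    ‖x - y‖ ≤ h := by
  rw [← dist_eq_norm]
  exact (dist_le_diam_of_mem (tri_compact t).isBounded hx hy).trans (Tr.diam_le t ht)

lemma infDist_le (hM : MeshHyp Srf K ρ γ h m Tr) {t} (ht : t ∈ Tr.T) {x : E3} (hx : x ∈ triOf t) :
    infDist x Srf.S ≤ h := by
  have hv : t.1 ∈ vertsOf t := by simp [vertsOf]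
  refine (infDist_le_dist_of_mem (Tr.verts_on t ht hv)).trans ?_
  rw [dist_eq_norm]
  exact hM.dist_le ht hx (vertsOf_sub t hv)

lemma Kh (hM : MeshHyp Srf K ρ γ h m Tr) : 0 < K * h := mul_pos hM.geo.K_pos hM.hpos

lemma tube (hM : MeshHyp Srf K ρ γ h m Tr) {t} (ht : t ∈ Tr.T) {x : E3} (hx : x ∈ triOf t) :
    8 * K * infDist x Srf.S < 1 := by
  have h1 := mul_le_mul_of_nonneg_left (hM.infDist_le ht hx) hM.geo.K_pos.le
  have := hM.smallK; have := hM.Kh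
  linarith

lemma a_eq (hM : MeshHyp Srf K ρ γ h m Tr) {t} (ht : t ∈ Tr.T) {x : E3} (hx : x ∈ triOf t) :
    Tr.a x = Srf.proj x := by
  have hN : x ∈ Tr.N := Tr.Sh_sub (Set.mem_biUnion ht hx)
  exact (hM.geo.nearest_eq (Tr.a_mem x hN) (Tr.a_nearest x hN) (hM.geo.tube4 (hM.tube ht hx))).symm

lemma γ_le (hM : MeshHyp Srf K ρ γ h m Tr) : γ ≤ 1 := by
  obtain ⟨t, ht⟩ := Tr.T_nonempty
  have hne : t.1 ≠ t.2.1 := by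
    have := (Tr.indep t ht).injective.ne (show (0 : Fin 3) ≠ 1 by decide)
    simpa using this
  have h1 : t.1 - t.2.1 ∈ dirOf t := sub_mem_dir (vertsOf_sub t (by simp [vertsOf])) (vertsOf_sub t (by simp [vertsOf]))
  set τ := t.1 - t.2.1
  have hn : 0 < ‖τ‖ := norm_pos_iff.2 (sub_ne_zero.2 hne)
  obtain ⟨y, hy, hd⟩ := hM.disk' ht
  have hg : 0 < γ * h := mul_pos hM.γpos hM.hpos
  have hns : ‖(γ * h / ‖τ‖) • τ‖ = γ * h := by
    rw [norm_smul, Real.norm_eq_abs, abs_of_pos (by positivity)]; field_simp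
  have h2 := hM.dist_le ht (hd ((γ * h / ‖τ‖) • τ) ((dirOf t).smul_mem _ h1) hns.le) hy
  rw [add_sub_cancel_left, hns] at h2
  exact le_of_mul_le_mul_right (by linarith) hM.hpos

lemma Kh_le (hM : MeshHyp Srf K ρ γ h m Tr) : K * h ≤ m := by
  rw [hM.m_eq, le_div_iff₀ hM.γpos]
  nlinarith [hM.γ_le, hM.Kh]

/-- distance of a vertex to the projection of a point of the triangle -/
lemma vert_near (hM : MeshHyp Srf K ρ γ h m Tr) {t} (ht : t ∈ Tr.T) {x y : E3} (hx : x ∈ triOf t) (hy : y ∈ triOf t) :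
    ‖y - Srf.proj x‖ ≤ 2 * h := by
  have h1 := hM.dist_le ht hy hx
  have h2 : ‖x - Srf.proj x‖ ≤ h := by
    rw [← dist_eq_norm, ← Srf.dist_proj]; exact hM.infDist_le ht hx
  have := norm_sub_le_norm_sub_add_norm_sub y x (Srf.proj x)
  linarith

lemma slope (hM : MeshHyp Srf K ρ γ h m Tr) {t} (ht : t ∈ Tr.T) {x : E3} (hx : x ∈ triOf t) {τ : E3} (hτ : τ ∈ dirOf t) :
    |⟪Srf.n (Srf.proj x), τ⟫| ≤ 4 * m * ‖τ‖ := by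
  set p := Srf.proj x
  have hp : p ∈ Srf.S := Srf.proj_mem x
  have := hM.aff_slope ht (innerSL ℝ (Srf.n p)).toLinearMap (-⟪Srf.n p, p⟫) (4 * K * h ^ 2) (fun q hq => by
    have h1 := hM.geo.quad p hp q (Tr.verts_on t ht hq)
    have h2 := hM.vert_near ht hx (vertsOf_sub t hq)
    have e : (innerSL ℝ (Srf.n p)).toLinearMap q + -⟪Srf.n p, p⟫ = ⟪Srf.n p, q - p⟫ := by
      rw [inner_sub_right]; rfl
    rw [e]
    refine h1.trans ?_
    have := hM.geo.K_pos
    calc K * ‖q - p‖ ^ 2 ≤ K * (2 * h) ^ 2 := by gcongr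
      _ = _ := by ring) hτ
  have e : 4 * K * h ^ 2 / (γ * h) = 4 * m := by
    rw [hM.m_eq]; have := hM.γpos.ne'; have := hM.hpos.ne'; field_simp
  rw [e] at this
  exact this

lemma seg (hM : MeshHyp Srf K ρ γ h m Tr) {t} (ht : t ∈ Tr.T) {x y : E3} (hx : x ∈ triOf t) (hy : y ∈ triOf t) :
    ‖Srf.proj y - Srf.proj x - (y - x)‖ ≤ 8 * m * ‖y - x‖ := by
  have hs : ∀ z ∈ segment ℝ x y, z ∈ triOf t := fun z hz => (tri_convex t).segment_subset hx hy hz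
  have hK := hM.geo.K_pos
  have h1 := hM.geo.proj_seg (z1 := x) (z2 := y) (q := Srf.proj x) (δ' := h) (ρ' := 2 * h) (β := 4 * m) (Srf.proj_mem x)
    (fun z hz => hM.infDist_le ht (hs z hz)) (by have := hM.smallK; have := hM.Kh; linarith)
    (fun z hz => by
      have := hM.geo.proj_lip (hM.geo.tube4 (hM.tube ht (hs z hz))) (hM.geo.tube4 (hM.tube ht hx))
      have := hM.dist_le ht (hs z hz) hx
      linarith) (hM.slope ht hx (sub_mem_dir hx hy))
  refine h1.trans ?_
  have := hM.Kh_le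
  gcongr; linarith

/-- the curved cell -/
lemma iso (hM : MeshHyp Srf K ρ γ h m Tr) {t} (ht : t ∈ Tr.T) :
    NearIso Srf.proj (triOf t) (Srf.proj '' triOf t) (1 + 16 * m) := by
  have hm := hM.m_pos
  have hs := hM.small
  have hlip : ∀ x ∈ triOf t, ∀ y ∈ triOf t, dist (Srf.proj x) (Srf.proj y) ≤ (1 + 16 * m) * dist x y ∧
      dist x y ≤ (1 + 16 * m) * dist (Srf.proj x) (Srf.proj y) := by
    intro x hx y hy
    have h1 := hM.seg ht hy hx
    rw [dist_eq_norm, dist_eq_norm]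
    have h2 := norm_sub_norm_le (Srf.proj x - Srf.proj y) (x - y)
    have h3 := norm_sub_norm_le (x - y) (Srf.proj x - Srf.proj y)
    rw [norm_sub_rev (x - y) (Srf.proj x - Srf.proj y)] at h3
    have h4 := norm_nonneg (x - y)
    have h5 := norm_nonneg (Srf.proj x - Srf.proj y)
    refine ⟨by nlinarith, ?_⟩
    have h6 : (1 - 8 * m) * ‖x - y‖ ≤ ‖Srf.proj x - Srf.proj y‖ := by linarith
    have h7 : (1 + 16 * m) * ((1 - 8 * m) * ‖x - y‖) ≤ (1 + 16 * m) * ‖Srf.proj x - Srf.proj y‖ := by gcongr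
    have h8 : 1 ≤ (1 + 16 * m) * (1 - 8 * m) := by nlinarith
    nlinarith
  have hc : ContinuousOn Srf.proj (triOf t) := by
    have : LipschitzOnWith (Real.toNNReal (1 + 16 * m)) Srf.proj (triOf t) :=
      LipschitzOnWith.of_dist_le_mul (fun x hx y hy => by
        rw [Real.coe_toNNReal _ (by positivity)]; exact (hlip x hx y hy).1)
    exact this.continuousOn
  refine ⟨⟨Set.mapsTo_image _ _, ?_, Set.surjOn_image _ _⟩, (tri_compact t).measurableSet,
    ((tri_compact t).image_of_continuousOn hc).measurableSet, hc, by linarith,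
    ⟨1, one_pos, fun x hx y hy _ => hlip x hx y hy⟩, fun x hx y hy => ?_⟩
  · intro x hx y hy e
    have := (hlip x hx y hy).2
    rw [e, dist_self, mul_zero] at this
    exact dist_le_zero.1 this
  · refine ((hlip x hx y hy).2).trans ?_
    gcongr; linarith
end MeshHyp

end

section
variable {Srf : SmoothSurface} {K ρ : ℝ}
variable {γ h m : ℝ} {Tr : Triangulation Srf γ h}

namespace MeshHyp

/-- span argument: derivatives within a triangle are determined on its direction -/
lemma deriv_dir (hM : MeshHyp Srf K ρ γ h m Tr) {t} (ht : t ∈ Tr.T) {x : E3} (hx : x ∈ triOf t) {w : E3 → ℝ}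
    {A : E3 →L[ℝ] ℝ} (hA : HasFDerivWithinAt w A (triOf t) x) {L : E3 →ₗ[ℝ] ℝ} {c : ℝ}
    (hw : ∀ y ∈ triOf t, w y = L y + c) {τ : E3} (hτ : τ ∈ dirOf t) : A τ = L τ := by
  have hL : HasFDerivWithinAt w (LinearMap.toContinuousLinearMap L) (triOf t) x := by
    have h1 : HasFDerivAt (fun y => (LinearMap.toContinuousLinearMap L) y + c) (LinearMap.toContinuousLinearMap L) x :=
      (LinearMap.toContinuousLinearMap L).hasFDerivAt.add_const c
    exact h1.hasFDerivWithinAt.congr (fun y hy => hw y hy) (hw x hx)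
  have hu := hA.unique_on hL
  have key : ∀ y ∈ triOf t, A (y - x) = L (y - x) := fun y hy =>
    hu (mem_tangentConeAt_of_segment_subset ((tri_convex t).segment_subset hx hy))
  obtain ⟨y, hy, hd⟩ := hM.disk' ht
  have hg : 0 < γ * h := mul_pos hM.γpos hM.hpos
  obtain ⟨s, hs0, hs⟩ : ∃ s : ℝ, 0 < s ∧ ‖s • τ‖ ≤ γ * h := by
    refine ⟨γ * h / (‖τ‖ + 1), by positivity, ?_⟩
    rw [norm_smul, Real.norm_eq_abs, abs_of_pos (by positivity), div_mul_eq_mul_div, div_le_iff₀ (by positivity)]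
    nlinarith [norm_nonneg τ]
  have h1 := key _ (hd _ ((dirOf t).smul_mem s hτ) hs)
  have h2 := key y hy
  have e : y + s • τ - x = (y - x) + s • τ := by abel
  rw [e, map_add, map_add, h2, map_smul, map_smul] at h1
  have := add_left_cancel h1
  rw [smul_eq_mul, smul_eq_mul] at this
  exact mul_left_cancel₀ hs0.ne' this

lemma gradTri_mem (t : E3 × E3 × E3) (v : E3 → ℝ) (x : E3) : gradTri t v x ∈ dirOf t := by
  unfold gradTri tGrad; exact Submodule.coe_mem _

lemma gradTri_spec (hM : MeshHyp Srf K ρ γ h m Tr) {t} (ht : t ∈ Tr.T) {x : E3} (hx : x ∈ triOf t) {v : E3 → ℝ}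
    {L : E3 →ₗ[ℝ] ℝ} {c : ℝ} (hw : ∀ y ∈ triOf t, v y = L y + c) {τ : E3} (hτ : τ ∈ dirOf t) :
    ⟪gradTri t v x, τ⟫ = L τ := by
  have hL : HasFDerivWithinAt v (LinearMap.toContinuousLinearMap L) (triOf t) x := by
    have h1 : HasFDerivAt (fun y => (LinearMap.toContinuousLinearMap L) y + c) (LinearMap.toContinuousLinearMap L) x :=
      (LinearMap.toContinuousLinearMap L).hasFDerivAt.add_const c
    exact h1.hasFDerivWithinAt.congr (fun y hy => hw y hy) (hw x hx)
  have := hM.deriv_dir ht hx hL.differentiableWithinAt.hasFDerivWithinAt hw hτ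
  rw [← this]
  unfold gradTri tGrad
  have h1 := Submodule.inner_orthogonalProjectionOnto_eq_of_mem_right (K := dirOf t) ⟨τ, hτ⟩
    ((InnerProductSpace.toDual ℝ E3).symm (fderivWithin ℝ v (triOf t) x))
  rw [← InnerProductSpace.toDual_symm_apply (𝕜 := ℝ) (E := E3)]
  exact h1

lemma finrank_dir {t} (ht : t ∈ Tr.T) : Module.finrank ℝ (dirOf t) = 2 := by
  have := (Tr.indep t ht).finrank_vectorSpan (n := 2) (by simp)
  have e : Set.range ![t.1, t.2.1, t.2.2] = vertsOf t := by
    unfold vertsOf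
    ext z
    simp only [Matrix.range_cons, Matrix.range_empty, Set.union_empty, Set.mem_union, Set.mem_singleton_iff, Set.mem_insert_iff]
  rw [e] at this
  unfold dirOf
  rw [direction_affineSpan]
  exact this

/-- tangent vectors are almost in the plane of the triangle -/
lemma tan_proj (hM : MeshHyp Srf K ρ γ h m Tr) {t} (ht : t ∈ Tr.T) {x : E3} (hx : x ∈ triOf t) {g : E3}
    (hg : ⟪Srf.n (Srf.proj x), g⟫ = 0) : ‖g - (dirOf t).starProjection g‖ ≤ 5 * m * ‖g‖ := by
  set p := Srf.proj x
  set n := Srf.n p with hn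
  have hn1 : ‖n‖ = 1 := Srf.n_unit p (Srf.proj_mem x)
  have hm := hM.m_pos
  have hs := hM.small
  set P := (dirOf t).starProjection with hP
  have hPm : ∀ v, P v ∈ dirOf t := fun v => Submodule.starProjection_apply_mem _ v
  have hQm : ∀ v, v - P v ∈ (dirOf t)ᗮ := fun v => Submodule.sub_starProjection_mem_orthogonal v
  have horth : ∀ v, ∀ τ ∈ dirOf t, ⟪τ, v - P v⟫ = 0 := fun v τ hτ => (Submodule.mem_orthogonal _ _).1 (hQm v) τ hτ
  have h1 : ‖P n‖ ≤ 4 * m := by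
    have e : ‖P n‖ ^ 2 = ⟪n, P n⟫ := by
      have := horth n (P n) (hPm n)
      rw [inner_sub_right, real_inner_self_eq_norm_sq] at this
      rw [real_inner_comm]; linarith
    have h2 := (le_abs_self _).trans (hM.slope ht hx (hPm n))
    rw [← hn, ← e] at h2
    rcases eq_or_lt_of_le (norm_nonneg (P n)) with h0 | h0
    · rw [← h0]; positivity
    · rw [pow_two] at h2; exact le_of_mul_le_mul_right h2 h0
  have h2 : 1 - 4 * m ≤ ‖n - P n‖ := by
    have := norm_sub_norm_le n (P n); rw [hn1] at this; linarith
  have hne : n - P n ≠ 0 := by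
    intro h0; rw [h0, norm_zero] at h2; linarith
  have hfr : Module.finrank ℝ (dirOf t)ᗮ = 1 := by
    have := (dirOf t).finrank_add_finrank_orthogonal
    rw [finrank_dir ht, finrank_euclideanSpace, Fintype.card_fin] at this
    omega
  obtain ⟨s, hs'⟩ := (finrank_eq_one_iff_of_nonzero' (⟨n - P n, hQm n⟩ : ((dirOf t)ᗮ : Submodule ℝ E3))
    (by intro h0; exact hne (congrArg Subtype.val h0))).1 hfr ⟨g - P g, hQm g⟩
  have hs2 : s • (n - P n) = g - P g := congrArg Subtype.val hs'
  have h3 : ‖g - P g‖ * ‖n - P n‖ = |⟪g - P g, n - P n⟫| := by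
    rw [← hs2, real_inner_smul_left, real_inner_self_eq_norm_sq, norm_smul, abs_mul,
      abs_of_nonneg (sq_nonneg ‖n - P n‖), Real.norm_eq_abs]
    ring
  have h4 : ⟪g - P g, n - P n⟫ = - ⟪g, P n⟫ := by
    rw [inner_sub_left, horth n (P g) (hPm g), sub_zero, inner_sub_right, real_inner_comm, hg, zero_sub]
  have h5 : |⟪g, P n⟫| ≤ ‖g‖ * (4 * m) := (abs_real_inner_le_norm _ _).trans (by gcongr)
  rw [h4, abs_neg] at h3
  have h6 : ‖g - P g‖ * (1 - 4 * m) ≤ ‖g - P g‖ * ‖n - P n‖ := by gcongr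
  have h7 := norm_nonneg (g - P g)
  have h8 := norm_nonneg g
  have h9 : (4 / 5 : ℝ) ≤ 1 - 4 * m := by linarith
  nlinarith

lemma mem_Sh {t} (ht : t ∈ Tr.T) {x : E3} (hx : x ∈ triOf t) : x ∈ Tr.Sh := Set.mem_biUnion ht hx

lemma lift_eq (hM : MeshHyp Srf K ρ γ h m Tr) {t} (ht : t ∈ Tr.T) {x : E3} (hx : x ∈ triOf t) (v : E3 → ℝ) :
    Tr.liftS v (Srf.proj x) = v x := by
  have hS := mem_Sh ht hx
  rw [← hM.a_eq ht hx]
  unfold Triangulation.liftS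
  have h1 : Tr.a x ∈ Tr.a '' Tr.Sh := ⟨x, hS, rfl⟩
  have e : Function.invFunOn Tr.a Tr.Sh (Tr.a x) = x :=
    Tr.a_bij.injOn (Function.invFunOn_mem h1) hS (Function.invFunOn_eq h1)
  rw [e]

lemma sub_proj_inner (hM : MeshHyp Srf K ρ γ h m Tr) (x : E3) {g : E3} (hg : ⟪Srf.n (Srf.proj x), g⟫ = 0) :
    ⟪g, x - Srf.proj x⟫ = 0 := by
  have := hM.geo.proj_decomp x
  have e : x - Srf.proj x = Srf.sd x • Srf.n (Srf.proj x) := by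
    nth_rewrite 1 [this]; abel
  rw [e, inner_smul_right, real_inner_comm, hg, mul_zero]

lemma grad_n (hM : MeshHyp Srf K ρ γ h m Tr) (x : E3) (w : E3 → ℝ) :
    ⟪Srf.n (Srf.proj x), Srf.grad w (Srf.proj x)⟫ = 0 := by
  rw [← Srf.grad_tan w]; exact Srf.inner_n_Pt (Srf.proj_mem x) _

/-- the surface gradient of a lift tested with directions of the triangle -/
lemma grad_dir (hM : MeshHyp Srf K ρ γ h m Tr) {t} (ht : t ∈ Tr.T) {x : E3} (hx : x ∈ triOf t) {v : E3 → ℝ}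
    {L : E3 →ₗ[ℝ] ℝ} {c : ℝ} (hw : ∀ y ∈ triOf t, v y = L y + c)
    (hd : DifferentiableWithinAt ℝ (Tr.liftS v) Srf.S (Srf.proj x)) {τ : E3} (hτ : τ ∈ dirOf t) :
    |⟪Srf.grad (Tr.liftS v) (Srf.proj x), τ⟫ - L τ| ≤ 2 * m * ‖Srf.grad (Tr.liftS v) (Srf.proj x)‖ * ‖τ‖ := by
  have hz := hM.tube ht hx
  obtain ⟨A, hA, hA2⟩ := hM.geo.hasFDerivAt_proj hz
  have hD := (hM.geo.diff_comp hz hd).hasFDerivAt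
  have h1 := hM.deriv_dir ht hx (hD.hasFDerivWithinAt (s := triOf t)) (L := L) (c := c)
    (fun y hy => by rw [hM.lift_eq ht hy, hw y hy]) hτ
  rw [hM.geo.fderiv_comp_proj hz hd hA] at h1
  rw [← h1]
  set g := Srf.grad (Tr.liftS v) (Srf.proj x) with hg
  have h2 : ⟪g, τ⟫ = ⟪g, Srf.Pt (Srf.proj x) τ⟫ := by
    rw [← Srf.Pt_symm, hg, Srf.grad_tan]
  rw [h2, ← inner_sub_right]
  refine (abs_real_inner_le_norm _ _).trans ?_
  have h3 := hA2 τ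
  rw [norm_sub_rev] at h3
  have h4 : 2 * K * infDist x Srf.S * ‖τ‖ ≤ 2 * m * ‖τ‖ := by
    have := mul_le_mul_of_nonneg_left (hM.infDist_le ht hx) hM.geo.K_pos.le
    have := hM.Kh_le
    gcongr ?_ * _
    linarith
  calc ‖g‖ * _ ≤ ‖g‖ * (2 * m * ‖τ‖) := by gcongr; exact h3.trans h4
    _ = _ := by ring

lemma norm_le_of_dir (hM : MeshHyp Srf K ρ γ h m Tr) {t} (ht : t ∈ Tr.T) {x : E3} (hx : x ∈ triOf t) {g : E3} {B : ℝ}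
    (hg : ⟪Srf.n (Srf.proj x), g⟫ = 0) (hB : ∀ τ ∈ dirOf t, |⟪g, τ⟫| ≤ B * ‖τ‖) : ‖g‖ ≤ B + 5 * m * ‖g‖ := by
  have h1 := hM.tan_proj ht hx hg
  set P := (dirOf t).starProjection g with hP
  have hPm : P ∈ dirOf t := Submodule.starProjection_apply_mem _ g
  have horth : ⟪P, g - P⟫ = 0 := (Submodule.mem_orthogonal _ _).1 (Submodule.sub_starProjection_mem_orthogonal g) P hPm
  have h2 := (le_abs_self _).trans (hB P hPm)
  rw [inner_sub_right, real_inner_self_eq_norm_sq] at horth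
  rw [real_inner_comm] at h2
  have h3 : ‖P‖ * ‖P‖ ≤ B * ‖P‖ := by nlinarith
  have hB0 : 0 ≤ B ∨ ‖P‖ = 0 := by
    by_contra hc
    push Not at hc
    have : 0 < ‖P‖ := lt_of_le_of_ne (norm_nonneg P) (Ne.symm hc.2)
    nlinarith
  have h5 : ‖g‖ ≤ ‖P‖ + ‖g - P‖ := by
    have := norm_add_le P (g - P); rwa [add_sub_cancel] at this
  have h4 : ‖P‖ ≤ max B 0 := by
    rcases eq_or_lt_of_le (norm_nonneg P) with h0 | h0
    · rw [← h0]; exact le_max_right _ _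
    · exact (le_of_mul_le_mul_right h3 h0).trans (le_max_left _ _)
  rcases le_or_gt 0 B with h0 | h0
  · rw [max_eq_left h0] at h4; linarith
  · exfalso
    have h6 := hB (t.1 - t.2.1) (sub_mem_dir (vertsOf_sub t (by simp [vertsOf])) (vertsOf_sub t (by simp [vertsOf])))
    have hne : t.1 ≠ t.2.1 := by
      have := (Tr.indep t ht).injective.ne (show (0 : Fin 3) ≠ 1 by decide)
      simpa using this
    have hn : 0 < ‖t.1 - t.2.1‖ := norm_pos_iff.2 (sub_ne_zero.2 hne)
    have := abs_nonneg ⟪g, t.1 - t.2.1⟫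
    nlinarith

/-- almost-affine property of lifts at vertices -/
lemma lift_vert (hM : MeshHyp Srf K ρ γ h m Tr) {t} (ht : t ∈ Tr.T) {x : E3} (hx : x ∈ triOf t) {v : E3 → ℝ}
    (hv : Tr.IsVh v) (hd : DifferentiableWithinAt ℝ (Tr.liftS v) Srf.S (Srf.proj x)) {q : E3} (hq : q ∈ vertsOf t) :
    |Tr.liftS v q - Tr.liftS v (Srf.proj x) - ⟪Srf.grad (Tr.liftS v) (Srf.proj x), q - Srf.proj x⟫| ≤
      2 * m * h * ‖Srf.grad (Tr.liftS v) (Srf.proj x)‖ := by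
  obtain ⟨L, c, hL⟩ := hv.2 t ht
  have hqt := vertsOf_sub t hq
  have e1 : Tr.liftS v q = L q + c := by
    have := hM.lift_eq ht hqt v
    rwa [hM.geo.proj_self (Tr.verts_on t ht hq), hL q hqt] at this
  have hn := hM.grad_n x (Tr.liftS v)
  have e2 : ⟪Srf.grad (Tr.liftS v) (Srf.proj x), q - Srf.proj x⟫ = ⟪Srf.grad (Tr.liftS v) (Srf.proj x), q - x⟫ := by
    have := hM.sub_proj_inner x hn
    rw [← sub_add_sub_cancel q x (Srf.proj x), inner_add_right, this, add_zero]
  rw [e2, e1, hM.lift_eq ht hx, hL x hx]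
  have h1 := hM.grad_dir ht hx hL hd (sub_mem_dir hx hqt)
  rw [abs_sub_comm, map_sub] at h1
  have e3 : L q + c - (L x + c) = L q - L x := by ring
  rw [e3]
  refine h1.trans ?_
  have := hM.dist_le ht hqt hx
  have := hM.m_pos
  calc _ ≤ 2 * m * ‖Srf.grad (Tr.liftS v) (Srf.proj x)‖ * h := by gcongr
    _ = _ := by ring

lemma interp_pt (hM : MeshHyp Srf K ρ γ h m Tr) {t} (ht : t ∈ Tr.T) {x : E3} (hx : x ∈ triOf t) {v : E3 → ℝ}
    (hv : Tr.IsVh v) (hd : DifferentiableWithinAt ℝ (Tr.liftS v) Srf.S (Srf.proj x)) {α M : ℝ} {ℓ : E3}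
    (hℓ : ⟪Srf.n (Srf.proj x), ℓ⟫ = 0)
    (hb : ∀ q ∈ vertsOf t, |Tr.liftS v q - α - ⟪ℓ, q - Srf.proj x⟫| ≤ M) :
    |Tr.liftS v (Srf.proj x) - α| ≤ M ∧
    ‖Srf.grad (Tr.liftS v) (Srf.proj x) - ℓ‖ ≤ 2 * (M / (γ * h)) + 4 * m * ‖ℓ‖ := by
  obtain ⟨L, c, hL⟩ := hv.2 t ht
  set g := Srf.grad (Tr.liftS v) (Srf.proj x) with hg
  set L' : E3 →ₗ[ℝ] ℝ := L - (innerSL ℝ ℓ).toLinearMap with hL'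
  have hLa : ∀ y, L' y = L y - ⟪ℓ, y⟫ := fun y => rfl
  have hx0 := hM.sub_proj_inner x hℓ
  have hb' : ∀ q ∈ vertsOf t, |L' q + (c - α + ⟪ℓ, x⟫)| ≤ M := by
    intro q hq
    have hqt := vertsOf_sub t hq
    have e1 : Tr.liftS v q = L q + c := by
      have := hM.lift_eq ht hqt v
      rwa [hM.geo.proj_self (Tr.verts_on t ht hq), hL q hqt] at this
    have h1 := hb q hq
    have e2 : ⟪ℓ, q - Srf.proj x⟫ = ⟪ℓ, q⟫ - ⟪ℓ, x⟫ := by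
      rw [← sub_add_sub_cancel q x (Srf.proj x), inner_add_right, hx0, add_zero, inner_sub_right]
    rw [e1, e2] at h1
    rw [hLa]
    convert h1 using 2
    ring
  constructor
  · have := aff_le L' _ M hb' hx
    rw [hM.lift_eq ht hx, hL x hx]
    rw [hLa] at this
    convert this using 2
    ring
  · have hn : ⟪Srf.n (Srf.proj x), g - ℓ⟫ = 0 := by rw [inner_sub_right, hℓ, hM.grad_n, sub_zero]
    have h1 := hM.norm_le_of_dir ht hx (g := g - ℓ) (B := M / (γ * h) + 2 * m * ‖g‖) hn (fun τ hτ => by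
      have h2 := hM.grad_dir ht hx hL hd hτ
      have h3 := hM.aff_slope ht L' _ M hb' hτ
      rw [hLa] at h3
      have e : ⟪g - ℓ, τ⟫ = (⟪g, τ⟫ - L τ) + (L τ - ⟪ℓ, τ⟫) := by rw [inner_sub_left]; ring
      rw [e]
      refine (abs_add_le _ _).trans ?_
      rw [add_mul]
      linarith)
    have h2 : ‖g‖ ≤ ‖g - ℓ‖ + ‖ℓ‖ := by
      have := norm_add_le (g - ℓ) ℓ; rwa [sub_add_cancel] at this
    have hm := hM.m_pos
    have hs := hM.small
    have h3 := norm_nonneg (g - ℓ)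
    have h4 : 2 * m * ‖g‖ ≤ 2 * m * (‖g - ℓ‖ + ‖ℓ‖) := by gcongr
    have h5 : 7 * m * ‖g - ℓ‖ ≤ 1 / 2 * ‖g - ℓ‖ := by gcongr; linarith
    linarith

/-- comparison with the triangle-wise gradient -/
lemma gradTri_near (hM : MeshHyp Srf K ρ γ h m Tr) {t} (ht : t ∈ Tr.T) {x : E3} (hx : x ∈ triOf t) {v : E3 → ℝ}
    (hv : Tr.IsVh v) (hd : DifferentiableWithinAt ℝ (Tr.liftS v) Srf.S (Srf.proj x)) :
    ‖gradTri t v x - Srf.grad (Tr.liftS v) (Srf.proj x)‖ ≤ 7 * m * ‖Srf.grad (Tr.liftS v) (Srf.proj x)‖ := by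
  obtain ⟨L, c, hL⟩ := hv.2 t ht
  set g := Srf.grad (Tr.liftS v) (Srf.proj x) with hg
  have h1 := hM.tan_proj ht hx (hM.grad_n x (Tr.liftS v))
  rw [← hg] at h1
  set P := (dirOf t).starProjection g with hP
  have hPm : P ∈ dirOf t := Submodule.starProjection_apply_mem _ g
  set G := gradTri t v x
  have hτ : P - G ∈ dirOf t := (dirOf t).sub_mem hPm (gradTri_mem t v x)
  have horth : ⟪P - G, g - P⟫ = 0 :=
    (Submodule.mem_orthogonal _ _).1 (Submodule.sub_starProjection_mem_orthogonal g) _ hτ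
  have h2 := hM.grad_dir ht hx hL hd hτ
  rw [← hM.gradTri_spec ht hx hL hτ, ← inner_sub_left] at h2
  have e : ⟪g - G, P - G⟫ = ‖P - G‖ ^ 2 := by
    have : g - G = (g - P) + (P - G) := by abel
    rw [this, inner_add_left, real_inner_comm, horth, zero_add, real_inner_self_eq_norm_sq]
  rw [e] at h2
  have h3 : ‖P - G‖ ≤ 2 * m * ‖g‖ := by
    rcases eq_or_lt_of_le (norm_nonneg (P - G)) with h0 | h0
    · rw [← h0]; have := hM.m_pos; positivity
    · rw [abs_of_nonneg (by positivity), pow_two] at h2; exact le_of_mul_le_mul_right h2 h0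
  have e2 : G - g = -((g - P) + (P - G)) := by abel
  rw [e2, norm_neg]
  refine (norm_add_le _ _).trans ?_
  linarith
end MeshHyp

end

section
variable {Srf : SmoothSurface} {K ρ : ℝ}
variable {γ h m : ℝ} {Tr : Triangulation Srf γ h}

/-- chaining along an interval covered by finitely many closed sets -/
lemma chain_cover {ι : Type*} [DecidableEq ι] (A : ι → Set ℝ) (f : ℝ → ℝ) (M : ℝ) : ∀ (N : ℕ) (I : Finset ι), I.card = N →
    ∀ a b : ℝ, a ≤ b → (∀ i ∈ I, IsClosed (A i)) → Set.Icc a b ⊆ (⋃ i ∈ I, A i) →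
    (∀ i ∈ I, ∀ x ∈ A i, ∀ y ∈ A i, x ≤ y → |f y - f x| ≤ M * (y - x)) → |f b - f a| ≤ M * (b - a) := by
  intro N
  induction N with
  | zero =>
    intro I hI a b hab _ hc _
    have : a ∈ ⋃ i ∈ I, A i := hc ⟨le_rfl, hab⟩
    rw [Finset.card_eq_zero.1 hI] at this
    simp at this
  | succ N ih =>
    intro I hI a b hab hcl hc hf
    obtain ⟨i, hi, hai⟩ : ∃ i ∈ I, a ∈ A i := by
      have : a ∈ ⋃ i ∈ I, A i := hc ⟨le_rfl, hab⟩
      simpa using this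
    set B := A i ∩ Set.Icc a b with hB
    have hBc : IsCompact B := isCompact_Icc.inter_left (hcl i hi)
    have hBn : B.Nonempty := ⟨a, hai, le_rfl, hab⟩
    set s := sSup B with hs
    have hsB : s ∈ B := hBc.sSup_mem hBn
    have hsup : ∀ x ∈ B, x ≤ s := fun x hx => le_csSup hBc.bddAbove hx
    have h1 : |f s - f a| ≤ M * (s - a) := hf i hi a hai s hsB.1 hsB.2.1
    rcases eq_or_lt_of_le hsB.2.2 with h | h
    · rw [h] at h1; exact h1
    · have hcl' : IsClosed (⋃ j ∈ I.erase i, A j) :=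
        isClosed_biUnion_finset (fun j hj => hcl j (Finset.mem_of_mem_erase hj))
      have hsub : Set.Ioc s b ⊆ ⋃ j ∈ I.erase i, A j := by
        intro x hx
        have hx' : x ∈ ⋃ i ∈ I, A i := hc ⟨hsB.2.1.trans hx.1.le, hx.2⟩
        simp only [Set.mem_iUnion, exists_prop] at hx' ⊢
        obtain ⟨j, hj, hxj⟩ := hx'
        refine ⟨j, Finset.mem_erase.2 ⟨?_, hj⟩, hxj⟩
        rintro rfl
        exact absurd (hsup x ⟨hxj, hsB.2.1.trans hx.1.le, hx.2⟩) (not_le.2 hx.1)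
      have hsub2 : Set.Icc s b ⊆ ⋃ j ∈ I.erase i, A j := by
        rw [← closure_Ioc h.ne]
        exact closure_minimal hsub hcl'
      have h2 := ih (I.erase i) (by rw [Finset.card_erase_of_mem hi, hI]; rfl) s b h.le
        (fun j hj => hcl j (Finset.mem_of_mem_erase hj)) hsub2 (fun j hj => hf j (Finset.mem_of_mem_erase hj))
      have e : f b - f a = (f b - f s) + (f s - f a) := by ring
      rw [e]
      refine (abs_add_le _ _).trans ?_
      linarith

namespace MeshHyp

/-- every point of the surface lies in a curved cell -/
lemma cover (hM : MeshHyp Srf K ρ γ h m Tr) {p : E3} (hp : p ∈ Srf.S) :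
    ∃ t ∈ Tr.T, ∃ x ∈ triOf t, Srf.proj x = p := by
  obtain ⟨x, hx, hxp⟩ := Tr.a_bij.surjOn hp
  simp only [Set.mem_iUnion, exists_prop] at hx
  obtain ⟨t, ht, hxt⟩ := hx
  exact ⟨t, ht, x, hxt, by rw [← hM.a_eq ht hxt, hxp]⟩

lemma cell_lip (hM : MeshHyp Srf K ρ γ h m Tr) {v : E3 → ℝ} (hv : Tr.IsVh v) :
    ∃ M B : ℝ, 0 ≤ M ∧ 0 ≤ B ∧ ∀ t ∈ Tr.T, ∀ x ∈ triOf t, |Tr.liftS v (Srf.proj x)| ≤ B ∧ ∀ y ∈ triOf t,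
      |Tr.liftS v (Srf.proj x) - Tr.liftS v (Srf.proj y)| ≤ M * ‖Srf.proj x - Srf.proj y‖ := by
  choose! L c hL using hv.2
  have hb : ∀ t, ∃ B : ℝ, ∀ x ∈ triOf t, ‖x‖ ≤ B := fun t =>
    (tri_compact t).exists_bound_of_continuousOn continuousOn_id
  choose R hR using hb
  set Mt : E3 × E3 × E3 → ℝ := fun t => 2 * ‖LinearMap.toContinuousLinearMap (L t)‖ with hMt
  set Bt : E3 × E3 × E3 → ℝ := fun t => ‖LinearMap.toContinuousLinearMap (L t)‖ * |R t| + |c t| with hBt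
  have hMn : ∀ t ∈ Tr.T, 0 ≤ Mt t := fun t _ => by positivity
  have hBn : ∀ t ∈ Tr.T, 0 ≤ Bt t := fun t _ => by positivity
  refine ⟨∑ t ∈ Tr.T, Mt t, ∑ t ∈ Tr.T, Bt t, Finset.sum_nonneg hMn, Finset.sum_nonneg hBn, ?_⟩
  intro t ht x hx
  constructor
  · rw [hM.lift_eq ht hx, hL t ht x hx]
    refine le_trans ?_ (Finset.single_le_sum hBn ht)
    refine (abs_add_le _ _).trans ?_
    have h1 := (LinearMap.toContinuousLinearMap (L t)).le_opNorm x
    have h2 : ‖x‖ ≤ |R t| := (hR t x hx).trans (le_abs_self _)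
    have h3 : |L t x| ≤ ‖LinearMap.toContinuousLinearMap (L t)‖ * |R t| :=
      le_trans h1 (by gcongr)
    simp only [hBt]; linarith
  · intro y hy
    rw [hM.lift_eq ht hx, hM.lift_eq ht hy, hL t ht x hx, hL t ht y hy]
    have h1 := (LinearMap.toContinuousLinearMap (L t)).le_opNorm (x - y)
    have h2 := hM.seg ht hy hx
    have h3 : ‖x - y‖ ≤ 2 * ‖Srf.proj x - Srf.proj y‖ := by
      have := norm_sub_norm_le (x - y) (Srf.proj x - Srf.proj y)
      rw [norm_sub_rev] at h2
      have hs := hM.small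
      have := norm_nonneg (x - y)
      nlinarith
    have e : L t x + c t - (L t y + c t) = L t (x - y) := by rw [map_sub]; ring
    rw [e]
    calc |L t (x - y)| ≤ ‖LinearMap.toContinuousLinearMap (L t)‖ * ‖x - y‖ := h1
      _ ≤ ‖LinearMap.toContinuousLinearMap (L t)‖ * (2 * ‖Srf.proj x - Srf.proj y‖) := by gcongr
      _ = Mt t * ‖Srf.proj x - Srf.proj y‖ := by simp only [hMt]; ring
      _ ≤ _ := by gcongr; exact Finset.single_le_sum hMn ht

/-- lifts of finite element functions are Lipschitz on the surface -/
lemma Lip_lift (hM : MeshHyp Srf K ρ γ h m Tr) {v : E3 → ℝ} (hv : Tr.IsVh v) : Srf.Lip (Tr.liftS v) := by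
  classical
  obtain ⟨M, B, hM0, hB0, hcell⟩ := hM.cell_lip hv
  have hK := hM.geo.K_pos
  set r : ℝ := 1 / (4 * K) with hr
  have hr0 : 0 < r := by positivity
  refine ⟨2 * M + 2 * B / r, by positivity, ?_⟩
  intro p hp q hq
  rcases le_or_gt ‖p - q‖ r with hpq | hpq
  · have htube : ∀ s ∈ Set.Icc (0 : ℝ) 1, 4 * K * infDist (q + s • (p - q)) Srf.S ≤ 1 := by
      intro s hs
      have h1 := infDist_le_norm hq (s • (p - q))
      rw [norm_smul, Real.norm_eq_abs, abs_of_nonneg hs.1] at h1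
      have h2 : s * ‖p - q‖ ≤ r := by nlinarith [hs.2, norm_nonneg (p - q), hs.1]
      have h3 : 4 * K * infDist (q + s • (p - q)) Srf.S ≤ 4 * K * r := by gcongr; exact h1.trans h2
      refine h3.trans (le_of_eq ?_)
      rw [hr]; field_simp
    set g : ℝ → E3 := fun s => Srf.proj (q + s • (p - q)) with hg
    have hgl : ∀ s ∈ Set.Icc (0 : ℝ) 1, ∀ s' ∈ Set.Icc (0 : ℝ) 1, ‖g s - g s'‖ ≤ 2 * (|s - s'| * ‖p - q‖) := by
      intro s hs s' hs'
      have := hM.geo.proj_lip (htube s hs) (htube s' hs')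
      have e : q + s • (p - q) - (q + s' • (p - q)) = (s - s') • (p - q) := by rw [sub_smul]; abel
      rw [e, norm_smul, Real.norm_eq_abs] at this
      exact this
    have hgc : ContinuousOn g (Set.Icc 0 1) := by
      have : LipschitzOnWith (2 * ‖p - q‖).toNNReal g (Set.Icc 0 1) := by
        apply LipschitzOnWith.of_dist_le_mul
        intro s hs s' hs'
        rw [dist_eq_norm, Real.dist_eq, Real.coe_toNNReal _ (by positivity)]
        have := hgl s hs s' hs'
        linarith
      exact this.continuousOn
    have h1 := chain_cover (fun t => Set.Icc (0 : ℝ) 1 ∩ g ⁻¹' (Srf.proj '' triOf t)) (fun s => Tr.liftS v (g s))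
      (2 * M * ‖p - q‖) _ Tr.T rfl 0 1 zero_le_one (fun t ht => by
        refine hgc.preimage_isClosed_of_isClosed isClosed_Icc ?_
        exact ((tri_compact t).image_of_continuousOn (hM.iso ht).cont).isClosed)
      (fun s hs => by
        obtain ⟨t, ht, x, hx, hxp⟩ := hM.cover (Srf.proj_mem (q + s • (p - q)))
        exact Set.mem_biUnion ht ⟨hs, x, hx, hxp⟩)
      (fun t ht s hs s' hs' hss => by
        obtain ⟨hs0, x, hx, hxs⟩ := hs
        obtain ⟨hs0', x', hx', hxs'⟩ := hs'
        have := (hcell t ht x' hx').2 x hx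
        rw [hxs, hxs'] at this
        refine this.trans ?_
        have h2 := hgl s' hs0' s hs0
        rw [abs_of_nonneg (by linarith)] at h2
        calc M * ‖g s' - g s‖ ≤ M * (2 * ((s' - s) * ‖p - q‖)) := by gcongr
          _ = _ := by ring)
    have e0 : g 0 = q := by simp only [hg, zero_smul, add_zero]; exact hM.geo.proj_self hq
    have e1 : g 1 = p := by simp only [hg, one_smul, add_sub_cancel]; exact hM.geo.proj_self hp
    simp only [e0, e1] at h1
    have : 0 ≤ 2 * B / r * ‖p - q‖ := by positivity
    linarith
  · obtain ⟨t, ht, x, hx, hxp⟩ := hM.cover hp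
    obtain ⟨t', ht', x', hx', hxq⟩ := hM.cover hq
    have a1 := (hcell t ht x hx).1
    have a2 := (hcell t' ht' x' hx').1
    rw [hxp] at a1
    rw [hxq] at a2
    have h1 : |Tr.liftS v p - Tr.liftS v q| ≤ 2 * B := by
      refine (abs_sub _ _).trans ?_; linarith
    have h2 : 2 * B ≤ 2 * B / r * ‖p - q‖ := by
      rw [div_mul_eq_mul_div, le_div_iff₀ hr0]; gcongr
    have : 0 ≤ 2 * M * ‖p - q‖ := by positivity
    linarith

end MeshHyp

end

section
variable {Srf : SmoothSurface} {K ρ : ℝ}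
variable {γ h m : ℝ} {Tr : Triangulation Srf γ h}

/-- affine interpolation on a nondegenerate triangle -/
lemma aff_interp {a b c : E3} (hi : AffineIndependent ℝ ![a, b, c]) (g : E3 → ℝ) :
    ∃ (L : E3 →ₗ[ℝ] ℝ) (d : ℝ), L a + d = g a ∧ L b + d = g b ∧ L c + d = g c := by
  rw [affineIndependent_iff_linearIndependent_vsub ℝ _ (0 : Fin 3)] at hi
  have h2 := hi.comp (fun i : Fin 2 => (⟨i.succ, Fin.succ_ne_zero i⟩ : {x : Fin 3 // x ≠ 0}))
    (fun i j hij => by simpa using hij)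
  set w : Fin 2 → E3 := fun i => ![b - a, c - a] i with hw
  have h3 : LinearIndependent ℝ w := by
    have e : w = ((fun i : {x : Fin 3 // x ≠ 0} => ![a, b, c] ↑i -ᵥ ![a, b, c] 0) ∘
        fun i : Fin 2 => ⟨i.succ, Fin.succ_ne_zero i⟩) := by
      funext i
      fin_cases i <;> simp [hw]
    rw [e]; exact h2
  set bs := Module.Basis.span h3 with hbs
  obtain ⟨L, hL⟩ := LinearMap.exists_extend (bs.constr ℝ (fun i : Fin 2 => ![g b - g a, g c - g a] i))
  have key : ∀ i, L (w i) = ![g b - g a, g c - g a] i := by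
    intro i
    have h4 := bs.constr_basis ℝ (fun i : Fin 2 => ![g b - g a, g c - g a] i) i
    rw [← hL] at h4
    have h5 : ((bs i : Submodule.span ℝ (Set.range w)) : E3) = w i := by
      rw [hbs, Module.Basis.span_apply]
    rw [← h5]; exact h4
  refine ⟨L, g a - L a, by ring, ?_, ?_⟩
  · have := key 0
    simp only [hw, Matrix.cons_val_zero, map_sub] at this
    linarith
  · have := key 1
    simp only [hw, Matrix.cons_val_one, map_sub] at this
    simp at this
    linarith

lemma seg_agree {L L' : E3 →ₗ[ℝ] ℝ} {c c' : ℝ} {v w x : E3} (hv : L v + c = L' v + c') (hw : L w + c = L' w + c')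
    (hx : x ∈ segment ℝ v w) : L x + c = L' x + c' := by
  obtain ⟨a, b, ha, hb, hab, rfl⟩ := hx
  simp only [map_add, map_smul, smul_eq_mul]
  have e : c = (a + b) * c := by rw [hab, one_mul]
  have e' : c' = (a + b) * c' := by rw [hab, one_mul]
  rw [e, e']
  linear_combination a * hv + b * hw

lemma continuousOn_finset {f : E3 → ℝ} {ι : Type*} (I : Finset ι) (A : ι → Set E3) (hA : ∀ i ∈ I, IsClosed (A i))
    (hf : ∀ i ∈ I, ContinuousOn f (A i)) : ContinuousOn f (⋃ i ∈ I, A i) := by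
  classical
  induction I using Finset.induction_on with
  | empty => simp
  | insert i I hi ih =>
    rw [Finset.set_biUnion_insert]
    refine ContinuousOn.union_of_isClosed (hf i (Finset.mem_insert_self _ _))
      (ih (fun j hj => hA j (Finset.mem_insert_of_mem hj)) (fun j hj => hf j (Finset.mem_insert_of_mem hj)))
      (hA i (Finset.mem_insert_self _ _)) (isClosed_biUnion_finset (fun j hj => hA j (Finset.mem_insert_of_mem hj)))

/-- nodal interpolation -/
lemma Triangulation.exists_interp (Tr : Triangulation Srf γ h) (g : E3 → ℝ) :
    ∃ v, Tr.IsVh v ∧ ∀ t ∈ Tr.T, ∀ q ∈ vertsOf t, v q = g q := by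
  classical
  have h1 : ∀ t ∈ Tr.T, ∃ (L : E3 →ₗ[ℝ] ℝ) (d : ℝ), ∀ q ∈ vertsOf t, L q + d = g q := by
    intro t ht
    obtain ⟨L, d, ha, hb, hc⟩ := aff_interp (Tr.indep t ht) g
    refine ⟨L, d, ?_⟩
    intro q hq
    simp only [vertsOf, Set.mem_insert_iff, Set.mem_singleton_iff] at hq
    rcases hq with rfl | rfl | rfl <;> assumption
  choose! L d hLd using h1
  have hag : ∀ t ∈ Tr.T, ∀ t' ∈ Tr.T, ∀ x, x ∈ triOf t → x ∈ triOf t' → L t x + d t = L t' x + d t' := by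
    intro t ht t' ht' x hx hx'
    by_cases he : t = t'
    · rw [he]
    rcases Tr.meet t ht t' ht' he with h0 | ⟨v, hv, h0⟩ | ⟨v, w, _, hv, hw, h0⟩
    · have : x ∈ triOf t ∩ triOf t' := ⟨hx, hx'⟩
      rw [h0] at this; exact absurd this (Set.notMem_empty x)
    · have : x ∈ triOf t ∩ triOf t' := ⟨hx, hx'⟩
      rw [h0, Set.mem_singleton_iff] at this
      rw [this, hLd t ht v hv.1, hLd t' ht' v hv.2]
    · have : x ∈ triOf t ∩ triOf t' := ⟨hx, hx'⟩
      rw [h0] at this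
      exact seg_agree (by rw [hLd t ht v hv.1, hLd t' ht' v hv.2]) (by rw [hLd t ht w hw.1, hLd t' ht' w hw.2]) this
  set v : E3 → ℝ := fun x => if hx : ∃ t ∈ Tr.T, x ∈ triOf t then L hx.choose x + d hx.choose else 0 with hv
  have hvt : ∀ t ∈ Tr.T, ∀ x ∈ triOf t, v x = L t x + d t := by
    intro t ht x hx
    have hex : ∃ t ∈ Tr.T, x ∈ triOf t := ⟨t, ht, hx⟩
    simp only [hv]
    rw [dif_pos hex]
    exact hag _ hex.choose_spec.1 t ht x hex.choose_spec.2 hx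
  refine ⟨v, ⟨?_, fun t ht => ⟨L t, d t, hvt t ht⟩⟩, ?_⟩
  · refine continuousOn_finset _ _ (fun t _ => (tri_compact t).isClosed) (fun t ht => ?_)
    have : ContinuousOn (fun x => (LinearMap.toContinuousLinearMap (L t)) x + d t) (triOf t) := by fun_prop
    exact this.congr (hvt t ht)
  · intro t ht q hq
    rw [hvt t ht q (vertsOf_sub t hq), hLd t ht q hq]

lemma Triangulation.IsVh.sub {v w : E3 → ℝ} (hv : Tr.IsVh v) (hw : Tr.IsVh w) : Tr.IsVh (fun x => v x - w x) := by
  refine ⟨hv.1.sub hw.1, ?_⟩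
  intro t ht
  obtain ⟨L, c, hL⟩ := hv.2 t ht
  obtain ⟨L', c', hL'⟩ := hw.2 t ht
  exact ⟨L - L', c - c', fun x hx => by simp only [hL x hx, hL' x hx, LinearMap.sub_apply]; ring⟩

namespace MeshHyp

lemma gradTri_sub (hM : MeshHyp Srf K ρ γ h m Tr) {t} (ht : t ∈ Tr.T) {x : E3} (hx : x ∈ triOf t) {v w : E3 → ℝ}
    (hv : Tr.IsVh v) (hw : Tr.IsVh w) :
    gradTri t (fun x => v x - w x) x = gradTri t v x - gradTri t w x := by
  obtain ⟨L, c, hL⟩ := hv.2 t ht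
  obtain ⟨L', c', hL'⟩ := hw.2 t ht
  set g := gradTri t (fun x => v x - w x) x - (gradTri t v x - gradTri t w x) with hg
  have hm : g ∈ dirOf t := (dirOf t).sub_mem (gradTri_mem _ _ _) ((dirOf t).sub_mem (gradTri_mem _ _ _) (gradTri_mem _ _ _))
  have h1 := hM.gradTri_spec ht hx hL hm
  have h2 := hM.gradTri_spec ht hx hL' hm
  have h3 := hM.gradTri_spec (v := fun x => v x - w x) (L := L - L') (c := c - c') ht hx
    (fun y hy => by simp only [hL y hy, hL' y hy, LinearMap.sub_apply]; ring) hm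
  have h4 : ⟪g, g⟫ = 0 := by
    nth_rewrite 1 [hg]
    rw [inner_sub_left, inner_sub_left, h1, h2, h3, LinearMap.sub_apply]; ring
  have h5 : g = 0 := inner_self_eq_zero.1 h4
  exact sub_eq_zero.1 h5

/-- the triangle-wise gradient is constant on each triangle -/
lemma gradTri_const (hM : MeshHyp Srf K ρ γ h m Tr) {t} (ht : t ∈ Tr.T) {x y : E3} (hx : x ∈ triOf t) (hy : y ∈ triOf t)
    {v : E3 → ℝ} (hv : Tr.IsVh v) : gradTri t v x = gradTri t v y := by
  obtain ⟨L, c, hL⟩ := hv.2 t ht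
  set g := gradTri t v x - gradTri t v y with hg
  have hm : g ∈ dirOf t := (dirOf t).sub_mem (gradTri_mem _ _ _) (gradTri_mem _ _ _)
  have h1 := hM.gradTri_spec ht hx hL hm
  have h2 := hM.gradTri_spec ht hy hL hm
  have h4 : ⟪g, g⟫ = 0 := by
    nth_rewrite 1 [hg]
    rw [inner_sub_left, h1, h2, sub_self]
  exact sub_eq_zero.1 (inner_self_eq_zero.1 h4)

lemma hausdorff_lineMap (x y : E3) : μH[2] (segment ℝ x y) = 0 := by
  rw [segment_eq_image_lineMap]
  have hl : LipschitzWith (nndist x y) (AffineMap.lineMap x y : ℝ → E3) := lipschitzWith_lineMap x y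
  have h0 : μH[2] (Set.Icc (0 : ℝ) 1) = 0 := by
    rcases Measure.hausdorffMeasure_zero_or_top (X := ℝ) (d₁ := 1) (d₂ := 2) (by norm_num) (Set.Icc (0 : ℝ) 1) with h | h
    · exact h
    · rw [hausdorffMeasure_real, Real.volume_Icc] at h
      exact absurd h ENNReal.ofReal_ne_top
  have := hl.hausdorffMeasure_image_le (d := 2) (by norm_num) (Set.Icc (0 : ℝ) 1)
  rw [h0, mul_zero] at this
  exact le_antisymm this bot_le

lemma meet_null {t t'} (ht : t ∈ Tr.T) (ht' : t' ∈ Tr.T) (hne : t ≠ t') : μH[2] (triOf t ∩ triOf t') = 0 := by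
  rcases Tr.meet t ht t' ht' hne with h0 | ⟨v, hv, h0⟩ | ⟨v, w, _, hv, hw, h0⟩
  · rw [h0, measure_empty]
  · rw [h0, ← segment_same ℝ v]; exact hausdorff_lineMap v v
  · rw [h0]; exact hausdorff_lineMap v w

lemma cell_disj (hM : MeshHyp Srf K ρ γ h m Tr) {t t'} (ht : t ∈ Tr.T) (ht' : t' ∈ Tr.T) (hne : t ≠ t') :
    μH[2] (Srf.proj '' triOf t ∩ Srf.proj '' triOf t') = 0 := by
  have hsub : Srf.proj '' triOf t ∩ Srf.proj '' triOf t' ⊆ Srf.proj '' (triOf t ∩ triOf t') := by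
    rintro _ ⟨⟨x, hx, rfl⟩, y, hy, hyx⟩
    have e : x = y := Tr.a_bij.injOn (mem_Sh ht hx) (mem_Sh ht' hy) (by rw [hM.a_eq ht hx, hM.a_eq ht' hy, hyx])
    exact ⟨x, ⟨hx, e ▸ hy⟩, rfl⟩
  have h1 := (hM.iso ht).measure_image_le (X := triOf t ∩ triOf t') Set.inter_subset_left
  rw [meet_null ht ht' hne, mul_zero] at h1
  exact le_antisymm ((measure_mono hsub).trans h1) bot_le

lemma cell_sub {t : E3 × E3 × E3} : Srf.proj '' triOf t ⊆ Srf.S := by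
  rintro _ ⟨x, _, rfl⟩; exact Srf.proj_mem x

lemma sum_union_ae {ι : Type*} {μ : Measure E3} {F : E3 → ℝ} (I : Finset ι) (A : ι → Set E3)
    (hA : ∀ i ∈ I, MeasurableSet (A i)) (hd : ∀ i ∈ I, ∀ j ∈ I, i ≠ j → μ (A i ∩ A j) = 0)
    (hF : ∀ i ∈ I, IntegrableOn F (A i) μ) :
    ∫ x in ⋃ i ∈ I, A i, F x ∂μ = ∑ i ∈ I, ∫ x in A i, F x ∂μ := by
  classical
  induction I using Finset.induction_on with
  | empty => simp
  | insert i I hi ih =>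
    rw [Finset.set_biUnion_insert, setIntegral_union₀, Finset.sum_insert hi, ih]
    · exact fun j hj => hA j (Finset.mem_insert_of_mem hj)
    · exact fun j hj k hk => hd j (Finset.mem_insert_of_mem hj) k (Finset.mem_insert_of_mem hk)
    · exact fun j hj => hF j (Finset.mem_insert_of_mem hj)
    · unfold AEDisjoint
      rw [Set.inter_iUnion₂]
      refine (measure_biUnion_null_iff I.countable_toSet).2 ?_
      intro j hj
      refine hd i (Finset.mem_insert_self _ _) j (Finset.mem_insert_of_mem hj) ?_
      rintro rfl; exact hi hj
    · exact (Finset.measurableSet_biUnion _ (fun j hj => hA j (Finset.mem_insert_of_mem hj))).nullMeasurableSet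
    · exact hF i (Finset.mem_insert_self _ _)
    · exact integrableOn_finset_iUnion.2 (fun j hj => hF j (Finset.mem_insert_of_mem hj))

/-- integrals over the surface are sums over curved cells -/
lemma sum_cells (hM : MeshHyp Srf K ρ γ h m Tr) {F : E3 → ℝ} (hF : Integrable F Srf.ms) :
    ∫ x, F x ∂Srf.ms = ∑ t ∈ Tr.T, ∫ x in Srf.proj '' triOf t, F x ∂μH[2] := by
  have e : (⋃ t ∈ Tr.T, Srf.proj '' triOf t) = Srf.S := by
    apply Set.Subset.antisymm
    · exact Set.iUnion₂_subset (fun t _ => cell_sub)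
    · intro p hp
      obtain ⟨t, ht, x, hx, hxp⟩ := hM.cover hp
      exact Set.mem_biUnion ht ⟨x, hx, hxp⟩
  unfold SmoothSurface.ms at hF ⊢
  rw [← sum_union_ae Tr.T (fun t => Srf.proj '' triOf t) (fun t ht => (hM.iso ht).mB)
    (fun t ht t' ht' hne => hM.cell_disj ht ht' hne) (fun t ht => IntegrableOn.mono_set hF cell_sub), e]

end MeshHyp

end

section
variable {Srf : SmoothSurface} {K ρ : ℝ}
variable {γ h m : ℝ} {Tr : Triangulation Srf γ h}

namespace MeshHyp

lemma ms_cell (t : E3 × E3 × E3) : Measure.restrict μH[2] (Srf.proj '' triOf t) ≤ Srf.ms :=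
  Measure.restrict_mono cell_sub le_rfl

lemma tri_fin (hM : MeshHyp Srf K ρ γ h m Tr) {t} (ht : t ∈ Tr.T) : μH[2] (triOf t) < ⊤ := by
  have h1 := (hM.iso ht).measure_le_image (X := triOf t) subset_rfl
  refine h1.trans_lt (ENNReal.mul_lt_top ENNReal.ofReal_lt_top ?_)
  have := hM.geo.finite_ms.measure_univ_lt_top
  unfold SmoothSurface.ms at this
  rw [Measure.restrict_apply_univ] at this
  exact (measure_mono cell_sub).trans_lt this

lemma tri_int (hM : MeshHyp Srf K ρ γ h m Tr) {t} (ht : t ∈ Tr.T) {v u : E3 → ℝ} (hv : Tr.IsVh v) (hu : Tr.IsVh u) :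
    IntegrableOn (fun x => ⟪gradTri t v x, gradTri t u x⟫ + v x * u x) (triOf t) μH[2] := by
  have hne : (triOf t).Nonempty := ⟨t.1, vertsOf_sub t (by simp [vertsOf])⟩
  obtain ⟨y, hy⟩ := hne
  have hsub : triOf t ⊆ Tr.Sh := fun x hx => mem_Sh ht hx
  have hc : ContinuousOn (fun x => ⟪gradTri t v x, gradTri t u x⟫ + v x * u x) (triOf t) := by
    have : ContinuousOn (fun x => ⟪gradTri t v y, gradTri t u y⟫ + v x * u x) (triOf t) :=
      continuousOn_const.add ((hv.1.mono hsub).mul (hu.1.mono hsub))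
    refine this.congr (fun x hx => ?_)
    simp only [hM.gradTri_const ht hx hy hv, hM.gradTri_const ht hx hy hu]
  obtain ⟨C, hC⟩ := (tri_compact t).exists_bound_of_continuousOn hc
  have hfin : IsFiniteMeasure (Measure.restrict μH[2] (triOf t)) :=
    ⟨by rw [Measure.restrict_apply_univ]; exact hM.tri_fin ht⟩
  exact Integrable.of_bound (hc.aestronglyMeasurable (tri_compact t).isClosed.measurableSet) C
    (ae_restrict_of_forall_mem (tri_compact t).isClosed.measurableSet hC)

lemma ah_sub_left (hM : MeshHyp Srf K ρ γ h m Tr) {v w u : E3 → ℝ} (hv : Tr.IsVh v) (hw : Tr.IsVh w) (hu : Tr.IsVh u) :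
    Tr.ahForm (fun x => v x - w x) u = Tr.ahForm v u - Tr.ahForm w u := by
  unfold Triangulation.ahForm
  rw [← Finset.sum_sub_distrib]
  refine Finset.sum_congr rfl (fun t ht => ?_)
  rw [← integral_sub (hM.tri_int ht hv hu) (hM.tri_int ht hw hu)]
  refine setIntegral_congr_fun (tri_compact t).isClosed.measurableSet (fun x hx => ?_)
  simp only [hM.gradTri_sub ht hx hv hw, inner_sub_left]
  ring

lemma geo_cell (hM : MeshHyp Srf K ρ γ h m Tr) {t} (ht : t ∈ Tr.T) {v u : E3 → ℝ} (hv : Tr.IsVh v) (hu : Tr.IsVh u) :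
    |∫ x in triOf t, (⟪gradTri t v x, gradTri t u x⟫ + v x * u x) ∂μH[2] -
      ∫ x in Srf.proj '' triOf t, (⟪Srf.grad (Tr.liftS v) x, Srf.grad (Tr.liftS u) x⟫ + Tr.liftS v x * Tr.liftS u x) ∂μH[2]|
      ≤ 60 * m * ∫ x in Srf.proj '' triOf t, Srf.pe (Tr.liftS v) x * Srf.pe (Tr.liftS u) x ∂μH[2] := by
  have hG := hM.geo
  have hm := hM.m_pos
  have hs := hM.small
  have hV := hM.Lip_lift hv
  have hU := hM.Lip_lift hu
  set F : E3 → ℝ := fun x => ⟪Srf.grad (Tr.liftS v) x, Srf.grad (Tr.liftS u) x⟫ + Tr.liftS v x * Tr.liftS u x with hF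
  set P : E3 → ℝ := fun x => Srf.pe (Tr.liftS v) x * Srf.pe (Tr.liftS u) x with hP
  have hP0 : ∀ x, 0 ≤ P x := fun x => mul_nonneg (Srf.pe_nonneg _ _) (Srf.pe_nonneg _ _)
  have iF : IntegrableOn F (Srf.proj '' triOf t) μH[2] := (hG.int_a hV hU).mono_measure (ms_cell t)
  have iP : IntegrableOn P (Srf.proj '' triOf t) μH[2] := (hG.int_pepe hV hU).1.mono_measure (ms_cell t)
  have h1 := (hM.iso ht).integral_comp_le iF
  have h2 : ∫ x in Srf.proj '' triOf t, |F x| ∂μH[2] ≤ ∫ x in Srf.proj '' triOf t, P x ∂μH[2] :=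
    integral_mono iF.abs iP (fun x => Srf.integrand_le _ _ x)
  have iFc := (hM.iso ht).integrable_comp iF
  have iPc := (hM.iso ht).integrable_comp iP
  have hdv := (hM.iso ht).ae_of_ae (Measure.absolutelyContinuous_of_le (ms_cell t) (hG.ae_diff hV))
  have hdu := (hM.iso ht).ae_of_ae (Measure.absolutelyContinuous_of_le (ms_cell t) (hG.ae_diff hU))
  have h3 : |∫ x in triOf t, (⟪gradTri t v x, gradTri t u x⟫ + v x * u x) ∂μH[2] - ∫ x in triOf t, F (Srf.proj x) ∂μH[2]|
      ≤ 15 * m * ∫ x in triOf t, P (Srf.proj x) ∂μH[2] := by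
    rw [← integral_sub (hM.tri_int ht hv hu) iFc, ← integral_const_mul]
    rw [← Real.norm_eq_abs]
    refine norm_integral_le_of_norm_le (iPc.const_mul _) ?_
    filter_upwards [hdv, hdu, ae_restrict_mem (tri_compact t).isClosed.measurableSet] with x h1 h2 hx
    have a1 := hM.gradTri_near ht hx hv h1
    have a2 := hM.gradTri_near ht hx hu h2
    have a3 := inner_perturb (by positivity) a1 a2
    simp only [hF, hM.lift_eq ht hx]
    rw [Real.norm_eq_abs, add_sub_add_right_eq_sub]
    refine a3.trans ?_
    have a4 : ‖Srf.grad (Tr.liftS v) (Srf.proj x)‖ * ‖Srf.grad (Tr.liftS u) (Srf.proj x)‖ ≤ P (Srf.proj x) := by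
      simp only [hP]
      have := Srf.grad_le_pe (Tr.liftS v) (Srf.proj x)
      have := Srf.grad_le_pe (Tr.liftS u) (Srf.proj x)
      have := Srf.pe_nonneg (Tr.liftS v) (Srf.proj x)
      gcongr
    have a5 : 2 * (7 * m) + (7 * m) ^ 2 ≤ 15 * m := by nlinarith
    gcongr
  have h4 := (hM.iso ht).integral_le iP hP0
  have h5 : 0 ≤ ∫ x in Srf.proj '' triOf t, P x ∂μH[2] := integral_nonneg hP0
  set IP := ∫ x in Srf.proj '' triOf t, P x ∂μH[2]
  set IPc := ∫ x in triOf t, P (Srf.proj x) ∂μH[2]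
  have h6 := (abs_sub_le _ _ _).trans (add_le_add h3 h1)
  refine h6.trans ?_
  have b1 : (1 + 16 * m) ^ 2 ≤ 1 + 33 * m := by nlinarith
  have b2 : IPc ≤ 2 * IP := h4.trans (by gcongr; linarith)
  have b3 : 15 * m * IPc ≤ 15 * m * (1.5 * IP) := by
    gcongr; exact h4.trans (by gcongr; linarith)
  have b4 : ((1 + 16 * m) ^ 2 - 1) * ∫ x in Srf.proj '' triOf t, |F x| ∂μH[2] ≤ (33 * m) * IP := by
    gcongr; linarith
  nlinarith

/-- geometric consistency of the discrete form -/
lemma geo_form (hM : MeshHyp Srf K ρ γ h m Tr) {v u : E3 → ℝ} (hv : Tr.IsVh v) (hu : Tr.IsVh u) :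
    |Tr.ahForm v u - Srf.aForm (Tr.liftS v) (Tr.liftS u)| ≤
      60 * m * ∫ x, Srf.pe (Tr.liftS v) x * Srf.pe (Tr.liftS u) x ∂Srf.ms := by
  have hG := hM.geo
  have hV := hM.Lip_lift hv
  have hU := hM.Lip_lift hu
  rw [Srf.aForm_def, hM.sum_cells (hG.int_a hV hU), hM.sum_cells (hG.int_pepe hV hU).1]
  unfold Triangulation.ahForm
  rw [← Finset.sum_sub_distrib, Finset.mul_sum]
  refine (Finset.abs_sum_le_sum_abs _ _).trans (Finset.sum_le_sum (fun t ht => hM.geo_cell ht hv hu))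

lemma tri_area (hM : MeshHyp Srf K ρ γ h m Tr) {t} (ht : t ∈ Tr.T) :
    ENNReal.ofReal ((γ * h) ^ 2) ≤ μH[2] (triOf t) := by
  obtain ⟨y, hy, hd⟩ := hM.disk' ht
  have hg : 0 < γ * h := mul_pos hM.γpos hM.hpos
  set b := (stdOrthonormalBasis ℝ (dirOf t)).reindex (finCongr (finrank_dir ht)) with hb
  set Q : E3 → (Fin 2 → ℝ) := fun z i => ⟪((b i : dirOf t) : E3), z - y⟫ with hQ
  have hb1 : ∀ i, ‖((b i : dirOf t) : E3)‖ = 1 := fun i => b.orthonormal.1 i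
  have hQl : LipschitzWith 1 Q := by
    apply LipschitzWith.of_dist_le_mul
    intro z w
    rw [NNReal.coe_one, one_mul, dist_pi_le_iff dist_nonneg]
    intro i
    rw [Real.dist_eq, dist_eq_norm]
    simp only [hQ]
    rw [← inner_sub_right, sub_sub_sub_cancel_right]
    have := abs_real_inner_le_norm ((b i : dirOf t) : E3) (z - w)
    rwa [hb1, one_mul] at this
  have hsub : closedBall (0 : Fin 2 → ℝ) (γ * h / 2) ⊆ Q '' triOf t := by
    intro a ha
    rw [mem_closedBall, dist_zero_right, pi_norm_le_iff_of_nonneg (by positivity)] at ha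
    set τ : dirOf t := ∑ i, a i • b i with hτ
    have hn : ‖(τ : E3)‖ ≤ γ * h := by
      have e : ‖(τ : E3)‖ = ‖τ‖ := rfl
      rw [e, hτ, Fin.sum_univ_two]
      refine (norm_add_le _ _).trans ?_
      rw [norm_smul, norm_smul, b.orthonormal.1 0, b.orthonormal.1 1]
      have := ha 0
      have := ha 1
      linarith
    refine ⟨y + (τ : E3), hd _ τ.2 hn, ?_⟩
    funext i
    simp only [hQ, add_sub_cancel_left]
    have e : ⟪((b i : dirOf t) : E3), (τ : E3)⟫ = ⟪b i, τ⟫ := rfl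
    rw [e, hτ]
    exact b.orthonormal.inner_right_fintype a i
  have hvol : (μH[2] : Measure (Fin 2 → ℝ)) = volume := by
    have := hausdorffMeasure_pi_real (ι := Fin 2)
    simpa using this
  have h1 := (hQl.lipschitzOnWith (s := triOf t)).hausdorffMeasure_image_le (d := 2) (by norm_num)
  have h2 : μH[2] (closedBall (0 : Fin 2 → ℝ) (γ * h / 2)) ≤ μH[2] (Q '' triOf t) := measure_mono hsub
  rw [hvol, Real.volume_pi_closedBall _ (by positivity)] at h2
  rw [hvol] at h1
  have h3 := h2.trans h1
  norm_num at h3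
  have e : 2 * (γ * h / 2) = γ * h := by ring
  rwa [e] at h3

lemma cell_area (hM : MeshHyp Srf K ρ γ h m Tr) {t} (ht : t ∈ Tr.T) :
    (γ * h) ^ 2 / 2 ≤ (μH[2] (Srf.proj '' triOf t)).toReal := by
  have h1 := (hM.tri_area ht).trans ((hM.iso ht).measure_le_image (X := triOf t) subset_rfl)
  have hm := hM.m_pos
  have hs := hM.small
  have hfin : μH[2] (Srf.proj '' triOf t) ≠ ⊤ := by
    have h2 := (hM.iso ht).measure_image_le (X := triOf t) subset_rfl
    exact (h2.trans_lt (ENNReal.mul_lt_top ENNReal.ofReal_lt_top (hM.tri_fin ht))).ne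
  have h2 := ENNReal.toReal_mono (ENNReal.mul_ne_top ENNReal.ofReal_ne_top hfin) h1
  rw [ENNReal.toReal_ofReal (by positivity), ENNReal.toReal_mul, ENNReal.toReal_ofReal (by positivity)] at h2
  have b1 : (1 + 16 * m) ^ 2 ≤ 2 := by nlinarith
  have h3 : 0 ≤ (μH[2] (Srf.proj '' triOf t)).toReal := ENNReal.toReal_nonneg
  nlinarith

lemma inv_arith {G G' V V' g h m : ℝ} (hG : 0 ≤ G) (hG' : 0 ≤ G') (hm : 0 < m) (hs : 4000 * m ≤ 1) (hh : 0 < h) (hh1 : h ≤ 1)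
    (h1 : G ≤ g + 7 * m * G) (h2 : g ≤ G' + 7 * m * G') (h3 : |V| ≤ |V'| + g * h) (hg : 0 ≤ g) :
    G ^ 2 + V ^ 2 ≤ 12 * (G' ^ 2 + V' ^ 2) := by
  have a1 : 7 * m * G ≤ 1 / 4 * G := by gcongr; linarith
  have a2 : 7 * m * G' ≤ 1 / 4 * G' := by gcongr; linarith
  have a3 : G ≤ 2 * G' := by linarith
  have a4 : g * h ≤ 2 * G' * 1 := by gcongr; linarith
  have a5 : |V| ≤ |V'| + 2 * G' := by linarith
  rw [← sq_abs V, ← sq_abs V']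
  have a6 : G ^ 2 ≤ (2 * G') ^ 2 := by gcongr
  have a7 : |V| ^ 2 ≤ (|V'| + 2 * G') ^ 2 := by gcongr
  nlinarith [sq_nonneg V', sq_nonneg G', sq_nonneg (|V'| - 2 * G'), sq_nonneg (1 : ℝ)]

/-- inverse estimate -/
lemma inverse (hM : MeshHyp Srf K ρ γ h m Tr) {v : E3 → ℝ} (hv : Tr.IsVh v) {p : E3} (hp : p ∈ Srf.S)
    (hd : DifferentiableWithinAt ℝ (Tr.liftS v) Srf.S p) :
    (γ * h) * Srf.pe (Tr.liftS v) p ≤ 5 * Srf.en (Tr.liftS v) := by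
  have hG := hM.geo
  have hm := hM.m_pos
  have hs := hM.small
  have hV := hM.Lip_lift hv
  have hgh : 0 < γ * h := mul_pos hM.γpos hM.hpos
  have hh1 : h ≤ 1 := hM.hρ.trans hG.ρ_le
  obtain ⟨t, ht, x, hx, rfl⟩ := hM.cover hp
  obtain ⟨L, c, hL⟩ := hv.2 t ht
  have i2 : IntegrableOn (fun x => 12 * Srf.pe (Tr.liftS v) x ^ 2) (Srf.proj '' triOf t) μH[2] :=
    ((hG.int_pe2 hV).mono_measure (ms_cell t)).const_mul 12
  have hfin : IsFiniteMeasure (Measure.restrict μH[2] (Srf.proj '' triOf t)) := by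
    constructor
    have := hG.finite_ms.measure_univ_lt_top
    exact (Measure.le_iff'.1 (ms_cell t) _).trans_lt this
  have hdv := (hM.iso ht).ae_of_ae (Measure.absolutelyContinuous_of_le (ms_cell t) (hG.ae_diff hV))
  have key : ∀ᵐ q ∂(Measure.restrict μH[2] (Srf.proj '' triOf t)),
      Srf.pe (Tr.liftS v) (Srf.proj x) ^ 2 ≤ 12 * Srf.pe (Tr.liftS v) q ^ 2 := by
    apply (hM.iso ht).ae_of_ae'
    filter_upwards [hdv, ae_restrict_mem (tri_compact t).isClosed.measurableSet] with x' hdx' hx'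
    rw [Srf.pe_sq, Srf.pe_sq]
    have a1 := hM.gradTri_near ht hx hv hd
    have a2 := hM.gradTri_near ht hx' hv hdx'
    rw [hM.gradTri_const ht hx' hx hv] at a2
    have b1 := norm_sub_norm_le (Srf.grad (Tr.liftS v) (Srf.proj x)) (gradTri t v x)
    have b2 := norm_sub_norm_le (gradTri t v x) (Srf.grad (Tr.liftS v) (Srf.proj x'))
    rw [norm_sub_rev] at b1
    refine inv_arith (g := ‖gradTri t v x‖) (norm_nonneg _) (norm_nonneg _) hm hs hM.hpos hh1 (by linarith) (by linarith)
      ?_ (norm_nonneg _)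
    rw [hM.lift_eq ht hx, hM.lift_eq ht hx']
    have e : v x - v x' = ⟪gradTri t v x, x - x'⟫ := by
      rw [hM.gradTri_spec ht hx hL (sub_mem_dir hx' hx), hL x hx, hL x' hx', map_sub]; ring
    have b3 := abs_real_inner_le_norm (gradTri t v x) (x - x')
    rw [← e] at b3
    have b4 := abs_sub_abs_le_abs_sub (v x) (v x')
    have b5 : ‖gradTri t v x‖ * ‖x - x'‖ ≤ ‖gradTri t v x‖ * h := by gcongr; exact hM.dist_le ht hx hx'
    linarith
  have h1 := integral_mono_ae (integrable_const _) i2 key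
  rw [integral_const, smul_eq_mul, measureReal_def, Measure.restrict_apply_univ, integral_const_mul] at h1
  have h2 : ∫ x in Srf.proj '' triOf t, Srf.pe (Tr.liftS v) x ^ 2 ∂μH[2] ≤ Srf.en (Tr.liftS v) ^ 2 := by
    rw [Srf.en_sq, Srf.aForm_self]
    exact integral_mono_measure (ms_cell t) (Filter.Eventually.of_forall (fun x => by positivity)) (hG.int_pe2 hV)
  have h3 := hM.cell_area ht
  have h4 : (γ * h) ^ 2 / 2 * Srf.pe (Tr.liftS v) (Srf.proj x) ^ 2 ≤
    (μH[2] (Srf.proj '' triOf t)).toReal * Srf.pe (Tr.liftS v) (Srf.proj x) ^ 2 := by gcongr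
  have h5 := Srf.en_nonneg (Tr.liftS v)
  have h6 := Srf.pe_nonneg (Tr.liftS v) (Srf.proj x)
  refine le_of_sq_le_sq ?_ (by positivity)
  nlinarith

end MeshHyp

end

section
variable {Srf : SmoothSurface} {K ρ : ℝ}

/-- unnormalized ball averages -/
def bav (W : E3 → ℝ) (h : ℝ) (z : E3) : ℝ := ∫ y in ball (0 : E3) h, W (z + y)

lemma ball_fin (h : ℝ) : IsFiniteMeasure (Measure.restrict (volume : Measure E3) (ball (0 : E3) h)) :=
  ⟨by rw [Measure.restrict_apply_univ]; exact measure_ball_lt_top⟩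

lemma int_fderiv {W : E3 → ℝ} {L : ℝ≥0} (hW : LipschitzWith L W) (h : ℝ) (z : E3) :
    Integrable (fun y => fderiv ℝ W (z + y)) (Measure.restrict volume (ball (0 : E3) h)) := by
  have := ball_fin h
  refine Integrable.of_bound (C := L) ?_ (Filter.Eventually.of_forall (fun y => norm_fderiv_le_of_lipschitz ℝ hW))
  exact ((measurable_fderiv ℝ W).comp (measurable_const_add z)).aestronglyMeasurable

lemma bav_deriv {W : E3 → ℝ} {L : ℝ≥0} (hW : LipschitzWith L W) (h : ℝ) (z : E3) :
    HasFDerivAt (bav W h) (∫ y in ball (0 : E3) h, fderiv ℝ W (z + y)) z := by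
  have hfin := ball_fin h
  have hmeas : ∀ x : E3, Continuous (fun y => W (x + y)) := fun x => hW.continuous.comp (continuous_const.add continuous_id)
  refine (hasFDerivAt_integral_of_dominated_loc_of_lip (μ := Measure.restrict volume (ball (0 : E3) h))
    (F := fun x y => W (x + y)) (x₀ := z) (F' := fun y => fderiv ℝ W (z + y)) (bound := fun _ => (L : ℝ)) (s := Set.univ) Filter.univ_mem
    (Filter.Eventually.of_forall (fun x => (hmeas x).aestronglyMeasurable)) ?_ (int_fderiv hW h z).aestronglyMeasurable
    ?_ (integrable_const _) ?_).2
  · have hb : ∀ y ∈ ball (0 : E3) h, ‖W (z + y)‖ ≤ ‖W z‖ + L * h := by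
      intro y hy
      rw [mem_ball_zero_iff] at hy
      have h1 := hW.dist_le_mul (z + y) z
      rw [dist_eq_norm, dist_eq_norm, add_sub_cancel_left] at h1
      have h2 := norm_sub_norm_le (W (z + y)) (W z)
      have h3 : (L : ℝ) * ‖y‖ ≤ L * h := by gcongr
      linarith
    exact Integrable.of_bound (hmeas z).aestronglyMeasurable _ (ae_restrict_of_forall_mem measurableSet_ball hb)
  · refine Filter.Eventually.of_forall (fun y => ?_)
    apply LipschitzOnWith.of_dist_le_mul
    intro a _ b _
    have := hW.dist_le_mul (a + y) (b + y)
    rw [dist_add_right] at this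
    simpa using this
  · have h1 : ∀ᵐ y : E3, DifferentiableAt ℝ W (z + y) :=
      (measurePreserving_add_left volume z).quasiMeasurePreserving.ae hW.ae_differentiableAt
    refine ae_restrict_of_ae ?_
    filter_upwards [h1] with y hy
    have h2 : HasFDerivAt (fun x : E3 => x + y) (ContinuousLinearMap.id ℝ E3) z := (hasFDerivAt_id z).add_const y
    have h3 : HasFDerivAt (fun x : E3 => W (x + y)) ((fderiv ℝ W (z + y)).comp (ContinuousLinearMap.id ℝ E3)) z :=
      hy.hasFDerivAt.comp z h2
    rwa [ContinuousLinearMap.comp_id] at h3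

lemma int_shift (F : E3 → ℝ) (h : ℝ) (z : E3) :
    ∫ y in ball (0 : E3) h, F (z + y) = ∫ y in ball z h, F y := by
  have h1 := (measurePreserving_add_left (volume : Measure E3) z).setIntegral_preimage_emb
    (measurableEmbedding_addLeft z) F (ball z h)
  rw [← h1]
  congr 2
  ext y
  simp [mem_ball, dist_eq_norm]

lemma int_shift_on {F : E3 → ℝ} (hF : Measurable F) {C : ℝ} (hC : ∀ x, ‖F x‖ ≤ C) (h : ℝ) (z : E3) :
    IntegrableOn F (ball z h) := by
  have : IsFiniteMeasure (Measure.restrict (volume : Measure E3) (ball z h)) :=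
    ⟨by rw [Measure.restrict_apply_univ]; exact measure_ball_lt_top⟩
  exact Integrable.of_bound hF.aestronglyMeasurable C (Filter.Eventually.of_forall hC)

def bvol (h : ℝ) : ℝ := (volume (ball (0 : E3) h)).toReal

lemma bvol_pos {h : ℝ} (hh : 0 < h) : 0 < bvol h :=
  ENNReal.toReal_pos (measure_ball_pos volume _ hh).ne' measure_ball_lt_top.ne

lemma bvol_three {h : ℝ} (hh : 0 < h) : bvol (3 * h) = 27 * bvol h := by
  unfold bvol
  rw [Measure.addHaar_ball_mul volume (0 : E3) (by norm_num : (0 : ℝ) ≤ 3) h, ENNReal.toReal_mul,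
    ENNReal.toReal_ofReal (by positivity), finrank_euclideanSpace, Fintype.card_fin]
  norm_num

/-- mean value estimate for ball averages -/
lemma bav_mvt {W : E3 → ℝ} {L : ℝ≥0} (hW : LipschitzWith L W) {h : ℝ} (hh : 0 < h) (p q : E3) (hq : ‖q - p‖ ≤ 2 * h)
    (ℓ : E3 →L[ℝ] ℝ) :
    |bav W h q - bav W h p - bvol h * ℓ (q - p)| ≤ (∫ y in ball (0 : E3) (3 * h), ‖fderiv ℝ W (p + y) - ℓ‖) * (2 * h) := by
  set J := ∫ y in ball (0 : E3) (3 * h), ‖fderiv ℝ W (p + y) - ℓ‖ with hJ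
  have hJ0 : 0 ≤ J := integral_nonneg (fun _ => norm_nonneg _)
  have hFm : Measurable (fun x => ‖fderiv ℝ W x - ℓ‖) := ((measurable_fderiv ℝ W).sub_const ℓ).norm
  have hFb : ∀ x, ‖‖fderiv ℝ W x - ℓ‖‖ ≤ L + ‖ℓ‖ := by
    intro x
    rw [norm_norm]
    exact (norm_sub_le _ _).trans (by gcongr; exact norm_fderiv_le_of_lipschitz ℝ hW)
  have key : ∀ z ∈ closedBall p (2 * h), ‖(∫ y in ball (0 : E3) h, fderiv ℝ W (z + y)) - bvol h • ℓ‖ ≤ J := by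
    intro z hz
    have hfin := ball_fin h
    have e : bvol h • ℓ = ∫ y in ball (0 : E3) h, ℓ := by
      rw [integral_const, measureReal_def, Measure.restrict_apply_univ, bvol]
    rw [e, ← integral_sub (int_fderiv hW h z) (integrable_const _)]
    refine (norm_integral_le_integral_norm _).trans ?_
    rw [hJ, int_shift (fun x => ‖fderiv ℝ W x - ℓ‖), int_shift (fun x => ‖fderiv ℝ W x - ℓ‖)]
    refine setIntegral_mono_set (int_shift_on hFm hFb _ _) (Filter.Eventually.of_forall (fun _ => norm_nonneg _)) ?_
    refine (ball_subset_ball' ?_).eventuallyLE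
    rw [mem_closedBall] at hz
    linarith
  have h1 := (convex_closedBall p (2 * h)).norm_image_sub_le_of_norm_hasFDerivWithin_le'
    (f := bav W h) (f' := fun z => ∫ y in ball (0 : E3) h, fderiv ℝ W (z + y)) (φ := bvol h • ℓ) (C := J)
    (fun z _ => (bav_deriv hW h z).hasFDerivWithinAt) key (mem_closedBall_self (by positivity))
    (show q ∈ closedBall p (2 * h) by rw [mem_closedBall, dist_eq_norm]; exact hq)
  rw [Real.norm_eq_abs] at h1
  refine le_trans (le_of_eq ?_) (h1.trans (by gcongr))
  simp

lemma bav_sub {W : E3 → ℝ} {L : ℝ≥0} (hW : LipschitzWith L W) {h : ℝ} (hh : 0 < h) (p : E3) (c : ℝ) :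
    |bav W h p - bvol h * c| ≤ ∫ y in ball (0 : E3) (3 * h), |W (p + y) - c| := by
  have hfin := ball_fin h
  have hc : Continuous (fun y => W (p + y)) := hW.continuous.comp (continuous_const.add continuous_id)
  have hi : ∀ r, IntegrableOn (fun y => W (p + y) - c) (ball (0 : E3) r) := by
    intro r
    exact ((hc.sub continuous_const).continuousOn.integrableOn_compact (isCompact_closedBall 0 r)).mono_set ball_subset_closedBall
  have hi2 : IntegrableOn (fun y => W (p + y)) (ball (0 : E3) h) :=
    (hc.continuousOn.integrableOn_compact (isCompact_closedBall 0 h)).mono_set ball_subset_closedBall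
  have e : bav W h p - bvol h * c = ∫ y in ball (0 : E3) h, (W (p + y) - c) := by
    rw [integral_sub hi2 (integrable_const _), integral_const, measureReal_def, Measure.restrict_apply_univ, bvol, smul_eq_mul]
    rfl
  rw [e, ← Real.norm_eq_abs]
  refine (norm_integral_le_integral_norm _).trans ?_
  refine setIntegral_mono_set (hi _).norm (Filter.Eventually.of_forall (fun _ => norm_nonneg _)) ?_
  exact (ball_subset_ball (by linarith)).eventuallyLE

/-- Jensen and Tonelli for averages over a ball -/
lemma avg_sq {μ : Measure E3} [IsFiniteMeasure μ] {F : E3 → E3 → ℝ} (hF : Measurable (Function.uncurry F)) {C B h : ℝ}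
    (hh : 0 < h) (h0 : ∀ p y, 0 ≤ F p y) (hC : ∀ p, ∀ y ∈ ball (0 : E3) (3 * h), F p y ≤ C)
    (hB : ∀ y ∈ ball (0 : E3) (3 * h), ∫ p, F p y ^ 2 ∂μ ≤ B) :
    Integrable (fun p => ((bvol h)⁻¹ * ∫ y in ball (0 : E3) (3 * h), F p y) ^ 2) μ ∧
    ∫ p, ((bvol h)⁻¹ * ∫ y in ball (0 : E3) (3 * h), F p y) ^ 2 ∂μ ≤ 729 * B := by
  have hfin := ball_fin (3 * h)
  set ν := Measure.restrict (volume : Measure E3) (ball (0 : E3) (3 * h)) with hν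
  have hb0 := bvol_pos hh
  have hν1 : ν.real Set.univ = 27 * bvol h := by
    rw [measureReal_def, hν, Measure.restrict_apply_univ, ← bvol_three hh]; rfl
  have hmem : ∀ᵐ y ∂ν, y ∈ ball (0 : E3) (3 * h) := ae_restrict_mem measurableSet_ball
  have iF : ∀ p, Integrable (F p) ν := fun p =>
    Integrable.of_bound (hF.comp measurable_prodMk_left).aestronglyMeasurable C (by
      filter_upwards [hmem] with y hy
      rw [Real.norm_eq_abs, abs_of_nonneg (h0 p y)]; exact hC p y hy)
  have iF2' : ∀ p, Integrable (fun y => F p y ^ 2) ν := fun p =>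
    Integrable.of_bound ((hF.comp measurable_prodMk_left).pow_const 2).aestronglyMeasurable (C ^ 2) (by
      filter_upwards [hmem] with y hy
      rw [Real.norm_eq_abs, abs_of_nonneg (by positivity)]
      have := hC p y hy; have := h0 p y; gcongr)
  have hm1 : StronglyMeasurable (fun p => ∫ y, F p y ∂ν) :=
    StronglyMeasurable.integral_prod_right (f := F) (hF.stronglyMeasurable)
  have hm2 : StronglyMeasurable (fun p => ∫ y, F p y ^ 2 ∂ν) :=
    StronglyMeasurable.integral_prod_right (f := fun p y => F p y ^ 2) ((hF.pow_const 2).stronglyMeasurable)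
  have cs : ∀ p, (∫ y, F p y ∂ν) ^ 2 ≤ 27 * bvol h * ∫ y, F p y ^ 2 ∂ν := by
    intro p
    obtain ⟨_, h2⟩ := cs_integral (μ := ν) (f := fun _ => (1 : ℝ)) (g := F p) aestronglyMeasurable_const
      (iF p).aestronglyMeasurable (by simp) (iF2' p)
    simp only [one_mul, one_pow, integral_const, smul_eq_mul, mul_one, hν1] at h2
    have h3 : 0 ≤ ∫ y, F p y ^ 2 ∂ν := integral_nonneg (fun y => by positivity)
    have h4 := pow_le_pow_left₀ (abs_nonneg _) h2 2
    rw [sq_abs, mul_pow, Real.sq_sqrt (by positivity), Real.sq_sqrt h3] at h4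
    exact h4
  have hCn : ∀ p, ‖∫ y, F p y ∂ν‖ ≤ C * ν.real Set.univ := fun p =>
    norm_integral_le_of_norm_le_const (by
      filter_upwards [hmem] with y hy
      rw [Real.norm_eq_abs, abs_of_nonneg (h0 p y)]; exact hC p y hy)
  have hC2 : ∀ p, ‖∫ y, F p y ^ 2 ∂ν‖ ≤ C ^ 2 * ν.real Set.univ := fun p =>
    norm_integral_le_of_norm_le_const (by
      filter_upwards [hmem] with y hy
      rw [Real.norm_eq_abs, abs_of_nonneg (by positivity)]
      have := hC p y hy; have := h0 p y; gcongr)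
  have i1 : Integrable (fun p => ((bvol h)⁻¹ * ∫ y, F p y ∂ν) ^ 2) μ := by
    refine Integrable.of_bound ((hm1.const_mul _).pow 2).aestronglyMeasurable (((bvol h)⁻¹ * (C * ν.real Set.univ)) ^ 2)
      (Filter.Eventually.of_forall (fun p => ?_))
    rw [norm_pow, norm_mul, Real.norm_of_nonneg (by positivity : (0 : ℝ) ≤ (bvol h)⁻¹)]
    have := hCn p
    gcongr
  have i2 : Integrable (fun p => ∫ y, F p y ^ 2 ∂ν) μ :=
    Integrable.of_bound hm2.aestronglyMeasurable _ (Filter.Eventually.of_forall hC2)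
  refine ⟨i1, ?_⟩
  have i3 : Integrable (Function.uncurry (fun p y => F p y ^ 2)) (μ.prod ν) := by
    refine Integrable.of_bound (hF.pow_const 2).aestronglyMeasurable (C ^ 2) ?_
    have : ∀ᵐ z ∂(μ.prod ν), z.2 ∈ ball (0 : E3) (3 * h) :=
      Measure.quasiMeasurePreserving_snd.ae hmem
    filter_upwards [this] with z hz
    simp only [Function.uncurry]
    rw [Real.norm_eq_abs, abs_of_nonneg (by positivity)]
    have := hC z.1 z.2 hz; have := h0 z.1 z.2; gcongr
  have sw := integral_integral_swap i3
  have hB' : ∫ y, ∫ p, F p y ^ 2 ∂μ ∂ν ≤ ∫ _y, B ∂ν := by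
    refine integral_mono_ae i3.integral_prod_right (integrable_const _) ?_
    filter_upwards [hmem] with y hy
    exact hB y hy
  rw [integral_const, hν1, smul_eq_mul] at hB'
  calc ∫ p, ((bvol h)⁻¹ * ∫ y, F p y ∂ν) ^ 2 ∂μ ≤ ∫ p, ((bvol h)⁻¹) ^ 2 * (27 * bvol h) * ∫ y, F p y ^ 2 ∂ν ∂μ := by
        refine integral_mono i1 (i2.const_mul _) (fun p => ?_)
        have := cs p
        simp only
        rw [mul_pow, mul_assoc]
        gcongr
    _ = ((bvol h)⁻¹) ^ 2 * (27 * bvol h) * ∫ p, ∫ y, F p y ^ 2 ∂ν ∂μ := integral_const_mul _ _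
    _ = ((bvol h)⁻¹) ^ 2 * (27 * bvol h) * ∫ y, ∫ p, F p y ^ 2 ∂μ ∂ν := by rw [sw]
    _ ≤ ((bvol h)⁻¹) ^ 2 * (27 * bvol h) * (27 * bvol h * B) := by gcongr
    _ = 729 * B := by field_simp; ring

end

section
variable {Srf : SmoothSurface} {K ρ : ℝ}
variable {γ h m : ℝ} {Tr : Triangulation Srf γ h}

/-- `W` is a globally Lipschitz extension of `w ∘ proj` from the tube -/
def SmoothSurface.IsExt (Srf : SmoothSurface) (K : ℝ) (w W : E3 → ℝ) : Prop :=
  ∀ z, 4 * K * infDist z Srf.S ≤ 1 → W z = w (Srf.proj z)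

lemma GeoFacts.exists_ext (hG : GeoFacts Srf K ρ) {w : E3 → ℝ} (hw : Srf.Lip w) :
    ∃ (L : ℝ≥0) (W : E3 → ℝ), LipschitzWith L W ∧ Srf.IsExt K w W := by
  obtain ⟨L, hL⟩ := hw
  have h1 : LipschitzOnWith (2 * L).toNNReal (fun z => w (Srf.proj z)) {z | 4 * K * infDist z Srf.S ≤ 1} := by
    apply LipschitzOnWith.of_dist_le_mul
    intro a ha b hb
    rw [Real.coe_toNNReal _ (by linarith [hL.1]), dist_eq_norm, dist_eq_norm]
    exact hG.comp_lip hL ha hb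
  obtain ⟨W, hW, he⟩ := h1.extend_real
  exact ⟨_, W, hW, fun z hz => (he hz).symm⟩

lemma GeoFacts.ext_fderiv (hG : GeoFacts Srf K ρ) {w W : E3 → ℝ} (hW : Srf.IsExt K w W) {z : E3}
    (hz : 8 * K * infDist z Srf.S < 1) : fderiv ℝ W z = fderiv ℝ (fun y => w (Srf.proj y)) z := by
  apply Filter.EventuallyEq.fderiv_eq
  obtain ⟨r, hr, h⟩ := hG.tube_mem hz
  filter_upwards [ball_mem_nhds z hr] with z' hz'
  exact hW z' (hG.tube4 (h z' hz'))

lemma GeoFacts.ext_diff (hG : GeoFacts Srf K ρ) {w W : E3 → ℝ} (hW : Srf.IsExt K w W) (hw : Srf.Lip w) {y p : E3}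
    (hy : 8 * K * ‖y‖ < 1) (hp : p ∈ Srf.S) (h1 : DifferentiableWithinAt ℝ w Srf.S p)
    (h2 : DifferentiableWithinAt ℝ w Srf.S (Srf.phi y p)) :
    ‖fderiv ℝ W (p + y) - fderiv ℝ W p‖ ≤ ‖Srf.grad (fun x => w (Srf.phi y x) - w x) p‖
      + 6 * K * ‖y‖ * ‖Srf.grad w (Srf.phi y p)‖ := by
  have hK := hG.K_pos
  refine ContinuousLinearMap.opNorm_le_bound _ (by positivity) (fun v => ?_)
  rw [ContinuousLinearMap.sub_apply, hG.ext_fderiv hW (hG.tube_add hp hy), hG.ext_fderiv hW (hG.tube_self hp),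
    ← hG.inner_grad hp w v]
  have e1 := hG.grad_ext hp hy h2 v
  have e2 := hG.grad_phi hp hy h2
  have e3 := hG.grad_sub hp (hG.diff_phi hp hy h2) h1
  have e4 : |⟪Srf.grad w (Srf.phi y p) - Srf.grad (fun z => w (Srf.phi y z)) p, v⟫| ≤
      4 * K * ‖y‖ * ‖Srf.grad w (Srf.phi y p)‖ * ‖v‖ := by
    refine (abs_real_inner_le_norm _ _).trans ?_
    rw [norm_sub_rev]
    gcongr
  have e5 := abs_real_inner_le_norm (Srf.grad (fun x => w (Srf.phi y x) - w x) p) v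
  rw [e3, inner_sub_left] at e5
  rw [inner_sub_left] at e4
  rw [e3, Real.norm_eq_abs]
  rw [abs_le] at e1 e4 e5 ⊢
  constructor <;> nlinarith [e1.1, e1.2, e4.1, e4.2, e5.1, e5.2]

lemma SmoothSurface.int_grad_sq_le (hG : GeoFacts Srf K ρ) {w : E3 → ℝ} (hw : Srf.Lip w) :
    ∫ x, ‖Srf.grad w x‖ ^ 2 ∂Srf.ms ≤ Srf.en w ^ 2 := by
  have e : Srf.en w ^ 2 = ∫ x, Srf.pe w x ^ 2 ∂Srf.ms := by
    rw [Srf.en_sq, Srf.aForm_self]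
  rw [e]
  refine integral_mono (hG.int_sq_grad hw) (hG.int_pe2 hw) (fun x => ?_)
  have := Srf.grad_le_pe w x
  gcongr

lemma GeoFacts.ext_sq (hG : GeoFacts Srf K ρ) {w W : E3 → ℝ} (hW : Srf.IsExt K w W) (hw : Srf.Lip w) {b : ℝ}
    (hb : Sml K ρ b) {y : E3} (hy : ‖y‖ ≤ b) :
    ∫ p, ‖fderiv ℝ W (p + y) - fderiv ℝ W p‖ ^ 2 ∂Srf.ms ≤
      2 * Srf.en (fun x => w (Srf.phi y x) - w x) ^ 2 + 144 * K ^ 2 * b ^ 2 * Srf.en w ^ 2 := by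
  have hK := hG.K_pos
  have h8 := hG.sml8 hb hy
  have hd : Srf.Lip (fun x => w (Srf.phi y x) - w x) := (hG.Lip_phi hw h8).sub hw
  obtain ⟨i1, j1⟩ := hG.int_phi_le hb hy (hG.int_sq_grad hw) (fun x => by positivity)
  have i2 := hG.int_sq_grad hd
  have hle : ∀ᵐ p ∂Srf.ms, ‖fderiv ℝ W (p + y) - fderiv ℝ W p‖ ^ 2 ≤
      2 * ‖Srf.grad (fun x => w (Srf.phi y x) - w x) p‖ ^ 2 + 72 * K ^ 2 * b ^ 2 * ‖Srf.grad w (Srf.phi y p)‖ ^ 2 := by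
    filter_upwards [Srf.ae_mem, hG.ae_diff hw, hG.ae_phi hb hy hw] with p hp h1 h2
    have e := hG.ext_diff hW hw h8 hp h1 h2
    have e2 : 6 * K * ‖y‖ * ‖Srf.grad w (Srf.phi y p)‖ ≤ 6 * K * b * ‖Srf.grad w (Srf.phi y p)‖ := by gcongr
    have e3 := pow_le_pow_left₀ (norm_nonneg _) (e.trans (add_le_add le_rfl e2)) 2
    refine e3.trans ((add_sq_le).trans (le_of_eq ?_))
    ring
  refine (integral_mono_of_nonneg (Filter.Eventually.of_forall (fun p => by positivity))
    ((i2.const_mul 2).add (i1.const_mul (72 * K ^ 2 * b ^ 2))) hle).trans ?_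
  simp only [Pi.add_apply]
  rw [integral_add (i2.const_mul 2) (i1.const_mul (72 * K ^ 2 * b ^ 2)), integral_const_mul, integral_const_mul]
  have k1 := SmoothSurface.int_grad_sq_le hG hd
  have k2 := SmoothSurface.int_grad_sq_le hG hw
  have k3 : 72 * K ^ 2 * b ^ 2 * ∫ x, ‖Srf.grad w (Srf.phi y x)‖ ^ 2 ∂Srf.ms ≤ 72 * K ^ 2 * b ^ 2 * (2 * Srf.en w ^ 2) := by
    have := j1.trans (mul_le_mul_of_nonneg_left k2 (by norm_num : (0 : ℝ) ≤ 2))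
    gcongr
  linarith

lemma GeoFacts.ext_sq0 (hG : GeoFacts Srf K ρ) {w W : E3 → ℝ} (hW : Srf.IsExt K w W) (hw : Srf.Lip w) {b : ℝ}
    (hb : Sml K ρ b) {y : E3} (hy : ‖y‖ ≤ b) :
    ∫ p, |W (p + y) - W p| ^ 2 ∂Srf.ms ≤ 16 * b ^ 2 * Srf.en w ^ 2 := by
  have h8 := hG.sml8 hb hy
  have e : ∫ p, |W (p + y) - W p| ^ 2 ∂Srf.ms = ∫ x, (w (Srf.phi y x) - w x) ^ 2 ∂Srf.ms := by
    apply integral_congr_ae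
    filter_upwards [Srf.ae_mem] with p hp
    rw [hW _ (hG.tube4 (hG.tube_add hp h8)), hW _ (hG.tube4 (hG.tube_self hp)), hG.proj_self hp, sq_abs]
    rfl
  rw [e]
  refine (hG.trans_L2 hb hy hw).trans ?_
  have k2 := SmoothSurface.int_grad_sq_le hG hw
  have : 0 ≤ ∫ x, ‖Srf.grad w x‖ ^ 2 ∂Srf.ms := integral_nonneg (fun x => by positivity)
  gcongr

/-- the local averages controlling the quasi-interpolant -/
def avJ (W : E3 → ℝ) (h : ℝ) (p : E3) : ℝ := (bvol h)⁻¹ * ∫ y in ball (0 : E3) (3 * h), ‖fderiv ℝ W (p + y) - fderiv ℝ W p‖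
def avA (W : E3 → ℝ) (h : ℝ) (p : E3) : ℝ := (bvol h)⁻¹ * ∫ y in ball (0 : E3) (3 * h), |W (p + y) - W p|

lemma GeoFacts.avJ_sq (hG : GeoFacts Srf K ρ) {w W : E3 → ℝ} {L : ℝ≥0} (hL : LipschitzWith L W) (hW : Srf.IsExt K w W)
    (hw : Srf.Lip w) (hh : 0 < h) (hb : Sml K ρ (3 * h)) {X : ℝ} (hX : ∀ y, ‖y‖ ≤ 3 * h → Srf.en (fun x => w (Srf.phi y x) - w x) ≤ X) :
    Integrable (fun p => avJ W h p ^ 2) Srf.ms ∧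
    ∫ p, avJ W h p ^ 2 ∂Srf.ms ≤ 729 * (2 * X ^ 2 + 144 * K ^ 2 * (3 * h) ^ 2 * Srf.en w ^ 2) := by
  have := hG.finite_ms
  refine avg_sq (F := fun p y => ‖fderiv ℝ W (p + y) - fderiv ℝ W p‖) ?_ hh (fun _ _ => norm_nonneg _) (C := L + L)
    (fun p y _ => (norm_sub_le _ _).trans (add_le_add (norm_fderiv_le_of_lipschitz ℝ hL) (norm_fderiv_le_of_lipschitz ℝ hL))) ?_
  · exact (((measurable_fderiv ℝ W).comp (measurable_fst.add measurable_snd)).sub ((measurable_fderiv ℝ W).comp measurable_fst)).norm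
  · intro y hy
    have hy' : ‖y‖ ≤ 3 * h := (mem_ball_zero_iff.1 hy).le
    refine (hG.ext_sq hW hw hb hy').trans ?_
    have := hX y hy'
    have := Srf.en_nonneg (fun x => w (Srf.phi y x) - w x)
    gcongr

lemma GeoFacts.avA_sq (hG : GeoFacts Srf K ρ) {w W : E3 → ℝ} {L : ℝ≥0} (hL : LipschitzWith L W) (hW : Srf.IsExt K w W)
    (hw : Srf.Lip w) (hh : 0 < h) (hb : Sml K ρ (3 * h)) :
    Integrable (fun p => avA W h p ^ 2) Srf.ms ∧
    ∫ p, avA W h p ^ 2 ∂Srf.ms ≤ 729 * (16 * (3 * h) ^ 2 * Srf.en w ^ 2) := by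
  have := hG.finite_ms
  refine avg_sq (F := fun p y => |W (p + y) - W p|) ?_ hh (fun _ _ => abs_nonneg _) (C := L * (3 * h)) ?_ ?_
  · exact ((hL.continuous.measurable.comp (measurable_fst.add measurable_snd)).sub (hL.continuous.measurable.comp measurable_fst)).norm
  · intro p y hy
    have := hL.dist_le_mul (p + y) p
    rw [dist_eq_norm, dist_eq_norm, add_sub_cancel_left] at this
    have h2 : ‖y‖ ≤ 3 * h := (mem_ball_zero_iff.1 hy).le
    refine this.trans ?_
    gcongr
  · intro y hy
    exact hG.ext_sq0 hW hw hb (mem_ball_zero_iff.1 hy).le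

/-- pointwise error of the quasi-interpolant -/
lemma MeshHyp.quasi_pt (M : MeshHyp Srf K ρ γ h m Tr) {w W : E3 → ℝ} {L : ℝ≥0} (hL : LipschitzWith L W) (hW : Srf.IsExt K w W)
    {v : E3 → ℝ} (hv : Tr.IsVh v)
    (hvq : ∀ t ∈ Tr.T, ∀ q ∈ vertsOf t, v q = (bvol h)⁻¹ * bav W h q) {p : E3} (hp : p ∈ Srf.S)
    (hd : DifferentiableWithinAt ℝ (Tr.liftS v) Srf.S p) :
    |Tr.liftS v p - w p| ≤ 2 * h * avJ W h p + avA W h p ∧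
    ‖Srf.grad (Tr.liftS v) p - Srf.grad w p‖ ≤ 4 / γ * avJ W h p + 4 * m * ‖Srf.grad w p‖ := by
  obtain ⟨t, ht, x, hx, rfl⟩ := M.cover hp
  have hh := M.hpos
  have hγ := M.γpos
  have hb := bvol_pos hh
  set p := Srf.proj x with hpdef
  have hlip : ∀ q ∈ vertsOf t, |Tr.liftS v q - (bvol h)⁻¹ * bav W h p - ⟪Srf.grad w p, q - p⟫| ≤ 2 * h * avJ W h p := by
    intro q hq
    have hqS := Tr.verts_on t ht hq
    have e1 : Tr.liftS v q = (bvol h)⁻¹ * bav W h q := by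
      have h1 := M.lift_eq ht (vertsOf_sub t hq) v
      rw [M.geo.proj_self hqS] at h1
      rw [h1, hvq t ht q hq]
    have h2 := bav_mvt hL hh p q (M.vert_near ht hx (vertsOf_sub t hq)) (fderiv ℝ W p)
    have e2 : fderiv ℝ W p (q - p) = ⟪Srf.grad w p, q - p⟫ := by
      rw [M.geo.inner_grad hp, M.geo.ext_fderiv hW (M.geo.tube_self hp)]
    rw [e2] at h2
    have e3 : Tr.liftS v q - (bvol h)⁻¹ * bav W h p - ⟪Srf.grad w p, q - p⟫ =
        (bvol h)⁻¹ * (bav W h q - bav W h p - bvol h * ⟪Srf.grad w p, q - p⟫) := by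
      rw [e1]; field_simp
    rw [e3, abs_mul, abs_of_pos (inv_pos.2 hb)]
    unfold avJ
    calc _ ≤ (bvol h)⁻¹ * ((∫ y in ball (0 : E3) (3 * h), ‖fderiv ℝ W (p + y) - fderiv ℝ W p‖) * (2 * h)) := by gcongr
      _ = _ := by ring
  obtain ⟨r1, r2⟩ := M.interp_pt ht hx hv hd (M.grad_n x w) hlip
  have h3 := bav_sub hL hh p (W p)
  have e4 : W p = w p := by rw [hW _ (M.geo.tube4 (M.geo.tube_self hp)), M.geo.proj_self hp]
  have h4 : |(bvol h)⁻¹ * bav W h p - w p| ≤ avA W h p := by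
    have e5 : (bvol h)⁻¹ * bav W h p - w p = (bvol h)⁻¹ * (bav W h p - bvol h * W p) := by rw [e4]; field_simp
    rw [e5, abs_mul, abs_of_pos (inv_pos.2 hb)]
    unfold avA
    gcongr
  constructor
  · have := abs_add_le (Tr.liftS v p - (bvol h)⁻¹ * bav W h p) ((bvol h)⁻¹ * bav W h p - w p)
    rw [sub_add_sub_cancel] at this
    linarith
  · refine r2.trans (le_of_eq ?_)
    field_simp
    ring

lemma quasi_arith {a b J A g h γ m : ℝ} (ha0 : 0 ≤ a) (hb0 : 0 ≤ b) (h1 : a ≤ 2 * h * J + A)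
    (h2 : b ≤ 4 / γ * J + 4 * m * g) : b ^ 2 + a ^ 2 ≤ (32 / γ ^ 2 + 8 * h ^ 2) * J ^ 2 + 32 * m ^ 2 * g ^ 2 + 2 * A ^ 2 := by
  have e1 := (pow_le_pow_left₀ ha0 h1 2).trans add_sq_le
  have e2 := (pow_le_pow_left₀ hb0 h2 2).trans add_sq_le
  have e3 : 2 * ((4 / γ * J) ^ 2 + (4 * m * g) ^ 2) = 32 / γ ^ 2 * J ^ 2 + 32 * m ^ 2 * g ^ 2 := by ring
  nlinarith

def quasiC (K γ C₁ : ℝ) : ℝ := √(729 * ((32 / γ ^ 2 + 8) * (2 * C₁ ^ 2 + 5184 * K ^ 2) + 1152) + 128 * K ^ 2 / γ ^ 2)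

lemma quasi_arith2 {K γ C₁ h N X e m IJ IA Ig : ℝ} (hγ : 0 < γ) (hh : 0 < h) (h1 : h ≤ 1) (he0 : 0 ≤ e) (he : e ≤ 2 * N) (hX : X = C₁ * h * N)
    (hm : m = K * h / γ)
    (hJ : IJ ≤ 729 * (2 * X ^ 2 + 144 * K ^ 2 * (3 * h) ^ 2 * e ^ 2)) (hA : IA ≤ 729 * (16 * (3 * h) ^ 2 * e ^ 2))
    (hg : Ig ≤ e ^ 2) :
    (32 / γ ^ 2 + 8 * h ^ 2) * IJ + 32 * m ^ 2 * Ig + 2 * IA ≤ (quasiC K γ C₁ * h * N) ^ 2 := by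
  have hs : quasiC K γ C₁ ^ 2 = 729 * ((32 / γ ^ 2 + 8) * (2 * C₁ ^ 2 + 5184 * K ^ 2) + 1152) + 128 * K ^ 2 / γ ^ 2 :=
    Real.sq_sqrt (by positivity)
  have he2 : e ^ 2 ≤ 4 * N ^ 2 := by nlinarith
  have hh2 : h ^ 2 ≤ 1 := by nlinarith
  have k1 : IJ ≤ 729 * (2 * C₁ ^ 2 + 5184 * K ^ 2) * (h ^ 2 * N ^ 2) := by
    have : 729 * (144 * K ^ 2 * (3 * h) ^ 2) * e ^ 2 ≤ 729 * (144 * K ^ 2 * (3 * h) ^ 2) * (4 * N ^ 2) := by gcongr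
    rw [hX] at hJ
    nlinarith
  have k2 : IA ≤ 729 * 576 * (h ^ 2 * N ^ 2) := by
    have : 729 * (16 * (3 * h) ^ 2) * e ^ 2 ≤ 729 * (16 * (3 * h) ^ 2) * (4 * N ^ 2) := by gcongr
    nlinarith
  have k3 : 32 * m ^ 2 * Ig ≤ 128 * K ^ 2 / γ ^ 2 * (h ^ 2 * N ^ 2) := by
    have : 32 * m ^ 2 * Ig ≤ 32 * m ^ 2 * (4 * N ^ 2) := by gcongr; linarith
    refine this.trans (le_of_eq ?_)
    rw [hm]; field_simp; ring
  have k4 : (32 / γ ^ 2 + 8 * h ^ 2) * IJ ≤ (32 / γ ^ 2 + 8) * (729 * (2 * C₁ ^ 2 + 5184 * K ^ 2) * (h ^ 2 * N ^ 2)) := by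
    calc _ ≤ (32 / γ ^ 2 + 8 * h ^ 2) * (729 * (2 * C₁ ^ 2 + 5184 * K ^ 2) * (h ^ 2 * N ^ 2)) := by gcongr
      _ ≤ (32 / γ ^ 2 + 8 * 1) * (729 * (2 * C₁ ^ 2 + 5184 * K ^ 2) * (h ^ 2 * N ^ 2)) := by gcongr
      _ = _ := by ring
  rw [mul_pow, mul_pow, hs]
  nlinarith

lemma MeshHyp.quasi (M : MeshHyp Srf K ρ γ h m Tr) (hb : Sml K ρ (3 * h)) {w : E3 → ℝ} (hw : Srf.Lip w) {N C₁ : ℝ}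
    (hN0 : 0 ≤ N) (hN : Srf.en w ≤ 2 * N) (hC : ∀ y, ‖y‖ ≤ 3 * h → Srf.en (fun x => w (Srf.phi y x) - w x) ≤ C₁ * h * N) :
    ∃ v, Tr.IsVh v ∧ Srf.en (fun x => Tr.liftS v x - w x) ≤ quasiC K γ C₁ * h * N := by
  have hG := M.geo
  have hh := M.hpos
  obtain ⟨L, W, hL, hW⟩ := hG.exists_ext hw
  obtain ⟨v, hv, hvq⟩ := Tr.exists_interp (fun q => (bvol h)⁻¹ * bav W h q)
  refine ⟨v, hv, ?_⟩
  have hV := M.Lip_lift hv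
  obtain ⟨iJ, jJ⟩ := hG.avJ_sq hL hW hw hh hb hC
  obtain ⟨iA, jA⟩ := hG.avA_sq hL hW hw hh hb
  have ig := hG.int_sq_grad hw
  have h1 : h ≤ 1 := M.hρ.trans hG.ρ_le
  have hq0 : 0 ≤ quasiC K γ C₁ * h * N := by
    have : 0 ≤ quasiC K γ C₁ := Real.sqrt_nonneg _
    positivity
  refine le_of_sq_le_sq ?_ hq0
  have hle : Srf.en (fun x => Tr.liftS v x - w x) ^ 2 ≤ ∫ p, ((32 / γ ^ 2 + 8 * h ^ 2) * avJ W h p ^ 2 +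
      32 * m ^ 2 * ‖Srf.grad w p‖ ^ 2 + 2 * avA W h p ^ 2) ∂Srf.ms := by
    rw [Srf.en_sq, Srf.aForm_self]
    refine integral_mono_of_nonneg (Filter.Eventually.of_forall (fun p => by positivity))
      (((iJ.const_mul _).add (ig.const_mul _)).add (iA.const_mul _)) ?_
    filter_upwards [Srf.ae_mem, hG.ae_diff hw, hG.ae_diff hV] with p hp d1 d2
    obtain ⟨r1, r2⟩ := M.quasi_pt hL hW hv hvq hp d2
    simp only [Srf.pe_sq]
    rw [hG.grad_sub hp d2 d1, ← sq_abs (Tr.liftS v p - w p)]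
    exact quasi_arith (abs_nonneg _) (norm_nonneg _) r1 r2
  refine hle.trans ?_
  have i12 : Integrable (fun p => (32 / γ ^ 2 + 8 * h ^ 2) * avJ W h p ^ 2 + 32 * m ^ 2 * ‖Srf.grad w p‖ ^ 2) Srf.ms :=
    (iJ.const_mul _).add (ig.const_mul _)
  rw [integral_add i12 (iA.const_mul _), integral_add (iJ.const_mul _) (ig.const_mul _),
    integral_const_mul, integral_const_mul, integral_const_mul]
  exact quasi_arith2 M.γpos hh h1 (Srf.en_nonneg _) hN rfl M.m_eq jJ jA (SmoothSurface.int_grad_sq_le hG hw)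

end

section
variable {Srf : SmoothSurface} {K ρ : ℝ}

/-! regularized logarithm in `E3` -/

def aq (P : E3 →L[ℝ] E3) (z₀ : E3) (η : ℝ) (x : E3) : ℝ := ‖P (x - z₀)‖ ^ 2 + η ^ 2
def glg (P : E3 →L[ℝ] E3) (z₀ : E3) (η : ℝ) (x : E3) : ℝ := 1 / 2 * Real.log (aq P z₀ η x)
def glD (P : E3 →L[ℝ] E3) (z₀ : E3) (η : ℝ) (x : E3) : E3 →L[ℝ] ℝ :=
  (aq P z₀ η x)⁻¹ • (innerSL ℝ (P (x - z₀))).comp P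

lemma glD_apply (P : E3 →L[ℝ] E3) (z₀ : E3) (η : ℝ) (x v : E3) :
    glD P z₀ η x v = (aq P z₀ η x)⁻¹ * ⟪P (x - z₀), P v⟫ := by
  rfl

lemma aq_nonneg (P : E3 →L[ℝ] E3) (z₀ : E3) (η : ℝ) (x : E3) : 0 ≤ aq P z₀ η x := by unfold aq; positivity

lemma hasFDerivAt_glg (P : E3 →L[ℝ] E3) (z₀ : E3) (η : ℝ) (x : E3) (h : aq P z₀ η x ≠ 0) :
    HasFDerivAt (glg P z₀ η) (glD P z₀ η x) x := by
  have h1 : HasFDerivAt (fun x => P (x - z₀)) P x := P.hasFDerivAt.comp x ((hasFDerivAt_id x).sub_const z₀)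
  have h2 := ((h1.norm_sq.add_const (η ^ 2)).log h).const_mul (1 / 2)
  refine h2.congr_fderiv ?_
  ext v
  simp [glD, aq]
  ring

lemma glD_norm {P : E3 →L[ℝ] E3} (hP : ∀ v, ‖P v‖ ≤ ‖v‖) (z₀ : E3) (η : ℝ) (x : E3) :
    ‖glD P z₀ η x‖ ≤ (√(aq P z₀ η x))⁻¹ := by
  refine ContinuousLinearMap.opNorm_le_bound _ (by positivity) (fun v => ?_)
  rw [glD_apply, norm_mul, norm_inv, Real.norm_of_nonneg (aq_nonneg _ _ _ _)]
  have h1 : ‖⟪P (x - z₀), P v⟫‖ ≤ ‖P (x - z₀)‖ * ‖v‖ := (norm_inner_le_norm _ _).trans (by gcongr; exact hP v)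
  have h2 : ‖P (x - z₀)‖ ≤ √(aq P z₀ η x) := Real.le_sqrt_of_sq_le (by unfold aq; nlinarith [sq_nonneg η])
  rcases (aq_nonneg P z₀ η x).eq_or_lt with h0 | h0
  · rw [← h0]; simp
  have h3 : 0 < √(aq P z₀ η x) := Real.sqrt_pos.2 h0
  calc _ ≤ (aq P z₀ η x)⁻¹ * (√(aq P z₀ η x) * ‖v‖) := by gcongr; exact h1.trans (by gcongr)
    _ = _ := by
      nth_rewrite 1 [← Real.sq_sqrt h0.le]
      field_simp

lemma log_lin {s : ℝ} (h : |s| ≤ 1 / 2) : |Real.log (1 + s) - s| ≤ 2 * s ^ 2 := by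
  rw [abs_le] at h
  have hp : 0 < 1 + s := by linarith
  have h1 := Real.log_le_sub_one_of_pos hp
  have h2 := Real.one_sub_inv_le_log_of_pos hp
  have h3 : 1 - (1 + s)⁻¹ = s - s ^ 2 / (1 + s) := by field_simp; ring
  have h4 : s ^ 2 / (1 + s) ≤ 2 * s ^ 2 := by
    rw [div_le_iff₀ hp]; nlinarith [sq_nonneg s]
  rw [abs_le]; constructor <;> nlinarith [sq_nonneg s]

/-- the real-variable heart of the Taylor estimate -/
lemma taylor_arith {a i n q h : ℝ} (hh : 0 < h) (ha : 256 * h ^ 2 ≤ a) (hq : q = √a) (hi : |i| ≤ q * n) (hn0 : 0 ≤ n) (hn : n ≤ 2 * h) :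
    |1 / 2 * Real.log (a + 2 * i + n ^ 2) - 1 / 2 * Real.log a - a⁻¹ * i| ≤ 30 * h ^ 2 / a ∧
    |1 / 2 * Real.log (a + 2 * i + n ^ 2) - 1 / 2 * Real.log a| ≤ 6 * h / q := by
  have ha0 : 0 < a := by nlinarith
  have hq0 : 0 < q := hq ▸ Real.sqrt_pos.2 ha0
  have hqa : q ^ 2 = a := by rw [hq, Real.sq_sqrt ha0.le]
  have hqh : 16 * h ≤ q := by rw [hq]; apply Real.le_sqrt_of_sq_le; nlinarith
  obtain ⟨s, hs⟩ : ∃ s, s = (2 * i + n ^ 2) / a := ⟨_, rfl⟩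
  have hi2 : |i| ≤ 2 * h * q := by nlinarith
  have hsb : |s| ≤ 5 * h / q := by
    rw [hs, abs_div, abs_of_pos ha0, div_le_div_iff₀ ha0 hq0]
    have h1 : |2 * i + n ^ 2| ≤ 4 * h * q + 4 * h ^ 2 := by
      rw [abs_le] at hi2 ⊢
      constructor <;> nlinarith
    have h2 : |2 * i + n ^ 2| ≤ 5 * h * q := by nlinarith
    rw [← hqa]
    nlinarith
  have hs2 : |s| ≤ 1 / 2 := by
    refine hsb.trans ?_
    rw [div_le_iff₀ hq0]; linarith
  have hl := log_lin hs2
  have e : a + 2 * i + n ^ 2 = a * (1 + s) := by rw [hs]; field_simp; ring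
  have hp : 0 < 1 + s := by rw [abs_le] at hs2; linarith
  rw [e, Real.log_mul ha0.ne' hp.ne']
  have hss : s ^ 2 ≤ 25 * h ^ 2 / a := by
    rw [← sq_abs]
    refine (pow_le_pow_left₀ (abs_nonneg _) hsb 2).trans (le_of_eq ?_)
    rw [div_pow, hqa]; ring
  have hna : n ^ 2 / a ≤ 4 * h ^ 2 / a := by gcongr; nlinarith
  have hna0 : 0 ≤ n ^ 2 / a := by positivity
  have ei : a⁻¹ * i = s / 2 - n ^ 2 / a / 2 := by rw [hs]; field_simp; ring
  have e25 : 30 * h ^ 2 / a = 25 * h ^ 2 / a + 5 / 4 * (4 * h ^ 2 / a) := by ring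
  constructor
  · rw [ei, e25, abs_le]
    rw [abs_le] at hl
    constructor <;> nlinarith
  · have h4 : s ^ 2 ≤ 1 / 2 * (5 * h / q) := by
      rw [← sq_abs, sq]
      gcongr
    have e6 : 6 * h / q = 6 / 5 * (5 * h / q) := by ring
    rw [abs_le] at hl hsb
    rw [e6, abs_le]
    constructor <;> nlinarith

lemma aq_add (P : E3 →L[ℝ] E3) (z₀ : E3) (η : ℝ) (x d : E3) :
    aq P z₀ η (x + d) = aq P z₀ η x + 2 * ⟪P (x - z₀), P d⟫ + ‖P d‖ ^ 2 := by
  unfold aq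
  have : P (x + d - z₀) = P (x - z₀) + P d := by rw [← map_add]; congr 1; abel
  rw [this, norm_add_sq_real]; ring

lemma glg_taylor {P : E3 →L[ℝ] E3} (hP : ∀ v, ‖P v‖ ≤ ‖v‖) (z₀ : E3) {η h : ℝ} (hh : 0 < h) (hη : 16 * h ≤ η) (x d : E3)
    (hd : ‖d‖ ≤ 2 * h) :
    |glg P z₀ η (x + d) - glg P z₀ η x - glD P z₀ η x d| ≤ 30 * h ^ 2 / aq P z₀ η x ∧
    |glg P z₀ η (x + d) - glg P z₀ η x| ≤ 6 * h / √(aq P z₀ η x) := by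
  have h2 : ‖P (x - z₀)‖ ≤ √(aq P z₀ η x) := Real.le_sqrt_of_sq_le (by unfold aq; nlinarith [sq_nonneg η])
  rw [glD_apply]
  unfold glg
  rw [aq_add]
  refine taylor_arith hh ?_ rfl ?_ (norm_nonneg _) ((hP d).trans hd)
  · unfold aq; nlinarith [sq_nonneg (‖P (x - z₀)‖)]
  · exact (abs_real_inner_le_norm _ _).trans (by gcongr)

lemma log_sqrt_le {a b : ℝ} (ha : 0 < a) (hab : a ≤ b) : 1 / 2 * Real.log b - 1 / 2 * Real.log a ≤ (b - a) / (√a * √b) := by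
  have hb : 0 < b := by linarith
  have hsa := Real.sqrt_pos.2 ha
  have hsb := Real.sqrt_pos.2 hb
  have h1 : 1 / 2 * Real.log b - 1 / 2 * Real.log a = Real.log (√b / √a) := by
    rw [Real.log_div hsb.ne' hsa.ne', Real.log_sqrt hb.le, Real.log_sqrt ha.le]; ring
  rw [h1]
  have h2 := Real.log_le_sub_one_of_pos (div_pos hsb hsa)
  refine h2.trans ?_
  have h3 : √a ≤ √b := Real.sqrt_le_sqrt hab
  have e : (b - a) / (√a * √b) = (√b - √a) * (√b + √a) / (√a * √b) := by
    congr 1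
    have := Real.sq_sqrt ha.le
    have := Real.sq_sqrt hb.le
    nlinarith
  rw [e, div_sub_one hsa.ne', div_le_div_iff₀ hsa (by positivity)]
  have h4 : 0 ≤ √b - √a := by linarith
  have : 0 ≤ (√b - √a) * √a * √a := by positivity
  nlinarith

lemma glg_diff (P : E3 →L[ℝ] E3) (z₀ : E3) {δ η : ℝ} (hδ : 0 ≤ δ) (hη : δ ≤ η) (x : E3) (ha : 0 < aq P z₀ δ x) :
    |glg P z₀ η x - glg P z₀ δ x| ≤ η ^ 2 / (√(aq P z₀ δ x) * √(aq P z₀ η x)) := by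
  have hle : aq P z₀ δ x ≤ aq P z₀ η x := by unfold aq; nlinarith
  have h1 := log_sqrt_le ha hle
  have h2 := Real.log_le_log ha hle
  unfold glg
  rw [abs_of_nonneg (by linarith)]
  refine h1.trans ?_
  gcongr
  unfold aq; nlinarith

lemma glD_diff {P : E3 →L[ℝ] E3} (hP : ∀ v, ‖P v‖ ≤ ‖v‖) (z₀ : E3) {δ η : ℝ} (hδ : 0 ≤ δ) (hη : δ ≤ η) (x : E3) (ha : 0 < aq P z₀ δ x) :
    ‖glD P z₀ η x - glD P z₀ δ x‖ ≤ η ^ 2 / (√(aq P z₀ δ x) * aq P z₀ η x) := by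
  have hle : aq P z₀ δ x ≤ aq P z₀ η x := by unfold aq; nlinarith
  have hb : 0 < aq P z₀ η x := by linarith
  have hsa := Real.sqrt_pos.2 ha
  refine ContinuousLinearMap.opNorm_le_bound _ (by positivity) (fun v => ?_)
  rw [ContinuousLinearMap.sub_apply, glD_apply, glD_apply, ← sub_mul, norm_mul]
  have h1 : ‖⟪P (x - z₀), P v⟫‖ ≤ ‖P (x - z₀)‖ * ‖v‖ := (norm_inner_le_norm _ _).trans (by gcongr; exact hP v)
  have h2 : ‖P (x - z₀)‖ ≤ √(aq P z₀ δ x) := Real.le_sqrt_of_sq_le (by unfold aq; nlinarith [sq_nonneg δ])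
  have h3 : ‖(aq P z₀ η x)⁻¹ - (aq P z₀ δ x)⁻¹‖ ≤ η ^ 2 / (aq P z₀ δ x * aq P z₀ η x) := by
    rw [norm_sub_rev, inv_sub_inv ha.ne' hb.ne', Real.norm_of_nonneg (by apply div_nonneg <;> nlinarith)]
    gcongr
    unfold aq; nlinarith
  calc _ ≤ η ^ 2 / (aq P z₀ δ x * aq P z₀ η x) * (√(aq P z₀ δ x) * ‖v‖) := by gcongr; exact h1.trans (by gcongr)
    _ = _ := by
      nth_rewrite 1 [← Real.sq_sqrt ha.le]
      field_simp

lemma abs_log_le_inv {a B : ℝ} (ha : 0 < a) (hB : a ≤ B) : |Real.log a| ≤ (B ^ 2 + 1) / a := by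
  have h1 := Real.log_le_sub_one_of_pos ha
  have h2 := Real.one_sub_inv_le_log_of_pos ha
  have h3 : a ≤ B ^ 2 / a := by rw [le_div_iff₀ ha]; nlinarith
  have h4 : (B ^ 2 + 1) / a = B ^ 2 / a + a⁻¹ := by rw [add_div, one_div]
  have h5 := inv_pos.2 ha
  have h6 : 0 ≤ B ^ 2 / a := by positivity
  rw [h4, abs_le]; constructor <;> linarith

lemma abs_half_log_le {a B : ℝ} (ha : 0 < a) (hB : √a ≤ B) : |1 / 2 * Real.log a| ≤ (B ^ 2 + 1) / √a := by
  have := abs_log_le_inv (Real.sqrt_pos.2 ha) hB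
  rwa [Real.log_sqrt ha.le, div_eq_mul_one_div, mul_comm] at this

end

section
variable {Srf : SmoothSurface} {K ρ : ℝ}

lemma SmoothSurface.P0_eq (Srf : SmoothSurface) (z₀ x : E3) : Srf.P0 z₀ x = z₀ + Srf.Pt z₀ (x - z₀) := by
  unfold SmoothSurface.P0 SmoothSurface.Pt
  rw [Submodule.starProjection_apply]

lemma SmoothSurface.rfn_eq (Srf : SmoothSurface) (z₀ x : E3) : Srf.rfn z₀ x = ‖Srf.Pt z₀ (x - z₀)‖ := by
  unfold SmoothSurface.rfn
  rw [Srf.P0_eq, add_sub_cancel_left]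

lemma GeoFacts.exists_rc (hG : GeoFacts Srf K ρ) {r₁ : ℝ} (hr : Srf.IsGraphRadius r₁) :
    ∃ c > 0, c ≤ 1 ∧ ∀ z ∈ Srf.S, ∀ x ∈ Srf.S, ‖x - z‖ ≤ 2 * r₁ → c * ‖x - z‖ ≤ ‖Srf.Pt z (x - z)‖ := by
  have hK := hG.K_pos
  obtain ⟨hr0, hr1, hinj⟩ := hr
  have near : ∀ z ∈ Srf.S, ∀ x ∈ Srf.S, 2 * K * ‖x - z‖ ≤ 1 → 1 / 2 * ‖x - z‖ ≤ ‖Srf.Pt z (x - z)‖ := by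
    intro z hz x hx h
    have h1 := hG.quad z hz x hx
    have h2 := Srf.sub_Pt_norm hz (x - z)
    have h3 := norm_sub_norm_le (x - z) (Srf.Pt z (x - z))
    rw [h2] at h3
    nlinarith [norm_nonneg (x - z)]
  set C : Set (E3 × E3) := (Srf.S ×ˢ Srf.S) ∩ {q | 1 ≤ 2 * K * ‖q.2 - q.1‖ ∧ ‖q.2 - q.1‖ ≤ 2 * r₁} with hC
  have hCc : IsCompact C := by
    refine (Srf.compact.prod Srf.compact).inter_right ?_
    have c1 : Continuous (fun q : E3 × E3 => ‖q.2 - q.1‖) := (continuous_snd.sub continuous_fst).norm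
    exact (isClosed_le continuous_const (continuous_const.mul c1)).inter (isClosed_le c1 continuous_const)
  have hn : ContinuousOn Srf.n Srf.S := by
    have : LipschitzOnWith K.toNNReal Srf.n Srf.S := by
      apply LipschitzOnWith.of_dist_le_mul
      intro a ha b hb
      rw [Real.coe_toNNReal _ hK.le, dist_eq_norm, dist_eq_norm]
      exact hG.lip a ha b hb
    exact this.continuousOn
  have hn1 : ContinuousOn (fun q : E3 × E3 => Srf.n q.1) C :=
    hn.comp continuous_fst.continuousOn (fun q hq => hq.1.1)
  have hf : ContinuousOn (fun q : E3 × E3 => ‖Srf.Pt q.1 (q.2 - q.1)‖) C := by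
    have h1 : ContinuousOn (fun q : E3 × E3 => q.2 - q.1) C := by fun_prop
    exact ContinuousOn.norm (ContinuousOn.congr (h1.sub ((hn1.inner (𝕜 := ℝ) h1).smul hn1)) (fun q hq => Srf.Pt_apply hq.1.1 _))
  rcases C.eq_empty_or_nonempty with h0 | h0
  · refine ⟨1 / 2, by norm_num, by norm_num, fun z hz x hx hxz => near z hz x hx ?_⟩
    by_contra hcon
    push Not at hcon
    have : (z, x) ∈ C := ⟨⟨hz, hx⟩, hcon.le, hxz⟩
    rw [h0] at this
    exact this
  · obtain ⟨q, hq, hmin⟩ := hCc.exists_isMinOn h0 hf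
    have hpos : 0 < ‖Srf.Pt q.1 (q.2 - q.1)‖ := by
      rw [norm_pos_iff]
      intro h
      have h1 := hinj q.1 hq.1.1 (x₁ := q.2) ⟨hq.1.2, by rw [mem_closedBall, dist_eq_norm]; exact hq.2.2⟩
        (x₂ := q.1) ⟨hq.1.1, mem_closedBall_self (by positivity)⟩ (by
          rw [Srf.P0_eq, Srf.P0_eq, h]; simp)
      have h2 := hq.2.1
      rw [h1] at h2
      norm_num at h2
    refine ⟨min (1 / 2) (‖Srf.Pt q.1 (q.2 - q.1)‖ / 2), lt_min (by norm_num) (by positivity),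
      (min_le_left _ _).trans (by norm_num), fun z hz x hx hxz => ?_⟩
    by_cases hcon : 2 * K * ‖x - z‖ ≤ 1
    · refine le_trans ?_ (near z hz x hx hcon)
      gcongr
      exact min_le_left _ _
    · push Not at hcon
      have h2 := hmin (show (z, x) ∈ C from ⟨⟨hz, hx⟩, hcon.le, hxz⟩)
      simp only [Set.mem_setOf_eq] at h2
      refine le_trans ?_ h2
      calc _ ≤ ‖Srf.Pt q.1 (q.2 - q.1)‖ / 2 * 2 := by
            gcongr
            · exact min_le_right _ _
            · linarith
        _ = _ := by ring

lemma GeoFacts.grad_of_fderiv (hG : GeoFacts Srf K ρ) {x : E3} (hx : x ∈ Srf.S) {F : E3 → ℝ} {F' : E3 →L[ℝ] ℝ}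
    (hF : HasFDerivAt F F' x) (v : E3) : ⟪Srf.grad F x, v⟫ = F' (Srf.Pt x v) := by
  rw [hG.inner_grad hx]
  have h1 := hG.hasFDerivAt_proj_self hx
  have h2 : HasFDerivAt F F' (Srf.proj x) := by rw [hG.proj_self hx]; exact hF
  have h3 : HasFDerivAt (fun y => F (Srf.proj y)) (F'.comp (Srf.Pt x)) x := h2.comp x h1
  rw [h3.fderiv]; rfl

lemma GeoFacts.grad_norm_le (hG : GeoFacts Srf K ρ) {x : E3} (hx : x ∈ Srf.S) {F : E3 → ℝ} {F' : E3 →L[ℝ] ℝ}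
    (hF : HasFDerivAt F F' x) : ‖Srf.grad F x‖ ≤ ‖F'‖ := by
  have h1 := hG.grad_of_fderiv hx hF (Srf.grad F x)
  rw [real_inner_self_eq_norm_sq] at h1
  have h2 : F' (Srf.Pt x (Srf.grad F x)) ≤ ‖F'‖ * ‖Srf.grad F x‖ := by
    refine (le_abs_self _).trans ((F'.le_opNorm _).trans ?_)
    gcongr
    exact Srf.Pt_norm_le _ _
  by_contra hcon
  push Not at hcon
  have : 0 < ‖Srf.grad F x‖ := (norm_nonneg _).trans_lt hcon
  nlinarith

lemma Lip_of_contDiff (Srf : SmoothSurface) {F : E3 → ℝ} (hF : ContDiff ℝ 1 F) : Srf.Lip F := by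
  obtain ⟨R, hR⟩ := Srf.compact.isBounded.subset_closedBall (0 : E3)
  obtain ⟨C, hC⟩ := (isCompact_closedBall (0 : E3) R).exists_bound_of_continuousOn
    (hF.continuous_fderiv one_ne_zero).continuousOn
  refine ⟨max C 0, le_max_right _ _, fun x hx y hy => ?_⟩
  exact (convex_closedBall (0 : E3) R).norm_image_sub_le_of_norm_fderiv_le
    (fun z _ => (hF.differentiable one_ne_zero) z) (fun z hz => (hC z hz).trans (le_max_left _ _)) (hR hy) (hR hx)

end

section
variable {Srf : SmoothSurface} {K ρ : ℝ}

/-- standing hypotheses for the cut-off logarithm -/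
structure LogHyp (Srf : SmoothSurface) (K ρ r₁ c Z : ℝ) (z₀ : E3) (ζ : E3 → ℝ) : Prop where
  geo : GeoFacts Srf K ρ
  hz : z₀ ∈ Srf.S
  r0 : 0 < r₁
  r1 : r₁ ≤ 1
  c0 : 0 < c
  c1 : c ≤ 1
  rc : ∀ x ∈ Srf.S, ‖x - z₀‖ ≤ 2 * r₁ → c * ‖x - z₀‖ ≤ ‖Srf.Pt z₀ (x - z₀)‖
  cut : IsCutoff z₀ r₁ Z ζ

/-- regularized cut-off logarithm -/
def SmoothSurface.lam (Srf : SmoothSurface) (z₀ : E3) (ζ : E3 → ℝ) (η : ℝ) (x : E3) : ℝ := ζ x * glg (Srf.Pt z₀) z₀ η x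

lemma cutLog_eq (Srf : SmoothSurface) (z₀ : E3) (ζ : E3 → ℝ) : cutLog Srf z₀ ζ = Srf.lam z₀ ζ 0 := by
  funext x
  unfold cutLog SmoothSurface.lam glg aq
  rw [Srf.rfn_eq]
  simp [Real.log_pow]

def SmoothSurface.lamD (Srf : SmoothSurface) (z₀ : E3) (ζ : E3 → ℝ) (η : ℝ) (x : E3) : E3 →L[ℝ] ℝ :=
  ζ x • glD (Srf.Pt z₀) z₀ η x + glg (Srf.Pt z₀) z₀ η x • fderiv ℝ ζ x

namespace LogHyp
variable {r₁ c Z : ℝ} {z₀ : E3} {ζ : E3 → ℝ}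

lemma diffζ (H : LogHyp Srf K ρ r₁ c Z z₀ ζ) : Differentiable ℝ ζ := H.cut.1.differentiable (by simp)

lemma ζ_le (H : LogHyp Srf K ρ r₁ c Z z₀ ζ) (x : E3) : |ζ x| ≤ Z := by
  have := H.cut.2.2.2 x
  linarith [norm_nonneg (fderiv ℝ ζ x), norm_nonneg (fderiv ℝ (fderiv ℝ ζ) x)]

lemma dζ_le (H : LogHyp Srf K ρ r₁ c Z z₀ ζ) (x : E3) : ‖fderiv ℝ ζ x‖ ≤ Z := by
  have := H.cut.2.2.2 x
  linarith [abs_nonneg (ζ x), norm_nonneg (fderiv ℝ (fderiv ℝ ζ) x)]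

lemma Z_ge (H : LogHyp Srf K ρ r₁ c Z z₀ ζ) : 1 ≤ Z := by
  have := H.ζ_le z₀
  rw [H.cut.2.2.1 z₀ (mem_closedBall_self H.r0.le)] at this
  simpa using this

lemma ζ_lip (H : LogHyp Srf K ρ r₁ c Z z₀ ζ) (x d : E3) : |ζ (x + d) - ζ x| ≤ Z * ‖d‖ := by
  have := convex_univ.norm_image_sub_le_of_norm_fderiv_le (f := ζ) (fun z _ => H.diffζ z) (fun z _ => H.dζ_le z)
    (Set.mem_univ x) (Set.mem_univ (x + d))
  rwa [add_sub_cancel_left] at this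

lemma ζ_taylor (H : LogHyp Srf K ρ r₁ c Z z₀ ζ) (x d : E3) : |ζ (x + d) - ζ x - fderiv ℝ ζ x d| ≤ Z * ‖d‖ ^ 2 := by
  have hZ := H.Z_ge
  have h1 : ContDiff ℝ 1 (fderiv ℝ ζ) := H.cut.1.fderiv_right (by norm_cast)
  have h2 : ∀ z, ‖fderiv ℝ (fderiv ℝ ζ) z‖ ≤ Z := by
    intro z
    have := H.cut.2.2.2 z
    linarith [abs_nonneg (ζ z), norm_nonneg (fderiv ℝ ζ z)]
  have h3 : ∀ z ∈ closedBall x ‖d‖, ‖fderiv ℝ ζ z - fderiv ℝ ζ x‖ ≤ Z * ‖d‖ := by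
    intro z hz
    have := convex_univ.norm_image_sub_le_of_norm_fderiv_le (f := fderiv ℝ ζ) (fun z _ => (h1.differentiable one_ne_zero) z)
      (fun z _ => h2 z) (Set.mem_univ x) (Set.mem_univ z)
    refine this.trans ?_
    rw [mem_closedBall, dist_eq_norm] at hz
    gcongr
  have h4 := (convex_closedBall x ‖d‖).norm_image_sub_le_of_norm_hasFDerivWithin_le'
    (f := ζ) (f' := fderiv ℝ ζ) (φ := fderiv ℝ ζ x) (fun z _ => (H.diffζ z).hasFDerivAt.hasFDerivWithinAt) h3
    (mem_closedBall_self (norm_nonneg _)) (show x + d ∈ closedBall x ‖d‖ by simp [mem_closedBall, dist_eq_norm])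
  rw [add_sub_cancel_left] at h4
  refine h4.trans (le_of_eq ?_)
  ring

lemma ζ_far (H : LogHyp Srf K ρ r₁ c Z z₀ ζ) {x : E3} (hx : 3 / 2 * r₁ < ‖x - z₀‖) : ζ =ᶠ[nhds x] 0 := by
  rw [← notMem_tsupport_iff_eventuallyEq]
  intro h
  have := H.cut.2.1 h
  rw [mem_closedBall, dist_eq_norm] at this
  linarith

lemma lam_far (H : LogHyp Srf K ρ r₁ c Z z₀ ζ) {x : E3} (hx : 3 / 2 * r₁ < ‖x - z₀‖) (η : ℝ) :
    Srf.lam z₀ ζ η x = 0 ∧ HasFDerivAt (Srf.lam z₀ ζ η) (0 : E3 →L[ℝ] ℝ) x := by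
  have h1 := H.ζ_far hx
  have h2 : Srf.lam z₀ ζ η =ᶠ[nhds x] fun _ => 0 := by
    filter_upwards [h1] with y hy
    simp only [SmoothSurface.lam, hy, Pi.zero_apply, zero_mul]
  exact ⟨h2.eq_of_nhds, (hasFDerivAt_const (0 : ℝ) x).congr_of_eventuallyEq h2⟩

lemma lam_deriv (H : LogHyp Srf K ρ r₁ c Z z₀ ζ) {x : E3} {η : ℝ} (ha : 0 < aq (Srf.Pt z₀) z₀ η x) :
    HasFDerivAt (Srf.lam z₀ ζ η) (Srf.lamD z₀ ζ η x) x :=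
  (H.diffζ x).hasFDerivAt.mul (hasFDerivAt_glg _ _ _ _ ha.ne')

lemma aq_le (z₀ : E3) (η : ℝ) (x : E3) : aq (Srf.Pt z₀) z₀ η x ≤ rho2 z₀ η x := by
  unfold aq rho2
  have := Srf.Pt_norm_le z₀ (x - z₀)
  gcongr

lemma aq_ge (H : LogHyp Srf K ρ r₁ c Z z₀ ζ) {x : E3} (hx : x ∈ Srf.S) (hn : ‖x - z₀‖ ≤ 2 * r₁) (η : ℝ) :
    c ^ 2 * rho2 z₀ η x ≤ aq (Srf.Pt z₀) z₀ η x := by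
  unfold aq rho2
  have h1 := pow_le_pow_left₀ (mul_nonneg H.c0.le (norm_nonneg _)) (H.rc x hx hn) 2
  have h2 : c ^ 2 ≤ 1 := pow_le_one₀ H.c0.le H.c1
  nlinarith [sq_nonneg η]

lemma sq_ge (H : LogHyp Srf K ρ r₁ c Z z₀ ζ) {x : E3} (hx : x ∈ Srf.S) (hn : ‖x - z₀‖ ≤ 2 * r₁) (η : ℝ) :
    c * √(rho2 z₀ η x) ≤ √(aq (Srf.Pt z₀) z₀ η x) := by
  have := Real.sqrt_le_sqrt (H.aq_ge hx hn η)
  rwa [Real.sqrt_mul (by positivity), Real.sqrt_sq H.c0.le] at this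

lemma sq_le3 (H : LogHyp Srf K ρ r₁ c Z z₀ ζ) {x : E3} (hn : ‖x - z₀‖ ≤ 2 * r₁) {η : ℝ} (h0 : 0 ≤ η) (h1 : η ≤ 1) :
    √(aq (Srf.Pt z₀) z₀ η x) ≤ 3 := by
  rw [Real.sqrt_le_left (by norm_num)]
  refine (aq_le z₀ η x).trans ?_
  unfold rho2
  have := H.r1
  nlinarith [norm_nonneg (x - z₀)]

/-- first order bounds near the pole -/
lemma lam_near (H : LogHyp Srf K ρ r₁ c Z z₀ ζ) {x : E3} (hn : ‖x - z₀‖ ≤ 2 * r₁) {η : ℝ} (h0 : 0 ≤ η) (h1 : η ≤ 1)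
    (ha : 0 < aq (Srf.Pt z₀) z₀ η x) :
    |glg (Srf.Pt z₀) z₀ η x| ≤ 10 / √(aq (Srf.Pt z₀) z₀ η x) ∧
    |Srf.lam z₀ ζ η x| ≤ 10 * Z / √(aq (Srf.Pt z₀) z₀ η x) ∧ ‖Srf.lamD z₀ ζ η x‖ ≤ 11 * Z / √(aq (Srf.Pt z₀) z₀ η x) := by
  have hZ := H.Z_ge
  have e1 : |glg (Srf.Pt z₀) z₀ η x| ≤ 10 / √(aq (Srf.Pt z₀) z₀ η x) := by
    have := abs_half_log_le ha (H.sq_le3 hn h0 h1)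
    norm_num at this
    unfold glg
    norm_num
    exact this
  have e2 := glD_norm (Srf.Pt_norm_le z₀) z₀ η x
  have e3 := H.ζ_le x
  have e4 := H.dζ_le x
  refine ⟨e1, ?_, ?_⟩
  · unfold SmoothSurface.lam
    rw [abs_mul]
    calc _ ≤ Z * (10 / √(aq (Srf.Pt z₀) z₀ η x)) := by gcongr
      _ = _ := by ring
  · unfold SmoothSurface.lamD
    refine (norm_add_le _ _).trans ?_
    rw [norm_smul, norm_smul, Real.norm_eq_abs, Real.norm_eq_abs]
    calc _ ≤ Z * (√(aq (Srf.Pt z₀) z₀ η x))⁻¹ + (10 / √(aq (Srf.Pt z₀) z₀ η x)) * Z := by gcongr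
      _ = _ := by ring

/-- (g2) -/
lemma lam_bd (H : LogHyp Srf K ρ r₁ c Z z₀ ζ) {x : E3} (hx : x ∈ Srf.S) {η : ℝ} (h0 : 0 ≤ η) (h1 : η ≤ 1)
    (ha : 0 < rho2 z₀ η x) :
    DifferentiableAt ℝ (Srf.lam z₀ ζ η) x ∧ |Srf.lam z₀ ζ η x| ≤ 10 * Z / c / √(rho2 z₀ η x) ∧
    ‖Srf.grad (Srf.lam z₀ ζ η) x‖ ≤ 11 * Z / c / √(rho2 z₀ η x) := by
  have hZ := H.Z_ge
  have hc := H.c0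
  by_cases hn : ‖x - z₀‖ ≤ 2 * r₁
  · have hage := H.aq_ge hx hn η
    have hq : 0 < aq (Srf.Pt z₀) z₀ η x := lt_of_lt_of_le (by positivity) hage
    have hs := H.sq_ge hx hn η
    obtain ⟨_, b1, b2⟩ := H.lam_near hn h0 h1 hq
    have hd := H.lam_deriv hq
    have hr : 0 < √(rho2 z₀ η x) := Real.sqrt_pos.2 ha
    refine ⟨hd.differentiableAt, b1.trans ?_, (H.geo.grad_norm_le hx hd).trans (b2.trans ?_)⟩
    · rw [div_div]; gcongr
    · rw [div_div]; gcongr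
  · push Not at hn
    obtain ⟨e1, e2⟩ := H.lam_far (show 3 / 2 * r₁ < ‖x - z₀‖ by linarith [H.r0]) η
    refine ⟨e2.differentiableAt, ?_, ?_⟩
    · rw [e1, abs_zero]; positivity
    · refine (H.geo.grad_norm_le hx e2).trans ?_
      rw [norm_zero]; positivity

/-- (g3) and (g5) -/
lemma lam_diff (H : LogHyp Srf K ρ r₁ c Z z₀ ζ) {x : E3} (hx : x ∈ Srf.S) {δ η : ℝ} (h0 : 0 ≤ δ) (hδη : δ ≤ η) (h1 : η ≤ 1)
    (ha : 0 < rho2 z₀ δ x) :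
    |Srf.lam z₀ ζ η x - Srf.lam z₀ ζ δ x| ≤ Z / c ^ 2 * (η ^ 2 / (√(rho2 z₀ δ x) * √(rho2 z₀ η x))) ∧
    ‖Srf.grad (fun y => Srf.lam z₀ ζ η y - Srf.lam z₀ ζ δ y) x‖ ≤
      4 * Z / c ^ 3 * (η ^ 2 / (√(rho2 z₀ δ x) * rho2 z₀ η x)) := by
  have hZ := H.Z_ge
  have hc := H.c0
  have hbr : 0 < rho2 z₀ η x := lt_of_lt_of_le ha (by unfold rho2; gcongr)
  have hr1 : 0 < √(rho2 z₀ δ x) := Real.sqrt_pos.2 ha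
  have hr2 : 0 < √(rho2 z₀ η x) := Real.sqrt_pos.2 hbr
  by_cases hn : ‖x - z₀‖ ≤ 2 * r₁
  · have hagea := H.aq_ge hx hn δ
    have hageb := H.aq_ge hx hn η
    have hqa : 0 < aq (Srf.Pt z₀) z₀ δ x := lt_of_lt_of_le (by positivity) hagea
    have hqb : 0 < aq (Srf.Pt z₀) z₀ η x := lt_of_lt_of_le (by positivity) hageb
    have hsa := H.sq_ge hx hn δ
    have hsb := H.sq_ge hx hn η
    have hs3 := H.sq_le3 hn (h0.trans hδη) h1
    have hqb' := Real.sqrt_pos.2 hqb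
    have hqa' := Real.sqrt_pos.2 hqa
    have g1 := glg_diff (Srf.Pt z₀) z₀ h0 hδη x hqa
    have g2 := glD_diff (Srf.Pt_norm_le z₀) z₀ h0 hδη x hqa
    constructor
    · unfold SmoothSurface.lam
      rw [← mul_sub, abs_mul]
      calc _ ≤ Z * (η ^ 2 / (√(aq (Srf.Pt z₀) z₀ δ x) * √(aq (Srf.Pt z₀) z₀ η x))) := by gcongr; exact H.ζ_le x
        _ ≤ Z * (η ^ 2 / ((c * √(rho2 z₀ δ x)) * (c * √(rho2 z₀ η x)))) := by gcongr
        _ = _ := by field_simp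
    · have hd : HasFDerivAt (fun y => Srf.lam z₀ ζ η y - Srf.lam z₀ ζ δ y) (Srf.lamD z₀ ζ η x - Srf.lamD z₀ ζ δ x) x :=
        (H.lam_deriv hqb).sub (H.lam_deriv hqa)
      refine (H.geo.grad_norm_le hx hd).trans ?_
      have e : Srf.lamD z₀ ζ η x - Srf.lamD z₀ ζ δ x = ζ x • (glD (Srf.Pt z₀) z₀ η x - glD (Srf.Pt z₀) z₀ δ x) +
          (glg (Srf.Pt z₀) z₀ η x - glg (Srf.Pt z₀) z₀ δ x) • fderiv ℝ ζ x := by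
        unfold SmoothSurface.lamD
        rw [smul_sub, sub_smul]; abel
      rw [e]
      refine (norm_add_le _ _).trans ?_
      rw [norm_smul, norm_smul, Real.norm_eq_abs, Real.norm_eq_abs]
      have e3 := H.ζ_le x
      have e4 := H.dζ_le x
      have e5 : η ^ 2 / (√(aq (Srf.Pt z₀) z₀ δ x) * √(aq (Srf.Pt z₀) z₀ η x)) ≤
          3 * (η ^ 2 / (√(aq (Srf.Pt z₀) z₀ δ x) * aq (Srf.Pt z₀) z₀ η x)) := by
        rw [← mul_div_assoc, div_le_div_iff₀ (by positivity) (by positivity)]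
        have e6 : aq (Srf.Pt z₀) z₀ η x ≤ 3 * √(aq (Srf.Pt z₀) z₀ η x) := by
          nth_rewrite 1 [← Real.sq_sqrt hqb.le]
          nlinarith
        calc _ = η ^ 2 * √(aq (Srf.Pt z₀) z₀ δ x) * aq (Srf.Pt z₀) z₀ η x := by ring
          _ ≤ η ^ 2 * √(aq (Srf.Pt z₀) z₀ δ x) * (3 * √(aq (Srf.Pt z₀) z₀ η x)) := by gcongr
          _ = _ := by ring
      calc _ ≤ Z * (η ^ 2 / (√(aq (Srf.Pt z₀) z₀ δ x) * aq (Srf.Pt z₀) z₀ η x)) +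
            3 * (η ^ 2 / (√(aq (Srf.Pt z₀) z₀ δ x) * aq (Srf.Pt z₀) z₀ η x)) * Z := by
              gcongr
              exact g1.trans e5
        _ = 4 * Z * (η ^ 2 / (√(aq (Srf.Pt z₀) z₀ δ x) * aq (Srf.Pt z₀) z₀ η x)) := by ring
        _ ≤ 4 * Z * (η ^ 2 / ((c * √(rho2 z₀ δ x)) * (c ^ 2 * rho2 z₀ η x))) := by gcongr
        _ = _ := by field_simp
  · push Not at hn
    have hn' : 3 / 2 * r₁ < ‖x - z₀‖ := by linarith [H.r0]
    obtain ⟨e1, e2⟩ := H.lam_far hn' η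
    obtain ⟨e3, e4⟩ := H.lam_far hn' δ
    constructor
    · rw [e1, e3, sub_zero, abs_zero]; positivity
    · refine (H.geo.grad_norm_le hx (e2.sub e4)).trans ?_
      rw [sub_zero, norm_zero]; positivity

/-- (g4) -/
lemma lam_taylor (H : LogHyp Srf K ρ r₁ c Z z₀ ζ) {p q : E3} (hp : p ∈ Srf.S) (hq : q ∈ Srf.S) {h η : ℝ} (hh : 0 < h) (h4 : 4 * h ≤ r₁)
    (hη : 16 * h ≤ η) (h1 : η ≤ 1) (hd : ‖q - p‖ ≤ 2 * h) :
    |Srf.lam z₀ ζ η q - Srf.lam z₀ ζ η p - ⟪Srf.grad (Srf.lam z₀ ζ η) p, q - p⟫| ≤ 318 * Z * K / c ^ 2 * (h ^ 2 / rho2 z₀ η p) := by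
  have hZ := H.Z_ge
  have hc := H.c0
  have hK := H.geo.K_ge
  have hη0 : 0 < η := by linarith
  have hbr : 0 < rho2 z₀ η p := rho2_pos hη0 p
  by_cases hn : ‖p - z₀‖ ≤ 2 * r₁
  · have hage := H.aq_ge hp hn η
    have hqa : 0 < aq (Srf.Pt z₀) z₀ η p := lt_of_lt_of_le (by positivity) hage
    have hs3 := H.sq_le3 hn hη0.le h1
    have hsq := Real.sqrt_pos.2 hqa
    obtain ⟨b0, b1, b2⟩ := H.lam_near hn hη0.le h1 hqa
    obtain ⟨d, rfl⟩ : ∃ d, q = p + d := ⟨q - p, by abel⟩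
    rw [add_sub_cancel_left] at hd ⊢
    obtain ⟨t1, t2⟩ := glg_taylor (Srf.Pt_norm_le z₀) z₀ hh hη p d hd
    have t3 := H.ζ_taylor p d
    have t4 := H.ζ_lip p d
    have t5 := H.geo.quad p hp (p + d) hq
    rw [add_sub_cancel_left, ← Srf.sub_Pt_norm hp] at t5
    rw [H.geo.grad_of_fderiv hp (H.lam_deriv hqa) d]
    have t6 : |Srf.lamD z₀ ζ η p (d - Srf.Pt p d)| ≤ 11 * Z / √(aq (Srf.Pt z₀) z₀ η p) * (K * ‖d‖ ^ 2) :=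
      ((Srf.lamD z₀ ζ η p).le_opNorm _).trans (by gcongr)
    rw [map_sub] at t6
    generalize hA : aq (Srf.Pt z₀) z₀ η p = A at *
    have hinv : 1 / √A ≤ 3 / A := by
      rw [div_le_div_iff₀ hsq hqa]
      nth_rewrite 1 [← Real.sq_sqrt hqa.le]
      nlinarith
    have hd2 : ‖d‖ ^ 2 ≤ 4 * h ^ 2 := by nlinarith [norm_nonneg d]
    have t6' : |Srf.lamD z₀ ζ η p d - Srf.lamD z₀ ζ η p (Srf.Pt p d)| ≤ 132 * (Z * K) * (h ^ 2 / A) := by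
      refine t6.trans ?_
      calc _ = 11 * Z * (1 / √A) * (K * ‖d‖ ^ 2) := by ring
        _ ≤ 11 * Z * (3 / A) * (K * (4 * h ^ 2)) := by gcongr
        _ = _ := by ring
    have e : Srf.lam z₀ ζ η (p + d) - Srf.lam z₀ ζ η p - Srf.lamD z₀ ζ η p d =
        glg (Srf.Pt z₀) z₀ η p * (ζ (p + d) - ζ p - fderiv ℝ ζ p d) +
        ζ p * (glg (Srf.Pt z₀) z₀ η (p + d) - glg (Srf.Pt z₀) z₀ η p - glD (Srf.Pt z₀) z₀ η p d) +
        (ζ (p + d) - ζ p) * (glg (Srf.Pt z₀) z₀ η (p + d) - glg (Srf.Pt z₀) z₀ η p) := by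
      simp only [SmoothSurface.lam, SmoothSurface.lamD, ContinuousLinearMap.add_apply, ContinuousLinearMap.smul_apply, smul_eq_mul]
      ring
    have m1 : |glg (Srf.Pt z₀) z₀ η p * (ζ (p + d) - ζ p - fderiv ℝ ζ p d)| ≤ 120 * Z * (h ^ 2 / A) := by
      rw [abs_mul]
      calc _ ≤ (10 / √A) * (Z * ‖d‖ ^ 2) := by gcongr
        _ = 10 * (1 / √A) * (Z * ‖d‖ ^ 2) := by ring
        _ ≤ 10 * (3 / A) * (Z * (4 * h ^ 2)) := by gcongr
        _ = _ := by ring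
    have m2 : |ζ p * (glg (Srf.Pt z₀) z₀ η (p + d) - glg (Srf.Pt z₀) z₀ η p - glD (Srf.Pt z₀) z₀ η p d)| ≤ 30 * Z * (h ^ 2 / A) := by
      rw [abs_mul]
      calc _ ≤ Z * (30 * h ^ 2 / A) := by gcongr; exact H.ζ_le p
        _ = _ := by ring
    have m3 : |(ζ (p + d) - ζ p) * (glg (Srf.Pt z₀) z₀ η (p + d) - glg (Srf.Pt z₀) z₀ η p)| ≤ 36 * Z * (h ^ 2 / A) := by
      rw [abs_mul]
      calc _ ≤ (Z * ‖d‖) * (6 * h / √A) := by gcongr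
        _ = 6 * h * Z * ‖d‖ * (1 / √A) := by ring
        _ ≤ 6 * h * Z * (2 * h) * (3 / A) := by gcongr
        _ = _ := by ring
    have hA' : h ^ 2 / A ≤ 1 / c ^ 2 * (h ^ 2 / rho2 z₀ η p) := by
      rw [div_mul_div_comm, one_mul]; gcongr
    have m4 : 318 * (Z * K) * (h ^ 2 / A) ≤ 318 * Z * K / c ^ 2 * (h ^ 2 / rho2 z₀ η p) := by
      calc _ ≤ 318 * (Z * K) * (1 / c ^ 2 * (h ^ 2 / rho2 z₀ η p)) := by gcongr
        _ = _ := by ring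
    have m5 : 186 * Z * (h ^ 2 / A) ≤ 186 * (Z * K) * (h ^ 2 / A) := by
      have : Z ≤ Z * K := by nlinarith
      have : 186 * Z ≤ 186 * (Z * K) := by linarith
      gcongr
    have m6 := abs_add_three (glg (Srf.Pt z₀) z₀ η p * (ζ (p + d) - ζ p - fderiv ℝ ζ p d))
      (ζ p * (glg (Srf.Pt z₀) z₀ η (p + d) - glg (Srf.Pt z₀) z₀ η p - glD (Srf.Pt z₀) z₀ η p d))
      ((ζ (p + d) - ζ p) * (glg (Srf.Pt z₀) z₀ η (p + d) - glg (Srf.Pt z₀) z₀ η p))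
    rw [← e] at m6
    have m7 := abs_add_le (Srf.lam z₀ ζ η (p + d) - Srf.lam z₀ ζ η p - Srf.lamD z₀ ζ η p d)
      (Srf.lamD z₀ ζ η p d - Srf.lamD z₀ ζ η p (Srf.Pt p d))
    rw [sub_add_sub_cancel] at m7
    linarith
  · push Not at hn
    obtain ⟨e1, e2⟩ := H.lam_far (show 3 / 2 * r₁ < ‖p - z₀‖ by linarith [H.r0]) η
    have h3 := norm_sub_norm_le (p - z₀) (q - z₀)
    rw [sub_sub_sub_cancel_right, norm_sub_rev p q] at h3
    obtain ⟨e3, _⟩ := H.lam_far (show 3 / 2 * r₁ < ‖q - z₀‖ by linarith [H.r0]) η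
    rw [e1, e3, H.geo.grad_of_fderiv hp e2]
    simp only [ContinuousLinearMap.zero_apply, sub_zero, abs_zero]
    positivity

lemma lam_Lip (H : LogHyp Srf K ρ r₁ c Z z₀ ζ) {η : ℝ} (hη : 0 < η) : Srf.Lip (Srf.lam z₀ ζ η) := by
  apply Lip_of_contDiff
  have h1 : ContDiff ℝ 1 ζ := H.cut.1.of_le (by norm_cast)
  refine h1.mul (contDiff_const.mul (ContDiff.log ?_ ?_))
  · exact ContDiff.add (ContDiff.norm_sq ℝ ((Srf.Pt z₀).contDiff.comp (contDiff_id.sub contDiff_const))) contDiff_const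
  · intro x
    unfold aq
    positivity

lemma lam_meas (H : LogHyp Srf K ρ r₁ c Z z₀ ζ) (η : ℝ) : Measurable (Srf.lam z₀ ζ η) := by
  unfold SmoothSurface.lam glg aq
  exact H.cut.1.continuous.measurable.mul (measurable_const.mul (Real.measurable_log.comp
    (Continuous.measurable (by fun_prop))))
end LogHyp

end

section
variable {Srf : SmoothSurface} {K ρ : ℝ}
variable {γ h m : ℝ} {Tr : Triangulation Srf γ h}
variable {r₁ c Z A Q δ η B : ℝ} {z₀ : E3} {ζ : E3 → ℝ}

lemma arith_D1 {t r : ℝ} (hQ : 1 ≤ Q) (hh : 0 < h) (hhη : h ≤ η) (ht : 0 < t) (htr : t ≤ r) :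
    Q * (h ^ 2 / r ^ 2) + Q * (η ^ 2 / (t * r)) ≤ 2 * Q * (η ^ 2 / (t * r)) := by
  have hr : 0 < r := ht.trans_le htr
  have h1 : h ^ 2 / r ^ 2 ≤ η ^ 2 / (t * r) := by
    rw [pow_two r]; gcongr
  nlinarith

lemma arith_D2 {t r : ℝ} (hQ : 1 ≤ Q) (hh : 0 < h) (hhη : h ≤ η) (ht : 0 < t) (htr : t ≤ r)
    (hηr : η ≤ r) (hrQ : r ≤ Q) (hγ : 0 < γ) (hγQ : 1 / γ ≤ Q) (hm : m ≤ Q * h) :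
    2 * (Q * (h ^ 2 / r ^ 2) / (γ * h)) + 4 * m * (Q / r) + Q * (η ^ 2 / (t * r ^ 2)) ≤ 7 * Q ^ 3 * (η / (t * r)) := by
  have hr : 0 < r := ht.trans_le htr
  have hη : 0 < η := hh.trans_le hhη
  set y := η / (t * r) with hy
  have hy0 : 0 < y := by positivity
  have a1 : h / r ^ 2 ≤ y := by
    rw [pow_two r, hy]; gcongr
  have a2 : 2 * (Q * (h ^ 2 / r ^ 2) / (γ * h)) = 2 * Q * ((1 / γ) * (h / r ^ 2)) := by
    field_simp
  have a3 : (1 / γ) * (h / r ^ 2) ≤ Q * y := by gcongr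
  have a4 : h / r ≤ Q * y := by
    have : h / r = t * (h / (t * r)) := by field_simp
    rw [this, hy]
    gcongr
    linarith
  have a5 : 4 * m * (Q / r) ≤ 4 * (Q * h) * (Q / r) := by gcongr
  have a6 : 4 * (Q * h) * (Q / r) = 4 * Q ^ 2 * (h / r) := by ring
  have a7 : η ^ 2 / (t * r ^ 2) ≤ y := by
    have : η ^ 2 / (t * r ^ 2) = (η / r) * y := by rw [hy]; field_simp
    rw [this]
    have : η / r ≤ 1 := by rw [div_le_one hr]; exact hηr
    nlinarith
  have b1 : 2 * Q * ((1 / γ) * (h / r ^ 2)) ≤ 2 * Q * (Q * y) := by gcongr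
  have b2 : 4 * Q ^ 2 * (h / r) ≤ 4 * Q ^ 2 * (Q * y) := by gcongr
  have b3 : Q * (η ^ 2 / (t * r ^ 2)) ≤ Q * y := by gcongr
  have c1 : Q ^ 2 * y ≤ Q ^ 3 * y := by
    have : Q ^ 2 ≤ Q ^ 3 := pow_le_pow_right₀ hQ (by norm_num)
    gcongr
  have c2 : Q * y ≤ Q ^ 3 * y := by
    have : Q ≤ Q ^ 3 := le_self_pow₀ hQ (by norm_num)
    gcongr
  rw [a2]
  linarith

lemma pe_le_add (w : E3 → ℝ) (x : E3) : Srf.pe w x ≤ ‖Srf.grad w x‖ + |w x| := by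
  unfold SmoothSurface.pe
  rw [Real.sqrt_le_left (by positivity)]
  have := sq_abs (w x)
  nlinarith [norm_nonneg (Srf.grad w x), abs_nonneg (w x), mul_nonneg (norm_nonneg (Srf.grad w x)) (abs_nonneg (w x))]

/-- square root of the weight -/
def rt (z₀ : E3) (η : ℝ) (x : E3) : ℝ := √(rho2 z₀ η x)

lemma rt_sq (z₀ : E3) (η : ℝ) (x : E3) : rt z₀ η x ^ 2 = rho2 z₀ η x := by
  unfold rt rho2
  exact Real.sq_sqrt (by positivity)

lemma rt_pos {z₀ : E3} {η : ℝ} (hη : 0 < η) (x : E3) : 0 < rt z₀ η x := Real.sqrt_pos.2 (rho2_pos hη x)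

lemma rt_meas (z₀ : E3) (η : ℝ) : Measurable (rt z₀ η) := (measurable_rho2 z₀ η).sqrt

/-- all hypotheses of the final assembly -/
structure AsmHyp (Srf : SmoothSurface) (K ρ γ h m r₁ c Z A Q δ η B : ℝ) (z₀ : E3) (ζ : E3 → ℝ)
    (Tr : Triangulation Srf γ h) : Prop where
  M : MeshHyp Srf K ρ γ h m Tr
  H : LogHyp Srf K ρ r₁ c Z z₀ ζ
  Q1 : 1 ≤ Q
  q1 : 318 * Z * K / c ^ 2 ≤ Q
  q2 : 11 * Z / c ≤ Q
  q3 : 4 * Z / c ^ 3 ≤ Q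
  q4 : 1 / γ ≤ Q
  q5 : m ≤ Q * h
  q6 : K ≤ Q
  q7 : ∀ x ∈ Srf.S, ‖x - z₀‖ ^ 2 + 1 ≤ Q ^ 2
  q8 : A ≤ Q
  ahl : Srf.Ahl A
  hδ : δ = h ^ 2
  hη : η = 400 * Q ^ 3 * h
  h4 : 4 * h ≤ r₁
  sm : 10000 * Q ^ 3 * h ≤ 1
  B1 : 1 ≤ B
  intB : Integrable (fun x => 1 / rho2 z₀ δ x) Srf.ms
  leB : ∫ x, 1 / rho2 z₀ δ x ∂Srf.ms ≤ B
  sml : Sml K ρ (3 * h)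
  qq : quasiC K γ (390 * K + 4) ≤ Q

namespace AsmHyp

lemma Q3 (H : AsmHyp Srf K ρ γ h m r₁ c Z A Q δ η B z₀ ζ Tr) : 1 ≤ Q ^ 3 := one_le_pow₀ H.Q1

lemma hpos (H : AsmHyp Srf K ρ γ h m r₁ c Z A Q δ η B z₀ ζ Tr) : 0 < h := H.M.hpos

lemma h_le (H : AsmHyp Srf K ρ γ h m r₁ c Z A Q δ η B z₀ ζ Tr) : 10000 * h ≤ 1 := by
  have := H.Q3
  have := H.hpos
  have := H.sm
  nlinarith

lemma η_le (H : AsmHyp Srf K ρ γ h m r₁ c Z A Q δ η B z₀ ζ Tr) : η ≤ 1 / 25 := by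
  have := H.sm
  rw [H.hη]; linarith

lemma η_ge (H : AsmHyp Srf K ρ γ h m r₁ c Z A Q δ η B z₀ ζ Tr) : 400 * h ≤ η := by
  have := H.Q3
  have := H.hpos
  rw [H.hη]; nlinarith

lemma η_pos (H : AsmHyp Srf K ρ γ h m r₁ c Z A Q δ η B z₀ ζ Tr) : 0 < η := by
  linarith [H.η_ge, H.hpos]

lemma δ_pos (H : AsmHyp Srf K ρ γ h m r₁ c Z A Q δ η B z₀ ζ Tr) : 0 < δ := by
  rw [H.hδ]; exact pow_pos H.hpos 2

lemma δ_le (H : AsmHyp Srf K ρ γ h m r₁ c Z A Q δ η B z₀ ζ Tr) : δ ≤ η := by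
  rw [H.hδ]; nlinarith [H.η_ge, H.hpos, H.h_le]

lemma rt_mono (H : AsmHyp Srf K ρ γ h m r₁ c Z A Q δ η B z₀ ζ Tr) (p : E3) : rt z₀ δ p ≤ rt z₀ η p := by
  unfold rt rho2
  have := H.δ_le
  have := H.δ_pos
  gcongr

lemma rt_le (H : AsmHyp Srf K ρ γ h m r₁ c Z A Q δ η B z₀ ζ Tr) {p : E3} (hp : p ∈ Srf.S) : rt z₀ η p ≤ Q := by
  unfold rt
  rw [Real.sqrt_le_left (by linarith [H.Q1])]
  refine le_trans ?_ (H.q7 p hp)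
  unfold rho2
  nlinarith [H.η_le, H.η_pos]

lemma rt_ge (H : AsmHyp Srf K ρ γ h m r₁ c Z A Q δ η B z₀ ζ Tr) (p : E3) : η ≤ rt z₀ η p := by
  unfold rt rho2
  refine Real.le_sqrt_of_sq_le ?_
  nlinarith [sq_nonneg ‖p - z₀‖]

lemma rt_ge' (p : E3) : ‖p - z₀‖ ≤ rt z₀ η p := by
  unfold rt rho2
  refine Real.le_sqrt_of_sq_le ?_
  nlinarith [sq_nonneg η]

lemma lamd (H : AsmHyp Srf K ρ γ h m r₁ c Z A Q δ η B z₀ ζ Tr) {p : E3} (hp : p ∈ Srf.S) {ε : ℝ} (h0 : 0 < ε) (h1 : ε ≤ 1) :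
    DifferentiableWithinAt ℝ (Srf.lam z₀ ζ ε) Srf.S p :=
  (H.H.lam_bd hp h0.le h1 (rho2_pos h0 p)).1.differentiableWithinAt

/-- the interpolant of the regularized logarithm -/
lemma interp (H : AsmHyp Srf K ρ γ h m r₁ c Z A Q δ η B z₀ ζ Tr) : ∃ u, Tr.IsVh u ∧ ∀ p ∈ Srf.S,
    DifferentiableWithinAt ℝ (Tr.liftS u) Srf.S p →
    |Tr.liftS u p - Srf.lam z₀ ζ η p| ≤ Q * (h ^ 2 / rt z₀ η p ^ 2) ∧
    ‖Srf.grad (Tr.liftS u) p - Srf.grad (Srf.lam z₀ ζ η) p‖ ≤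
      2 * (Q * (h ^ 2 / rt z₀ η p ^ 2) / (γ * h)) + 4 * m * (Q / rt z₀ η p) := by
  obtain ⟨u, hu, huq⟩ := Tr.exists_interp (Srf.lam z₀ ζ η)
  refine ⟨u, hu, ?_⟩
  intro p hp
  obtain ⟨t, ht, x, hx, rfl⟩ := H.M.cover hp
  intro hd
  have hη1 : η ≤ 1 := by linarith [H.η_le]
  have hb : ∀ q ∈ vertsOf t, |Tr.liftS u q - Srf.lam z₀ ζ η (Srf.proj x) - ⟪Srf.grad (Srf.lam z₀ ζ η) (Srf.proj x), q - Srf.proj x⟫| ≤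
      Q * (h ^ 2 / rt z₀ η (Srf.proj x) ^ 2) := by
    intro q hq
    have hqS := Tr.verts_on t ht hq
    have e := H.M.lift_eq ht (vertsOf_sub t hq) u
    rw [H.M.geo.proj_self hqS, huq t ht q hq] at e
    rw [e, rt_sq]
    refine (H.H.lam_taylor hp hqS H.hpos H.h4 (by linarith [H.η_ge, H.hpos]) hη1
      (H.M.vert_near ht hx (vertsOf_sub t hq))).trans ?_
    have := rho2_pos (z₀ := z₀) H.η_pos (Srf.proj x)
    gcongr
    exact H.q1
  obtain ⟨h1, h2⟩ := H.M.interp_pt ht hx hu hd (H.M.grad_n x (Srf.lam z₀ ζ η)) hb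
  refine ⟨h1, h2.trans ?_⟩
  have h3 := (H.H.lam_bd hp H.η_pos.le hη1 (rho2_pos H.η_pos _)).2.2
  have h4 : ‖Srf.grad (Srf.lam z₀ ζ η) (Srf.proj x)‖ ≤ Q / rt z₀ η (Srf.proj x) := by
    refine h3.trans ?_
    have := H.q2
    unfold rt
    gcongr
  have := H.M.m_pos
  gcongr

/-- pointwise bounds for the difference of interpolant and regularized logarithm -/
lemma D_pt (H : AsmHyp Srf K ρ γ h m r₁ c Z A Q δ η B z₀ ζ Tr) : ∃ u, Tr.IsVh u ∧ ∀ p ∈ Srf.S,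
    DifferentiableWithinAt ℝ (Tr.liftS u) Srf.S p →
    |Tr.liftS u p - Srf.lam z₀ ζ δ p| ≤ 2 * Q * (η ^ 2 / (rt z₀ δ p * rt z₀ η p)) ∧
    ‖Srf.grad (fun y => Tr.liftS u y - Srf.lam z₀ ζ δ y) p‖ ≤ 7 * Q ^ 3 * (η / (rt z₀ δ p * rt z₀ η p)) := by
  obtain ⟨u, hu, hup⟩ := H.interp
  refine ⟨u, hu, ?_⟩
  intro p hp hd
  obtain ⟨h1, h2⟩ := hup p hp hd
  have hη1 : η ≤ 1 := by linarith [H.η_le]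
  obtain ⟨h3, h4⟩ := H.H.lam_diff hp H.δ_pos.le H.δ_le hη1 (rho2_pos H.δ_pos p)
  have d1 := H.lamd hp H.η_pos hη1
  have d2 := H.lamd hp H.δ_pos (H.δ_le.trans hη1)
  have hη := H.η_pos
  have hZ := H.H.Z_ge
  have hc := H.H.c0
  have t0 : 0 < rt z₀ δ p := rt_pos H.δ_pos p
  have r0 : 0 < rt z₀ η p := rt_pos H.η_pos p
  have hhη : h ≤ η := by linarith [H.η_ge, H.hpos]
  have hZc : Z / c ^ 2 ≤ Q := by
    refine le_trans ?_ H.q1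
    have := H.M.geo.K_ge
    gcongr
    nlinarith
  constructor
  · have e : Tr.liftS u p - Srf.lam z₀ ζ δ p = (Tr.liftS u p - Srf.lam z₀ ζ η p) + (Srf.lam z₀ ζ η p - Srf.lam z₀ ζ δ p) := by ring
    rw [e]
    refine (abs_add_le _ _).trans (le_trans (add_le_add h1 ?_) (arith_D1 H.Q1 H.hpos hhη t0 (H.rt_mono p)))
    refine h3.trans ?_
    unfold rt at t0 r0 ⊢
    gcongr
  · rw [H.M.geo.grad_sub hp hd d2]
    rw [H.M.geo.grad_sub hp d1 d2] at h4
    have e : Srf.grad (Tr.liftS u) p - Srf.grad (Srf.lam z₀ ζ δ) p = (Srf.grad (Tr.liftS u) p - Srf.grad (Srf.lam z₀ ζ η) p)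
      + (Srf.grad (Srf.lam z₀ ζ η) p - Srf.grad (Srf.lam z₀ ζ δ) p) := by abel
    rw [e]
    refine (norm_add_le _ _).trans (le_trans (add_le_add h2 ?_) (arith_D2 H.Q1 H.hpos hhη t0 (H.rt_mono p) (H.rt_ge p) (H.rt_le hp)
      H.M.γpos H.q4 H.q5))
    refine h4.trans ?_
    rw [rt_sq]
    have := rho2_pos (z₀ := z₀) H.η_pos p
    have := H.q3
    unfold rt at t0 ⊢
    gcongr

end AsmHyp

end

section
variable {Srf : SmoothSurface} {K ρ : ℝ}
variable {γ h m : ℝ} {Tr : Triangulation Srf γ h}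
variable {r₁ c Z A Q δ η B : ℝ} {z₀ : E3} {ζ : E3 → ℝ} {u lh : E3 → ℝ}

namespace AsmHyp

lemma gen_sq (H : AsmHyp Srf K ρ γ h m r₁ c Z A Q δ η B z₀ ζ Tr) {F : E3 → ℝ} {b : ℝ}
    (hF : ∀ᵐ p ∂Srf.ms, |F p| ≤ b / rt z₀ δ p) : ∫ p, F p ^ 2 ∂Srf.ms ≤ b ^ 2 * B := by
  calc ∫ p, F p ^ 2 ∂Srf.ms ≤ ∫ p, b ^ 2 * (1 / rho2 z₀ δ p) ∂Srf.ms := by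
        refine integral_mono_of_nonneg (ae_of_all _ (fun p => sq_nonneg _)) (H.intB.const_mul _) ?_
        filter_upwards [hF] with p hp
        have h1 : |F p| ^ 2 ≤ (b / rt z₀ δ p) ^ 2 := by gcongr
        rw [sq_abs, div_pow, rt_sq] at h1
        rw [mul_one_div]; exact h1
    _ ≤ b ^ 2 * B := by
        rw [integral_const_mul]
        exact mul_le_mul_of_nonneg_left H.leB (sq_nonneg _)

lemma gen_en (H : AsmHyp Srf K ρ γ h m r₁ c Z A Q δ η B z₀ ζ Tr) {w : E3 → ℝ} {b : ℝ} (hb : 0 ≤ b)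
    (hF : ∀ᵐ p ∂Srf.ms, Srf.pe w p ≤ b / rt z₀ δ p) : Srf.en w ≤ b * √B := by
  have h1 : ∫ p, Srf.pe w p ^ 2 ∂Srf.ms ≤ b ^ 2 * B := by
    refine H.gen_sq ?_
    filter_upwards [hF] with p hp
    rwa [abs_of_nonneg (Srf.pe_nonneg w p)]
  unfold SmoothSurface.en
  rw [Srf.aForm_self, ← Real.sqrt_sq hb, ← Real.sqrt_mul (sq_nonneg _)]
  exact Real.sqrt_le_sqrt h1

lemma gen_l2 (H : AsmHyp Srf K ρ γ h m r₁ c Z A Q δ η B z₀ ζ Tr) {w : E3 → ℝ} {b : ℝ} (hb : 0 ≤ b)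
    (hF : ∀ᵐ p ∂Srf.ms, |w p| ≤ b / rt z₀ δ p) : Srf.l2 w ≤ b * √B := by
  have h1 := H.gen_sq hF
  unfold SmoothSurface.l2
  rw [← Real.sqrt_sq hb, ← Real.sqrt_mul (sq_nonneg _)]
  exact Real.sqrt_le_sqrt h1

end AsmHyp

lemma arith_pe1 {t r : ℝ} (hQ : 1 ≤ Q) (ht : 0 < t) (hr : 0 < r) (hη : 0 < η) (hη1 : η ≤ 1) {g d : ℝ}
    (hg : g ≤ 7 * Q ^ 3 * (η / (t * r))) (hd : d ≤ 2 * Q * (η ^ 2 / (t * r))) : g + d ≤ 9 * Q ^ 3 * (η / (t * r)) := by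
  have c2 : Q ≤ Q ^ 3 := le_self_pow₀ hQ (by norm_num)
  have h1 : 2 * Q * (η ^ 2 / (t * r)) ≤ 2 * Q ^ 3 * (η / (t * r)) := by
    have : η ^ 2 ≤ η := by nlinarith
    gcongr
  linarith

lemma arith_pe2 {t r : ℝ} (ht : 0 < t) (hr : 0 < r) (hη : 0 < η) (hηr : η ≤ r) : η / (t * r) ≤ 1 / t := by
  rw [div_le_div_iff₀ (by positivity) ht]
  nlinarith

lemma arith_pe3 {t : ℝ} (hQ : 1 ≤ Q) (ht : 0 < t) {g d g' d' y : ℝ} (hy : y ≤ 1 / t)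
    (hgd : g + d ≤ 9 * Q ^ 3 * y) (hg' : g' ≤ Q / t) (hd' : d' ≤ Q / t) : (g + g') + (d + d') ≤ 11 * Q ^ 3 / t := by
  have c2 : Q ≤ Q ^ 3 := le_self_pow₀ hQ (by norm_num)
  have h1 : 9 * Q ^ 3 * y ≤ 9 * Q ^ 3 * (1 / t) := by gcongr
  have h2 : Q / t ≤ Q ^ 3 / t := by gcongr
  have e : 11 * Q ^ 3 / t = 9 * Q ^ 3 * (1 / t) + Q ^ 3 / t + Q ^ 3 / t := by ring
  linarith

/-- the discrete error setting -/
structure ErrHyp (Srf : SmoothSurface) (K ρ γ h m r₁ c Z A Q δ η B : ℝ) (z₀ : E3) (ζ : E3 → ℝ)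
    (Tr : Triangulation Srf γ h) (u lh : E3 → ℝ) : Prop where
  a : AsmHyp Srf K ρ γ h m r₁ c Z A Q δ η B z₀ ζ Tr
  hu : Tr.IsVh u
  hl : Tr.IsVh lh
  hD : ∀ p ∈ Srf.S, DifferentiableWithinAt ℝ (Tr.liftS u) Srf.S p →
    |Tr.liftS u p - Srf.lam z₀ ζ δ p| ≤ 2 * Q * (η ^ 2 / (rt z₀ δ p * rt z₀ η p)) ∧
    ‖Srf.grad (fun y => Tr.liftS u y - Srf.lam z₀ ζ δ y) p‖ ≤ 7 * Q ^ 3 * (η / (rt z₀ δ p * rt z₀ η p))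
  pr : ∀ vh : E3 → ℝ, Tr.IsVh vh → Tr.ahForm lh vh = Srf.aForm (Srf.lam z₀ ζ 0) (Tr.liftS vh)

/-- interpolant minus regularized logarithm -/
def Triangulation.dd (Tr : Triangulation Srf γ h) (z₀ : E3) (ζ : E3 → ℝ) (δ : ℝ) (u : E3 → ℝ) : E3 → ℝ :=
  fun y => Tr.liftS u y - Srf.lam z₀ ζ δ y

namespace ErrHyp

lemma Lip_u (H : ErrHyp Srf K ρ γ h m r₁ c Z A Q δ η B z₀ ζ Tr u lh) : Srf.Lip (Tr.liftS u) := H.a.M.Lip_lift H.hu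

lemma Lip_lam (H : ErrHyp Srf K ρ γ h m r₁ c Z A Q δ η B z₀ ζ Tr u lh) : Srf.Lip (Srf.lam z₀ ζ δ) := H.a.H.lam_Lip H.a.δ_pos

lemma Lip_D (H : ErrHyp Srf K ρ γ h m r₁ c Z A Q δ η B z₀ ζ Tr u lh) : Srf.Lip (Tr.dd z₀ ζ δ u) := H.Lip_u.sub H.Lip_lam

lemma peD (H : ErrHyp Srf K ρ γ h m r₁ c Z A Q δ η B z₀ ζ Tr u lh) :
    ∀ᵐ p ∂Srf.ms, Srf.pe (Tr.dd z₀ ζ δ u) p ≤ 9 * Q ^ 3 * (η / (rt z₀ δ p * rt z₀ η p)) := by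
  filter_upwards [Srf.ae_mem, H.a.M.geo.ae_diff H.Lip_u] with p hp hd
  obtain ⟨h1, h2⟩ := H.hD p hp hd
  refine (pe_le_add _ _).trans ?_
  exact arith_pe1 H.a.Q1 (rt_pos H.a.δ_pos p) (rt_pos H.a.η_pos p) H.a.η_pos (by linarith [H.a.η_le]) h2 h1

lemma peI (H : ErrHyp Srf K ρ γ h m r₁ c Z A Q δ η B z₀ ζ Tr u lh) :
    ∀ᵐ p ∂Srf.ms, Srf.pe (Tr.liftS u) p ≤ 11 * Q ^ 3 / rt z₀ δ p := by
  filter_upwards [Srf.ae_mem, H.a.M.geo.ae_diff H.Lip_u] with p hp hd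
  obtain ⟨h1, h2⟩ := H.hD p hp hd
  have hδ1 : δ ≤ 1 := by linarith [H.a.η_le, H.a.δ_le]
  have hη1 : η ≤ 1 := by linarith [H.a.η_le]
  obtain ⟨_, h3, h4⟩ := H.a.H.lam_bd hp H.a.δ_pos.le hδ1 (rho2_pos H.a.δ_pos p)
  have d2 := H.a.lamd hp H.a.δ_pos hδ1
  rw [H.a.M.geo.grad_sub hp hd d2] at h2
  have t0 := rt_pos (z₀ := z₀) H.a.δ_pos p
  have r0 := rt_pos (z₀ := z₀) H.a.η_pos p
  have k1 := arith_pe1 H.a.Q1 t0 r0 H.a.η_pos hη1 h2 h1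
  have k2 := arith_pe2 t0 r0 H.a.η_pos (H.a.rt_ge p)
  have hc := H.a.H.c0
  have hZ := H.a.H.Z_ge
  have h3' : |Srf.lam z₀ ζ δ p| ≤ Q / rt z₀ δ p := by
    refine h3.trans ?_
    have : 10 * Z / c ≤ Q := le_trans (by gcongr; norm_num) H.a.q2
    unfold rt; gcongr
  have h4' : ‖Srf.grad (Srf.lam z₀ ζ δ) p‖ ≤ Q / rt z₀ δ p := by
    refine h4.trans ?_
    have := H.a.q2
    unfold rt; gcongr
  refine (pe_le_add _ _).trans (le_trans ?_ (arith_pe3 H.a.Q1 t0 k2 k1 h4' h3'))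
  have e1 := norm_add_le (Srf.grad (Tr.liftS u) p - Srf.grad (Srf.lam z₀ ζ δ) p) (Srf.grad (Srf.lam z₀ ζ δ) p)
  have e2 := abs_add_le (Tr.liftS u p - Srf.lam z₀ ζ δ p) (Srf.lam z₀ ζ δ p)
  rw [sub_add_cancel] at e1 e2
  linarith

lemma enD (H : ErrHyp Srf K ρ γ h m r₁ c Z A Q δ η B z₀ ζ Tr u lh) : Srf.en (Tr.dd z₀ ζ δ u) ≤ 9 * Q ^ 3 * √B := by
  have := H.a.Q3
  refine H.a.gen_en (by positivity) ?_
  filter_upwards [H.peD] with p hp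
  refine hp.trans ?_
  have k2 := arith_pe2 (rt_pos (z₀ := z₀) H.a.δ_pos p) (rt_pos (z₀ := z₀) H.a.η_pos p) H.a.η_pos (H.a.rt_ge p)
  rw [div_eq_mul_one_div (9 * Q ^ 3)]
  gcongr

lemma enI (H : ErrHyp Srf K ρ γ h m r₁ c Z A Q δ η B z₀ ζ Tr u lh) : Srf.en (Tr.liftS u) ≤ 11 * Q ^ 3 * √B := by
  have := H.a.Q3
  exact H.a.gen_en (by positivity) H.peI

lemma l2D (H : ErrHyp Srf K ρ γ h m r₁ c Z A Q δ η B z₀ ζ Tr u lh) : Srf.l2 (Tr.dd z₀ ζ δ u) ≤ 2 * Q * η * √B := by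
  have := H.a.Q1
  have := H.a.η_pos
  refine H.a.gen_l2 (by positivity) ?_
  filter_upwards [Srf.ae_mem, H.a.M.geo.ae_diff H.Lip_u] with p hp hd
  obtain ⟨h1, h2⟩ := H.hD p hp hd
  refine h1.trans ?_
  have k2 := arith_pe2 (rt_pos (z₀ := z₀) H.a.δ_pos p) (rt_pos (z₀ := z₀) H.a.η_pos p) H.a.η_pos (H.a.rt_ge p)
  calc 2 * Q * (η ^ 2 / (rt z₀ δ p * rt z₀ η p)) = 2 * Q * η * (η / (rt z₀ δ p * rt z₀ η p)) := by ring
    _ ≤ 2 * Q * η * (1 / rt z₀ δ p) := by gcongr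
    _ = _ := by ring

end ErrHyp

end

section
variable {Srf : SmoothSurface} {K ρ : ℝ}
variable {γ h m : ℝ} {Tr : Triangulation Srf γ h}
variable {r₁ c Z A Q δ η B : ℝ} {z₀ : E3} {ζ : E3 → ℝ} {u lh v : E3 → ℝ}

lemma SmoothSurface.ae_ne (Srf : SmoothSurface) (z₀ : E3) : ∀ᵐ x ∂Srf.ms, x ≠ z₀ := by
  have : NullSingletonClass (μH[2] : Measure E3) := Measure.noAtoms_hausdorff E3 (by norm_num)
  unfold SmoothSurface.ms
  exact ae_restrict_of_ae (Measure.ae_ne _ z₀)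

lemma arith_sing {t d a g : ℝ} (hQ : 1 ≤ Q) (ht : 0 < t) (htQ : t ≤ Q) (hd : 0 < d)
    (ha : a ≤ Q * (δ ^ 2 / (d * t))) (hg : g ≤ Q * (δ ^ 2 / (d * t ^ 2))) : a + g ≤ 2 * Q ^ 2 * (δ ^ 2 / (d * t ^ 2)) := by
  have e : δ ^ 2 / (d * t) = t * (δ ^ 2 / (d * t ^ 2)) := by field_simp
  set y := δ ^ 2 / (d * t ^ 2) with hy
  have hy0 : 0 ≤ y := by positivity
  rw [e] at ha
  have h1 : Q * (t * y) ≤ Q * (Q * y) := by gcongr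
  have h2 : Q * y ≤ Q * (Q * y) := mul_le_mul_of_nonneg_left (le_mul_of_one_le_left hy0 hQ) (by linarith)
  nlinarith

namespace ErrHyp

lemma sing (H : ErrHyp Srf K ρ γ h m r₁ c Z A Q δ η B z₀ ζ Tr u lh) {p : E3} (hp : p ∈ Srf.S) (hne : p ≠ z₀) :
    DifferentiableWithinAt ℝ (Srf.lam z₀ ζ 0) Srf.S p ∧
    |Srf.lam z₀ ζ δ p - Srf.lam z₀ ζ 0 p| + ‖Srf.grad (fun y => Srf.lam z₀ ζ δ y - Srf.lam z₀ ζ 0 y) p‖ ≤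
      2 * Q ^ 2 * omg z₀ δ p := by
  have hn : 0 < ‖p - z₀‖ := norm_pos_iff.2 (sub_ne_zero.2 hne)
  have e0 : rho2 z₀ 0 p = ‖p - z₀‖ ^ 2 := by unfold rho2; ring
  have hr : 0 < rho2 z₀ 0 p := by rw [e0]; positivity
  have hδ1 : δ ≤ 1 := by linarith [H.a.η_le, H.a.δ_le]
  refine ⟨(H.a.H.lam_bd hp le_rfl zero_le_one hr).1.differentiableWithinAt, ?_⟩
  obtain ⟨h1, h2⟩ := H.a.H.lam_diff hp le_rfl H.a.δ_pos.le hδ1 hr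
  rw [e0, Real.sqrt_sq hn.le] at h1 h2
  have t0 := rt_pos (z₀ := z₀) H.a.δ_pos p
  have hZ := H.a.H.Z_ge
  have hc := H.a.H.c0
  have hK := H.a.M.geo.K_ge
  have hZc : Z / c ^ 2 ≤ Q := by
    refine le_trans ?_ H.a.q1
    gcongr
    nlinarith
  have h3 : |Srf.lam z₀ ζ δ p - Srf.lam z₀ ζ 0 p| ≤ Q * (δ ^ 2 / (‖p - z₀‖ * rt z₀ δ p)) := by
    refine h1.trans ?_
    unfold rt at t0 ⊢
    gcongr
  have h4 : ‖Srf.grad (fun y => Srf.lam z₀ ζ δ y - Srf.lam z₀ ζ 0 y) p‖ ≤ Q * (δ ^ 2 / (‖p - z₀‖ * rt z₀ δ p ^ 2)) := by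
    refine h2.trans ?_
    rw [rt_sq]
    have := H.a.q3
    have := rho2_pos (z₀ := z₀) H.a.δ_pos p
    gcongr
  have := arith_sing H.a.Q1 t0 ((H.a.rt_mono p).trans (H.a.rt_le hp)) hn h3 h4
  rwa [rt_sq] at this

lemma peV (H : ErrHyp Srf K ρ γ h m r₁ c Z A Q δ η B z₀ ζ Tr u lh) (hv : Tr.IsVh v) {p : E3} (hp : p ∈ Srf.S)
    (hd : DifferentiableWithinAt ℝ (Tr.liftS v) Srf.S p) :
    Srf.pe (Tr.liftS v) p ≤ 5 * Q / h * Srf.en (Tr.liftS v) := by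
  have h1 := H.a.M.inverse hv hp hd
  have hγ := H.a.M.γpos
  have hh := H.a.hpos
  have hq := H.a.q4
  have e0 := Srf.en_nonneg (Tr.liftS v)
  have h2 : Srf.pe (Tr.liftS v) p ≤ (5 * Srf.en (Tr.liftS v)) / (γ * h) := by
    rw [le_div_iff₀ (by positivity)]; linarith
  refine h2.trans ?_
  calc (5 * Srf.en (Tr.liftS v)) / (γ * h) = 5 * (1 / γ) / h * Srf.en (Tr.liftS v) := by field_simp
    _ ≤ _ := by gcongr

lemma cons (H : ErrHyp Srf K ρ γ h m r₁ c Z A Q δ η B z₀ ζ Tr u lh) (hv : Tr.IsVh v) :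
    |Srf.aForm (Srf.lam z₀ ζ δ) (Tr.liftS v) - Srf.aForm (Srf.lam z₀ ζ 0) (Tr.liftS v)| ≤
      240 * Q ^ 4 * h * Srf.en (Tr.liftS v) := by
  have hG := H.a.M.geo
  have hV := H.a.M.Lip_lift hv
  have hQ := H.a.Q1
  have hh := H.a.hpos
  set V := Tr.liftS v with hVd
  set d : E3 → ℝ := fun y => Srf.lam z₀ ζ δ y - Srf.lam z₀ ζ 0 y with hd
  have e0 := Srf.en_nonneg V
  set b := 2 * Q ^ 2 * (5 * Q / h * Srf.en V) with hb
  have hb0 : 0 ≤ b := by positivity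
  obtain ⟨iω, jω⟩ := H.a.ahl.omg_int H.a.H.hz H.a.δ_pos
  have hpt : ∀ᵐ p ∂Srf.ms, ‖⟪Srf.grad d p, Srf.grad V p⟫ + d p * V p‖ ≤ b * omg z₀ δ p := by
    filter_upwards [Srf.ae_mem, Srf.ae_ne z₀, hG.ae_diff hV] with p hp hne hdV
    have k1 := (H.sing hp hne).2
    have k2 := H.peV hv hp hdV
    rw [Real.norm_eq_abs]
    refine (abs_add_le _ _).trans ?_
    rw [abs_mul]
    have k3 := abs_real_inner_le_norm (Srf.grad d p) (Srf.grad V p)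
    have k4 := Srf.grad_le_pe V p
    have k5 := Srf.abs_le_pe V p
    have ω0 := omg_nonneg z₀ δ p
    calc |⟪Srf.grad d p, Srf.grad V p⟫| + |d p| * |V p| ≤ ‖Srf.grad d p‖ * Srf.pe V p + |d p| * Srf.pe V p := by
          refine add_le_add (k3.trans ?_) ?_ <;> gcongr
      _ = (|d p| + ‖Srf.grad d p‖) * Srf.pe V p := by ring
      _ ≤ (2 * Q ^ 2 * omg z₀ δ p) * (5 * Q / h * Srf.en V) := by
          refine mul_le_mul k1 k2 (Srf.pe_nonneg _ _) (by positivity)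
      _ = _ := by rw [hb]; ring
  have md : AEStronglyMeasurable d Srf.ms := ((H.a.H.lam_meas δ).sub (H.a.H.lam_meas 0)).aestronglyMeasurable
  have hintg : Integrable (fun p => ⟪Srf.grad d p, Srf.grad V p⟫ + d p * V p) Srf.ms :=
    Integrable.mono' (iω.const_mul b) (((hG.meas_grad d).inner (hG.meas_grad V)).add (md.mul hV.meas)) hpt
  have hL := hG.int_a H.Lip_lam hV
  have e1 : Srf.aForm (Srf.lam z₀ ζ 0) V = Srf.aForm (Srf.lam z₀ ζ δ) V - ∫ p, (⟪Srf.grad d p, Srf.grad V p⟫ + d p * V p) ∂Srf.ms := by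
    rw [Srf.aForm_def, Srf.aForm_def, ← integral_sub hL hintg]
    refine integral_congr_ae ?_
    filter_upwards [Srf.ae_mem, Srf.ae_ne z₀] with p hp hne
    have hδ1 : δ ≤ 1 := by linarith [H.a.η_le, H.a.δ_le]
    have := hG.grad_sub hp (H.a.lamd hp H.a.δ_pos hδ1) (H.sing hp hne).1
    simp only [hd]
    rw [this, inner_sub_left]
    ring
  rw [e1, sub_sub_cancel]
  refine (norm_integral_le_of_norm_le (iω.const_mul b) hpt).trans ?_
  rw [integral_const_mul]
  have hA := H.a.q8
  have hA1 := H.a.ahl.1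
  calc b * ∫ p, omg z₀ δ p ∂Srf.ms ≤ b * (Q * (24 * δ)) := by
        refine mul_le_mul_of_nonneg_left (jω.trans ?_) hb0
        have := H.a.δ_pos
        gcongr
    _ = _ := by rw [hb, H.a.hδ]; field_simp; ring

/-- residual bound -/
lemma R_le (H : ErrHyp Srf K ρ γ h m r₁ c Z A Q δ η B z₀ ζ Tr u lh) (hv : Tr.IsVh v) :
    |Tr.ahForm (fun x => u x - lh x) v| ≤ 60 * Q * h * ∫ x, Srf.pe (Tr.liftS u) x * Srf.pe (Tr.liftS v) x ∂Srf.ms +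
      |Srf.aForm (Tr.dd z₀ ζ δ u) (Tr.liftS v)| + 240 * Q ^ 4 * h * Srf.en (Tr.liftS v) := by
  have hV := H.a.M.Lip_lift hv
  rw [H.a.M.ah_sub_left H.hu H.hl hv, H.pr v hv]
  have h1 := H.a.M.geo_form H.hu hv
  have h2 := H.cons hv
  have h3 : Srf.aForm (Tr.dd z₀ ζ δ u) (Tr.liftS v) = Srf.aForm (Tr.liftS u) (Tr.liftS v) - Srf.aForm (Srf.lam z₀ ζ δ) (Tr.liftS v) :=
    H.a.M.geo.aForm_sub_left H.Lip_u H.Lip_lam hV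
  have h4 : 60 * m * ∫ x, Srf.pe (Tr.liftS u) x * Srf.pe (Tr.liftS v) x ∂Srf.ms ≤
      60 * Q * h * ∫ x, Srf.pe (Tr.liftS u) x * Srf.pe (Tr.liftS v) x ∂Srf.ms := by
    refine mul_le_mul_of_nonneg_right (by linarith [H.a.q5]) (integral_nonneg (fun x => mul_nonneg (Srf.pe_nonneg _ _) (Srf.pe_nonneg _ _)))
  have e : Tr.ahForm u v - Srf.aForm (Srf.lam z₀ ζ 0) (Tr.liftS v) = (Tr.ahForm u v - Srf.aForm (Tr.liftS u) (Tr.liftS v))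
    + Srf.aForm (Tr.dd z₀ ζ δ u) (Tr.liftS v) + (Srf.aForm (Srf.lam z₀ ζ δ) (Tr.liftS v) - Srf.aForm (Srf.lam z₀ ζ 0) (Tr.liftS v)) := by
    rw [h3]; ring
  rw [e]
  refine (abs_add_three _ _ _).trans ?_
  linarith

end ErrHyp

end

section
variable {Srf : SmoothSurface} {K ρ : ℝ}
variable {γ h m : ℝ} {Tr : Triangulation Srf γ h}
variable {r₁ c Z A Q δ η B : ℝ} {z₀ : E3} {ζ : E3 → ℝ} {u lh v : E3 → ℝ}

lemma arith_en {x s a R d : ℝ} (hx : 0 ≤ x) (hQ : 1 ≤ Q) (hh : 0 < h) (hsm : 10000 * Q ^ 3 * h ≤ 1) (hm : 4000 * m ≤ 1)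
    (hs : 1 ≤ s) (h1 : |a - x ^ 2| ≤ 60 * m * x ^ 2) (h2 : |a| ≤ 60 * Q * h * R + d + 240 * Q ^ 4 * h * x)
    (hR : R ≤ 11 * Q ^ 3 * s * x) (hd : d ≤ 9 * Q ^ 3 * s * x) : x ≤ 10 * Q ^ 3 * s := by
  have hQ3 : 1 ≤ Q ^ 3 := one_le_pow₀ hQ
  have hQQ : Q ≤ Q ^ 3 := le_self_pow₀ hQ (by norm_num)
  have hQh : 10000 * (Q * h) ≤ 1 := by nlinarith
  have a1 := le_abs_self (-(a - x ^ 2))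
  rw [abs_neg] at a1
  have a2 := le_abs_self a
  have b1 : 60 * Q * h * R ≤ 60 * Q * h * (11 * Q ^ 3 * s * x) := by gcongr
  have y0 : 0 ≤ Q ^ 3 * s * x := by positivity
  have b2 : 60 * Q * h * (11 * Q ^ 3 * s * x) ≤ 1 / 10 * (Q ^ 3 * s * x) := by nlinarith
  have b3 : 240 * Q ^ 4 * h * x ≤ 1 / 10 * (Q ^ 3 * s * x) := by
    have : 240 * Q ^ 4 * h * x = 240 * (Q * h) * (Q ^ 3 * x) := by ring
    rw [this]
    have : Q ^ 3 * x ≤ Q ^ 3 * s * x := by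
      have : 0 ≤ Q ^ 3 * x := by positivity
      nlinarith
    nlinarith
  have b4 : 60 * m * x ^ 2 ≤ 3 / 200 * x ^ 2 := by nlinarith [sq_nonneg x]
  have b5 : x * x ≤ (10 * Q ^ 3 * s) * x := by nlinarith
  by_contra hc
  push Not at hc
  have : 0 < x := lt_of_le_of_lt (by positivity) hc
  nlinarith

lemma arith_dual {x s b U d l y R aWE aEwV aEV geo aDVw aDw q yw aDV r : ℝ} (hs : 0 < s) (hQ : 1 ≤ Q) (hh : 0 < h)
    (hsm : 10000 * Q ^ 3 * h ≤ 1) (hb : 1 ≤ b) (x0 : 0 ≤ x) (U0 : 0 ≤ U) (d0 : 0 ≤ d) (q0 : 0 ≤ q)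
    (hx : x ≤ 10 * Q ^ 3 * b) (hU : U ≤ 11 * Q ^ 3 * b) (hd : d ≤ 9 * Q ^ 3 * b) (hl : l ≤ 2 * Q * (400 * Q ^ 3 * h) * b)
    (hq : q ≤ Q * h * s) (hyw : yw ≤ 2 * s) (hy : y ≤ yw + q)
    (h1 : |aWE - s ^ 2| ≤ h * s * x) (h2 : aWE = aEwV + aEV) (h3 : |aEwV| ≤ x * q)
    (h4 : |R - aEV| ≤ 60 * (Q * h) * geo) (hgeo : geo ≤ x * y)
    (h5 : |R| ≤ 60 * Q * h * r + |aDV| + 240 * Q ^ 4 * h * y) (hr : r ≤ U * y)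
    (h6 : aDV = aDVw + aDw) (h7 : |aDVw| ≤ d * q) (h8 : |aDw| ≤ s * l + h * s * d) :
    s ≤ 6000 * Q ^ 4 * h * b := by
  have hQ3 : 1 ≤ Q ^ 3 := one_le_pow₀ hQ
  have hQh : Q * h ≤ 1 := by
    have : Q ≤ Q ^ 3 := le_self_pow₀ hQ (by norm_num)
    nlinarith
  have y3 : y ≤ 3 * s := by nlinarith
  set t := Q ^ 4 * h * b with ht
  have t0 : 0 < t := by positivity
  have hhQ : h ≤ Q * h := by nlinarith
  have g1 : h * s * x ≤ s * (10 * t) := by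
    calc h * s * x ≤ (Q * h) * s * (10 * Q ^ 3 * b) := by gcongr
      _ = _ := by rw [ht]; ring
  have g2 : x * q ≤ s * (10 * t) := by
    calc x * q ≤ (10 * Q ^ 3 * b) * (Q * h * s) := mul_le_mul hx hq q0 (by positivity)
      _ = _ := by rw [ht]; ring
  have g3 : 60 * (Q * h) * geo ≤ s * (1800 * t) := by
    calc 60 * (Q * h) * geo ≤ 60 * (Q * h) * ((10 * Q ^ 3 * b) * (3 * s)) := by
          refine mul_le_mul_of_nonneg_left (hgeo.trans ?_) (by positivity)
          calc x * y ≤ x * (3 * s) := by gcongr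
            _ ≤ _ := by gcongr
      _ = _ := by rw [ht]; ring
  have g4 : 60 * Q * h * r ≤ s * (1980 * t) := by
    calc 60 * Q * h * r ≤ 60 * Q * h * ((11 * Q ^ 3 * b) * (3 * s)) := by
          refine mul_le_mul_of_nonneg_left (hr.trans ?_) (by positivity)
          calc U * y ≤ U * (3 * s) := by gcongr
            _ ≤ _ := by gcongr
      _ = _ := by rw [ht]; ring
  have g5 : 240 * Q ^ 4 * h * y ≤ s * (720 * t) := by
    calc 240 * Q ^ 4 * h * y ≤ 240 * Q ^ 4 * h * (3 * s) := by gcongr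
      _ = 720 * s * (Q ^ 4 * h) * 1 := by ring
      _ ≤ 720 * s * (Q ^ 4 * h) * b := by gcongr
      _ = _ := by rw [ht]; ring
  have g6 : d * q ≤ s * (9 * t) := by
    calc d * q ≤ (9 * Q ^ 3 * b) * (Q * h * s) := mul_le_mul hd hq q0 (by positivity)
      _ = _ := by rw [ht]; ring
  have g7 : s * l ≤ s * (800 * t) := by
    refine mul_le_mul_of_nonneg_left (hl.trans (le_of_eq ?_)) hs.le
    rw [ht]; ring
  have g8 : h * s * d ≤ s * (9 * t) := by
    calc h * s * d ≤ (Q * h) * s * (9 * Q ^ 3 * b) := by gcongr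
      _ = _ := by rw [ht]; ring
  have a1 := (abs_le.1 h1).1
  have a3 := le_abs_self aEwV
  have a4 := (abs_le.1 h4).1
  have a5 := le_abs_self R
  have a6 := abs_add_le aDVw aDw
  rw [← h6] at a6
  have fin : s * s ≤ s * (6000 * t) := by nlinarith
  have := le_of_mul_le_mul_left fin hs
  rw [ht] at this
  linarith

namespace ErrHyp

lemma he (H : ErrHyp Srf K ρ γ h m r₁ c Z A Q δ η B z₀ ζ Tr u lh) : Tr.IsVh (fun x => u x - lh x) := H.hu.sub H.hl

lemma Lip_E (H : ErrHyp Srf K ρ γ h m r₁ c Z A Q δ η B z₀ ζ Tr u lh) : Srf.Lip (Tr.liftS (fun x => u x - lh x)) :=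
  H.a.M.Lip_lift H.he

lemma sB (H : ErrHyp Srf K ρ γ h m r₁ c Z A Q δ η B z₀ ζ Tr u lh) : 1 ≤ √B := Real.one_le_sqrt.2 H.a.B1

lemma enE (H : ErrHyp Srf K ρ γ h m r₁ c Z A Q δ η B z₀ ζ Tr u lh) :
    Srf.en (Tr.liftS (fun x => u x - lh x)) ≤ 10 * Q ^ 3 * √B := by
  have hG := H.a.M.geo
  have h1 := H.a.M.geo_form H.he H.he
  have h2 := H.R_le H.he
  have h3 := (hG.int_pepe H.Lip_u H.Lip_E).2
  have h4 := (hG.int_pepe H.Lip_E H.Lip_E).2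
  have h5 := hG.aForm_cs H.Lip_D H.Lip_E
  have e0 := Srf.en_nonneg (Tr.liftS (fun x => u x - lh x))
  rw [← Srf.en_sq] at h1
  have hm := H.a.M.m_pos
  refine arith_en e0 H.a.Q1 H.a.hpos H.a.sm H.a.M.small H.sB (h1.trans ?_) h2 (h3.trans ?_) (h5.trans ?_)
  · rw [pow_two]; gcongr
  · exact mul_le_mul_of_nonneg_right H.enI e0
  · exact mul_le_mul_of_nonneg_right H.enD e0

lemma l2E (H : ErrHyp Srf K ρ γ h m r₁ c Z A Q δ η B z₀ ζ Tr u lh) :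
    Srf.l2 (Tr.liftS (fun x => u x - lh x)) ≤ 6000 * Q ^ 4 * h * √B := by
  have hG := H.a.M.geo
  have hh := H.a.hpos
  have hQ := H.a.Q1
  have hE := H.Lip_E
  have hDL := H.Lip_D
  set E := Tr.liftS (fun x => u x - lh x) with hEd
  rcases (Srf.l2_nonneg E).eq_or_lt with h0 | hs
  · rw [← h0]; positivity
  have hε : 0 < h * Srf.l2 E := by positivity
  have hh1 : h ≤ 1 := by linarith [H.a.h_le]
  obtain ⟨w, hw, hwe, hsol⟩ := hG.approx_sol hE hε
  have hw2 : Srf.en w ≤ 2 * Srf.l2 E := by nlinarith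
  obtain ⟨v, hv, hvw⟩ := H.a.M.quasi H.a.sml hw (C₁ := 390 * K + 4) hs.le hw2 (by
    intro y hy
    refine (hG.regularity H.a.sml hy hE hw hε hwe hsol).trans ?_
    have hK := hG.K_pos
    have : 130 * K * ‖y‖ ≤ 130 * K * (3 * h) := by gcongr
    nlinarith)
  have hV := H.a.M.Lip_lift hv
  set V := Tr.liftS v with hVd
  have hVw : Srf.Lip (fun x => V x - w x) := hV.sub hw
  have hq : Srf.en (fun x => V x - w x) ≤ Q * h * Srf.l2 E := by
    refine hvw.trans ?_
    have := H.a.qq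
    gcongr
  have eq1 : Srf.en V ≤ Srf.en w + Srf.en (fun x => V x - w x) := by
    have := hG.en_add hw hVw
    have e : (fun x => w x + (V x - w x)) = V := by funext x; ring
    rwa [e] at this
  have s1 := hsol E hE
  have s1' : ∫ x, E x * E x ∂Srf.ms = Srf.l2 E ^ 2 := by
    rw [Srf.l2_sq]; congr 1; funext x; ring
  rw [s1'] at s1
  have s2 := hsol _ hDL
  have s3 := hG.l2_cs hE hDL
  have k1 := hG.aForm_sub_right hV hw hE
  have k2 := hG.aForm_sub_right hV hw hDL
  have R1 := H.R_le hv
  have G1 := H.a.M.geo_form H.he hv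
  have P1 := (hG.int_pepe H.Lip_u hV).2
  have P2 := (hG.int_pepe hE hV).2
  have G0 : 0 ≤ ∫ x, Srf.pe E x * Srf.pe V x ∂Srf.ms :=
    integral_nonneg (fun x => mul_nonneg (Srf.pe_nonneg _ _) (Srf.pe_nonneg _ _))
  refine arith_dual (aWE := Srf.aForm w E) (aEwV := -Srf.aForm E (fun x => V x - w x)) (aEV := Srf.aForm E V)
    (R := Tr.ahForm (fun x => u x - lh x) v)
    (geo := ∫ x, Srf.pe E x * Srf.pe V x ∂Srf.ms) (aDVw := Srf.aForm (Tr.dd z₀ ζ δ u) (fun x => V x - w x))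
    (aDw := Srf.aForm (Tr.dd z₀ ζ δ u) w) (l := Srf.l2 (Tr.dd z₀ ζ δ u))
    hs hQ hh H.a.sm H.sB (Srf.en_nonneg E) (Srf.en_nonneg (Tr.liftS u)) (Srf.en_nonneg (Tr.dd z₀ ζ δ u)) (Srf.en_nonneg _)
    H.enE H.enI H.enD ?_ hq hw2 eq1 s1 ?_ ?_ ?_ P2 R1 P1 ?_ (hG.aForm_cs hDL hVw) ?_
  · have := H.l2D
    rwa [H.a.hη] at this
  · rw [k1, Srf.aForm_symm w E]; ring
  · rw [abs_neg]; exact hG.aForm_cs hE hVw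
  · refine G1.trans ?_
    have := H.a.q5
    gcongr
  · rw [k2]; ring
  · rw [Srf.aForm_symm]
    have := abs_add_le (Srf.aForm w (Tr.dd z₀ ζ δ u) - ∫ x, E x * Tr.dd z₀ ζ δ u x ∂Srf.ms) (∫ x, E x * Tr.dd z₀ ζ δ u x ∂Srf.ms)
    rw [sub_add_cancel] at this
    linarith

end ErrHyp

end

section
variable {Srf : SmoothSurface} {K ρ : ℝ}
variable {γ h m : ℝ} {Tr : Triangulation Srf γ h}
variable {r₁ c Z A Q δ η B : ℝ} {z₀ : E3} {ζ : E3 → ℝ} {u lh v : E3 → ℝ}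

lemma arith_wM {r g e a rem sd lin : ℝ} (hQ : 1 ≤ Q) (hh : 0 < h) (hr : 0 < r) (hrQ : r ≤ Q) (hg : 0 ≤ g) (hm0 : 0 < m)
    (hm : m ≤ Q * h) (hm1 : 4000 * m ≤ 1) (h1 : |rem| ≤ 2 * m * h * g) (h2 : |a| ≤ g * (2 * h)) (h3 : |sd| ≤ 5 * h * r)
    (h4 : |sd - lin| ≤ 12 * Q ^ 2 * h ^ 2) :
    |(r ^ 2 + sd) * (e + a + rem) - r ^ 2 * e - (r ^ 2 * a + e * lin)| ≤ 17 * Q ^ 2 * h ^ 2 * (r * g + |e|) := by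
  have e1 : (r ^ 2 + sd) * (e + a + rem) - r ^ 2 * e - (r ^ 2 * a + e * lin) = r ^ 2 * rem + sd * (a + rem) + e * (sd - lin) := by ring
  rw [e1]
  refine (abs_add_three _ _ _).trans ?_
  rw [abs_mul, abs_mul, abs_mul, abs_of_nonneg (sq_nonneg r)]
  have b1 : r ^ 2 * |rem| ≤ 2 * Q ^ 2 * h ^ 2 * (r * g) := by
    calc r ^ 2 * |rem| ≤ r ^ 2 * (2 * m * h * g) := by gcongr
      _ = 2 * m * h * (r * g) * r := by ring
      _ ≤ 2 * (Q * h) * h * (r * g) * Q := by gcongr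
      _ = _ := by ring
  have b2 : |a + rem| ≤ 3 * h * g := by
    refine (abs_add_le _ _).trans ?_
    have : 0 ≤ h * g := by positivity
    nlinarith
  have b3 : |sd| * |a + rem| ≤ 15 * Q ^ 2 * h ^ 2 * (r * g) := by
    calc |sd| * |a + rem| ≤ (5 * h * r) * (3 * h * g) := by gcongr
      _ = 15 * 1 * h ^ 2 * (r * g) := by ring
      _ ≤ _ := by
        have : 1 ≤ Q ^ 2 := one_le_pow₀ hQ
        gcongr
  have b4 : |e| * |sd - lin| ≤ |e| * (12 * Q ^ 2 * h ^ 2) := by gcongr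
  have : 0 ≤ Q ^ 2 * h ^ 2 * |e| := by positivity
  nlinarith

lemma arith_wnu {r g Y ν : ℝ} (hQ : 1 ≤ Q) (hh : 0 < h) (hr : 0 < r) (hrQ : r ≤ Q) (hg : 0 ≤ g) (hY : 0 ≤ Y)
    (hγ : 0 < γ) (hγQ : 1 / γ ≤ Q) (hm : m ≤ Q * h) (hηr : 400 * Q ^ 3 * h ≤ r)
    (hν : ν ≤ 2 * (17 * Q ^ 2 * h ^ 2 * (r * g + Y) / (γ * h)) + 4 * m * (r ^ 2 * g + 2 * r * Y)) : ν ≤ r / 8 * (r * g + Y) := by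
  set y := r * g + Y with hy
  have hy0 : 0 ≤ y := by positivity
  have a1 : 2 * (17 * Q ^ 2 * h ^ 2 * y / (γ * h)) = 34 * Q ^ 2 * h * (1 / γ) * y := by field_simp; ring
  have a2 : 34 * Q ^ 2 * h * (1 / γ) * y ≤ 34 * Q ^ 2 * h * Q * y := by gcongr
  have a3 : r ^ 2 * g + 2 * r * Y ≤ 2 * Q * y := by
    have : r * (r * g + 2 * Y) ≤ Q * (2 * y) := by
      have : 0 ≤ r * g := by positivity
      refine mul_le_mul hrQ ?_ (by positivity) (by linarith)
      rw [hy]; linarith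
    nlinarith
  have a4 : 4 * m * (r ^ 2 * g + 2 * r * Y) ≤ 4 * (Q * h) * (2 * Q * y) := by gcongr
  have a5 : Q ^ 2 * h * y ≤ Q ^ 3 * h * y := by
    have : Q ^ 2 ≤ Q ^ 3 := pow_le_pow_right₀ hQ (by norm_num)
    gcongr
  have a6 : Q ^ 3 * h * y * 400 ≤ r * y := by nlinarith
  have : 0 ≤ r * y := by positivity
  nlinarith

lemma arith_w1 {r g Y ip il id V e M : ℝ} (hr : 0 < r) (hg : 0 ≤ g) (hY : Y = |e|)
    (h1 : r ^ 2 * g ^ 2 - 2 * (r * g) * Y ≤ il) (h2 : |id| ≤ g * (r / 8 * (r * g + Y))) (hip : ip = il + id)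
    (hV : |V - r ^ 2 * e| ≤ M) (hM : M ≤ 1 / 8 * (r * g + Y)) : (r * g) ^ 2 / 2 - 5 * Y ^ 2 ≤ ip + e * V := by
  have hY0 : 0 ≤ Y := by rw [hY]; positivity
  have a1 := (abs_le.1 h2).1
  have a2 : |e * (V - r ^ 2 * e)| ≤ Y * (1 / 8 * (r * g + Y)) := by
    rw [abs_mul, ← hY]
    exact mul_le_mul_of_nonneg_left (hV.trans hM) hY0
  have a3 := (abs_le.1 a2).1
  have e1 : e * V = r ^ 2 * Y ^ 2 + e * (V - r ^ 2 * e) := by rw [hY, sq_abs]; ring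
  set X := r * g with hX
  have e2 : g * (r / 8 * (X + Y)) = X * (X + Y) / 8 := by rw [hX]; ring
  have e3 : r ^ 2 * g ^ 2 = X ^ 2 := by rw [hX]; ring
  rw [e2] at a1
  rw [e3] at h1
  have : 0 ≤ r ^ 2 * Y ^ 2 := by positivity
  nlinarith [sq_nonneg (X - 4 * Y), sq_nonneg (X - Y)]

lemma arith_w2 {r g Y nl nd nV V e M : ℝ} (hQ : 1 ≤ Q) (hr : 0 < r) (hrQ : r ≤ Q) (hg : 0 ≤ g) (hY : Y = |e|)
    (h1 : nl ≤ r ^ 2 * g + 2 * r * Y) (h2 : nd ≤ r / 8 * (r * g + Y)) (hip : nV ≤ nl + nd)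
    (hV : |V - r ^ 2 * e| ≤ M) (hM : M ≤ r * (r * g + Y)) : nV + |V| ≤ 5 * Q * r * (r * g + Y) := by
  have hY0 : 0 ≤ Y := by rw [hY]; positivity
  have a1 := abs_add_le (V - r ^ 2 * e) (r ^ 2 * e)
  rw [sub_add_cancel, abs_mul, ← hY, abs_of_nonneg (sq_nonneg r)] at a1
  have X0 : 0 ≤ r * g := by positivity
  have b1 : r ^ 2 * Y ≤ Q * r * Y := by rw [pow_two]; gcongr
  have b2 : r * (r * g) ≤ Q * r * (r * g) := by
    have := mul_nonneg hr.le X0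
    nlinarith
  have b3 : r * Y ≤ Q * r * Y := by
    have := mul_nonneg hr.le hY0
    nlinarith
  nlinarith

namespace ErrHyp

/-- pointwise properties of the weighted test function -/
lemma wt_pt (H : ErrHyp Srf K ρ γ h m r₁ c Z A Q δ η B z₀ ζ Tr u lh) {f : E3 → ℝ} (hf : Tr.IsVh f) :
    ∃ v, Tr.IsVh v ∧ ∀ p ∈ Srf.S,
    DifferentiableWithinAt ℝ (Tr.liftS f) Srf.S p → DifferentiableWithinAt ℝ (Tr.liftS v) Srf.S p →
    (rt z₀ η p * ‖Srf.grad (Tr.liftS f) p‖) ^ 2 / 2 - 5 * |Tr.liftS f p| ^ 2 ≤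
      ⟪Srf.grad (Tr.liftS f) p, Srf.grad (Tr.liftS v) p⟫ + Tr.liftS f p * Tr.liftS v p ∧
    Srf.pe (Tr.liftS v) p ≤ 5 * Q * rt z₀ η p * (rt z₀ η p * ‖Srf.grad (Tr.liftS f) p‖ + |Tr.liftS f p|) := by
  obtain ⟨v, hv, hvq⟩ := Tr.exists_interp (fun q => rho2 z₀ η q * Tr.liftS f q)
  refine ⟨v, hv, ?_⟩
  intro p hp
  obtain ⟨t, ht, x, hx, rfl⟩ := H.a.M.cover hp
  intro hdf hdv
  have hG := H.a.M.geo
  have hh := H.a.hpos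
  have hQ := H.a.Q1
  have hm0 := H.a.M.m_pos
  have hgn := H.a.M.grad_n x (Tr.liftS f)
  have hLV := fun q hq => H.a.M.lift_vert ht hx hf hdf (q := q) hq
  have hvn := fun q hq => H.a.M.vert_near ht hx (y := q) (vertsOf_sub t hq)
  have hb0 := fun (ℓ : E3) (M : ℝ) hℓ => H.a.M.interp_pt ht hx hv hdv (ℓ := ℓ) (M := M) (α := rho2 z₀ η (Srf.proj x) * Tr.liftS f (Srf.proj x)) hℓ
  have hvq' : ∀ q ∈ vertsOf t, Tr.liftS v q = rho2 z₀ η q * Tr.liftS f q := by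
    intro q hq
    have e := H.a.M.lift_eq ht (vertsOf_sub t hq) v
    rwa [hG.proj_self (Tr.verts_on t ht hq), hvq t ht q hq] at e
  have r0 := rt_pos (z₀ := z₀) H.a.η_pos (Srf.proj x)
  have rQ := H.a.rt_le hp
  have rge := H.a.rt_ge (Srf.proj x)
  have rge' : ‖Srf.proj x - z₀‖ ≤ rt z₀ η (Srf.proj x) := AsmHyp.rt_ge' _
  generalize hpx : Srf.proj x = p at *
  rw [← rt_sq z₀ η p] at hb0
  set r := rt z₀ η p with hr
  set E := Tr.liftS f with hE
  set G := Srf.grad E p with hGd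
  set ℓ : E3 := r ^ 2 • G + (2 * E p) • Srf.Pt p (p - z₀) with hℓ
  have hℓn : ⟪Srf.n p, ℓ⟫ = 0 := by
    rw [hℓ, inner_add_right, inner_smul_right, inner_smul_right, hgn, Srf.inner_n_Pt hp]; ring
  have hPn : ‖Srf.Pt p (p - z₀)‖ ≤ r := (Srf.Pt_norm_le p _).trans rge'
  have hη400 : 400 * Q ^ 3 * h ≤ r := by rw [← H.a.hη]; exact rge
  have hr400 : 400 * h ≤ r := H.a.η_ge.trans rge
  have key : ∀ q ∈ vertsOf t, |Tr.liftS v q - r ^ 2 * E p - ⟪ℓ, q - p⟫| ≤ 17 * Q ^ 2 * h ^ 2 * (r * ‖G‖ + |E p|) := by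
    intro q hq
    have hqS := Tr.verts_on t ht hq
    have hqp := hvn q hq
    have e1 : rho2 z₀ η q = r ^ 2 + (2 * ⟪p - z₀, q - p⟫ + ‖q - p‖ ^ 2) := by
      rw [hr, rt_sq]
      unfold rho2
      have : q - z₀ = (p - z₀) + (q - p) := by abel
      rw [this, norm_add_sq_real]; ring
    have e2 : E q = E p + ⟪G, q - p⟫ + (E q - E p - ⟪G, q - p⟫) := by ring
    have e3 : ⟪ℓ, q - p⟫ = r ^ 2 * ⟪G, q - p⟫ + E p * (2 * ⟪Srf.Pt p (p - z₀), q - p⟫) := by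
      rw [hℓ, inner_add_left, real_inner_smul_left, real_inner_smul_left]; ring
    have hn1 := Srf.n_unit p hp
    have i1 : |⟪p - z₀, q - p⟫| ≤ r * (2 * h) :=
      (abs_real_inner_le_norm _ _).trans (mul_le_mul rge' hqp (norm_nonneg _) r0.le)
    have i2 : ‖q - p‖ ^ 2 ≤ 4 * h ^ 2 := by
      calc ‖q - p‖ ^ 2 ≤ (2 * h) ^ 2 := by gcongr
        _ = _ := by ring
    have i3 : |2 * ⟪p - z₀, q - p⟫ + ‖q - p‖ ^ 2| ≤ 5 * h * r := by
      refine (abs_add_le _ _).trans ?_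
      rw [abs_mul, abs_of_nonneg (sq_nonneg ‖q - p‖), abs_two]
      nlinarith
    have i4 : |2 * ⟪p - z₀, q - p⟫ + ‖q - p‖ ^ 2 - 2 * ⟪Srf.Pt p (p - z₀), q - p⟫| ≤ 12 * Q ^ 2 * h ^ 2 := by
      have j1 : ⟪p - z₀, q - p⟫ - ⟪Srf.Pt p (p - z₀), q - p⟫ = ⟪Srf.n p, p - z₀⟫ * ⟪Srf.n p, q - p⟫ := by
        rw [← inner_sub_left, Srf.Pt_apply hp, sub_sub_cancel, real_inner_smul_left]
      have j2 : 2 * ⟪p - z₀, q - p⟫ + ‖q - p‖ ^ 2 - 2 * ⟪Srf.Pt p (p - z₀), q - p⟫ =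
        2 * (⟪Srf.n p, p - z₀⟫ * ⟪Srf.n p, q - p⟫) + ‖q - p‖ ^ 2 := by rw [← j1]; ring
      have j3 : |⟪Srf.n p, p - z₀⟫| ≤ Q := by
        refine (abs_real_inner_le_norm _ _).trans ?_
        rw [hn1, one_mul]; exact rge'.trans rQ
      have j4 : |⟪Srf.n p, q - p⟫| ≤ Q * (4 * h ^ 2) := by
        refine (hG.quad p hp q hqS).trans ?_
        have := H.a.q6
        have := hG.K_pos
        gcongr
      rw [j2]
      refine (abs_add_le _ _).trans ?_
      rw [abs_mul, abs_of_nonneg (sq_nonneg ‖q - p‖), abs_two, abs_mul]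
      have j5 : |⟪Srf.n p, p - z₀⟫| * |⟪Srf.n p, q - p⟫| ≤ Q * (Q * (4 * h ^ 2)) := by gcongr
      have j6 : h ^ 2 ≤ Q ^ 2 * h ^ 2 := by
        have : 1 ≤ Q ^ 2 := one_le_pow₀ hQ
        nlinarith [sq_nonneg h]
      nlinarith
    have i5 : |⟪G, q - p⟫| ≤ ‖G‖ * (2 * h) :=
      (abs_real_inner_le_norm _ _).trans (mul_le_mul_of_nonneg_left hqp (norm_nonneg _))
    have fin := arith_wM (e := E p) hQ hh r0 rQ (norm_nonneg G) hm0 H.a.q5 H.a.M.small (hLV q hq) i5 i3 i4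
    rw [← e2, ← e1, ← e3] at fin
    rwa [hvq' q hq]
  obtain ⟨f1, f2⟩ := hb0 ℓ _ hℓn key
  have hℓle : ‖ℓ‖ ≤ r ^ 2 * ‖G‖ + 2 * r * |E p| := by
    refine (norm_add_le _ _).trans ?_
    rw [norm_smul, norm_smul, Real.norm_eq_abs, Real.norm_eq_abs, abs_of_nonneg (sq_nonneg r), abs_mul, abs_two]
    have : 2 * |E p| * ‖Srf.Pt p (p - z₀)‖ ≤ 2 * |E p| * r := by gcongr
    linarith
  have f3 := arith_wnu hQ hh r0 rQ (norm_nonneg G) (abs_nonneg (E p)) H.a.M.γpos H.a.q4 H.a.q5 hη400 (f2.trans (by gcongr))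
  have hy0 : 0 ≤ r * ‖G‖ + |E p| := by positivity
  have hQh : 10000 * (Q ^ 2 * h) ≤ 1 := by
    have : Q ^ 2 ≤ Q ^ 3 := pow_le_pow_right₀ hQ (by norm_num)
    nlinarith [H.a.sm]
  have hQh2 : 17 * Q ^ 2 * h ^ 2 ≤ h := by nlinarith
  constructor
  · refine arith_w1 (M := 17 * Q ^ 2 * h ^ 2 * (r * ‖G‖ + |E p|)) (il := ⟪G, ℓ⟫) (id := ⟪G, Srf.grad (Tr.liftS v) p - ℓ⟫) r0 (norm_nonneg G) rfl ?_ ?_ ?_ f1 ?_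
    · rw [hℓ, inner_add_right, inner_smul_right, inner_smul_right, real_inner_self_eq_norm_sq]
      have k1 : |2 * E p * ⟪G, Srf.Pt p (p - z₀)⟫| ≤ 2 * |E p| * (‖G‖ * r) := by
        rw [abs_mul, abs_mul, abs_two]
        have := (abs_real_inner_le_norm G (Srf.Pt p (p - z₀))).trans (mul_le_mul_of_nonneg_left hPn (norm_nonneg G))
        gcongr
      have := (abs_le.1 k1).1
      linarith
    · exact (abs_real_inner_le_norm _ _).trans (mul_le_mul_of_nonneg_left f3 (norm_nonneg _))
    · rw [← inner_add_right, add_sub_cancel]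
    · have := H.a.h_le
      refine mul_le_mul_of_nonneg_right ?_ hy0
      linarith
  · refine (pe_le_add _ _).trans ?_
    refine arith_w2 (M := 17 * Q ^ 2 * h ^ 2 * (r * ‖G‖ + |E p|)) hQ r0 rQ (norm_nonneg G) rfl hℓle f3 ?_ f1 ?_
    · have := norm_add_le ℓ (Srf.grad (Tr.liftS v) p - ℓ)
      rwa [add_sub_cancel] at this
    · refine mul_le_mul_of_nonneg_right ?_ hy0
      linarith

end ErrHyp

end

section
variable {Srf : SmoothSurface} {K ρ : ℝ}
variable {γ h m : ℝ} {Tr : Triangulation Srf γ h}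
variable {r₁ c Z A Q δ η B : ℝ} {z₀ : E3} {ζ : E3 → ℝ} {u lh v : E3 → ℝ}

lemma arith_wt {s b x l a R P U d y : ℝ} (hQ : 1 ≤ Q) (hh : 0 < h) (hsm : 10000 * Q ^ 3 * h ≤ 1) (hb : 1 ≤ b)
    (hs : 0 ≤ s) (hl0 : 0 ≤ l) (hl : l ≤ 6000 * Q ^ 4 * h * b) (h1 : x / 2 - 5 * l ^ 2 ≤ a)
    (h2 : |R - a| ≤ 60 * (Q * h) * P) (hP : P ≤ 5 * Q ^ 2 * s ^ 2)
    (h3 : |R| ≤ 60 * Q * h * U + d + 240 * Q ^ 4 * h * y) (hU : U ≤ 55 * Q ^ 5 * (s * b))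
    (hd : d ≤ 45 * Q ^ 4 * (400 * Q ^ 3 * h) * (s * b)) (hy : y ≤ 5 * Q ^ 2 * s) (hx : s ^ 2 ≤ 2 * (x + l ^ 2)) :
    s ≤ 200000 * Q ^ 7 * h * b := by
  set t := Q ^ 7 * h * b with ht
  have t0 : 0 < t := by positivity
  have q1 : Q ^ 6 ≤ Q ^ 7 := pow_le_pow_right₀ hQ (by norm_num)
  have q2 : Q ^ 4 ≤ Q ^ 7 := pow_le_pow_right₀ hQ (by norm_num)
  have g1 : 60 * (Q * h) * P ≤ 3 / 100 * s ^ 2 := by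
    calc 60 * (Q * h) * P ≤ 60 * (Q * h) * (5 * Q ^ 2 * s ^ 2) := by gcongr
      _ = 3 / 100 * (10000 * Q ^ 3 * h) * s ^ 2 := by ring
      _ ≤ 3 / 100 * 1 * s ^ 2 := by gcongr
      _ = _ := by ring
  have g2 : 60 * Q * h * U ≤ 3300 * t * s := by
    calc 60 * Q * h * U ≤ 60 * Q * h * (55 * Q ^ 5 * (s * b)) := by gcongr
      _ = 3300 * (Q ^ 6 * h * b) * s := by ring
      _ ≤ 3300 * (Q ^ 7 * h * b) * s := by gcongr
  have g3 : d ≤ 18000 * t * s := hd.trans (le_of_eq (by rw [ht]; ring))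
  have g4 : 240 * Q ^ 4 * h * y ≤ 1200 * t * s := by
    calc 240 * Q ^ 4 * h * y ≤ 240 * Q ^ 4 * h * (5 * Q ^ 2 * s) := by gcongr
      _ = 1200 * (Q ^ 6 * h * 1) * s := by ring
      _ ≤ 1200 * (Q ^ 7 * h * b) * s := by gcongr
  have g5 : l ≤ 6000 * t := hl.trans (by
    calc 6000 * Q ^ 4 * h * b ≤ 6000 * Q ^ 7 * h * b := by gcongr
      _ = _ := by rw [ht]; ring)
  have g6 : l ^ 2 ≤ 36000000 * t ^ 2 := by
    calc l ^ 2 ≤ (6000 * t) ^ 2 := by gcongr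
      _ = _ := by ring
  have a1 := (abs_le.1 h2).1
  have a2 := le_abs_self R
  have key : s ^ 2 ≤ 22 * (36000000 * t ^ 2) + 90000 * t * s + 3 / 25 * s ^ 2 := by linarith
  have : s ≤ 200000 * t := by
    by_contra hc
    push Not at hc
    nlinarith
  rw [ht] at this; linarith

lemma arith_pv {X Y r g Q pE pV : ℝ} (hQ : 1 ≤ Q) (hr : 0 ≤ r) (hrQ : r ≤ Q) (hg : 0 ≤ g) (hY : 0 ≤ Y) (hX : X = r * g)
    (hE : pE ≤ g + Y) (h0 : 0 ≤ pV) (hV : pV ≤ 5 * Q * r * (X + Y)) :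
    pE * pV ≤ 5 * Q ^ 2 * (X + Y) ^ 2 := by
  have X0 : 0 ≤ X := by rw [hX]; positivity
  have k : r * (g + Y) ≤ Q * (X + Y) := by
    have e1 : r * Y ≤ Q * Y := by gcongr
    have e2 : X ≤ Q * X := by nlinarith
    calc r * (g + Y) = X + r * Y := by rw [hX]; ring
      _ ≤ _ := by linarith
  calc pE * pV ≤ (g + Y) * pV := by gcongr
    _ ≤ (g + Y) * (5 * Q * r * (X + Y)) := by gcongr
    _ = 5 * Q * (X + Y) * (r * (g + Y)) := by ring
    _ ≤ 5 * Q * (X + Y) * (Q * (X + Y)) := by gcongr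
    _ = _ := by ring

lemma arith_pd {G t r Q pD pV : ℝ} (hQ : 1 ≤ Q) (ht : 0 < t) (hr : 0 < r) (hη : 0 < η) (hV : pV ≤ 5 * Q * r * G) (h0 : 0 ≤ pV)
    (hD : pD ≤ 9 * Q ^ 3 * (η / (t * r))) : pD * pV ≤ 45 * Q ^ 4 * η * (G * (1 / t)) := by
  calc pD * pV ≤ 9 * Q ^ 3 * (η / (t * r)) * pV := by gcongr
    _ ≤ 9 * Q ^ 3 * (η / (t * r)) * (5 * Q * r * G) := by gcongr
    _ = _ := by field_simp; ring

/-- the weighted error density -/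
def SmoothSurface.gw (Srf : SmoothSurface) (z₀ : E3) (η : ℝ) (E : E3 → ℝ) (p : E3) : ℝ :=
  rt z₀ η p * ‖Srf.grad E p‖ + |E p|

namespace AsmHyp

lemma int_X (H : AsmHyp Srf K ρ γ h m r₁ c Z A Q δ η B z₀ ζ Tr) {E : E3 → ℝ} (hE : Srf.Lip E) :
    Integrable (fun p => (rt z₀ η p * ‖Srf.grad E p‖) ^ 2) Srf.ms := by
  have hG := H.M.geo
  refine Integrable.mono' ((hG.int_sq_grad hE).const_mul (Q ^ 2))
    (((rt_meas z₀ η).aestronglyMeasurable.mul (hG.meas_grad E).norm).pow 2) ?_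
  filter_upwards [Srf.ae_mem] with p hp
  have h1 := H.rt_le hp
  have h2 := (rt_pos (z₀ := z₀) H.η_pos p).le
  rw [Real.norm_eq_abs, abs_of_nonneg (sq_nonneg _), mul_pow]
  gcongr

lemma gw_meas (H : AsmHyp Srf K ρ γ h m r₁ c Z A Q δ η B z₀ ζ Tr) {E : E3 → ℝ} (hE : Srf.Lip E) :
    AEStronglyMeasurable (Srf.gw z₀ η E) Srf.ms :=
  ((rt_meas z₀ η).aestronglyMeasurable.mul (H.M.geo.meas_grad E).norm).add hE.meas.norm

lemma gw_nonneg (H : AsmHyp Srf K ρ γ h m r₁ c Z A Q δ η B z₀ ζ Tr) (E : E3 → ℝ) (p : E3) : 0 ≤ Srf.gw z₀ η E p := by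
  have h2 := (rt_pos (z₀ := z₀) H.η_pos p).le
  unfold SmoothSurface.gw; positivity

lemma gw_sq (H : AsmHyp Srf K ρ γ h m r₁ c Z A Q δ η B z₀ ζ Tr) {E : E3 → ℝ} (hE : Srf.Lip E) :
    Integrable (fun p => Srf.gw z₀ η E p ^ 2) Srf.ms ∧
    ∫ p, Srf.gw z₀ η E p ^ 2 ∂Srf.ms ≤ 2 * (∫ p, (rt z₀ η p * ‖Srf.grad E p‖) ^ 2 ∂Srf.ms + Srf.l2 E ^ 2) := by
  have i1 := H.int_X hE
  have i2 := H.M.geo.int_sq hE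
  have i3 : Integrable (fun p => 2 * ((rt z₀ η p * ‖Srf.grad E p‖) ^ 2 + E p ^ 2)) Srf.ms := (i1.add i2).const_mul 2
  have k : ∀ p, Srf.gw z₀ η E p ^ 2 ≤ 2 * ((rt z₀ η p * ‖Srf.grad E p‖) ^ 2 + E p ^ 2) := by
    intro p
    unfold SmoothSurface.gw
    have := sq_abs (E p)
    nlinarith [sq_nonneg (rt z₀ η p * ‖Srf.grad E p‖ - |E p|)]
  refine ⟨Integrable.mono' i3 ((H.gw_meas hE).pow 2) (ae_of_all _ fun p => ?_), ?_⟩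
  · rw [Real.norm_eq_abs, abs_of_nonneg (sq_nonneg _)]; exact k p
  · refine (integral_mono_of_nonneg (ae_of_all _ fun p => sq_nonneg _) i3 (ae_of_all _ k)).trans ?_
    rw [integral_const_mul, integral_add i1 i2, Srf.l2_sq]

lemma gw_tau (H : AsmHyp Srf K ρ γ h m r₁ c Z A Q δ η B z₀ ζ Tr) {E : E3 → ℝ} (hE : Srf.Lip E) :
    Integrable (fun p => Srf.gw z₀ η E p * (1 / rt z₀ δ p)) Srf.ms ∧
    ∫ p, Srf.gw z₀ η E p * (1 / rt z₀ δ p) ∂Srf.ms ≤ √(∫ p, Srf.gw z₀ η E p ^ 2 ∂Srf.ms) * √B := by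
  have e : (fun p => (1 / rt z₀ δ p) ^ 2) = fun p => 1 / rho2 z₀ δ p := by
    funext p; rw [div_pow, one_pow, rt_sq]
  have mt : AEStronglyMeasurable (fun p => 1 / rt z₀ δ p) Srf.ms :=
    (measurable_const.div (rt_meas z₀ δ)).aestronglyMeasurable
  obtain ⟨h1, h2⟩ := cs_integral (H.gw_meas hE) mt (H.gw_sq hE).1 (by rw [e]; exact H.intB)
  refine ⟨h1, (le_abs_self _).trans (h2.trans ?_)⟩
  rw [e]
  exact mul_le_mul_of_nonneg_left (Real.sqrt_le_sqrt H.leB) (Real.sqrt_nonneg _)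

end AsmHyp

namespace ErrHyp

lemma wt_est (H : ErrHyp Srf K ρ γ h m r₁ c Z A Q δ η B z₀ ζ Tr u lh) :
    √(∫ p, Srf.gw z₀ η (Tr.liftS (fun x => u x - lh x)) p ^ 2 ∂Srf.ms) ≤ 200000 * Q ^ 7 * h * √B := by
  have hG := H.a.M.geo
  have hQ := H.a.Q1
  have hh := H.a.hpos
  have hη := H.a.η_pos
  obtain ⟨v, hv, hvp⟩ := H.wt_pt H.he
  have hE := H.Lip_E
  have hV := H.a.M.Lip_lift hv
  obtain ⟨ig, jg⟩ := H.a.gw_sq hE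
  obtain ⟨it, jt⟩ := H.a.gw_tau hE
  have iX := H.a.int_X hE
  have R1 := H.R_le hv
  have G1 := H.a.M.geo_form H.he hv
  have gn := H.a.gw_nonneg (Tr.liftS (fun x => u x - lh x))
  have dE := hG.ae_diff hE
  have dV := hG.ae_diff hV
  have l2s := Srf.l2_sq (Tr.liftS (fun x => u x - lh x))
  have hl2 := H.l2E
  have i2 := hG.int_sq hE
  generalize Tr.liftS (fun x => u x - lh x) = E at *
  generalize Tr.liftS v = V at *
  have W2 : √(∫ p, Srf.gw z₀ η E p ^ 2 ∂Srf.ms) ^ 2 = ∫ p, Srf.gw z₀ η E p ^ 2 ∂Srf.ms :=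
    Real.sq_sqrt (integral_nonneg fun p => sq_nonneg _)
  have W0 := Real.sqrt_nonneg (∫ p, Srf.gw z₀ η E p ^ 2 ∂Srf.ms)
  have ev : ∀ᵐ p ∂Srf.ms, (rt z₀ η p * ‖Srf.grad E p‖) ^ 2 / 2 - 5 * E p ^ 2 ≤ ⟪Srf.grad E p, Srf.grad V p⟫ + E p * V p ∧
      Srf.pe V p ≤ 5 * Q * rt z₀ η p * Srf.gw z₀ η E p ∧ rt z₀ η p ≤ Q := by
    filter_upwards [Srf.ae_mem, dE, dV] with p hp h1 h2
    obtain ⟨k1, k2⟩ := hvp p hp h1 h2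
    rw [sq_abs] at k1
    exact ⟨k1, k2, H.a.rt_le hp⟩
  have pV5 : ∀ᵐ p ∂Srf.ms, Srf.pe V p ≤ 5 * Q ^ 2 * Srf.gw z₀ η E p := by
    filter_upwards [ev] with p hp
    have := gn p
    calc Srf.pe V p ≤ _ := hp.2.1
      _ ≤ 5 * Q * Q * Srf.gw z₀ η E p := by have := hp.2.2; gcongr
      _ = _ := by ring
  -- coercivity
  have h1 : (∫ p, (rt z₀ η p * ‖Srf.grad E p‖) ^ 2 ∂Srf.ms) / 2 - 5 * Srf.l2 E ^ 2 ≤ Srf.aForm E V := by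
    rw [l2s, Srf.aForm_def, ← integral_div, ← integral_const_mul, ← integral_sub (iX.div_const 2) (i2.const_mul 5)]
    refine integral_mono_ae ((iX.div_const 2).sub (i2.const_mul 5)) (hG.int_a hE hV) ?_
    filter_upwards [ev] with p hp using hp.1
  have hP : ∫ x, Srf.pe E x * Srf.pe V x ∂Srf.ms ≤ 5 * Q ^ 2 * √(∫ p, Srf.gw z₀ η E p ^ 2 ∂Srf.ms) ^ 2 := by
    rw [W2, ← integral_const_mul]
    refine integral_mono_of_nonneg (ae_of_all _ fun x => mul_nonneg (Srf.pe_nonneg _ _) (Srf.pe_nonneg _ _)) (ig.const_mul _) ?_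
    filter_upwards [ev] with p hp
    exact arith_pv hQ (rt_pos hη p).le hp.2.2 (norm_nonneg _) (abs_nonneg _) rfl (pe_le_add E p) (Srf.pe_nonneg _ _) hp.2.1
  have hU : ∫ x, Srf.pe (Tr.liftS u) x * Srf.pe V x ∂Srf.ms ≤ 55 * Q ^ 5 * (√(∫ p, Srf.gw z₀ η E p ^ 2 ∂Srf.ms) * √B) := by
    refine (integral_mono_of_nonneg (ae_of_all _ fun x => mul_nonneg (Srf.pe_nonneg _ _) (Srf.pe_nonneg _ _))
      (it.const_mul (55 * Q ^ 5)) ?_).trans ?_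
    · filter_upwards [pV5, H.peI] with p hp hu
      have t0 := rt_pos (z₀ := z₀) H.a.δ_pos p
      calc Srf.pe (Tr.liftS u) p * Srf.pe V p ≤ 11 * Q ^ 3 / rt z₀ δ p * (5 * Q ^ 2 * Srf.gw z₀ η E p) :=
            mul_le_mul hu hp (Srf.pe_nonneg _ _) (by positivity)
        _ = _ := by ring
    · rw [integral_const_mul]; gcongr
  have hD : |Srf.aForm (Tr.dd z₀ ζ δ u) V| ≤ 45 * Q ^ 4 * η * (√(∫ p, Srf.gw z₀ η E p ^ 2 ∂Srf.ms) * √B) := by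
    rw [Srf.aForm_def, ← Real.norm_eq_abs]
    refine (norm_integral_le_of_norm_le (it.const_mul (45 * Q ^ 4 * η)) ?_).trans ?_
    · filter_upwards [ev, H.peD] with p hp hd
      refine (Srf.integrand_le _ _ _).trans ?_
      exact arith_pd hQ (rt_pos H.a.δ_pos p) (rt_pos hη p) hη hp.2.1 (Srf.pe_nonneg _ _) hd
    · rw [integral_const_mul]; gcongr
  have hy : Srf.en V ≤ 5 * Q ^ 2 * √(∫ p, Srf.gw z₀ η E p ^ 2 ∂Srf.ms) := by
    unfold SmoothSurface.en
    rw [Srf.aForm_self]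
    refine Real.sqrt_le_iff.2 ⟨by positivity, ?_⟩
    rw [mul_pow, W2, ← integral_const_mul]
    refine integral_mono_of_nonneg (ae_of_all _ fun x => sq_nonneg _) (ig.const_mul _) ?_
    filter_upwards [pV5] with p hp
    have := Srf.pe_nonneg V p
    calc Srf.pe V p ^ 2 ≤ (5 * Q ^ 2 * Srf.gw z₀ η E p) ^ 2 := by gcongr
      _ = _ := by ring
  have G0 : 0 ≤ ∫ x, Srf.pe E x * Srf.pe V x ∂Srf.ms :=
    integral_nonneg (fun x => mul_nonneg (Srf.pe_nonneg _ _) (Srf.pe_nonneg _ _))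
  refine arith_wt hQ hh H.a.sm H.sB W0 (Srf.l2_nonneg E) hl2 h1 (G1.trans ?_) hP R1 hU ?_ hy ?_
  · have := H.a.q5
    gcongr
  · rw [← H.a.hη]; exact hD
  · rw [W2]; exact jg

end ErrHyp

end

section
variable {Srf : SmoothSurface} {K ρ : ℝ}
variable {γ h m : ℝ} {Tr : Triangulation Srf γ h}
variable {r₁ c Z A Q δ η B : ℝ} {z₀ : E3} {ζ : E3 → ℝ} {u lh v : E3 → ℝ}

lemma arith_f1 {t r pD : ℝ} (hQ : 1 ≤ Q) (ht : 0 < t) (htr : t ≤ r) (hη : 0 < η)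
    (hD : pD ≤ 9 * Q ^ 3 * (η / (t * r))) : 2 * pD ≤ 18 * Q ^ 3 * η * (1 / t ^ 2) := by
  calc 2 * pD ≤ 2 * (9 * Q ^ 3 * (η / (t * r))) := by linarith
    _ ≤ 2 * (9 * Q ^ 3 * (η / (t * t))) := by gcongr
    _ = _ := by rw [pow_two t]; ring

lemma arith_f2 {t r g y : ℝ} (hQ : 1 ≤ Q) (ht : 0 < t) (htr : t ≤ r) (hr : r ≤ Q) (hg : 0 ≤ g) (hy : 0 ≤ y) :
    y + g ≤ Q * ((r * g + y) * (1 / t)) := by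
  rw [mul_one_div, mul_div_assoc', le_div_iff₀ ht]
  have h1 : y * t ≤ y * Q := by gcongr; linarith
  have h2 : g * t ≤ g * r := by gcongr
  have h3 : g * r ≤ Q * (g * r) := by
    have : 0 ≤ g * r := mul_nonneg hg (by linarith)
    nlinarith
  nlinarith

lemma arith_f3 {o b T W : ℝ} (hQ : 1 ≤ Q) (hh : 0 < h) (h1 : h ≤ 1) (hB : 1 ≤ B) (ho : o ≤ Q * (24 * h ^ 2)) (hb : b ≤ B)
    (hT : T ≤ W * √B) (hW : W ≤ 200000 * Q ^ 7 * h * √B) :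
    2 * Q ^ 2 * o + 18 * Q ^ 3 * (400 * Q ^ 3 * h) * b + Q * T ≤ 300000 * Q ^ 8 * h * B := by
  have q3 : Q ^ 3 ≤ Q ^ 8 := pow_le_pow_right₀ hQ (by norm_num)
  have q6 : Q ^ 6 ≤ Q ^ 8 := pow_le_pow_right₀ hQ (by norm_num)
  have hs : √B * √B = B := Real.mul_self_sqrt (by linarith)
  have e1 : 2 * Q ^ 2 * o ≤ 48 * (Q ^ 8 * h * B) := by
    calc 2 * Q ^ 2 * o ≤ 2 * Q ^ 2 * (Q * (24 * h ^ 2)) := by gcongr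
      _ = 48 * (Q ^ 3 * (h * h) * 1) := by ring
      _ ≤ 48 * (Q ^ 8 * (h * 1) * B) := by gcongr
      _ = _ := by ring
  have e2 : 18 * Q ^ 3 * (400 * Q ^ 3 * h) * b ≤ 7200 * (Q ^ 8 * h * B) := by
    calc 18 * Q ^ 3 * (400 * Q ^ 3 * h) * b = 7200 * (Q ^ 6 * h * b) := by ring
      _ ≤ 7200 * (Q ^ 6 * h * B) := by gcongr
      _ ≤ 7200 * (Q ^ 8 * h * B) := by gcongr
  have e3 : Q * T ≤ 200000 * (Q ^ 8 * h * B) := by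
    calc Q * T ≤ Q * ((200000 * Q ^ 7 * h * √B) * √B) := by
          refine mul_le_mul_of_nonneg_left (hT.trans ?_) (by linarith)
          gcongr
      _ = 200000 * (Q ^ 8 * h * (√B * √B)) := by ring
      _ = _ := by rw [hs]
  have : 0 < Q ^ 8 * h * B := by positivity
  linarith

lemma arith_f4 {a b c : ℝ} {x y z w : E3} (hw : w = -x - y + z) (d : ℝ) (hd : d = -a - b + c) :
    |d| + ‖w‖ ≤ (|a| + ‖x‖) + (|b| + ‖y‖) + (|c| + ‖z‖) := by
  have h1 : ‖w‖ ≤ ‖x‖ + ‖y‖ + ‖z‖ := by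
    rw [hw]
    refine (norm_add_le _ _).trans ?_
    have := norm_sub_le (-x) y
    rw [norm_neg] at this
    linarith
  have h2 : |d| ≤ |a| + |b| + |c| := by
    rw [hd]
    refine (abs_add_le _ _).trans ?_
    have := abs_sub (-a) b
    rw [abs_neg] at this
    linarith
  linarith

namespace ErrHyp

lemma final (H : ErrHyp Srf K ρ γ h m r₁ c Z A Q δ η B z₀ ζ Tr u lh) :
    ∫ x, (|Srf.lam z₀ ζ 0 x - Tr.liftS lh x| + ‖Srf.grad (fun y => Srf.lam z₀ ζ 0 y - Tr.liftS lh y) x‖) ∂Srf.ms ≤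
      300000 * Q ^ 8 * h * B := by
  have hG := H.a.M.geo
  have hQ := H.a.Q1
  have hL := H.a.M.Lip_lift H.hl
  obtain ⟨iω, jω⟩ := H.a.ahl.omg_int H.a.H.hz H.a.δ_pos
  obtain ⟨it, jt⟩ := H.a.gw_tau H.Lip_E
  have hW := H.wt_est
  have i1 := iω.const_mul (2 * Q ^ 2)
  have i2 := H.a.intB.const_mul (18 * Q ^ 3 * η)
  have i3 := it.const_mul Q
  have i12 : Integrable (fun p => 2 * Q ^ 2 * omg z₀ δ p + 18 * Q ^ 3 * η * (1 / rho2 z₀ δ p)) Srf.ms := i1.add i2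
  refine (integral_mono_of_nonneg (g := fun p => 2 * Q ^ 2 * omg z₀ δ p + 18 * Q ^ 3 * η * (1 / rho2 z₀ δ p) +
    Q * (Srf.gw z₀ η (Tr.liftS (fun x => u x - lh x)) p * (1 / rt z₀ δ p)))
    (ae_of_all _ fun p => by positivity) (i12.add i3) ?_).trans ?_
  · filter_upwards [Srf.ae_mem, Srf.ae_ne z₀, hG.ae_diff H.Lip_u, hG.ae_diff hL, H.peD] with p hp hne du dl hD
    obtain ⟨d0, hs⟩ := H.sing hp hne
    have hδ1 : δ ≤ 1 := by linarith [H.a.η_le, H.a.δ_le]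
    have dd := H.a.lamd hp H.a.δ_pos hδ1
    have t0 := rt_pos (z₀ := z₀) H.a.δ_pos p
    have tr := H.a.rt_mono p
    have k1 := arith_f1 hQ t0 tr H.a.η_pos hD
    rw [rt_sq] at k1
    have k2 := arith_f2 hQ t0 tr (H.a.rt_le hp) (norm_nonneg (Srf.grad (Tr.liftS (fun x => u x - lh x)) p))
      (abs_nonneg (Tr.liftS (fun x => u x - lh x) p))
    have p1 := Srf.grad_le_pe (Tr.dd z₀ ζ δ u) p
    have p2 := Srf.abs_le_pe (Tr.dd z₀ ζ δ u) p
    have e0 := hG.grad_sub hp d0 dl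
    have e1 := hG.grad_sub hp dd d0
    have e2 : Srf.grad (Tr.dd z₀ ζ δ u) p = _ := hG.grad_sub hp du dd
    have e3 : Srf.grad (Tr.liftS (fun x => u x - lh x)) p = Srf.grad (Tr.liftS u) p - Srf.grad (Tr.liftS lh) p := hG.grad_sub hp du dl
    have key := arith_f4 (a := Srf.lam z₀ ζ δ p - Srf.lam z₀ ζ 0 p) (b := Tr.dd z₀ ζ δ u p) (c := Tr.liftS (fun x => u x - lh x) p)
      (x := Srf.grad (fun y => Srf.lam z₀ ζ δ y - Srf.lam z₀ ζ 0 y) p) (y := Srf.grad (Tr.dd z₀ ζ δ u) p)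
      (z := Srf.grad (Tr.liftS (fun x => u x - lh x)) p) (w := Srf.grad (fun y => Srf.lam z₀ ζ 0 y - Tr.liftS lh y) p)
      (by rw [e0, e1, e2, e3]; abel) (Srf.lam z₀ ζ 0 p - Tr.liftS lh p)
      (by
        have a1 : Tr.dd z₀ ζ δ u p = Tr.liftS u p - Srf.lam z₀ ζ δ p := rfl
        have a2 : Tr.liftS (fun x => u x - lh x) p = Tr.liftS u p - Tr.liftS lh p := rfl
        rw [a1, a2]; ring)
    refine key.trans ?_
    unfold SmoothSurface.gw
    linarith
  · have s1 : ∫ p, (2 * Q ^ 2 * omg z₀ δ p + 18 * Q ^ 3 * η * (1 / rho2 z₀ δ p) +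
        Q * (Srf.gw z₀ η (Tr.liftS (fun x => u x - lh x)) p * (1 / rt z₀ δ p))) ∂Srf.ms =
        2 * Q ^ 2 * ∫ p, omg z₀ δ p ∂Srf.ms + 18 * Q ^ 3 * η * ∫ p, 1 / rho2 z₀ δ p ∂Srf.ms +
        Q * ∫ p, Srf.gw z₀ η (Tr.liftS (fun x => u x - lh x)) p * (1 / rt z₀ δ p) ∂Srf.ms := by
      rw [integral_add i12 i3, integral_add i1 i2, integral_const_mul, integral_const_mul, integral_const_mul]
    rw [s1]
    have hη := H.a.hη
    have ho : ∫ p, omg z₀ δ p ∂Srf.ms ≤ Q * (24 * h ^ 2) := by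
      rw [← H.a.hδ]
      refine jω.trans ?_
      have := H.a.δ_pos
      have := H.a.q8
      gcongr
    have := arith_f3 hQ H.a.hpos (by linarith [H.a.h_le]) H.a.B1 ho H.a.leB jt hW
    rw [← hη] at this
    exact this

end ErrHyp

lemma le_of_inv_small {r : ℝ} (hr : 0 < r) (hh : 0 < h) (hQ : 1 / r ≤ Q) (hs : 10000 * (Q * h) ≤ 1) : 4 * h ≤ r := by
  rw [div_le_iff₀ hr] at hQ
  calc 4 * h = 4 * h * 1 := by ring
    _ ≤ 4 * h * (Q * r) := by gcongr
    _ = 4 * (Q * h) * r := by ring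
    _ ≤ 1 * r := by gcongr; linarith
    _ = r := one_mul r

lemma arith_q7 {n D : ℝ} (h0 : 0 ≤ n) (h1 : n ≤ D) (h2 : D + 1 ≤ Q) : n ^ 2 + 1 ≤ Q ^ 2 := by nlinarith

lemma arith_b1 {C l : ℝ} (hC : 0 < C) (hl : 1 / 2 ≤ l) : 1 ≤ (2 * C + 2) * l := by nlinarith

lemma arith_sm {a : ℝ} (hh : 0 < h) (ha : a ≤ Q ^ 3) (sm : 10000 * Q ^ 3 * h ≤ 1) : 10000 * (a * h) ≤ 1 := by nlinarith

lemma log_small (hh : 0 < h) (h1 : 10000 * h ≤ 1) : 1 / 2 ≤ |Real.log h| := by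
  have := Real.log_le_sub_one_of_pos hh
  rw [abs_of_nonpos (by linarith)]
  linarith

end

/-- **W^{1,1}-estimate for the discrete projection of the cut-off logarithm.**
`‖l̃ − L̃_h‖_{W^{1,1}(S)} ≤ c h |log h|`, with `c` independent of `z₀` and `h`. -/
theorem cutlog_w11_estimate (Srf : SmoothSurface) (γ₀ : ℝ) (hγ₀ : 0 < γ₀)
    (r₁ : ℝ) (hr₁ : Srf.IsGraphRadius r₁) (Cζ : ℝ) (hCζ : 0 < Cζ) :
    ∃ c > 0, ∃ h₀ > 0, h₀ < 1 ∧
      ∀ z₀ ∈ Srf.S, ∀ ζ : E3 → ℝ, IsCutoff z₀ r₁ Cζ ζ →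
        ∀ h : ℝ, 0 < h → h ≤ h₀ →
          ∀ Tr : Triangulation Srf γ₀ h, ∀ lh : E3 → ℝ,
            Tr.IsDiscreteProjection (cutLog Srf z₀ ζ) lh →
            (∫ x in Srf.S,
                (|cutLog Srf z₀ ζ x - Tr.liftS lh x| +
                  ‖Srf.grad (fun y => cutLog Srf z₀ ζ y - Tr.liftS lh y) x‖) ∂μH[2]) ≤
              c * h * |Real.log h| := by
  obtain ⟨K, ρ, hG⟩ := exists_geoFacts Srf
  obtain ⟨A, hA⟩ := hG.exists_Ahl
  obtain ⟨C, hC, hrho⟩ := hG.exists_rho2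
  obtain ⟨c, hc0, hc1, hrc⟩ := hG.exists_rc hr₁
  obtain ⟨hr0, hr1, -⟩ := hr₁
  have hK := hG.K_pos
  have hρ := hG.ρ_pos
  have hA1 := hA.1
  have hD0 : 0 ≤ Metric.diam Srf.S := diam_nonneg
  have hq0 : 0 ≤ quasiC K γ₀ (390 * K + 4) := Real.sqrt_nonneg _
  obtain ⟨Q, hQ⟩ : ∃ Q, Q = 1 + 318 * Cζ * K / c ^ 2 + 11 * Cζ / c + 4 * Cζ / c ^ 3 + 1 / γ₀ + K / γ₀ + K + A +
    quasiC K γ₀ (390 * K + 4) + Metric.diam Srf.S + 1 / r₁ + 1 / ρ := ⟨_, rfl⟩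
  have t1 : 0 ≤ 318 * Cζ * K / c ^ 2 := by positivity
  have t2 : 0 ≤ 11 * Cζ / c := by positivity
  have t3 : 0 ≤ 4 * Cζ / c ^ 3 := by positivity
  have t4 : 0 ≤ 1 / γ₀ := by positivity
  have t5 : 0 ≤ K / γ₀ := by positivity
  have t6 : 0 ≤ 1 / r₁ := by positivity
  have t7 : 0 ≤ 1 / ρ := by positivity
  have hQ1 : 1 ≤ Q := by linarith
  have hQ3 : 1 ≤ Q ^ 3 := one_le_pow₀ hQ1
  have hQQ : Q ≤ Q ^ 3 := le_self_pow₀ hQ1 (by norm_num)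
  refine ⟨300000 * Q ^ 8 * (2 * C + 2), by positivity, 1 / (10000 * Q ^ 3), by positivity, ?_, ?_⟩
  · rw [div_lt_one (by positivity)]; linarith
  have b1 : 318 * Cζ * K / c ^ 2 ≤ Q := by linarith
  have b2 : 11 * Cζ / c ≤ Q := by linarith
  have b3 : 4 * Cζ / c ^ 3 ≤ Q := by linarith
  have b4 : 1 / γ₀ ≤ Q := by linarith
  have b5 : K / γ₀ ≤ Q := by linarith
  have b6 : K ≤ Q := by linarith
  have b7 : 1 / r₁ ≤ Q := by linarith
  have b8 : 1 / ρ ≤ Q := by linarith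
  have b9 : A ≤ Q := by linarith
  have b10 : quasiC K γ₀ (390 * K + 4) ≤ Q := by linarith
  have b11 : Metric.diam Srf.S + 1 ≤ Q := by linarith
  clear hQ t1 t2 t3 t4 t5 t6 t7 hD0 hq0
  intro z₀ hz ζ hζ h hh hle Tr lh hlh
  have sm : 10000 * Q ^ 3 * h ≤ 1 := by
    rw [le_div_iff₀ (by positivity)] at hle; linarith
  have sQ : 10000 * (Q * h) ≤ 1 := arith_sm hh hQQ sm
  have sh : 10000 * h ≤ 1 := by have := arith_sm hh hQ3 sm; rwa [one_mul] at this
  have hm : K * h / γ₀ ≤ Q * h := by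
    rw [mul_div_right_comm]
    exact mul_le_mul_of_nonneg_right b5 hh.le
  have hKh : K * h ≤ Q * h := mul_le_mul_of_nonneg_right b6 hh.le
  have h4ρ := le_of_inv_small hρ hh b8 sQ
  have lg := log_small hh sh
  obtain ⟨ib, jb⟩ := hrho z₀ hz (h ^ 2) (by positivity) (by nlinarith only [hh, sh])
  rw [Real.log_pow, abs_mul] at jb
  have jb' : ∫ x, 1 / rho2 z₀ (h ^ 2) x ∂Srf.ms ≤ (2 * C + 2) * |Real.log h| := by
    refine jb.trans ?_
    rw [show |((2 : ℕ) : ℝ)| = 2 by norm_num]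
    linarith
  have MH : MeshHyp Srf K ρ γ₀ h (K * h / γ₀) Tr :=
    ⟨hG, hh, hγ₀, by linarith, rfl, by linarith, by linarith⟩
  have LH : LogHyp Srf K ρ r₁ c Cζ z₀ ζ := ⟨hG, hz, hr0, hr1, hc0, hc1, hrc z₀ hz, hζ⟩
  have AH : AsmHyp Srf K ρ γ₀ h (K * h / γ₀) r₁ c Cζ A Q (h ^ 2) (400 * Q ^ 3 * h) ((2 * C + 2) * |Real.log h|) z₀ ζ Tr :=
    { M := MH, H := LH, Q1 := hQ1, q1 := b1, q2 := b2, q3 := b3, q4 := b4,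
      q5 := hm, q6 := b6
      q7 := by
        intro x hx
        have h1 : ‖x - z₀‖ ≤ Metric.diam Srf.S := by
          rw [← dist_eq_norm]
          exact dist_le_diam_of_mem Srf.compact.isBounded hx hz
        exact arith_q7 (norm_nonneg _) h1 b11
      q8 := b9, ahl := hA, hδ := rfl, hη := rfl, h4 := le_of_inv_small hr0 hh b7 sQ
      sm := sm, B1 := arith_b1 hC lg, intB := ib, leB := jb', sml := ⟨by positivity, by linarith, by linarith⟩
      qq := b10 }
  obtain ⟨u, hu, hD⟩ := AH.D_pt
  rw [cutLog_eq] at hlh ⊢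
  have EH : ErrHyp Srf K ρ γ₀ h (K * h / γ₀) r₁ c Cζ A Q (h ^ 2) (400 * Q ^ 3 * h) ((2 * C + 2) * |Real.log h|) z₀ ζ Tr u lh :=
    ⟨AH, hu, hlh.1, hD, hlh.2⟩
  refine EH.final.trans (le_of_eq ?_)
  ring

end
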